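/- Suppose p ≤ q, 3/p − 1/q < 1, 1/p + 1/q ≤ 1, and 1/p + 3/q ≥ 1. Then there is a constant C such that ‖ r^{1/q} ∑_{k≥2} sup_{1<t<2} |φ_k(r) 𝒜_t g| ‖_{L^q_{r,x₃}} ≤ C ‖g‖_{L^p} for all g. In particular, for each fixed k ≥ 2, ‖ r^{1/q} sup_{1<t<2} |φ_k(r) 𝒜_t g| ‖_{L^q_{r,x₃}} ≤ C ‖g‖_{L^p} with C independent of k. -/

import Mathlib

open MeasureTheory Real Set
open scoped ENNReal

noncomputable section

/-- Euclidean norm on `ℝ²` (the product norm on `ℝ × ℝ` is the sup norm, so we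
spell out the Euclidean one). -/
def enorm2 (ξ : ℝ × ℝ) : ℝ := Real.sqrt (ξ.1 ^ 2 + ξ.2 ^ 2)

/-- Fourier transform on `ℝ²` (nonunitary convention). -/
def ft2 (g : ℝ × ℝ → ℂ) (ξ : ℝ × ℝ) : ℂ :=
  ∫ y : ℝ × ℝ, Complex.exp (-(Complex.I) * ((y.1 * ξ.1 + y.2 * ξ.2 : ℝ) : ℂ)) * g y

/-- Fourier transform of the arclength measure `dσ` on the unit circle in `ℝ²`. -/
def sigmaHat (ξ : ℝ × ℝ) : ℂ :=
  ∫ θ in Set.Ioc (0:ℝ) (2 * π),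
    Complex.exp (-(Complex.I) * ((ξ.1 * Real.cos θ + ξ.2 * Real.sin θ : ℝ) : ℂ))

/-- The operator `𝒜_t g(r,x₃) = (2π)⁻² ∫ e^{i(((r²+t²)/2)ξ₁+x₃ξ₂)} \widehat{dσ}(trξ) ĝ(ξ) dξ`. -/
def Aop (g : ℝ × ℝ → ℂ) (t r x₃ : ℝ) : ℂ :=
  (((2 * π) ^ (-2 : ℤ) : ℝ) : ℂ) *
    ∫ ξ : ℝ × ℝ,
      Complex.exp (Complex.I * ((((r ^ 2 + t ^ 2) / 2) * ξ.1 + x₃ * ξ.2 : ℝ) : ℂ)) *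
        sigmaHat (t * r * ξ.1, t * r * ξ.2) * ft2 g ξ

/-- A Littlewood–Paley bump: nonnegative, smooth, supported in `[1−10⁻³, 2+10⁻³]`,
with `∑_{j∈ℤ} φ(2^{−j}s) = 1` for all `s > 0`. -/
def IsLPBump (φ : ℝ → ℝ) : Prop :=
  ContDiff ℝ (⊤ : ℕ∞) φ ∧ (∀ s, 0 ≤ φ s) ∧
    Function.support φ ⊆ Set.Icc (1 - 1/1000) (2 + 1/1000) ∧
    ∀ s : ℝ, 0 < s → HasSum (fun j : ℤ => φ ((2:ℝ) ^ (-j) * s)) 1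

/-- The Littlewood–Paley projection `𝒫_j`, defined via its multiplier `φ(2^{−j}|ξ|)`. -/
def proj (φ : ℝ → ℝ) (j : ℤ) (g : ℝ × ℝ → ℂ) (x : ℝ × ℝ) : ℂ :=
  (((2 * π) ^ (-2 : ℤ) : ℝ) : ℂ) *
    ∫ ξ : ℝ × ℝ,
      Complex.exp (Complex.I * ((x.1 * ξ.1 + x.2 * ξ.2 : ℝ) : ℂ)) *
        ((φ ((2:ℝ) ^ (-j) * enorm2 ξ) : ℝ) : ℂ) * ft2 g ξ

/-- `φ_{<ℓ}(s) = ∑_{j<ℓ} φ(2^{−j} s)`. -/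
def philt (φ : ℝ → ℝ) (l : ℤ) (s : ℝ) : ℝ :=
  ∑' j : ℤ, if j < l then φ ((2:ℝ) ^ (-j) * s) else 0

/-- The projection `𝒫_{<ℓ}`, with multiplier `φ_{<ℓ}(|ξ|)`. -/
def projLt (φ : ℝ → ℝ) (l : ℤ) (g : ℝ × ℝ → ℂ) (x : ℝ × ℝ) : ℂ :=
  (((2 * π) ^ (-2 : ℤ) : ℝ) : ℂ) *
    ∫ ξ : ℝ × ℝ,
      Complex.exp (Complex.I * ((x.1 * ξ.1 + x.2 * ξ.2 : ℝ) : ℂ)) *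
        ((philt φ l (enorm2 ξ) : ℝ) : ℂ) * ft2 g ξ

section

/-- The oscillatory superposition `z ↦ ∫ H(ω) e(z, ω) dμ(ω)`. -/
def osc {Z Ω : Type*} [MeasurableSpace Ω] (e : Z → Ω → ℂ) (μ : Measure Ω) (H : Ω → ℂ) (z : Z) : ℂ :=
  ∫ ω, H ω * e z ω ∂μ

theorem lintegral_enorm_sq_eq {Z : Type*} [MeasurableSpace Z] {ρ : Measure Z} [IsFiniteMeasure ρ]
    {U : Z → ℂ} (hU : AEStronglyMeasurable U ρ) {B : ℝ} (hB : ∀ z, ‖U z‖ ≤ B) :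
    ∫⁻ z, ‖U z‖ₑ ^ 2 ∂ρ = ‖∫ z, U z * (starRingEnd ℂ) (U z) ∂ρ‖ₑ := by
  have hintg : Integrable (fun z => ‖U z‖ ^ 2) ρ := by
    refine Integrable.of_bound (hU.norm.pow 2) (B ^ 2) (Filter.Eventually.of_forall fun z => ?_)
    rw [norm_pow, norm_norm]
    gcongr
    exact hB z
  have : ∀ z, U z * (starRingEnd ℂ) (U z) = ((‖U z‖ ^ 2 : ℝ) : ℂ) := by
    intro z
    rw [Complex.mul_conj, Complex.normSq_eq_norm_sq]
  simp_rw [this]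
  rw [integral_complex_ofReal]
  have h2 : ‖((∫ z, ‖U z‖ ^ 2 ∂ρ : ℝ) : ℂ)‖ₑ = ENNReal.ofReal (∫ z, ‖U z‖ ^ 2 ∂ρ) := by
    rw [← ofReal_norm, Complex.norm_real, Real.norm_of_nonneg
      (integral_nonneg fun z => by positivity)]
  rw [h2, ofReal_integral_eq_lintegral_ofReal hintg
    (Filter.Eventually.of_forall fun z => by positivity)]
  refine lintegral_congr fun z => ?_
  rw [ENNReal.ofReal_pow (norm_nonneg _), ofReal_norm]

theorem ENNReal.mul_le_sq_add_sq (a b : ℝ≥0∞) : a * b ≤ a ^ 2 + b ^ 2 := by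
  rcases le_total a b with h | h
  · calc a * b ≤ b * b := by gcongr
      _ = b ^ 2 := (sq _).symm
      _ ≤ _ := le_add_self
  · calc a * b ≤ a * a := by gcongr
      _ = a ^ 2 := (sq _).symm
      _ ≤ _ := le_self_add

section Abstract

variable {Z Ω : Type*} [MeasurableSpace Z] [MeasurableSpace Ω]

theorem norm_osc_le {e : Z → Ω → ℂ} {μ : Measure Ω} (he : ∀ z ω, ‖e z ω‖ ≤ 1) {H : Ω → ℂ}
    (hH : Integrable H μ) (z : Z) : ‖osc e μ H z‖ ≤ ∫ ω, ‖H ω‖ ∂μ := by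
  refine norm_integral_le_of_norm_le hH.norm (Filter.Eventually.of_forall fun ω => ?_)
  rw [norm_mul]
  exact mul_le_of_le_one_right (norm_nonneg _) (he z ω)

theorem osc_stronglyMeasurable {e : Z → Ω → ℂ} {μ : Measure Ω} [SFinite μ]
    (hem : Measurable (Function.uncurry e)) {H : Ω → ℂ} (hHm : Measurable H) :
    StronglyMeasurable (osc e μ H) := by
  have : StronglyMeasurable (Function.uncurry fun z ω => H ω * e z ω) :=
    ((hHm.comp measurable_snd).mul hem).stronglyMeasurable
  exact this.integral_prod_right

theorem osc_inner {e : Z → Ω → ℂ} {ρ : Measure Z} [IsFiniteMeasure ρ] {μ : Measure Ω} [SFinite μ]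
    (hem : Measurable (Function.uncurry e)) (he : ∀ z ω, ‖e z ω‖ ≤ 1)
    {H H' : Ω → ℂ} (hH : Integrable H μ) (hH' : Integrable H' μ) :
    ∫ z, osc e μ H z * (starRingEnd ℂ) (osc e μ H' z) ∂ρ =
      ∫ p : Ω × Ω, H p.1 * (starRingEnd ℂ) (H' p.2) *
        (∫ z, e z p.1 * (starRingEnd ℂ) (e z p.2) ∂ρ) ∂(μ.prod μ) := by
  have h1 : ∀ z, osc e μ H z * (starRingEnd ℂ) (osc e μ H' z) =
      ∫ p : Ω × Ω, (H p.1 * e z p.1) * (starRingEnd ℂ) (H' p.2 * e z p.2) ∂(μ.prod μ) := by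
    intro z
    rw [osc, osc, ← integral_conj, ← integral_prod_mul]
  simp_rw [h1]
  rw [integral_integral_swap]
  · refine integral_congr_ae (Filter.Eventually.of_forall fun p => ?_)
    simp only
    rw [← integral_const_mul]
    refine integral_congr_ae (Filter.Eventually.of_forall fun z => ?_)
    simp only [map_mul]
    ring
  · have hc : Integrable (fun x : Z × (Ω × Ω) =>
        (1 : ℂ) * (H x.2.1 * (starRingEnd ℂ) (H' x.2.2))) (ρ.prod (μ.prod μ)) := by
      refine Integrable.mul_prod (μ := ρ) (f := fun _ => (1:ℂ)) (integrable_const (1 : ℂ)) (Integrable.mul_prod (μ := μ) (ν := μ) (f := H) (g := fun ω => (starRingEnd ℂ) (H' ω)) hH ?_)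
      exact Complex.conjCLE.toContinuousLinearMap.integrable_comp hH'
    refine hc.mono ?_ (Filter.Eventually.of_forall fun x => ?_)
    · have hm1 : Measurable fun x : Z × (Ω × Ω) => e x.1 x.2.1 :=
        hem.comp (measurable_fst.prodMk (measurable_fst.comp measurable_snd))
      have hm2 : Measurable fun x : Z × (Ω × Ω) => (starRingEnd ℂ) (e x.1 x.2.2) :=
        Complex.continuous_conj.measurable.comp
          (hem.comp (measurable_fst.prodMk (measurable_snd.comp measurable_snd)))
      refine (hc.1.mul (hm1.mul hm2).aestronglyMeasurable).congr
        (Filter.Eventually.of_forall fun x => ?_)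
      simp only [Pi.mul_apply, Function.uncurry, map_mul]
      ring
    · simp only [Function.uncurry, map_mul, norm_mul, RCLike.norm_conj, one_mul]
      have a1 := he x.1 x.2.1
      have a2 := he x.1 x.2.2
      calc ‖H x.2.1‖ * ‖e x.1 x.2.1‖ * (‖H' x.2.2‖ * ‖e x.1 x.2.2‖)
          ≤ ‖H x.2.1‖ * 1 * (‖H' x.2.2‖ * 1) := by gcongr
        _ = _ := by ring

theorem osc_inner_eq_zero {e : Z → Ω → ℂ} {ρ : Measure Z} [IsFiniteMeasure ρ] {μ : Measure Ω}
    [SFinite μ] (hem : Measurable (Function.uncurry e)) (he : ∀ z ω, ‖e z ω‖ ≤ 1)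
    {H H' : Ω → ℂ} (hH : Integrable H μ) (hH' : Integrable H' μ)
    (h0 : ∀ ω ω', H ω ≠ 0 → H' ω' ≠ 0 → ∫ z, e z ω * (starRingEnd ℂ) (e z ω') ∂ρ = 0) :
    ∫ z, osc e μ H z * (starRingEnd ℂ) (osc e μ H' z) ∂ρ = 0 := by
  rw [osc_inner hem he hH hH']
  refine integral_eq_zero_of_ae (Filter.Eventually.of_forall fun p => ?_)
  simp only [Pi.zero_apply]
  by_cases a : H p.1 = 0
  · simp [a]
  by_cases b : H' p.2 = 0
  · simp [b]
  rw [h0 _ _ a b, mul_zero]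

theorem osc_sq_lintegral_le {e : Z → Ω → ℂ} {ρ : Measure Z} [IsFiniteMeasure ρ] {μ : Measure Ω}
    [SFinite μ] (hem : Measurable (Function.uncurry e)) (he : ∀ z ω, ‖e z ω‖ ≤ 1)
    {H : Ω → ℂ} (hH : Integrable H μ) (hHm : Measurable H) {near : Ω → Ω → Prop}
    (hnm : MeasurableSet {p : Ω × Ω | near p.1 p.2}) (hns : ∀ ω ω', near ω ω' → near ω' ω)
    {C B : ℝ≥0∞} (hC : ∀ ω ω', ‖∫ z, e z ω * (starRingEnd ℂ) (e z ω') ∂ρ‖ₑ ≤ C)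
    (h0 : ∀ ω ω', H ω ≠ 0 → H ω' ≠ 0 → ¬ near ω ω' →
      ∫ z, e z ω * (starRingEnd ℂ) (e z ω') ∂ρ = 0)
    (hB : ∀ ω, H ω ≠ 0 → μ {ω' | H ω' ≠ 0 ∧ near ω ω'} ≤ B) :
    ∫⁻ z, ‖osc e μ H z‖ₑ ^ 2 ∂ρ ≤ 2 * C * B * ∫⁻ ω, ‖H ω‖ₑ ^ 2 ∂μ := by
  have hUm := (osc_stronglyMeasurable (μ := μ) hem hHm)
  have e1 : ∫⁻ z, ‖osc e μ H z‖ₑ ^ 2 ∂ρ =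
      ‖∫ z, osc e μ H z * (starRingEnd ℂ) (osc e μ H z) ∂ρ‖ₑ :=
    lintegral_enorm_sq_eq hUm.aestronglyMeasurable (norm_osc_le he hH)
  rw [e1, osc_inner hem he hH hH]
  set S : Set (Ω × Ω) := {p | (H p.1 ≠ 0 ∧ H p.2 ≠ 0) ∧ near p.1 p.2} with hS
  have hsup : MeasurableSet {ω | H ω ≠ 0} := (hHm (measurableSet_singleton 0)).compl
  have hSm : MeasurableSet S :=
    ((hsup.preimage measurable_fst).inter (hsup.preimage measurable_snd)).inter hnm
  have hHe : Measurable fun ω => ‖H ω‖ₑ ^ 2 := (hHm.enorm).pow_const 2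
  have key : ∀ p : Ω × Ω, ‖H p.1 * (starRingEnd ℂ) (H p.2) *
        (∫ z, e z p.1 * (starRingEnd ℂ) (e z p.2) ∂ρ)‖ₑ ≤
      S.indicator (fun p => C * ‖H p.1‖ₑ ^ 2) p + S.indicator (fun p => C * ‖H p.2‖ₑ ^ 2) p := by
    intro p
    by_cases hp : p ∈ S
    · rw [indicator_of_mem hp, indicator_of_mem hp, enorm_mul, enorm_mul, RCLike.enorm_conj, mul_comm,
        ← mul_add]
      gcongr
      · exact hC _ _
      exact ENNReal.mul_le_sq_add_sq _ _
    · have : H p.1 * (starRingEnd ℂ) (H p.2) *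
        (∫ z, e z p.1 * (starRingEnd ℂ) (e z p.2) ∂ρ) = 0 := by
        by_cases a : H p.1 = 0
        · simp [a]
        by_cases b : H p.2 = 0
        · simp [b]
        rw [h0 _ _ a b (fun h => hp ⟨⟨a, b⟩, h⟩), mul_zero]
      rw [this]; simp
  have m1 : Measurable (S.indicator (fun p : Ω × Ω => C * ‖H p.1‖ₑ ^ 2)) :=
    (((hHe.comp measurable_fst).const_mul C)).indicator hSm
  have m2 : Measurable (S.indicator (fun p : Ω × Ω => C * ‖H p.2‖ₑ ^ 2)) :=
    (((hHe.comp measurable_snd).const_mul C)).indicator hSm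
  have b1 : ∀ ω, ∫⁻ ω', S.indicator (fun p : Ω × Ω => C * ‖H p.1‖ₑ ^ 2) (ω, ω') ∂μ
      ≤ C * B * ‖H ω‖ₑ ^ 2 := by
    intro ω
    by_cases a : H ω = 0
    · have : ∀ ω', S.indicator (fun p : Ω × Ω => C * ‖H p.1‖ₑ ^ 2) (ω, ω') = 0 := fun ω' =>
        indicator_of_notMem (fun h => h.1.1 a) _
      simp [this]
    · have : ∀ ω', S.indicator (fun p : Ω × Ω => C * ‖H p.1‖ₑ ^ 2) (ω, ω') =
          {ω' | H ω' ≠ 0 ∧ near ω ω'}.indicator (fun _ => C * ‖H ω‖ₑ ^ 2) ω' := by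
        intro ω'
        by_cases hm : H ω' ≠ 0 ∧ near ω ω'
        · rw [indicator_of_mem (show (ω, ω') ∈ S from ⟨⟨a, hm.1⟩, hm.2⟩),
            indicator_of_mem (show ω' ∈ {ω' | H ω' ≠ 0 ∧ near ω ω'} from hm)]
        · rw [indicator_of_notMem (show (ω, ω') ∉ S from fun h => hm ⟨h.1.2, h.2⟩),
            indicator_of_notMem (show ω' ∉ {ω' | H ω' ≠ 0 ∧ near ω ω'} from hm)]
      simp_rw [this]
      refine (lintegral_indicator_const_le _ _).trans ?_
      calc C * ‖H ω‖ₑ ^ 2 * μ {ω' | H ω' ≠ 0 ∧ near ω ω'} ≤ C * ‖H ω‖ₑ ^ 2 * B := by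
            gcongr; exact hB ω a
        _ = _ := by ring
  have b2 : ∀ ω', ∫⁻ ω, S.indicator (fun p : Ω × Ω => C * ‖H p.2‖ₑ ^ 2) (ω, ω') ∂μ
      ≤ C * B * ‖H ω'‖ₑ ^ 2 := by
    intro ω'
    refine le_trans (le_of_eq ?_) (b1 ω')
    refine lintegral_congr fun ω => ?_
    by_cases hm : (ω, ω') ∈ S
    · rw [indicator_of_mem hm, indicator_of_mem
        (show (ω', ω) ∈ S from ⟨⟨hm.1.2, hm.1.1⟩, hns _ _ hm.2⟩)]
    · rw [indicator_of_notMem hm, indicator_of_notMem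
        (show (ω', ω) ∉ S from fun h => hm ⟨⟨h.1.2, h.1.1⟩, hns _ _ h.2⟩)]
  calc _ ≤ ∫⁻ p : Ω × Ω, ‖H p.1 * (starRingEnd ℂ) (H p.2) *
        (∫ z, e z p.1 * (starRingEnd ℂ) (e z p.2) ∂ρ)‖ₑ ∂(μ.prod μ) := enorm_integral_le_lintegral_enorm _
    _ ≤ ∫⁻ p : Ω × Ω, (S.indicator (fun p => C * ‖H p.1‖ₑ ^ 2) p +
          S.indicator (fun p => C * ‖H p.2‖ₑ ^ 2) p) ∂(μ.prod μ) := lintegral_mono key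
    _ = _ := lintegral_add_left m1 _
    _ = (∫⁻ ω, ∫⁻ ω', S.indicator (fun p : Ω × Ω => C * ‖H p.1‖ₑ ^ 2) (ω, ω') ∂μ ∂μ) +
        ∫⁻ ω', ∫⁻ ω, S.indicator (fun p : Ω × Ω => C * ‖H p.2‖ₑ ^ 2) (ω, ω') ∂μ ∂μ := by
      rw [lintegral_prod _ m1.aemeasurable, lintegral_prod_symm _ m2.aemeasurable]
    _ ≤ (∫⁻ ω, C * B * ‖H ω‖ₑ ^ 2 ∂μ) + ∫⁻ ω, C * B * ‖H ω‖ₑ ^ 2 ∂μ := by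
      gcongr with ω ω
      · exact b1 ω
      · exact b2 ω
    _ = _ := by
      rw [lintegral_const_mul _ hHe]; ring

end Abstract

end

section

/-- A nonnegative weight, at least one on `[-10, 10]`, rapidly decaying, with Fourier transform
supported in `[-1, 1]`. -/
structure IsBandWeight (κ : ℝ → ℝ) : Prop where
  cont : Continuous κ
  nonneg : ∀ x, 0 ≤ κ x
  one_le : ∀ x, |x| ≤ 10 → 1 ≤ κ x
  moment : ∀ n : ℕ, Integrable fun x => |x| ^ n * κ x
  vanish : ∀ θ : ℝ, 1 ≤ |θ| → ∫ x : ℝ, Complex.exp (Complex.I * ((x * θ : ℝ) : ℂ)) * (κ x : ℂ) = 0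

open FourierTransform Pointwise in
theorem exists_isBandWeight : ∃ κ, IsBandWeight κ := by
  let b : ContDiffBump (0:ℝ) := ⟨1/400, 1/200, by norm_num, by norm_num⟩
  let f : ℝ → ℂ := fun x => (b x : ℂ)
  have hfs : HasCompactSupport f := b.hasCompactSupport.comp_left (g := fun x : ℝ => (x:ℂ)) (by simp)
  have hfd : ContDiff ℝ (⊤ : ℕ∞) f := Complex.ofRealCLM.contDiff.comp b.contDiff
  have hfc : Continuous f := hfd.continuous
  have hfi : Integrable f := hfc.integrable_of_hasCompactSupport hfs
  let φ : SchwartzMap ℝ ℂ := hfs.toSchwartzMap hfd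
  let G : SchwartzMap ℝ ℂ := 𝓕 φ
  have hG : ∀ x, G x = 𝓕 f x := fun x => by
    show (𝓕 φ) x = _
    rw [SchwartzMap.fourier_coe]; rfl
  have hval : ∀ x, 𝓕 f x = ∫ u : ℝ, Complex.exp (((-2 * π * u * x : ℝ) : ℂ) * Complex.I) * f u := by
    intro x
    rw [Real.fourier_real_eq_integral_exp_smul]
    simp only [smul_eq_mul]
  have hvalm : ∀ x, Integrable fun u : ℝ =>
      Complex.exp (((-2 * π * u * x : ℝ) : ℂ) * Complex.I) * f u := by
    intro x
    refine hfi.norm.mono' (by fun_prop) (Filter.Eventually.of_forall fun u => ?_)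
    rw [norm_mul, Complex.norm_exp_ofReal_mul_I, one_mul]
  have heven : ∀ x, f (-x) = f x := fun x => by
    simp only [f]
    rw [b.neg]
  have hconj : ∀ x, (starRingEnd ℂ) (𝓕 f x) = 𝓕 f x := by
    intro x
    rw [hval, ← integral_conj, ← integral_neg_eq_self]
    refine integral_congr_ae (Filter.Eventually.of_forall fun u => ?_)
    simp only [map_mul, heven]
    rw [← Complex.exp_conj]
    congr 1
    · congr 1
      simp only [map_mul, Complex.conj_ofReal, Complex.conj_I]
      push_cast; ring
    · simp [f]
  have hsq : ∀ x, ((‖G x‖ ^ 2 : ℝ) : ℂ) = 𝓕 f x * 𝓕 f x := by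
    intro x
    rw [← Complex.normSq_eq_norm_sq, ← Complex.mul_conj, hG, hconj]
  let cv : ℝ → ℂ := convolution f f (ContinuousLinearMap.mul ℂ ℂ) volume
  have hcvF : ∀ x, 𝓕 cv x = 𝓕 f x * 𝓕 f x := fun x => Real.fourier_mul_convolution_eq hfi hfi x
  have hcvc : Continuous cv :=
    hfs.continuous_convolution_left _ hfc hfi.locallyIntegrable
  have hcvi : Integrable cv := hfi.integrable_convolution _ hfi
  have hmom : ∀ n : ℕ, Integrable fun x => |x| ^ n * ‖G x‖ ^ 2 := by
    intro n
    obtain ⟨B, hB⟩ : ∃ B, ∀ x, ‖G x‖ ≤ B := ⟨_, fun x => G.norm_le_seminorm ℝ x⟩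
    refine ((G.integrable_pow_mul volume n).mul_const B).mono' ?_
      (Filter.Eventually.of_forall fun x => ?_)
    · have := G.continuous
      fun_prop
    · rw [Real.norm_of_nonneg (by positivity), sq, Real.norm_eq_abs, mul_assoc]
      gcongr
      exact hB x
  have hFi : Integrable (𝓕 cv) := by
    have : 𝓕 cv = fun x => ((‖G x‖ ^ 2 : ℝ) : ℂ) := by
      ext x; rw [hcvF, hsq]
    rw [this]
    have := (hmom 0).ofReal (𝕜 := ℂ)
    simpa using this
  have hinv := hcvc.fourierInv_fourier_eq hcvi hFi
  have hpos : 0 < ∫ u, b u := b.integral_pos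
  set m := ∫ u, b u with hm
  have hlow : ∀ x, |x| ≤ 10 → m / 2 ≤ ‖G x‖ := by
    intro x hx
    refine le_trans ?_ (Complex.re_le_norm _)
    rw [hG, hval]
    have : (∫ u : ℝ, Complex.exp (((-2 * π * u * x : ℝ) : ℂ) * Complex.I) * f u).re =
        ∫ u : ℝ, (Complex.exp (((-2 * π * u * x : ℝ) : ℂ) * Complex.I) * f u).re := by
      have := integral_re (𝕜 := ℂ) (hvalm x)
      simpa using this.symm
    rw [this, hm, div_eq_mul_inv, ← integral_mul_const]
    refine integral_mono (b.integrable.mul_const _) (hvalm x).re fun u => ?_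
    simp only [f]
    have : (Complex.exp (((-2 * π * u * x : ℝ) : ℂ) * Complex.I) * (b u : ℂ)).re =
        Real.cos (-2 * π * u * x) * b u := by
      rw [Complex.re_mul_ofReal, Complex.exp_ofReal_mul_I_re]
    show b u * 2⁻¹ ≤ (Complex.exp (((-2 * π * u * x : ℝ) : ℂ) * Complex.I) * (b u : ℂ)).re
    rw [this, mul_comm]
    by_cases hu : b u = 0
    · simp [hu]
    have hub : |u| < 1/200 := by
      have : u ∈ Function.support b := hu
      rw [b.support_eq] at this
      simpa [Metric.mem_ball, Real.dist_eq, b] using this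
    gcongr
    · exact b.nonneg
    have hab : |(-2 * π * u * x)| ≤ 1 := by
      rw [abs_mul, abs_mul, abs_mul, abs_neg, abs_of_pos (by norm_num : (0:ℝ) < 2),
        abs_of_pos Real.pi_pos]
      have := Real.pi_lt_d2
      calc 2 * π * |u| * |x| ≤ 2 * 3.15 * (1/200) * 10 := by gcongr
        _ ≤ 1 := by norm_num
    have h1 := Real.one_sub_sq_div_two_le_cos (x := -2 * π * u * x)
    have h2 : (-2 * π * u * x) ^ 2 ≤ 1 := (sq_le_one_iff_abs_le_one _).2 hab
    linarith
  refine ⟨fun x => 4 / m ^ 2 * ‖G x‖ ^ 2, ?_, ?_, ?_, ?_, ?_⟩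
  · have := G.continuous
    fun_prop
  · intro x; positivity
  · intro x hx
    have := hlow x hx
    rw [div_mul_eq_mul_div, le_div_iff₀ (by positivity)]
    nlinarith
  · intro n
    refine ((hmom n).const_mul (4 / m ^ 2)).congr (Filter.Eventually.of_forall fun x => ?_)
    simp only; ring
  · intro θ hθ
    have h1 : cv (θ / (2 * π)) = 0 := by
      have hs : Function.support cv ⊆ Function.support f + Function.support f :=
        support_convolution_subset _
      by_contra hne
      obtain ⟨a, ha, c, hc, hac⟩ := hs hne
      have key : ∀ u, u ∈ Function.support f → |u| < 1/200 := by
        intro u hu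
        have : u ∈ Function.support b := fun h => hu (by simp [f, h])
        rw [b.support_eq] at this
        simpa [Metric.mem_ball, Real.dist_eq, b] using this
      have h3 : |θ / (2 * π)| < 1/100 := by
        rw [← hac]
        refine (abs_add_le a c).trans_lt ?_
        have := key a ha
        have := key c hc
        linarith
      rw [abs_div, abs_of_pos (by positivity : 0 < 2 * π), div_lt_iff₀ (by positivity)] at h3
      have := Real.pi_lt_d2
      nlinarith
    rw [← hinv, Real.fourierInv_eq_fourier_neg, Real.fourier_real_eq_integral_exp_smul] at h1
    have h4 : ∫ x : ℝ, Complex.exp (Complex.I * ((x * θ : ℝ) : ℂ)) * ((4 / m ^ 2 * ‖G x‖ ^ 2 : ℝ) : ℂ)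
        = ((4 / m ^ 2 : ℝ) : ℂ) * ∫ x : ℝ, Complex.exp (((-2 * π * x * -(θ / (2 * π)) : ℝ) : ℂ) * Complex.I) • 𝓕 cv x := by
      rw [← integral_const_mul]
      refine integral_congr_ae (Filter.Eventually.of_forall fun x => ?_)
      simp only [smul_eq_mul]
      rw [hcvF, ← hsq]
      have : -2 * π * x * -(θ / (2 * π)) = x * θ := by
        field_simp
      rw [this, mul_comm Complex.I]
      push_cast; ring
    rw [h4, h1, mul_zero]

end

section

/-- The unimodular character `x ↦ e^{ix}`. -/
def ec (x : ℝ) : ℂ := Complex.exp (Complex.I * (x : ℂ))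

theorem norm_ec (x : ℝ) : ‖ec x‖ = 1 := by
  rw [ec, mul_comm, Complex.norm_exp_ofReal_mul_I]

theorem enorm_ec (x : ℝ) : ‖ec x‖ₑ = 1 := by
  rw [← ofReal_norm, norm_ec, ENNReal.ofReal_one]

theorem ec_add (x y : ℝ) : ec (x + y) = ec x * ec y := by
  rw [ec, ec, ec, ← Complex.exp_add]; push_cast; ring_nf

theorem conj_ec (x : ℝ) : (starRingEnd ℂ) (ec x) = ec (-x) := by
  rw [ec, ec, ← Complex.exp_conj]; simp

theorem ec_zero : ec 0 = 1 := by simp [ec]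

@[fun_prop]
theorem continuous_ec : Continuous ec := by unfold ec; fun_prop

@[fun_prop]
theorem measurable_ec : Measurable ec := continuous_ec.measurable

/-- The measure with density `κ`. -/
def wMeas (κ : ℝ → ℝ) : Measure ℝ := volume.withDensity fun x => ENNReal.ofReal (κ x)

theorem IsBandWeight.integrable {κ : ℝ → ℝ} (h : IsBandWeight κ) : Integrable κ := by
  simpa using h.moment 0

theorem IsBandWeight.isFiniteMeasure {κ : ℝ → ℝ} (h : IsBandWeight κ) :
    IsFiniteMeasure (wMeas κ) :=
  isFiniteMeasure_withDensity_ofReal h.integrable.2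

instance (κ : ℝ → ℝ) : SFinite (wMeas κ) := by unfold wMeas; infer_instance

theorem IsBandWeight.integral_ec_eq_zero {κ : ℝ → ℝ} (h : IsBandWeight κ) {θ : ℝ} (hθ : 1 ≤ |θ|) :
    ∫ x, ec (x * θ) ∂(wMeas κ) = 0 := by
  rw [wMeas, integral_withDensity_eq_integral_toReal_smul (by
    have := h.cont.measurable
    fun_prop) (Filter.Eventually.of_forall fun x => ENNReal.ofReal_lt_top)]
  rw [← h.vanish θ hθ]
  refine integral_congr_ae (Filter.Eventually.of_forall fun x => ?_)
  simp only [ENNReal.toReal_ofReal (h.nonneg x), ec, Complex.real_smul]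
  ring

/-- The product weight on space-time `ℝ × ℝ × ℝ`. -/
def wMeas3 (κ : ℝ → ℝ) : Measure (ℝ × ℝ × ℝ) := (wMeas κ).prod ((wMeas κ).prod (wMeas κ))

/-- The pairing of `ℝ × ℝ × ℝ` with itself. -/
def dot3 (z θ : ℝ × ℝ × ℝ) : ℝ := z.1 * θ.1 + (z.2.1 * θ.2.1 + z.2.2 * θ.2.2)

@[fun_prop]
theorem Continuous.dot3 {X : Type*} [TopologicalSpace X] {f g : X → ℝ × ℝ × ℝ}
    (hf : Continuous f) (hg : Continuous g) : Continuous fun x => dot3 (f x) (g x) := by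
  unfold _root_.dot3; fun_prop

@[fun_prop]
theorem Measurable.dot3 {X : Type*} [MeasurableSpace X] {f g : X → ℝ × ℝ × ℝ}
    (hf : Measurable f) (hg : Measurable g) : Measurable fun x => dot3 (f x) (g x) := by
  unfold _root_.dot3; fun_prop

/-- Closeness in all three coordinates. -/
def near3 (θ θ' : ℝ × ℝ × ℝ) : Prop :=
  |θ.1 - θ'.1| < 1 ∧ |θ.2.1 - θ'.2.1| < 1 ∧ |θ.2.2 - θ'.2.2| < 1

theorem near3_symm {θ θ' : ℝ × ℝ × ℝ} (h : near3 θ θ') : near3 θ' θ := by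
  unfold near3 at *
  rwa [abs_sub_comm, abs_sub_comm θ'.2.1, abs_sub_comm θ'.2.2]

theorem integral_dot3_eq_zero {κ : ℝ → ℝ} (h : IsBandWeight κ) {θ θ' : ℝ × ℝ × ℝ}
    (hn : ¬ near3 θ θ') :
    ∫ z, ec (dot3 z θ) * (starRingEnd ℂ) (ec (dot3 z θ')) ∂(wMeas3 κ) = 0 := by
  have hs : ∀ z : ℝ × ℝ × ℝ, ec (dot3 z θ) * (starRingEnd ℂ) (ec (dot3 z θ')) =
      ec (z.1 * (θ.1 - θ'.1)) * (ec (z.2.1 * (θ.2.1 - θ'.2.1)) * ec (z.2.2 * (θ.2.2 - θ'.2.2))) := by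
    intro z
    rw [conj_ec, ← ec_add, ← ec_add, ← ec_add]
    congr 1
    unfold dot3; ring
  simp_rw [hs]
  rw [wMeas3, integral_prod_mul (f := fun x => ec (x * (θ.1 - θ'.1)))
    (g := fun y : ℝ × ℝ => ec (y.1 * (θ.2.1 - θ'.2.1)) * ec (y.2 * (θ.2.2 - θ'.2.2))),
    integral_prod_mul (f := fun x => ec (x * (θ.2.1 - θ'.2.1)))
    (g := fun x => ec (x * (θ.2.2 - θ'.2.2)))]
  unfold near3 at hn
  by_cases h1 : 1 ≤ |θ.1 - θ'.1|
  · rw [h.integral_ec_eq_zero h1, zero_mul]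
  by_cases h2 : 1 ≤ |θ.2.1 - θ'.2.1|
  · rw [h.integral_ec_eq_zero h2, zero_mul, mul_zero]
  by_cases h3 : 1 ≤ |θ.2.2 - θ'.2.2|
  · rw [h.integral_ec_eq_zero h3, mul_zero, mul_zero]
  push Not at h1 h2 h3
  exact absurd ⟨h1, h2, h3⟩ hn

theorem enorm_integral_dot3_le (κ : ℝ → ℝ) (θ θ' : ℝ × ℝ × ℝ) :
    ‖∫ z, ec (dot3 z θ) * (starRingEnd ℂ) (ec (dot3 z θ')) ∂(wMeas3 κ)‖ₑ ≤ wMeas3 κ univ := by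
  refine (enorm_integral_le_lintegral_enorm _).trans (le_of_eq ?_)
  simp [conj_ec, enorm_ec]

theorem IsBandWeight.isFiniteMeasure3 {κ : ℝ → ℝ} (h : IsBandWeight κ) :
    IsFiniteMeasure (wMeas3 κ) := by
  have := h.isFiniteMeasure
  unfold wMeas3; infer_instance

/-- The superposition `z ↦ ∫ H(ω) e^{i z·Θ(ω)} dμ(ω)`. -/
def sup3 {Ω : Type*} [MeasurableSpace Ω] (Θ : Ω → ℝ × ℝ × ℝ) (μ : Measure Ω) (H : Ω → ℂ) :
    ℝ × ℝ × ℝ → ℂ := osc (fun z ω => ec (dot3 z (Θ ω))) μ H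

section
variable {Ω : Type*} [MeasurableSpace Ω] {Θ : Ω → ℝ × ℝ × ℝ} {μ : Measure Ω}

theorem sup3_stronglyMeasurable [SFinite μ] (hΘ : Measurable Θ) {H : Ω → ℂ} (hHm : Measurable H) :
    StronglyMeasurable (sup3 Θ μ H) :=
  osc_stronglyMeasurable (by unfold Function.uncurry; fun_prop) hHm

theorem norm_sup3_le {H : Ω → ℂ} (hH : Integrable H μ) (z : ℝ × ℝ × ℝ) :
    ‖sup3 Θ μ H z‖ ≤ ∫ ω, ‖H ω‖ ∂μ := norm_osc_le (fun _ _ => (norm_ec _).le) hH z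

theorem sup3_inner_eq_zero [SFinite μ] {κ : ℝ → ℝ} (h : IsBandWeight κ) (hΘ : Measurable Θ)
    {H H' : Ω → ℂ} (hH : Integrable H μ) (hH' : Integrable H' μ)
    (h0 : ∀ ω ω', H ω ≠ 0 → H' ω' ≠ 0 → ¬ near3 (Θ ω) (Θ ω')) :
    ∫ z, sup3 Θ μ H z * (starRingEnd ℂ) (sup3 Θ μ H' z) ∂(wMeas3 κ) = 0 := by
  have := h.isFiniteMeasure3
  exact osc_inner_eq_zero (by unfold Function.uncurry; fun_prop) (fun _ _ => (norm_ec _).le) hH hH'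
    fun ω ω' a b => integral_dot3_eq_zero h (h0 ω ω' a b)

theorem measurableSet_near3 (hΘ : Measurable Θ) :
    MeasurableSet {p : Ω × Ω | near3 (Θ p.1) (Θ p.2)} := by
  have m1 : Measurable fun p : Ω × Ω => |(Θ p.1).1 - (Θ p.2).1| :=
    continuous_abs.measurable.comp (by fun_prop)
  have m2 : Measurable fun p : Ω × Ω => |(Θ p.1).2.1 - (Θ p.2).2.1| :=
    continuous_abs.measurable.comp (by fun_prop)
  have m3 : Measurable fun p : Ω × Ω => |(Θ p.1).2.2 - (Θ p.2).2.2| :=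
    continuous_abs.measurable.comp (by fun_prop)
  exact (measurableSet_lt m1 measurable_const).inter
    ((measurableSet_lt m2 measurable_const).inter (measurableSet_lt m3 measurable_const))

theorem sup3_sq_lintegral_le [SFinite μ] {κ : ℝ → ℝ} (h : IsBandWeight κ) (hΘ : Measurable Θ)
    {H : Ω → ℂ} (hH : Integrable H μ) (hHm : Measurable H) {B : ℝ≥0∞}
    (hB : ∀ ω, H ω ≠ 0 → μ {ω' | H ω' ≠ 0 ∧ near3 (Θ ω) (Θ ω')} ≤ B) :
    ∫⁻ z, ‖sup3 Θ μ H z‖ₑ ^ 2 ∂(wMeas3 κ) ≤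
      2 * wMeas3 κ univ * B * ∫⁻ ω, ‖H ω‖ₑ ^ 2 ∂μ := by
  have := h.isFiniteMeasure3
  exact osc_sq_lintegral_le (by unfold Function.uncurry; fun_prop) (fun _ _ => (norm_ec _).le) hH hHm
    (measurableSet_near3 hΘ) (fun _ _ => near3_symm)
    (fun _ _ => enorm_integral_dot3_le κ _ _) (fun _ _ _ _ hn => integral_dot3_eq_zero h hn) hB

theorem sup3_mul_sup3 [SFinite μ] (H H' : Ω → ℂ) (z : ℝ × ℝ × ℝ) :
    sup3 Θ μ H z * sup3 Θ μ H' z =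
      sup3 (fun p : Ω × Ω => Θ p.1 + Θ p.2) (μ.prod μ) (fun p => H p.1 * H' p.2) z := by
  unfold sup3 osc
  rw [← integral_prod_mul]
  refine integral_congr_ae (Filter.Eventually.of_forall fun p => ?_)
  have : dot3 z (Θ p.1 + Θ p.2) = dot3 z (Θ p.1) + dot3 z (Θ p.2) := by
    unfold dot3; simp only [Prod.fst_add, Prod.snd_add]; ring
  simp only [this, ec_add]
  ring

theorem sup3_sum {ι : Type*} (s : Finset ι) {H : ι → Ω → ℂ} (hH : ∀ i ∈ s, Integrable (H i) μ)
    (hHm : Measurable Θ) (z : ℝ × ℝ × ℝ) :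
    sup3 Θ μ (fun ω => ∑ i ∈ s, H i ω) z = ∑ i ∈ s, sup3 Θ μ (H i) z := by
  unfold sup3 osc
  rw [← integral_finsetSum]
  · simp_rw [Finset.sum_mul]
  · intro i hi
    refine (hH i hi).mul_bdd (c := 1) (by fun_prop) (Filter.Eventually.of_forall fun ω => ?_)
    rw [norm_ec]

theorem sup3_mul_sq_lintegral_le [SFinite μ] {κ : ℝ → ℝ} (h : IsBandWeight κ) (hΘ : Measurable Θ)
    {H H' : Ω → ℂ} (hH : Integrable H μ) (hHm : Measurable H)
    (hH' : Integrable H' μ) (hHm' : Measurable H') {B : ℝ≥0∞}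
    (hB : ∀ ω : Ω × Ω, H ω.1 ≠ 0 → H' ω.2 ≠ 0 → (μ.prod μ) {ω' | (H ω'.1 ≠ 0 ∧ H' ω'.2 ≠ 0) ∧
      near3 (Θ ω.1 + Θ ω.2) (Θ ω'.1 + Θ ω'.2)} ≤ B) :
    ∫⁻ z, ‖sup3 Θ μ H z * sup3 Θ μ H' z‖ₑ ^ 2 ∂(wMeas3 κ) ≤
      2 * wMeas3 κ univ * B * ((∫⁻ ω, ‖H ω‖ₑ ^ 2 ∂μ) * ∫⁻ ω, ‖H' ω‖ₑ ^ 2 ∂μ) := by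
  simp_rw [sup3_mul_sup3]
  refine (sup3_sq_lintegral_le h (by fun_prop) (hH.mul_prod hH') (by fun_prop) (B := B) ?_).trans
    (le_of_eq ?_)
  · intro ω hω
    have := mul_ne_zero_iff.1 hω
    convert hB ω this.1 this.2 using 3
    simp
  · congr 1
    simp_rw [enorm_mul, mul_pow]
    exact lintegral_prod_mul (f := fun ω => ‖H ω‖ₑ ^ 2) (g := fun ω => ‖H' ω‖ₑ ^ 2)
      (by fun_prop) (by fun_prop)

end

end

section

section
variable {Ω : Type*} [MeasurableSpace Ω] {Θ : Ω → ℝ × ℝ × ℝ} {μ : Measure Ω}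

theorem integral_dot3_eq_zero_of_planar {κ : ℝ → ℝ} (h : IsBandWeight κ) (τ : Measure ℝ)
    [SFinite τ] {θ θ' : ℝ × ℝ × ℝ} (hn : ¬ (|θ.1 - θ'.1| < 1 ∧ |θ.2.1 - θ'.2.1| < 1)) :
    ∫ z, ec (dot3 z θ) * (starRingEnd ℂ) (ec (dot3 z θ'))
      ∂((wMeas κ).prod ((wMeas κ).prod τ)) = 0 := by
  have hs : ∀ z : ℝ × ℝ × ℝ, ec (dot3 z θ) * (starRingEnd ℂ) (ec (dot3 z θ')) =
      ec (z.1 * (θ.1 - θ'.1)) * (ec (z.2.1 * (θ.2.1 - θ'.2.1)) * ec (z.2.2 * (θ.2.2 - θ'.2.2))) := by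
    intro z
    rw [conj_ec, ← ec_add, ← ec_add, ← ec_add]
    congr 1
    unfold dot3; ring
  simp_rw [hs]
  rw [integral_prod_mul (f := fun x => ec (x * (θ.1 - θ'.1)))
    (g := fun y : ℝ × ℝ => ec (y.1 * (θ.2.1 - θ'.2.1)) * ec (y.2 * (θ.2.2 - θ'.2.2))),
    integral_prod_mul (f := fun x => ec (x * (θ.2.1 - θ'.2.1)))
    (g := fun x => ec (x * (θ.2.2 - θ'.2.2)))]
  by_cases h1 : 1 ≤ |θ.1 - θ'.1|
  · rw [h.integral_ec_eq_zero h1, zero_mul]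
  by_cases h2 : 1 ≤ |θ.2.1 - θ'.2.1|
  · rw [h.integral_ec_eq_zero h2, zero_mul, mul_zero]
  push Not at h1 h2
  exact absurd ⟨h1, h2⟩ hn

theorem sup3_sq_lintegral_le_planar [SFinite μ] {κ : ℝ → ℝ} (h : IsBandWeight κ) (τ : Measure ℝ)
    [IsFiniteMeasure τ] (hΘ : Measurable Θ) {H : Ω → ℂ} (hH : Integrable H μ) (hHm : Measurable H)
    {B : ℝ≥0∞} (hB : ∀ ω, μ {ω' | |(Θ ω).1 - (Θ ω').1| < 1 ∧ |(Θ ω).2.1 - (Θ ω').2.1| < 1} ≤ B) :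
    ∫⁻ z, ‖sup3 Θ μ H z‖ₑ ^ 2 ∂((wMeas κ).prod ((wMeas κ).prod τ)) ≤
      2 * ((wMeas κ).prod ((wMeas κ).prod τ)) univ * B * ∫⁻ ω, ‖H ω‖ₑ ^ 2 ∂μ := by
  have := h.isFiniteMeasure
  refine osc_sq_lintegral_le
    (near := fun ω ω' => |(Θ ω).1 - (Θ ω').1| < 1 ∧ |(Θ ω).2.1 - (Θ ω').2.1| < 1)
    (by unfold Function.uncurry; fun_prop) (fun _ _ => (norm_ec _).le) hH hHm
    ?_ ?_ ?_ (fun _ _ _ _ hn => integral_dot3_eq_zero_of_planar h τ hn) ?_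
  · have m1 : Measurable fun p : Ω × Ω => |(Θ p.1).1 - (Θ p.2).1| :=
      continuous_abs.measurable.comp (by fun_prop)
    have m2 : Measurable fun p : Ω × Ω => |(Θ p.1).2.1 - (Θ p.2).2.1| :=
      continuous_abs.measurable.comp (by fun_prop)
    exact (measurableSet_lt m1 measurable_const).inter (measurableSet_lt m2 measurable_const)
  · intro ω ω' hn
    rwa [abs_sub_comm, abs_sub_comm (Θ ω').2.1]
  · intro ω ω'
    refine (enorm_integral_le_lintegral_enorm _).trans (le_of_eq ?_)
    simp [conj_ec, enorm_ec]
  · intro ω _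
    exact (measure_mono fun ω' hω' => hω'.2).trans (hB ω)

end

/-- The frequency point `(ξ₁, ξ₂, |ξ|)` on the light cone. -/
def coneMap (ξ : ℝ × ℝ) : ℝ × ℝ × ℝ := (ξ.1, ξ.2, enorm2 ξ)

@[fun_prop]
theorem continuous_enorm2 : Continuous enorm2 := by unfold enorm2; fun_prop

@[fun_prop]
theorem continuous_coneMap : Continuous coneMap := by unfold coneMap; fun_prop

theorem volume_abs_sub_lt (a r : ℝ) : volume {x : ℝ | |a - x| < r} = ENNReal.ofReal (2 * r) := by
  have : {x : ℝ | |a - x| < r} = Metric.ball a r := by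
    ext x; simp [Real.dist_eq, abs_sub_comm]
  rw [this, Real.volume_ball]

theorem volume_box_lt (a : ℝ × ℝ) (r : ℝ) :
    volume {x : ℝ × ℝ | |a.1 - x.1| < r ∧ |a.2 - x.2| < r} =
      ENNReal.ofReal (2 * r) * ENNReal.ofReal (2 * r) := by
  have : {x : ℝ × ℝ | |a.1 - x.1| < r ∧ |a.2 - x.2| < r} =
      {x : ℝ | |a.1 - x| < r} ×ˢ {x : ℝ | |a.2 - x| < r} := rfl
  rw [this, Measure.volume_eq_prod, Measure.prod_prod, volume_abs_sub_lt, volume_abs_sub_lt]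

theorem cone_sq_lintegral_le {κ : ℝ → ℝ} (h : IsBandWeight κ) (τ : Measure ℝ)
    [IsFiniteMeasure τ] {H : ℝ × ℝ → ℂ} (hH : Integrable H) (hHm : Measurable H) :
    ∫⁻ z, ‖sup3 coneMap volume H z‖ₑ ^ 2 ∂((wMeas κ).prod ((wMeas κ).prod τ)) ≤
      8 * ((wMeas κ).prod ((wMeas κ).prod τ)) univ * ∫⁻ ω, ‖H ω‖ₑ ^ 2 := by
  refine (sup3_sq_lintegral_le_planar h τ (by fun_prop) hH hHm (B := 4) ?_).trans (le_of_eq ?_)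
  · intro ω
    have := volume_box_lt ω 1
    simp only [coneMap]
    rw [this, ← ENNReal.ofReal_mul (by norm_num)]
    norm_num
  · ring

theorem volume_restrict_le_wMeas {κ : ℝ → ℝ} (h : IsBandWeight κ) :
    volume.restrict (Icc (-10) 10) ≤ wMeas κ := by
  rw [← withDensity_indicator_one measurableSet_Icc]
  refine withDensity_mono (Filter.Eventually.of_forall fun x => ?_)
  by_cases hx : x ∈ Icc (-10:ℝ) 10
  · rw [indicator_of_mem hx]
    simpa using h.one_le x (abs_le.2 hx)
  · rw [indicator_of_notMem hx]; exact zero_le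

theorem lintegral_eq_smul_lintegral_comp {M : ℝ} (hM : 0 < M) (f : ℝ × ℝ → ℝ≥0∞) :
    ∫⁻ x, f x = ENNReal.ofReal (M ^ 2) * ∫⁻ w, f (M • w) := by
  have e : MeasurableEmbedding fun w : ℝ × ℝ => M • w := measurableEmbedding_const_smul₀ hM.ne'
  rw [← e.lintegral_map f, Measure.map_addHaar_smul _ hM.ne', lintegral_smul_measure]
  have : Module.finrank ℝ (ℝ × ℝ) = 2 := by simp
  rw [this, abs_of_pos (by positivity), smul_eq_mul, ← mul_assoc,
    ← ENNReal.ofReal_mul (by positivity), mul_inv_cancel₀ (by positivity), ENNReal.ofReal_one,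
    one_mul]

/-- Local Bessel inequality for `ft2`. -/
theorem exists_bessel : ∃ C : ℝ≥0∞, C ≠ ∞ ∧ ∀ (M : ℝ), 0 < M → ∀ g : ℝ × ℝ → ℂ, Integrable g →
    Measurable g → ∫⁻ ξ in Icc (-M) M ×ˢ Icc (-M) M, ‖ft2 g ξ‖ₑ ^ 2 ≤ C * ∫⁻ x, ‖g x‖ₑ ^ 2 := by
  obtain ⟨κ, h⟩ := exists_isBandWeight
  have := h.isFiniteMeasure
  refine ⟨8 * ((wMeas κ).prod ((wMeas κ).prod (Measure.dirac (0:ℝ)))) univ,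
    ENNReal.mul_ne_top (by norm_num) (measure_ne_top _ _), fun M hM g hg hgm => ?_⟩
  set Θ : ℝ × ℝ → ℝ × ℝ × ℝ := fun x => (-(M * x.1), -(M * x.2), 0) with hΘ
  have h1 := sup3_sq_lintegral_le_planar (μ := volume) h (Measure.dirac (0:ℝ)) (Θ := Θ)
    (by fun_prop) hg hgm (B := 4 * ENNReal.ofReal (1 / M ^ 2)) (by
      intro ω
      have h2 := volume_box_lt ω (1 / M)
      have h3 : {ω' : ℝ × ℝ | |(Θ ω).1 - (Θ ω').1| < 1 ∧ |(Θ ω).2.1 - (Θ ω').2.1| < 1} =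
          {x : ℝ × ℝ | |ω.1 - x.1| < 1 / M ∧ |ω.2 - x.2| < 1 / M} := by
        ext x
        simp only [hΘ, mem_ofPred_eq]
        have e : ∀ a b : ℝ, |-(M * a) - -(M * b)| < 1 ↔ |a - b| < 1 / M := by
          intro a b
          rw [lt_div_iff₀ hM, show -(M * a) - -(M * b) = -((a - b) * M) by ring, abs_neg, abs_mul,
            abs_of_pos hM]
        rw [e, e]
      rw [h3, h2, ← ENNReal.ofReal_mul (by positivity),
        show (4:ℝ≥0∞) = ENNReal.ofReal 4 by norm_num, ← ENNReal.ofReal_mul (by norm_num)]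
      refine le_of_eq (congrArg _ ?_)
      field_simp; norm_num)
  have h4 : ∀ z : ℝ × ℝ × ℝ, sup3 Θ volume g z = ft2 g (M • (z.1, z.2.1)) := by
    intro z
    unfold sup3 osc ft2
    refine integral_congr_ae (Filter.Eventually.of_forall fun x => ?_)
    simp only [hΘ, dot3, ec]
    rw [mul_comm]
    congr 2
    simp only [Prod.smul_mk, smul_eq_mul]
    push_cast; ring
  have hfm : Measurable fun w : ℝ × ℝ => ‖ft2 g (M • w)‖ₑ ^ 2 := by
    have hm := (sup3_stronglyMeasurable (μ := volume) (Θ := Θ) (by fun_prop) hgm).measurable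
    have : (fun w : ℝ × ℝ => ‖ft2 g (M • w)‖ₑ ^ 2) =
      fun w => ‖sup3 Θ volume g (w.1, w.2, 0)‖ₑ ^ 2 := by
      ext w; rw [h4]
    rw [this]
    exact ((hm.comp (by fun_prop)).enorm).pow_const 2
  have h5 : ∫⁻ w in Icc (-1:ℝ) 1 ×ˢ Icc (-1:ℝ) 1, ‖ft2 g (M • w)‖ₑ ^ 2 ≤
      ∫⁻ z, ‖sup3 Θ volume g z‖ₑ ^ 2 ∂((wMeas κ).prod ((wMeas κ).prod (Measure.dirac (0:ℝ)))) := by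
    have e1 : ∫⁻ z, ‖sup3 Θ volume g z‖ₑ ^ 2
        ∂((wMeas κ).prod ((wMeas κ).prod (Measure.dirac (0:ℝ)))) =
        ∫⁻ w, ‖ft2 g (M • w)‖ₑ ^ 2 ∂((wMeas κ).prod (wMeas κ)) := by
      simp_rw [h4]
      have hF : Measurable fun z : ℝ × ℝ × ℝ => ‖ft2 g (M • (z.1, z.2.1))‖ₑ ^ 2 :=
        hfm.comp (by fun_prop : Measurable fun z : ℝ × ℝ × ℝ => (z.1, z.2.1))
      rw [lintegral_prod _ hF.aemeasurable, lintegral_prod _ hfm.aemeasurable]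
      refine lintegral_congr fun x => ?_
      have hF2 : Measurable fun w : ℝ × ℝ => ‖ft2 g (M • (x, w.1))‖ₑ ^ 2 :=
        hfm.comp (by fun_prop : Measurable fun w : ℝ × ℝ => (x, w.1))
      rw [lintegral_prod _ hF2.aemeasurable]
      simp
    rw [e1]
    refine lintegral_mono' ?_ le_rfl
    rw [Measure.volume_eq_prod, ← Measure.prod_restrict]
    have hsub : volume.restrict (Icc (-1:ℝ) 1) ≤ wMeas κ :=
      (Measure.restrict_mono (Icc_subset_Icc (by norm_num) (by norm_num)) le_rfl).trans
        (volume_restrict_le_wMeas h)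
    exact Measure.prod_mono hsub hsub
  have h6 : ∫⁻ ξ in Icc (-M) M ×ˢ Icc (-M) M, ‖ft2 g ξ‖ₑ ^ 2 =
      ENNReal.ofReal (M ^ 2) * ∫⁻ w in Icc (-1:ℝ) 1 ×ˢ Icc (-1:ℝ) 1, ‖ft2 g (M • w)‖ₑ ^ 2 := by
    rw [← lintegral_indicator (measurableSet_Icc.prod measurableSet_Icc),
      ← lintegral_indicator (measurableSet_Icc.prod measurableSet_Icc),
      lintegral_eq_smul_lintegral_comp hM]
    congr 1
    refine lintegral_congr fun w => ?_
    have hmem : M • w ∈ Icc (-M) M ×ˢ Icc (-M) M ↔ w ∈ Icc (-1:ℝ) 1 ×ˢ Icc (-1:ℝ) 1 := by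
      simp only [mem_prod, mem_Icc, Prod.smul_fst, Prod.smul_snd, smul_eq_mul]
      have e : ∀ a : ℝ, (-M ≤ M * a ∧ M * a ≤ M) ↔ (-1 ≤ a ∧ a ≤ 1) := by
        intro a
        constructor
        · rintro ⟨p1, p2⟩; constructor <;> nlinarith
        · rintro ⟨p1, p2⟩; constructor <;> nlinarith
      rw [e, e]
    by_cases hw : w ∈ Icc (-1:ℝ) 1 ×ˢ Icc (-1:ℝ) 1
    · rw [indicator_of_mem hw, indicator_of_mem (hmem.2 hw)]
    · rw [indicator_of_notMem hw, indicator_of_notMem (fun h => hw (hmem.1 h))]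
  rw [h6]
  calc _ ≤ ENNReal.ofReal (M ^ 2) * (2 * ((wMeas κ).prod ((wMeas κ).prod (Measure.dirac (0:ℝ)))) univ *
        (4 * ENNReal.ofReal (1 / M ^ 2)) * ∫⁻ x, ‖g x‖ₑ ^ 2) := by
        gcongr; exact h5.trans h1
    _ = (ENNReal.ofReal (M ^ 2) * ENNReal.ofReal (1 / M ^ 2)) *
        (8 * ((wMeas κ).prod ((wMeas κ).prod (Measure.dirac (0:ℝ)))) univ * ∫⁻ x, ‖g x‖ₑ ^ 2) := by
        ring
    _ = _ := by
        rw [← ENNReal.ofReal_mul (by positivity), mul_one_div_cancel (by positivity)]; simp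

end

/-- Almost orthogonality: functions orthogonal outside a relation of bounded degree. -/
theorem lintegral_sum_sq_le_of_almost_orthogonal {Z T : Type*} [MeasurableSpace Z] {ρ : Measure Z}
    [IsFiniteMeasure ρ] (s : Finset T) (H : T → Z → ℂ)
    (hm : ∀ t ∈ s, Measurable (H t)) {B : ℝ} (hB : ∀ t ∈ s, ∀ z, ‖H t z‖ ≤ B)
    (R : T → T → Prop) [DecidableRel R] (hR : ∀ t t', R t t' → R t' t) {D : ℕ}
    (hD : ∀ t ∈ s, (s.filter fun t' => R t t').card ≤ D)
    (h0 : ∀ t ∈ s, ∀ t' ∈ s, ¬ R t t' → ∫ z, H t z * (starRingEnd ℂ) (H t' z) ∂ρ = 0) :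
    ∫⁻ z, ‖∑ t ∈ s, H t z‖ₑ ^ 2 ∂ρ ≤ 2 * D * ∑ t ∈ s, ∫⁻ z, ‖H t z‖ₑ ^ 2 ∂ρ := by
  have hUm : Measurable fun z => ∑ t ∈ s, H t z := Finset.measurable_fun_sum s hm
  have hUb : ∀ z, ‖∑ t ∈ s, H t z‖ ≤ ∑ t ∈ s, B := fun z =>
    norm_sum_le_of_le _ fun t ht => hB t ht z
  rw [lintegral_enorm_sq_eq hUm.aestronglyMeasurable hUb]
  have hintg : ∀ t ∈ s, ∀ t' ∈ s, Integrable (fun z => H t z * (starRingEnd ℂ) (H t' z)) ρ := by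
    intro t ht t' ht'
    refine Integrable.of_bound (C := B * B) ?_ (Filter.Eventually.of_forall fun z => ?_)
    · exact ((hm t ht).mul (Complex.continuous_conj.measurable.comp (hm t' ht'))).aestronglyMeasurable
    · rw [norm_mul, RCLike.norm_conj]
      exact mul_le_mul (hB t ht z) (hB t' ht' z) (norm_nonneg _) ((norm_nonneg _).trans (hB t ht z))
  have hexp : ∫ z, (∑ t ∈ s, H t z) * (starRingEnd ℂ) (∑ t ∈ s, H t z) ∂ρ =
      ∑ t ∈ s, ∑ t' ∈ s, ∫ z, H t z * (starRingEnd ℂ) (H t' z) ∂ρ := by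
    simp_rw [map_sum, Finset.sum_mul_sum]
    rw [integral_finsetSum _ fun t ht => integrable_finsetSum _ fun t' ht' => hintg t ht t' ht']
    refine Finset.sum_congr rfl fun t ht => ?_
    rw [integral_finsetSum _ fun t' ht' => hintg t ht t' ht']
  rw [hexp]
  set E : T → ℝ≥0∞ := fun t => ∫⁻ z, ‖H t z‖ₑ ^ 2 ∂ρ with hE
  have hpair : ∀ t ∈ s, ∀ t' ∈ s, ‖∫ z, H t z * (starRingEnd ℂ) (H t' z) ∂ρ‖ₑ ≤
      if R t t' then E t + E t' else 0 := by
    intro t ht t' ht'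
    split_ifs with hr
    · refine (enorm_integral_le_lintegral_enorm _).trans ?_
      rw [hE]
      simp only
      rw [← lintegral_add_left ((hm t ht).enorm.pow_const 2)]
      refine lintegral_mono fun z => ?_
      simp only
      rw [enorm_mul, RCLike.enorm_conj]
      exact ENNReal.mul_le_sq_add_sq _ _
    · rw [h0 t ht t' ht' hr]; simp
  have hdeg : ∀ t ∈ s, ∑ t' ∈ s, (if R t t' then E t else 0) ≤ D * E t := by
    intro t ht
    rw [← Finset.sum_filter, Finset.sum_const, nsmul_eq_mul]
    gcongr
    exact hD t ht
  calc _ ≤ ∑ t ∈ s, ‖∑ t' ∈ s, ∫ z, H t z * (starRingEnd ℂ) (H t' z) ∂ρ‖ₑ := enorm_sum_le _ _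
    _ ≤ ∑ t ∈ s, ∑ t' ∈ s, ‖∫ z, H t z * (starRingEnd ℂ) (H t' z) ∂ρ‖ₑ := by
        gcongr; exact enorm_sum_le _ _
    _ ≤ ∑ t ∈ s, ∑ t' ∈ s, ((if R t t' then E t else 0) + if R t t' then E t' else 0) := by
        refine Finset.sum_le_sum fun t ht => Finset.sum_le_sum fun t' ht' =>
          (hpair t ht t' ht').trans ?_
        split_ifs <;> simp
    _ = (∑ t ∈ s, ∑ t' ∈ s, if R t t' then E t else 0) +
          ∑ t ∈ s, ∑ t' ∈ s, if R t t' then E t' else 0 := by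
        simp_rw [Finset.sum_add_distrib]
    _ = (∑ t ∈ s, ∑ t' ∈ s, if R t t' then E t else 0) +
          ∑ t ∈ s, ∑ t' ∈ s, if R t t' then E t else 0 := by
        congr 1
        rw [Finset.sum_comm]
        refine Finset.sum_congr rfl fun t _ => Finset.sum_congr rfl fun t' _ => ?_
        exact if_congr ⟨hR _ _, hR _ _⟩ rfl rfl
    _ ≤ (∑ t ∈ s, D * E t) + ∑ t ∈ s, D * E t := by
        gcongr with t ht t ht
        · exact hdeg t ht
        · exact hdeg t ht
    _ = _ := by
        rw [← Finset.mul_sum]; ring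

/-- An `L⁴` decoupling inequality from almost orthogonality of the products `F_c F_{c'}`. -/
theorem lintegral_sum_pow_four_le {Z T : Type*} [MeasurableSpace Z] {ρ : Measure Z}
    [IsFiniteMeasure ρ] (s : Finset T) (F : T → Z → ℂ)
    (hm : ∀ t ∈ s, Measurable (F t)) {B : ℝ} (hB : ∀ t ∈ s, ∀ z, ‖F t z‖ ≤ B)
    (R : T × T → T × T → Prop) [DecidableRel R] (hR : ∀ t t', R t t' → R t' t) {D : ℕ}
    (hD : ∀ t ∈ s ×ˢ s, ((s ×ˢ s).filter fun t' => R t t').card ≤ D)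
    (h0 : ∀ t ∈ s ×ˢ s, ∀ t' ∈ s ×ˢ s, ¬ R t t' →
      ∫ z, (F t.1 z * F t.2 z) * (starRingEnd ℂ) (F t'.1 z * F t'.2 z) ∂ρ = 0) :
    ∫⁻ z, ‖∑ t ∈ s, F t z‖ₑ ^ 4 ∂ρ ≤ 4 * D * s.card * ∑ t ∈ s, ∫⁻ z, ‖F t z‖ₑ ^ 4 ∂ρ := by
  have hsq : ∀ z, ‖∑ t ∈ s, F t z‖ₑ ^ 4 = ‖∑ t ∈ s ×ˢ s, F t.1 z * F t.2 z‖ₑ ^ 2 := by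
    intro z
    have h : ∑ t ∈ s ×ˢ s, F t.1 z * F t.2 z = (∑ t ∈ s, F t z) * ∑ t ∈ s, F t z := by
      rw [Finset.sum_mul_sum, Finset.sum_product]
    rw [h, enorm_mul]
    ring
  simp_rw [hsq]
  refine (lintegral_sum_sq_le_of_almost_orthogonal (s ×ˢ s) (fun t z => F t.1 z * F t.2 z)
    (fun t ht => (hm _ (Finset.mem_product.1 ht).1).mul (hm _ (Finset.mem_product.1 ht).2))
    (B := B * B) (fun t ht z => ?_) R hR hD h0).trans ?_
  · have h1 := hB _ (Finset.mem_product.1 ht).1 z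
    rw [norm_mul]
    exact mul_le_mul h1 (hB _ (Finset.mem_product.1 ht).2 z) (norm_nonneg _)
      ((norm_nonneg _).trans h1)
  · have key : ∑ t ∈ s ×ˢ s, ∫⁻ z, ‖F t.1 z * F t.2 z‖ₑ ^ 2 ∂ρ ≤
        2 * s.card * ∑ t ∈ s, ∫⁻ z, ‖F t z‖ₑ ^ 4 ∂ρ := by
      calc _ ≤ ∑ t ∈ s ×ˢ s, ((∫⁻ z, ‖F t.1 z‖ₑ ^ 4 ∂ρ) + ∫⁻ z, ‖F t.2 z‖ₑ ^ 4 ∂ρ) := by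
            refine Finset.sum_le_sum fun t ht => ?_
            rw [← lintegral_add_left ((hm _ (Finset.mem_product.1 ht).1).enorm.pow_const 4)]
            refine lintegral_mono fun z => ?_
            simp only
            rw [enorm_mul, mul_pow]
            refine (ENNReal.mul_le_sq_add_sq _ _).trans (le_of_eq ?_)
            ring
        _ = _ := by
            rw [Finset.sum_add_distrib, Finset.sum_product, Finset.sum_product_right]
            simp only [Finset.sum_const, nsmul_eq_mul]
            rw [← Finset.mul_sum]; ring
    calc _ ≤ 2 * (D:ℝ≥0∞) * (2 * s.card * ∑ t ∈ s, ∫⁻ z, ‖F t z‖ₑ ^ 4 ∂ρ) := by gcongr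
      _ = _ := by ring

/-- The pointwise broad-narrow inequality. -/
theorem broad_narrow (s : Finset ℤ) (a : ℤ → ℝ) (ha : ∀ c ∈ s, 0 ≤ a c) {S : ℝ}
    (hS : ∀ c ∈ s, a c ≤ S) {L : ℕ} (hL : s.card ≤ L) :
    (∑ c ∈ s, a c) ^ 5 ≤ 8 ^ 5 * ∑ c ∈ s, a c ^ 5 +
      4 * L ^ 7 * S * ∑ p ∈ (s ×ˢ s).filter (fun p => 4 ≤ |p.1 - p.2|), (a p.1 * a p.2) ^ 2 := by
  rcases s.eq_empty_or_nonempty with rfl | hne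
  · simp
  obtain ⟨m, hm, hmax⟩ := s.exists_max_image a hne
  have hm0 := ha m hm
  have hS0 : 0 ≤ S := hm0.trans (hS m hm)
  have hL1 : (1:ℝ) ≤ L := by
    exact_mod_cast (Finset.card_pos.2 hne).trans_le hL
  have hn1 : a m ^ 5 ≤ ∑ c ∈ s, a c ^ 5 :=
    Finset.single_le_sum (f := fun c => a c ^ 5) (fun c hc => pow_nonneg (ha c hc) 5) hm
  have hb0 : 0 ≤ ∑ p ∈ (s ×ˢ s).filter (fun p => 4 ≤ |p.1 - p.2|), (a p.1 * a p.2) ^ 2 :=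
    Finset.sum_nonneg fun p _ => sq_nonneg _
  have hsum0 : 0 ≤ ∑ c ∈ s, a c := Finset.sum_nonneg ha
  by_cases hex : ∃ c ∈ s, 4 ≤ |m - c| ∧ a m ≤ 2 * L * a c
  · obtain ⟨c, hc, hmc, hac⟩ := hex
    have h1 : ∑ c ∈ s, a c ≤ L * a m := by
      calc ∑ c ∈ s, a c ≤ ∑ c ∈ s, a m := Finset.sum_le_sum hmax
        _ = s.card * a m := by simp
        _ ≤ L * a m := by gcongr
    have h2 : (a m * a c) ^ 2 ≤
        ∑ p ∈ (s ×ˢ s).filter (fun p => 4 ≤ |p.1 - p.2|), (a p.1 * a p.2) ^ 2 :=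
      Finset.single_le_sum (f := fun p : ℤ × ℤ => (a p.1 * a p.2) ^ 2) (fun p _ => sq_nonneg _)
        (Finset.mem_filter.2 ⟨Finset.mem_product.2 ⟨hm, hc⟩, hmc⟩ : (m, c) ∈ _)
    have h3 : a m ^ 5 ≤ 4 * L ^ 2 * S * (a m * a c) ^ 2 := by
      have e : a m * a m ≤ 2 * L * (a m * a c) := by nlinarith
      calc a m ^ 5 = (a m * a m) ^ 2 * a m := by ring
        _ ≤ (2 * L * (a m * a c)) ^ 2 * S := by
            gcongr; exact hS m hm
        _ = _ := by ring
    calc (∑ c ∈ s, a c) ^ 5 ≤ (L * a m) ^ 5 := by gcongr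
      _ = L ^ 5 * a m ^ 5 := by ring
      _ ≤ L ^ 5 * (4 * L ^ 2 * S *
          ∑ p ∈ (s ×ˢ s).filter (fun p => 4 ≤ |p.1 - p.2|), (a p.1 * a p.2) ^ 2) := by
          gcongr
          exact h3.trans (by gcongr)
      _ = 4 * L ^ 7 * S *
          ∑ p ∈ (s ×ˢ s).filter (fun p => 4 ≤ |p.1 - p.2|), (a p.1 * a p.2) ^ 2 := by ring
      _ ≤ _ := by
          have : 0 ≤ ∑ c ∈ s, a c ^ 5 := le_trans (by positivity) hn1
          linarith
  · push Not at hex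
    have h1 : ∑ c ∈ s, a c ≤ 8 * a m := by
      rw [← Finset.sum_filter_add_sum_filter_not s (fun c => 4 ≤ |m - c|)]
      have e1 : ∑ c ∈ s.filter (fun c => 4 ≤ |m - c|), a c ≤ a m := by
        calc ∑ c ∈ s.filter (fun c => 4 ≤ |m - c|), a c
            ≤ ∑ c ∈ s.filter (fun c => 4 ≤ |m - c|), a m / L := by
              refine Finset.sum_le_sum fun c hc => ?_
              rw [Finset.mem_filter] at hc
              have := hex c hc.1 hc.2
              have := ha c hc.1
              rw [le_div_iff₀ (by linarith)]
              nlinarith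
          _ = (s.filter (fun c => 4 ≤ |m - c|)).card * (a m / L) := by simp
          _ ≤ L * (a m / L) := by
              gcongr
              exact (Finset.card_filter_le _ _).trans hL
          _ = a m := by field_simp
      have e2 : ∑ c ∈ s.filter (fun c => ¬ 4 ≤ |m - c|), a c ≤ 7 * a m := by
        calc ∑ c ∈ s.filter (fun c => ¬ 4 ≤ |m - c|), a c
            ≤ ∑ c ∈ s.filter (fun c => ¬ 4 ≤ |m - c|), a m :=
              Finset.sum_le_sum fun c hc => hmax c (Finset.mem_filter.1 hc).1
          _ = (s.filter (fun c => ¬ 4 ≤ |m - c|)).card * a m := by simp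
          _ ≤ 7 * a m := by
              gcongr
              have : s.filter (fun c => ¬ 4 ≤ |m - c|) ⊆ Finset.Icc (m - 3) (m + 3) := by
                intro c hc
                have := (Finset.mem_filter.1 hc).2
                push Not at this
                rw [abs_lt] at this
                rw [Finset.mem_Icc]; omega
              have := Finset.card_le_card this
              rw [Int.card_Icc] at this
              have h7 : (m + 3 + 1 - (m - 3)).toNat = 7 := by omega
              rw [h7] at this
              exact_mod_cast this
      linarith
    calc (∑ c ∈ s, a c) ^ 5 ≤ (8 * a m) ^ 5 := by gcongr
      _ = 8 ^ 5 * a m ^ 5 := by ring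
      _ ≤ 8 ^ 5 * ∑ c ∈ s, a c ^ 5 := by gcongr
      _ ≤ _ := by
          have : 0 ≤ 4 * L ^ 7 * S *
            ∑ p ∈ (s ×ˢ s).filter (fun p => 4 ≤ |p.1 - p.2|), (a p.1 * a p.2) ^ 2 := by positivity
          linarith

/-- The profile `√(1 + v²)` of the light cone. -/
def hyp (v : ℝ) : ℝ := Real.sqrt (1 + v ^ 2)

theorem hyp_sq (v : ℝ) : hyp v ^ 2 = 1 + v ^ 2 := Real.sq_sqrt (by positivity)

theorem one_le_hyp (v : ℝ) : 1 ≤ hyp v := Real.one_le_sqrt.2 (by nlinarith [sq_nonneg v])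

theorem abs_le_hyp (v : ℝ) : |v| ≤ hyp v := by
  apply abs_le_of_sq_le_sq
  · nlinarith [hyp_sq v]
  · linarith [one_le_hyp v]

theorem hyp_le_of_abs_le_two {v : ℝ} (h : |v| ≤ 2) : hyp v ≤ 9 / 4 := by
  unfold hyp
  rw [Real.sqrt_le_left (by norm_num)]
  nlinarith [abs_le.1 h, sq_abs v, abs_nonneg v]

/-- The derivative of `hyp`. -/
def hypDeriv (v : ℝ) : ℝ := v / hyp v

theorem abs_hypDeriv_le (v : ℝ) : |hypDeriv v| ≤ 1 := by
  unfold hypDeriv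
  rw [abs_div, abs_of_pos (by linarith [one_le_hyp v] : 0 < hyp v)]
  exact div_le_one_of_le₀ (abs_le_hyp v) (by linarith [one_le_hyp v])

theorem hyp_taylor (u v : ℝ) : hyp v - hyp u - hypDeriv u * (v - u) =
    (v - u) ^ 2 * (1 + hyp u * hyp v - u * v) / (hyp u * (hyp u + hyp v) ^ 2) := by
  have hu := one_le_hyp u
  have hv := one_le_hyp v
  have h1 := hyp_sq u
  have h2 := hyp_sq v
  unfold hypDeriv
  have h3 : hyp u ≠ 0 := by linarith
  have h4 : hyp u + hyp v ≠ 0 := by linarith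
  rw [eq_div_iff (by positivity)]
  have h5 : hyp v - hyp u - u / hyp u * (v - u) = (hyp v * hyp u - 1 - u * v) / hyp u := by
    field_simp
    linear_combination (-1) * h1
  rw [h5]
  field_simp
  have e1 : hyp u ^ 2 * hyp v ^ 2 = (1 + u ^ 2) * (1 + v ^ 2) := by rw [h1, h2]
  have e : (hyp u + hyp v) ^ 2 = 2 + u ^ 2 + v ^ 2 + 2 * (hyp u * hyp v) := by
    linear_combination h1 + h2
  rw [e]
  linear_combination 2 * e1

theorem hyp_taylor_nonneg (u v : ℝ) : 0 ≤ hyp v - hyp u - hypDeriv u * (v - u) := by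
  rw [hyp_taylor]
  have hu := one_le_hyp u
  have hv := one_le_hyp v
  have : u * v ≤ hyp u * hyp v := by
    calc u * v ≤ |u * v| := le_abs_self _
      _ = |u| * |v| := abs_mul _ _
      _ ≤ _ := mul_le_mul (abs_le_hyp u) (abs_le_hyp v) (abs_nonneg _) (by linarith)
  apply div_nonneg
  · apply mul_nonneg (sq_nonneg _); linarith
  · positivity

theorem hyp_taylor_le (u v : ℝ) : hyp v - hyp u - hypDeriv u * (v - u) ≤ 3 * (v - u) ^ 2 := by
  rw [hyp_taylor]
  have hu := one_le_hyp u
  have hv := one_le_hyp v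
  have : -(u * v) ≤ hyp u * hyp v := by
    calc -(u * v) ≤ |u * v| := neg_le_abs _
      _ = |u| * |v| := abs_mul _ _
      _ ≤ _ := mul_le_mul (abs_le_hyp u) (abs_le_hyp v) (abs_nonneg _) (by linarith)
  rw [div_le_iff₀ (by positivity)]
  have h2 : 1 + hyp u * hyp v - u * v ≤ 3 * (hyp u * (hyp u + hyp v) ^ 2) := by
    nlinarith [mul_nonneg (by linarith : 0 ≤ hyp u - 1) (by linarith : 0 ≤ hyp v - 1),
      mul_nonneg (by linarith : (0:ℝ) ≤ hyp u) (sq_nonneg (hyp u)), mul_nonneg (by linarith : (0:ℝ) ≤ hyp u) (sq_nonneg (hyp v)), mul_nonneg (mul_nonneg (by linarith : (0:ℝ) ≤ hyp u) (by linarith : (0:ℝ) ≤ hyp v)) (by linarith : (0:ℝ) ≤ hyp u - 1)]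
  nlinarith [mul_le_mul_of_nonneg_left h2 (sq_nonneg (v - u))]

theorem le_hyp_taylor {u v : ℝ} (hu2 : |u| ≤ 2) (hv2 : |v| ≤ 2) :
    (v - u) ^ 2 / 50 ≤ hyp v - hyp u - hypDeriv u * (v - u) := by
  rw [hyp_taylor]
  have hu := one_le_hyp u
  have hv := one_le_hyp v
  have hu3 := hyp_le_of_abs_le_two hu2
  have hv3 := hyp_le_of_abs_le_two hv2
  have : u * v ≤ hyp u * hyp v := by
    calc u * v ≤ |u * v| := le_abs_self _
      _ = |u| * |v| := abs_mul _ _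
      _ ≤ _ := mul_le_mul (abs_le_hyp u) (abs_le_hyp v) (abs_nonneg _) (by linarith)
  apply div_le_div₀
  · apply mul_nonneg (sq_nonneg _); linarith
  · nlinarith [sq_nonneg (v - u)]
  · positivity
  · have h1 : (hyp u + hyp v) ^ 2 ≤ (9/2) ^ 2 := by
      apply pow_le_pow_left₀ <;> linarith
    nlinarith [sq_nonneg (hyp u + hyp v)]

theorem hypDeriv_mono {u v : ℝ} (h : u ≤ v) : hypDeriv u ≤ hypDeriv v := by
  rcases h.eq_or_lt with rfl | h
  · rfl
  have h1 := hyp_taylor_nonneg u v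
  have h2 := hyp_taylor_nonneg v u
  nlinarith

theorem hypDeriv_sub_le {u v : ℝ} (h : u ≤ v) : hypDeriv v - hypDeriv u ≤ 6 * (v - u) := by
  rcases h.eq_or_lt with rfl | h
  · simp
  have h1 := hyp_taylor_le u v
  have h2 := hyp_taylor_le v u
  nlinarith

theorem le_hypDeriv_sub {u v : ℝ} (hu2 : |u| ≤ 2) (hv2 : |v| ≤ 2) (h : u ≤ v) :
    (v - u) / 25 ≤ hypDeriv v - hypDeriv u := by
  rcases h.eq_or_lt with rfl | h
  · simp
  have h1 := le_hyp_taylor hu2 hv2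
  have h2 := le_hyp_taylor hv2 hu2
  nlinarith

theorem enorm2_eq_mul_hyp {ξ : ℝ × ℝ} (h : 0 < ξ.1) : enorm2 ξ = ξ.1 * hyp (ξ.2 / ξ.1) := by
  unfold enorm2 hyp
  rw [← Real.sqrt_sq h.le, ← Real.sqrt_mul (by positivity), Real.sqrt_sq h.le]
  congr 1
  field_simp

set_option maxHeartbeats 1000000 in
theorem abs_sub_le_of_cone_sum_ordered {p₁ p₂ p₃ p₄ v₁ v₂ v₃ v₄ lam a L : ℝ} (hlam : 1 ≤ lam)
    (ha0 : 0 < a) (ha : 1 ≤ lam * a ^ 2) (hL : 1 ≤ L) (hp : lam / 8 ≤ p₁)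
    (hp2 : |p₂ - p₁| ≤ 2 * lam / L ^ 2) (hp3 : |p₃ - p₁| ≤ 2 * lam / L ^ 2)
    (hp4 : |p₄ - p₁| ≤ 2 * lam / L ^ 2)
    (hv1 : |v₁| ≤ 2) (hv3 : |v₃| ≤ 2)
    (hd2 : |v₂ - v₁| ≤ 2 * L * a) (hd3 : |v₃ - v₁| ≤ 2 * L * a) (hd4 : |v₄ - v₁| ≤ 2 * L * a)
    (h13 : v₁ ≤ v₃) (h34 : v₃ ≤ v₄)
    (hs1 : |p₁ + p₂ - (p₃ + p₄)| ≤ 1) (hs2 : |p₁ * v₁ + p₂ * v₂ - (p₃ * v₃ + p₄ * v₄)| ≤ 1)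
    (hs3 : |p₁ * hyp v₁ + p₂ * hyp v₂ - (p₃ * hyp v₃ + p₄ * hyp v₄)| ≤ 1) :
    |v₁ - v₃| ≤ 425 * a ∧ |v₂ - v₄| ≤ 425 * a := by
  have hlam0 : 0 < lam := by linarith
  have hL0 : 0 < L := by linarith
  have hil : 1 / lam ≤ a ^ 2 := by rw [div_le_iff₀ hlam0]; linarith
  have hil1 : 1 / lam ≤ 1 := by rw [div_le_iff₀ hlam0]; linarith
  have hil0 : 0 < 1 / lam := by positivity
  have hila : 1 / lam ≤ a := by
    rcases le_total a 1 with h | h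
    · nlinarith
    · linarith
  set K := 2 * lam / L ^ 2 with hK
  have hK0 : 0 < K := by positivity
  set δ₂ := v₂ - v₁ with e2
  set δ₃ := v₃ - v₁ with e3
  set δ₄ := v₄ - v₁ with e4
  set E := δ₂ - (δ₃ + δ₄) with hE
  have hpd : ∀ p δ : ℝ, |p - p₁| ≤ K → |δ| ≤ 2 * L * a → |(p - p₁) * δ| ≤ 4 * lam * a / L := by
    intro p δ h h'
    rw [abs_mul]
    calc |p - p₁| * |δ| ≤ K * (2 * L * a) := mul_le_mul h h' (abs_nonneg _) hK0.le
      _ = _ := by rw [hK]; field_simp; ring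
  have hEb : p₁ * |E| ≤ 3 + 12 * lam * a / L := by
    have e : p₁ * E = (p₁ * v₁ + p₂ * v₂ - (p₃ * v₃ + p₄ * v₄)) -
        v₁ * (p₁ + p₂ - (p₃ + p₄)) - (p₂ - p₁) * δ₂ + (p₃ - p₁) * δ₃ + (p₄ - p₁) * δ₄ := by
      rw [hE, e2, e3, e4]; ring
    have hp0 : 0 < p₁ := by linarith
    rw [← abs_of_pos hp0, ← abs_mul, e]
    have b2 := abs_le.1 (hpd _ _ hp2 hd2)
    have b3 := abs_le.1 (hpd _ _ hp3 hd3)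
    have b4 := abs_le.1 (hpd _ _ hp4 hd4)
    have b1 : |v₁ * (p₁ + p₂ - (p₃ + p₄))| ≤ 2 * 1 := by
      rw [abs_mul]; exact mul_le_mul hv1 hs1 (abs_nonneg _) (by norm_num)
    have b1 := abs_le.1 b1
    have b0 := abs_le.1 hs2
    have : 12 * lam * a / L = 3 * (4 * lam * a / L) := by ring
    rw [this, abs_le]
    constructor <;> linarith
  have hE' : |E| ≤ 24 * (1 / lam) + 96 * a / L := by
    have h1 : lam / 8 * |E| ≤ 3 + 12 * lam * a / L :=
      (mul_le_mul_of_nonneg_right hp (abs_nonneg _)).trans hEb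
    have h2 : 24 * (1 / lam) + 96 * a / L = (3 + 12 * lam * a / L) / (lam / 8) := by
      field_simp; ring
    rw [h2, le_div_iff₀ (by positivity)]
    linarith
  set Q : ℝ → ℝ := fun v => hyp v - hyp v₁ - hypDeriv v₁ * (v - v₁) with hQ
  have hQ0 : ∀ v, 0 ≤ Q v := fun v => hyp_taylor_nonneg v₁ v
  have hQ1 : ∀ v, |v - v₁| ≤ 2 * L * a → Q v ≤ 12 * L ^ 2 * a ^ 2 := by
    intro v hv
    refine (hyp_taylor_le v₁ v).trans ?_
    have := abs_le.1 hv
    nlinarith [sq_abs (v - v₁), abs_nonneg (v - v₁)]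
  have hpQ : ∀ p v : ℝ, |p - p₁| ≤ K → |v - v₁| ≤ 2 * L * a →
      |(p - p₁) * Q v| ≤ 24 * lam * a ^ 2 := by
    intro p v h h'
    rw [abs_mul, abs_of_nonneg (hQ0 v)]
    calc |p - p₁| * Q v ≤ K * (12 * L ^ 2 * a ^ 2) := mul_le_mul h (hQ1 v h') (hQ0 v) hK0.le
      _ = _ := by rw [hK]; field_simp; ring
  have hQs : lam / 8 * (Q v₂ - (Q v₃ + Q v₄)) ≤ 7 + 72 * lam * a ^ 2 := by
    have e : p₁ * (Q v₂ - (Q v₃ + Q v₄)) =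
        (p₁ * hyp v₁ + p₂ * hyp v₂ - (p₃ * hyp v₃ + p₄ * hyp v₄))
        - (hyp v₁ - hypDeriv v₁ * v₁) * (p₁ + p₂ - (p₃ + p₄))
        - hypDeriv v₁ * (p₁ * v₁ + p₂ * v₂ - (p₃ * v₃ + p₄ * v₄))
        - (p₂ - p₁) * Q v₂ + (p₃ - p₁) * Q v₃ + (p₄ - p₁) * Q v₄ := by
      simp only [hQ]; ring
    have hle : p₁ * (Q v₂ - (Q v₃ + Q v₄)) ≤ 7 + 72 * lam * a ^ 2 := by
      rw [e]
      have b2 := abs_le.1 (hpQ _ _ hp2 hd2)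
      have b3 := abs_le.1 (hpQ _ _ hp3 hd3)
      have b4 := abs_le.1 (hpQ _ _ hp4 hd4)
      have c1 := abs_hypDeriv_le v₁
      have b1 : |(hyp v₁ - hypDeriv v₁ * v₁) * (p₁ + p₂ - (p₃ + p₄))| ≤ (9 / 4 + 1 * 2) * 1 := by
        rw [abs_mul]
        refine mul_le_mul ?_ hs1 (abs_nonneg _) (by norm_num)
        refine (abs_sub _ _).trans ?_
        rw [abs_mul, abs_of_pos (by linarith [one_le_hyp v₁] : 0 < hyp v₁)]
        exact add_le_add (hyp_le_of_abs_le_two hv1)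
          (mul_le_mul c1 hv1 (abs_nonneg _) (by norm_num))
      have b5 : |hypDeriv v₁ * (p₁ * v₁ + p₂ * v₂ - (p₃ * v₃ + p₄ * v₄))| ≤ 1 * 1 := by
        rw [abs_mul]; exact mul_le_mul c1 hs2 (abs_nonneg _) (by norm_num)
      have b1 := abs_le.1 b1
      have b5 := abs_le.1 b5
      have b0 := abs_le.1 hs3
      linarith
    rcases le_total 0 (Q v₂ - (Q v₃ + Q v₄)) with h | h
    · exact (mul_le_mul_of_nonneg_right hp h).trans hle
    · have : lam / 8 * (Q v₂ - (Q v₃ + Q v₄)) ≤ 0 := mul_nonpos_of_nonneg_of_nonpos (by positivity) h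
      have : 0 ≤ 72 * lam * a ^ 2 := by positivity
      linarith
  have hQs' : Q v₂ - (Q v₃ + Q v₄) ≤ 632 * a ^ 2 := by
    have h1 : Q v₂ - (Q v₃ + Q v₄) ≤ (7 + 72 * lam * a ^ 2) / (lam / 8) := by
      rw [le_div_iff₀ (by positivity)]; linarith
    have h2 : (7 + 72 * lam * a ^ 2) / (lam / 8) = 56 * (1 / lam) + 576 * a ^ 2 := by
      field_simp; ring
    linarith
  have hlow : δ₃ ^ 2 / 50 + (hypDeriv v₄ - hypDeriv v₁) * E ≤ Q v₂ - (Q v₃ + Q v₄) := by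
    have t1 := hyp_taylor_nonneg v₄ v₂
    have t2 := le_hyp_taylor hv3 hv1
    have t3 := mul_nonneg (sub_nonneg.2 (hypDeriv_mono h34)) (sub_nonneg.2 h13)
    have e : Q v₂ - (Q v₃ + Q v₄) - (hypDeriv v₄ - hypDeriv v₁) * E =
        (hyp v₂ - hyp v₄ - hypDeriv v₄ * (v₂ - v₄)) + (hyp v₁ - hyp v₃ - hypDeriv v₃ * (v₁ - v₃))
        + (hypDeriv v₄ - hypDeriv v₃) * (v₃ - v₁) := by
      simp only [hQ, hE, e2, e3, e4]; ring
    have : (v₁ - v₃) ^ 2 = δ₃ ^ 2 := by rw [e3]; ring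
    rw [this] at t2
    linarith
  have hcross : |(hypDeriv v₄ - hypDeriv v₁) * E| ≤ 1200 * a ^ 2 := by
    have h14 : v₁ ≤ v₄ := h13.trans h34
    have m := hypDeriv_mono h14
    have m1 := hypDeriv_sub_le h14
    have c1 := abs_le.1 (abs_hypDeriv_le v₁)
    have c4 := abs_le.1 (abs_hypDeriv_le v₄)
    have c5 := (abs_le.1 hd4).2
    rw [abs_mul, abs_of_nonneg (by linarith)]
    set D := hypDeriv v₄ - hypDeriv v₁ with hD
    have hD0 : 0 ≤ D := by linarith
    calc D * |E| ≤ D * (24 * (1 / lam) + 96 * a / L) := mul_le_mul_of_nonneg_left hE' hD0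
      _ = D * (24 * (1 / lam)) + D * (96 * a / L) := by ring
      _ ≤ 2 * (24 * (1 / lam)) + (12 * L * a) * (96 * a / L) := by
          apply add_le_add <;> apply mul_le_mul_of_nonneg_right
          · linarith
          · positivity
          · linarith
          · positivity
      _ = 48 * (1 / lam) + 1152 * a ^ 2 := by field_simp; ring
      _ ≤ _ := by linarith
  have hsq : δ₃ ^ 2 ≤ (303 * a) ^ 2 := by
    have := (abs_le.1 hcross).1
    nlinarith
  have hδ : |δ₃| ≤ 303 * a := abs_le_of_sq_le_sq hsq (by positivity)
  have hδ' := abs_le.1 hδ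
  have haL : 96 * a / L ≤ 96 * a := div_le_self (by positivity) hL
  have hE2 : |E| ≤ 120 * a := by linarith
  have hE3 := abs_le.1 hE2
  constructor
  · rw [abs_sub_comm]; linarith
  · have : v₂ - v₄ = δ₃ + E := by rw [hE, e2, e3, e4]; ring
    rw [this, abs_le]
    constructor <;> linarith

/-- The piece of a thin annulus in frequency space with slopes within `a` of `w`. -/
def conePiece (lam r c₀ a w : ℝ) : Set (ℝ × ℝ) :=
  {ξ | lam / 8 ≤ ξ.1 ∧ ξ.1 ≤ 8 * lam ∧ |ξ.2| ≤ 2 * ξ.1 ∧ |ξ.1 - c₀| ≤ r ∧ |ξ.2 / ξ.1 - w| ≤ a}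

/-- Two pairs of points of the cone with nearly the same sum nearly agree up to order. -/
theorem abs_sub_le_of_near3 {lam a L c₀ : ℝ} (hlam : 1 ≤ lam) (ha0 : 0 < a)
    (ha : 1 ≤ lam * a ^ 2) (hL : 1 ≤ L) {w₁ w₂ w₃ w₄ : ℝ} {ξ₁ ξ₂ ξ₃ ξ₄ : ℝ × ℝ}
    (m₁ : ξ₁ ∈ conePiece lam (lam / L ^ 2) c₀ a w₁) (m₂ : ξ₂ ∈ conePiece lam (lam / L ^ 2) c₀ a w₂)
    (m₃ : ξ₃ ∈ conePiece lam (lam / L ^ 2) c₀ a w₃) (m₄ : ξ₄ ∈ conePiece lam (lam / L ^ 2) c₀ a w₄)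
    (hw : ∀ x ∈ ({w₁, w₂, w₃, w₄} : Set ℝ), ∀ y ∈ ({w₁, w₂, w₃, w₄} : Set ℝ),
      |x - y| ≤ (L - 1) * a)
    (hn : near3 (coneMap ξ₁ + coneMap ξ₂) (coneMap ξ₃ + coneMap ξ₄)) :
    (|w₁ - w₃| ≤ 427 * a ∧ |w₂ - w₄| ≤ 427 * a) ∨ (|w₁ - w₄| ≤ 427 * a ∧ |w₂ - w₃| ≤ 427 * a) := by
  have hlam0 : 0 < lam := by linarith
  have key : ∀ (η : Fin 4 → ℝ × ℝ) (w : Fin 4 → ℝ),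
      (∀ i, η i ∈ conePiece lam (lam / L ^ 2) c₀ a (w i)) → (∀ i j, |w i - w j| ≤ (L - 1) * a) →
      near3 (coneMap (η 0) + coneMap (η 1)) (coneMap (η 2) + coneMap (η 3)) →
      (η 0).2 / (η 0).1 ≤ (η 2).2 / (η 2).1 → (η 2).2 / (η 2).1 ≤ (η 3).2 / (η 3).1 →
      |w 0 - w 2| ≤ 427 * a ∧ |w 1 - w 3| ≤ 427 * a := by
    intro η w hη hw hn h02 h23
    have hpos : ∀ i, 0 < (η i).1 := fun i => by linarith [(hη i).1]
    have hdp : ∀ i, |(η i).1 - (η 0).1| ≤ 2 * lam / L ^ 2 := by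
      intro i
      have h1 := abs_le.1 (hη i).2.2.2.1
      have h2 := abs_le.1 (hη 0).2.2.2.1
      rw [mul_div_assoc, abs_le]
      constructor <;> linarith
    have hv : ∀ i, |(η i).2 / (η i).1| ≤ 2 := by
      intro i
      rw [abs_div, abs_of_pos (hpos i), div_le_iff₀ (hpos i)]
      exact (hη i).2.2.1
    have hdv : ∀ i, |(η i).2 / (η i).1 - (η 0).2 / (η 0).1| ≤ 2 * L * a := by
      intro i
      have h1 := abs_le.1 (hη i).2.2.2.2
      have h2 := abs_le.1 (hη 0).2.2.2.2
      have h3 := abs_le.1 (hw i 0)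
      rw [abs_le]
      constructor <;> nlinarith
    obtain ⟨n1, n2, n3⟩ := hn
    simp only [coneMap, Prod.fst_add, Prod.snd_add, enorm2_eq_mul_hyp (hpos _)] at n1 n2 n3
    have hq : ∀ i, (η i).1 * ((η i).2 / (η i).1) = (η i).2 := fun i =>
      mul_div_cancel₀ _ (hpos i).ne'
    have := abs_sub_le_of_cone_sum_ordered hlam ha0 ha hL (hη 0).1 (hdp 1) (hdp 2) (hdp 3) (hv 0)
      (hv 2) (hdv 1) (hdv 2) (hdv 3) h02 h23 n1.le (by simpa only [hq] using n2.le) n3.le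
    have b : ∀ i, _ := fun i => abs_le.1 (hη i).2.2.2.2
    have b0 := b 0
    have b1 := b 1
    have b2 := b 2
    have b3 := b 3
    have t1 := abs_le.1 this.1
    have t2 := abs_le.1 this.2
    constructor <;> rw [abs_le] <;> constructor <;> linarith
  have hn' := near3_symm hn
  have a12 := add_comm (coneMap ξ₁) (coneMap ξ₂)
  have a34 := add_comm (coneMap ξ₃) (coneMap ξ₄)
  have gen : ∀ (η₀ η₁ η₂ η₃ : ℝ × ℝ) (x₀ x₁ x₂ x₃ : ℝ),
      η₀ ∈ conePiece lam (lam / L ^ 2) c₀ a x₀ → η₁ ∈ conePiece lam (lam / L ^ 2) c₀ a x₁ →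
      η₂ ∈ conePiece lam (lam / L ^ 2) c₀ a x₂ → η₃ ∈ conePiece lam (lam / L ^ 2) c₀ a x₃ →
      x₀ ∈ ({w₁, w₂, w₃, w₄} : Set ℝ) → x₁ ∈ ({w₁, w₂, w₃, w₄} : Set ℝ) →
      x₂ ∈ ({w₁, w₂, w₃, w₄} : Set ℝ) → x₃ ∈ ({w₁, w₂, w₃, w₄} : Set ℝ) →
      near3 (coneMap η₀ + coneMap η₁) (coneMap η₂ + coneMap η₃) →
      η₀.2 / η₀.1 ≤ η₂.2 / η₂.1 → η₀.2 / η₀.1 ≤ η₃.2 / η₃.1 →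
      (|x₀ - x₂| ≤ 427 * a ∧ |x₁ - x₃| ≤ 427 * a) ∨ (|x₀ - x₃| ≤ 427 * a ∧ |x₁ - x₂| ≤ 427 * a) := by
    intro η₀ η₁ η₂ η₃ x₀ x₁ x₂ x₃ i0 i1 i2 i3 j0 j1 j2 j3 hn h2 h3
    rcases le_total (η₂.2 / η₂.1) (η₃.2 / η₃.1) with h | h
    · refine Or.inl (key ![η₀, η₁, η₂, η₃] ![x₀, x₁, x₂, x₃] ?_ ?_ hn h2 h)
      · intro i; fin_cases i <;> assumption
      · intro i j
        apply hw <;> [fin_cases i; fin_cases j] <;> assumption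
    · refine Or.inr (key ![η₀, η₁, η₃, η₂] ![x₀, x₁, x₃, x₂] ?_ ?_ ?_ h3 h)
      · intro i; fin_cases i <;> assumption
      · intro i j
        apply hw <;> [fin_cases i; fin_cases j] <;> assumption
      · simpa [add_comm] using hn
  have i1 : w₁ ∈ ({w₁, w₂, w₃, w₄} : Set ℝ) := by simp
  have i2 : w₂ ∈ ({w₁, w₂, w₃, w₄} : Set ℝ) := by simp
  have i3 : w₃ ∈ ({w₁, w₂, w₃, w₄} : Set ℝ) := by simp
  have i4 : w₄ ∈ ({w₁, w₂, w₃, w₄} : Set ℝ) := by simp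
  set s : Fin 4 → ℝ := ![ξ₁.2 / ξ₁.1, ξ₂.2 / ξ₂.1, ξ₃.2 / ξ₃.1, ξ₄.2 / ξ₄.1] with hs
  obtain ⟨i, hi⟩ := Finite.exists_min s
  have hi0 : s i ≤ ξ₁.2 / ξ₁.1 := hi 0
  have hi1 : s i ≤ ξ₂.2 / ξ₂.1 := hi 1
  have hi2 : s i ≤ ξ₃.2 / ξ₃.1 := hi 2
  have hi3 : s i ≤ ξ₄.2 / ξ₄.1 := hi 3
  fin_cases i
  · exact gen _ _ _ _ _ _ _ _ m₁ m₂ m₃ m₄ i1 i2 i3 i4 hn hi2 hi3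
  · have := gen _ _ _ _ _ _ _ _ m₂ m₁ m₃ m₄ i2 i1 i3 i4 (by rwa [a12] at hn) hi2 hi3
    tauto
  · have := gen _ _ _ _ _ _ _ _ m₃ m₄ m₁ m₂ i3 i4 i1 i2 hn' hi0 hi1
    rw [abs_sub_comm w₃, abs_sub_comm w₄, abs_sub_comm w₃, abs_sub_comm w₄] at this
    tauto
  · have := gen _ _ _ _ _ _ _ _ m₄ m₃ m₁ m₂ i4 i3 i1 i2 (by rwa [a34] at hn') hi0 hi1
    rw [abs_sub_comm w₃, abs_sub_comm w₄, abs_sub_comm w₃, abs_sub_comm w₄] at this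
    tauto

theorem measurableSet_conePiece (lam r c₀ a w : ℝ) : MeasurableSet (conePiece lam r c₀ a w) := by
  have h1 : Measurable fun ξ : ℝ × ℝ => ξ.2 / ξ.1 - w := by fun_prop
  have h2 : Measurable fun ξ : ℝ × ℝ => |ξ.2 / ξ.1 - w| := continuous_abs.measurable.comp h1
  have h3 : Measurable fun ξ : ℝ × ℝ => |ξ.2| := by fun_prop
  have h4 : Measurable fun ξ : ℝ × ℝ => |ξ.1 - c₀| := by fun_prop
  exact (measurableSet_le measurable_const measurable_fst).inter
    ((measurableSet_le measurable_fst measurable_const).inter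
    ((measurableSet_le h3 (by fun_prop)).inter
    ((measurableSet_le h4 measurable_const).inter (measurableSet_le h2 measurable_const))))

theorem abs_div_le_two_of_mem_conePiece {lam r c₀ a w : ℝ} (hlam : 0 < lam) {ξ : ℝ × ℝ}
    (h : ξ ∈ conePiece lam r c₀ a w) : 0 < ξ.1 ∧ |ξ.2 / ξ.1| ≤ 2 := by
  have h0 : 0 < ξ.1 := by linarith [h.1]
  refine ⟨h0, ?_⟩
  rw [abs_div, abs_of_pos h0, div_le_iff₀ h0]
  exact h.2.2.1

theorem enorm2_convex_slice {p q q' : ℝ} (hp : 0 < p) :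
    enorm2 (p, q) + hypDeriv (q / p) * (q' - q) ≤ enorm2 (p, q') := by
  rw [enorm2_eq_mul_hyp (by exact hp), enorm2_eq_mul_hyp (by exact hp)]
  have := mul_le_mul_of_nonneg_left (hyp_taylor_nonneg (q / p) (q' / p)) hp.le
  have e : p * (q' / p - q / p) = q' - q := by field_simp
  simp only at *
  have e2 : p * (hyp (q' / p) - hyp (q / p) - hypDeriv (q / p) * (q' / p - q / p)) =
      p * hyp (q' / p) - p * hyp (q / p) - hypDeriv (q / p) * (q' - q) := by
    rw [← e]; ring
  linarith

theorem volume_slice_le {lam r c₀ a w w' : ℝ} (hlam : 0 < lam) (ha : 0 < a) (hw : 4 * a ≤ |w - w'|)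
    (p n₀ : ℝ) (η : ℝ × ℝ) :
    volume {q : ℝ | (p, q) ∈ conePiece lam r c₀ a w ∧ η - (p, q) ∈ conePiece lam r c₀ a w' ∧
      |n₀ - (enorm2 (p, q) + enorm2 (η - (p, q)))| < 1} ≤ ENNReal.ofReal (25 / a) := by
  have key : ∀ q q', (p, q) ∈ conePiece lam r c₀ a w → η - (p, q) ∈ conePiece lam r c₀ a w' →
      (p, q') ∈ conePiece lam r c₀ a w → η - (p, q') ∈ conePiece lam r c₀ a w' →
      |n₀ - (enorm2 (p, q) + enorm2 (η - (p, q)))| < 1 →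
      |n₀ - (enorm2 (p, q') + enorm2 (η - (p, q')))| < 1 → q ≤ q' → q' - q ≤ 25 / a := by
    intro q q' m1 m2 m1' m2' hn hn' hqq
    obtain ⟨hp, b1⟩ := abs_div_le_two_of_mem_conePiece hlam m1
    obtain ⟨hp', b2⟩ := abs_div_le_two_of_mem_conePiece hlam m2
    obtain ⟨-, b3⟩ := abs_div_le_two_of_mem_conePiece hlam m1'
    obtain ⟨-, b4⟩ := abs_div_le_two_of_mem_conePiece hlam m2'
    have s1 := abs_le.1 m1.2.2.2.2
    have s2 := abs_le.1 m2.2.2.2.2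
    have s3 := abs_le.1 m1'.2.2.2.2
    have s4 := abs_le.1 m2'.2.2.2.2
    simp only [Prod.fst_sub, Prod.snd_sub] at *
    have c1 := enorm2_convex_slice (q := q) (q' := q') hp
    have c2 := enorm2_convex_slice (q := η.2 - q) (q' := η.2 - q') hp'
    have c3 := enorm2_convex_slice (q := q') (q' := q) hp
    have c4 := enorm2_convex_slice (q := η.2 - q') (q' := η.2 - q) hp'
    have e : ∀ x, enorm2 (η - (p, x)) = enorm2 (η.1 - p, η.2 - x) := fun x => rfl
    rw [e] at hn hn'
    have n1 := abs_lt.1 hn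
    have n2 := abs_lt.1 hn'
    rw [le_div_iff₀ ha]
    rcases le_abs.1 hw with h | h
    · have g1 := le_hypDeriv_sub b2 b1 (by linarith)
      nlinarith
    · have g1 := le_hypDeriv_sub b3 b4 (by linarith)
      nlinarith
  refine (Real.volume_le_diam _).trans (Metric.ediam_le fun q hq q' hq' => ?_)
  rw [edist_dist, Real.dist_eq]
  apply ENNReal.ofReal_le_ofReal
  rcases le_total q q' with h | h
  · rw [abs_sub_comm, abs_of_nonneg (by linarith)]
    exact key _ _ hq.1 hq.2.1 hq'.1 hq'.2.1 hq.2.2 hq'.2.2 h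
  · rw [abs_of_nonneg (by linarith)]
    exact key _ _ hq'.1 hq'.2.1 hq.1 hq.2.1 hq'.2.2 hq.2.2 h

theorem volume_bilinear_le {lam r c₀ a w w' : ℝ} (hlam : 0 < lam) (ha : 0 < a)
    (hw : 4 * a ≤ |w - w'|) (η₀ : ℝ × ℝ × ℝ) :
    (volume.prod volume) {ω : (ℝ × ℝ) × (ℝ × ℝ) | (ω.1 ∈ conePiece lam r c₀ a w ∧
      ω.2 ∈ conePiece lam r c₀ a w') ∧ near3 η₀ (coneMap ω.1 + coneMap ω.2)} ≤
      ENNReal.ofReal (800 * lam / a) := by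
  set E : Set ((ℝ × ℝ) × (ℝ × ℝ)) := {ω | (ω.1 ∈ conePiece lam r c₀ a w ∧
      ω.2 - ω.1 ∈ conePiece lam r c₀ a w') ∧ near3 η₀ (coneMap ω.1 + coneMap (ω.2 - ω.1))} with hE
  have hEm : MeasurableSet E := by
    refine MeasurableSet.inter ((measurable_fst (measurableSet_conePiece _ _ _ _ _)).inter
      ((measurable_snd.sub measurable_fst) (measurableSet_conePiece _ _ _ _ _))) ?_
    have hc : Continuous fun ω : (ℝ × ℝ) × (ℝ × ℝ) => coneMap ω.1 + coneMap (ω.2 - ω.1) := by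
      fun_prop
    refine IsOpen.measurableSet ?_
    exact (isOpen_lt (continuous_abs.comp (continuous_const.sub hc.fst)) continuous_const).inter
      ((isOpen_lt (continuous_abs.comp (continuous_const.sub hc.snd.fst)) continuous_const).inter
      (isOpen_lt (continuous_abs.comp (continuous_const.sub hc.snd.snd)) continuous_const))
  have hmp := measurePreserving_prod_add (volume : Measure (ℝ × ℝ)) (volume : Measure (ℝ × ℝ))
  have h1 := hmp.measure_preimage hEm.nullMeasurableSet
  have h2 : {ω : (ℝ × ℝ) × (ℝ × ℝ) | (ω.1 ∈ conePiece lam r c₀ a w ∧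
      ω.2 ∈ conePiece lam r c₀ a w') ∧ near3 η₀ (coneMap ω.1 + coneMap ω.2)} =
      (fun z : (ℝ × ℝ) × (ℝ × ℝ) => (z.1, z.1 + z.2)) ⁻¹' E := by
    ext ω
    simp [hE]
  rw [h2, h1, Measure.prod_apply_symm hEm]
  have hslice : ∀ η : ℝ × ℝ, volume ((fun ξ => (ξ, η)) ⁻¹' E) ≤
      {η : ℝ × ℝ | |η₀.1 - η.1| < 1 ∧ |η₀.2.1 - η.2| < 1}.indicator
        (fun _ => ENNReal.ofReal (200 * lam / a)) η := by
    intro η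
    by_cases hη : η ∈ {η : ℝ × ℝ | |η₀.1 - η.1| < 1 ∧ |η₀.2.1 - η.2| < 1}
    · rw [indicator_of_mem hη, Measure.volume_eq_prod, Measure.prod_apply (by
        exact measurable_prodMk_right hEm)]
      calc _ ≤ ∫⁻ p, (Icc (0:ℝ) (8 * lam)).indicator (fun _ => ENNReal.ofReal (25 / a)) p := by
            refine lintegral_mono fun p => ?_
            by_cases hp : p ∈ Icc (0:ℝ) (8 * lam)
            · rw [indicator_of_mem hp]
              refine (measure_mono ?_).trans (volume_slice_le hlam ha hw (r := r) (c₀ := c₀) p η₀.2.2 η)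
              intro q hq
              exact ⟨hq.1.1, hq.1.2, hq.2.2.2⟩
            · rw [indicator_of_notMem hp, le_zero_iff]
              convert measure_empty (μ := (volume : Measure ℝ))
              ext q
              simp only [mem_preimage, mem_empty_iff_false, iff_false]
              intro hq
              exact hp ⟨by have := hq.1.1.1; simp only at this; linarith, hq.1.1.2.1⟩
        _ = ENNReal.ofReal (200 * lam / a) := by
            rw [lintegral_indicator measurableSet_Icc, setLIntegral_const, Real.volume_Icc,
              ← ENNReal.ofReal_mul (by positivity)]
            congr 1; ring
    · rw [indicator_of_notMem hη, le_zero_iff]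
      convert measure_empty (μ := (volume : Measure (ℝ × ℝ)))
      ext ξ
      simp only [mem_preimage, mem_empty_iff_false, iff_false]
      intro hq
      apply hη
      have h3 := hq.2
      unfold near3 coneMap at h3
      simp only [Prod.fst_add, Prod.snd_add, Prod.fst_sub, Prod.snd_sub, add_sub_cancel] at h3
      exact ⟨h3.1, h3.2.1⟩
  refine (lintegral_mono hslice).trans ?_
  have hbox := volume_box_lt (η₀.1, η₀.2.1) 1
  refine (lintegral_indicator_const_le _ _).trans ?_
  rw [hbox, ← ENNReal.ofReal_mul (by positivity), ← ENNReal.ofReal_mul (by positivity)]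
  apply le_of_eq
  congr 1; ring

section

/-- Sums of consecutive blocks of `L` members of a family, iterated. -/
def blockWt (f : ℤ → ℝ × ℝ → ℝ) (L : ℕ) : ℕ → ℤ → ℝ × ℝ → ℝ
  | 0, k => f k
  | i + 1, k => fun ξ => ∑ c ∈ Finset.Ico (k * L) ((k + 1) * L), blockWt f L i c ξ

theorem sum_sum_Ico_mul {M : Type*} [AddCommMonoid M] (L n : ℕ) (f : ℤ → M) :
    ∑ k ∈ Finset.Ico (0:ℤ) n, ∑ c ∈ Finset.Ico (k * L) ((k + 1) * L), f c =
      ∑ c ∈ Finset.Ico (0:ℤ) ((n * L : ℕ) : ℤ), f c := by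
  induction n with
  | zero => simp
  | succ n ih =>
    have h1 : Finset.Ico (0:ℤ) ((n + 1 : ℕ) : ℤ) = insert (n:ℤ) (Finset.Ico 0 (n:ℤ)) := by
      ext x; simp only [Finset.mem_Ico, Finset.mem_insert]; push_cast; omega
    have h2 : (0:ℤ) ≤ (n * L : ℕ) := by positivity
    have h3 : ((n * L : ℕ) : ℤ) ≤ ((n + 1) * L : ℕ) := by
      exact_mod_cast Nat.mul_le_mul_right L (Nat.le_succ n)
    rw [h1, Finset.sum_insert (by simp), ih, ← Finset.Ico_union_Ico_eq_Ico h2 h3,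
      Finset.sum_union (Finset.Ico_disjoint_Ico_consecutive _ _ _), add_comm]
    push_cast
    rfl

section

variable {f : ℤ → ℝ × ℝ → ℝ} {L : ℕ}

theorem blockWt_measurable (hf : ∀ n, Measurable (f n)) (i : ℕ) (k : ℤ) :
    Measurable (blockWt f L i k) := by
  induction i generalizing k with
  | zero => exact hf k
  | succ i ih => exact Finset.measurable_fun_sum _ fun c _ => ih c

theorem blockWt_nonneg (hf : ∀ n ξ, 0 ≤ f n ξ) (i : ℕ) (k : ℤ) (ξ : ℝ × ℝ) :
    0 ≤ blockWt f L i k ξ := by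
  induction i generalizing k with
  | zero => exact hf k ξ
  | succ i ih => exact Finset.sum_nonneg fun c _ => ih c

theorem sum_blockWt (i j : ℕ) (ξ : ℝ × ℝ) :
    ∑ k ∈ Finset.Ico (0:ℤ) ((L ^ j : ℕ) : ℤ), blockWt f L i k ξ =
      ∑ n ∈ Finset.Ico (0:ℤ) ((L ^ (i + j) : ℕ) : ℤ), f n ξ := by
  induction i generalizing j with
  | zero => simp [blockWt]
  | succ i ih =>
    simp only [blockWt]
    rw [sum_sum_Ico_mul, ← pow_succ, ih]
    congr 4
    ring

theorem mem_conePiece_of_blockWt_ne_zero {lam r c₀ β w₀ : ℝ} (hβ : 0 < β) (hL : 1 ≤ L) {ξ : ℝ × ℝ}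
    (hf : ∀ n, f n ξ ≠ 0 → ξ ∈ conePiece lam r c₀ β (w₀ + n * β)) (i : ℕ) (k : ℤ)
    (h : blockWt f L i k ξ ≠ 0) : ξ ∈ conePiece lam r c₀ (L ^ i * β) (w₀ + k * (L ^ i * β)) := by
  have hL' : (1:ℝ) ≤ L := by exact_mod_cast hL
  have key : (lam / 8 ≤ ξ.1 ∧ ξ.1 ≤ 8 * lam ∧ |ξ.2| ≤ 2 * ξ.1 ∧ |ξ.1 - c₀| ≤ r) ∧
      (k * L ^ i - 1) * β ≤ ξ.2 / ξ.1 - w₀ ∧ ξ.2 / ξ.1 - w₀ ≤ (k + 1) * L ^ i * β := by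
    induction i generalizing k with
    | zero =>
      obtain ⟨h1, h2, h3, h4, h5⟩ := hf k h
      have := abs_le.1 h5
      refine ⟨⟨h1, h2, h3, h4⟩, ?_, ?_⟩ <;> simp <;> linarith
    | succ i ih =>
      obtain ⟨c, hc, hc0⟩ := Finset.exists_ne_zero_of_sum_ne_zero h
      obtain ⟨h1, h2, h3⟩ := ih c hc0
      rw [Finset.mem_Ico] at hc
      have c1 : (k:ℝ) * L ≤ c := by exact_mod_cast hc.1
      have c2 : (c:ℝ) + 1 ≤ (k + 1) * L := by exact_mod_cast hc.2
      have p : (0:ℝ) ≤ L ^ i * β := by positivity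
      refine ⟨h1, ?_, ?_⟩
      · refine le_trans ?_ h2
        rw [pow_succ]
        nlinarith [mul_le_mul_of_nonneg_right c1 p]
      · refine h3.trans ?_
        rw [pow_succ]
        nlinarith [mul_le_mul_of_nonneg_right c2 p]
  obtain ⟨⟨h1, h2, h3, h4⟩, h5, h6⟩ := key
  refine ⟨h1, h2, h3, h4, ?_⟩
  have : β ≤ L ^ i * β := le_mul_of_one_le_left hβ.le (one_le_pow₀ hL')
  rw [abs_le]
  constructor <;> nlinarith

end

/-- The hypotheses shared by the multiscale estimates. -/
structure ConeFamily (lam c₀ β w₀ : ℝ) (L J : ℕ) (f : ℤ → ℝ × ℝ → ℝ) (H : ℝ × ℝ → ℂ) : Prop where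
  one_le_lam : 1 ≤ lam
  β_pos : 0 < β
  le_lam : 1 ≤ lam * β ^ 2
  one_le_L : 1 ≤ L
  f_meas : ∀ n, Measurable (f n)
  f_nonneg : ∀ n ξ, 0 ≤ f n ξ
  f_sum : ∀ ξ, ∑ n ∈ Finset.Ico (0:ℤ) ((L ^ J : ℕ) : ℤ), f n ξ ≤ 1
  f_le : ∀ n ξ, f n ξ ≤ 1
  H_meas : Measurable H
  H_int : Integrable H
  supp : ∀ n ξ, f n ξ ≠ 0 → H ξ ≠ 0 → ξ ∈ conePiece lam (lam / L ^ 2) c₀ β (w₀ + n * β)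

/-- The function with frequency profile `H` localised to a block. -/
def blockFn (f : ℤ → ℝ × ℝ → ℝ) (H : ℝ × ℝ → ℂ) (L i : ℕ) (k : ℤ) (ξ : ℝ × ℝ) : ℂ :=
  (blockWt f L i k ξ : ℂ) * H ξ

namespace ConeFamily

variable {lam c₀ β w₀ : ℝ} {L J : ℕ} {f : ℤ → ℝ × ℝ → ℝ} {H : ℝ × ℝ → ℂ}

theorem meas (h : ConeFamily lam c₀ β w₀ L J f H) (i : ℕ) (k : ℤ) : Measurable (blockFn f H L i k) :=
  (Complex.measurable_ofReal.comp (blockWt_measurable h.f_meas i k)).mul h.H_meas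

theorem int (h : ConeFamily lam c₀ β w₀ L J f H) (i : ℕ) (k : ℤ) : Integrable (blockFn f H L i k) := by
  induction i generalizing k with
  | zero =>
    refine h.H_int.bdd_mul (c := 1)
      (Complex.measurable_ofReal.comp (h.f_meas k)).aestronglyMeasurable
      (Filter.Eventually.of_forall fun ξ => ?_)
    simp only [Complex.norm_real, Real.norm_eq_abs, blockWt]
    rw [abs_of_nonneg (h.f_nonneg k ξ)]
    exact h.f_le k ξ
  | succ i ih =>
    have : blockFn f H L (i + 1) k =
        fun ξ => ∑ c ∈ Finset.Ico (k * L) ((k + 1) * L), blockFn f H L i c ξ := by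
      funext ξ
      simp [blockFn, blockWt, Finset.sum_mul]
    rw [this]
    exact integrable_finsetSum _ fun c _ => ih c

theorem sup3_succ (h : ConeFamily lam c₀ β w₀ L J f H) (i : ℕ) (k : ℤ) (z : ℝ × ℝ × ℝ) :
    sup3 coneMap volume (blockFn f H L (i + 1) k) z =
      ∑ c ∈ Finset.Ico (k * L) ((k + 1) * L), sup3 coneMap volume (blockFn f H L i c) z := by
  rw [← sup3_sum _ (fun c _ => h.int i c) (by fun_prop)]
  congr 1
  funext ξ
  simp [blockFn, blockWt, Finset.sum_mul]

theorem smeas (h : ConeFamily lam c₀ β w₀ L J f H) (i : ℕ) (k : ℤ) :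
    Measurable (sup3 coneMap volume (blockFn f H L i k)) :=
  (sup3_stronglyMeasurable (by fun_prop) (h.meas i k)).measurable

theorem mem (h : ConeFamily lam c₀ β w₀ L J f H) {i : ℕ} {k : ℤ} {ξ : ℝ × ℝ}
    (hne : blockFn f H L i k ξ ≠ 0) :
    ξ ∈ conePiece lam (lam / L ^ 2) c₀ (L ^ i * β) (w₀ + k * (L ^ i * β)) := by
  have h1 := mul_ne_zero_iff.1 hne
  exact mem_conePiece_of_blockWt_ne_zero h.β_pos h.one_le_L (fun n hn => h.supp n ξ hn h1.2) i k
    (by exact_mod_cast h1.1)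

theorem le_scale (h : ConeFamily lam c₀ β w₀ L J f H) (i : ℕ) :
    0 < L ^ i * β ∧ 1 ≤ lam * (L ^ i * β) ^ 2 := by
  have hL' : (1:ℝ) ≤ L := by exact_mod_cast h.one_le_L
  have h0 := h.β_pos
  have h1 : β ≤ L ^ i * β := le_mul_of_one_le_left h0.le (one_le_pow₀ hL')
  refine ⟨by positivity, h.le_lam.trans ?_⟩
  have := h.one_le_lam
  gcongr

theorem sum_sq_le (h : ConeFamily lam c₀ β w₀ L J f H) {i j : ℕ} (hij : i + j = J) :
    ∑ k ∈ Finset.Ico (0:ℤ) ((L ^ j : ℕ) : ℤ), ∫⁻ ξ, ‖blockFn f H L i k ξ‖ₑ ^ 2 ≤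
      ∫⁻ ξ, ‖H ξ‖ₑ ^ 2 := by
  rw [← lintegral_finsetSum _ fun k _ => (h.meas i k).enorm.pow_const 2]
  refine lintegral_mono fun ξ => ?_
  simp only [blockFn, enorm_mul, mul_pow]
  rw [← Finset.sum_mul]
  refine mul_le_of_le_one_left zero_le ?_
  have h1 : ∀ k ∈ Finset.Ico (0:ℤ) ((L ^ j : ℕ) : ℤ), blockWt f L i k ξ ≤ 1 := fun k hk =>
    (Finset.single_le_sum (fun c _ => blockWt_nonneg h.f_nonneg i c ξ) hk).trans
      (by rw [sum_blockWt, hij]; exact h.f_sum ξ)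
  have h2 : ∀ k, ‖(blockWt f L i k ξ : ℂ)‖ₑ = ENNReal.ofReal (blockWt f L i k ξ) := by
    intro k
    rw [← ofReal_norm, Complex.norm_real, Real.norm_of_nonneg (blockWt_nonneg h.f_nonneg i k ξ)]
  calc _ ≤ ∑ k ∈ Finset.Ico (0:ℤ) ((L ^ j : ℕ) : ℤ), ENNReal.ofReal (blockWt f L i k ξ) := by
        refine Finset.sum_le_sum fun k hk => ?_
        rw [h2, sq]
        exact mul_le_of_le_one_left zero_le (ENNReal.ofReal_le_one.2 (h1 k hk))
    _ = ENNReal.ofReal (∑ k ∈ Finset.Ico (0:ℤ) ((L ^ j : ℕ) : ℤ), blockWt f L i k ξ) :=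
        (ENNReal.ofReal_sum_of_nonneg fun k _ => blockWt_nonneg h.f_nonneg i k ξ).symm
    _ ≤ 1 := by
        rw [sum_blockWt, hij]
        exact ENNReal.ofReal_le_one.2 (h.f_sum ξ)

end ConeFamily

end

section

namespace ConeFamily

variable {lam c₀ β w₀ : ℝ} {L J : ℕ} {f : ℤ → ℝ × ℝ → ℝ} {H : ℝ × ℝ → ℂ} {κ : ℝ → ℝ}

/-- The relation of pairs of blocks whose product functions can interact. -/
def Interact (t t' : ℤ × ℤ) : Prop :=
  (|t.1 - t'.1| ≤ 427 ∧ |t.2 - t'.2| ≤ 427) ∨ (|t.1 - t'.2| ≤ 427 ∧ |t.2 - t'.1| ≤ 427)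

instance : DecidableRel Interact := fun _ _ => by unfold Interact; infer_instance

theorem card_interact_le (s : Finset (ℤ × ℤ)) (t : ℤ × ℤ) :
    (s.filter fun t' => Interact t t').card ≤ 1462050 := by
  have hsub : (s.filter fun t' => Interact t t') ⊆
      (Finset.Icc (t.1 - 427) (t.1 + 427) ×ˢ Finset.Icc (t.2 - 427) (t.2 + 427)) ∪
      (Finset.Icc (t.2 - 427) (t.2 + 427) ×ˢ Finset.Icc (t.1 - 427) (t.1 + 427)) := by
    intro t' ht'
    have h := (Finset.mem_filter.1 ht').2
    simp only [Interact, abs_le] at h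
    simp only [Finset.mem_union, Finset.mem_product, Finset.mem_Icc]
    omega
  refine (Finset.card_le_card hsub).trans ((Finset.card_union_le _ _).trans ?_)
  simp only [Finset.card_product, Int.card_Icc]
  have e : ∀ x : ℤ, (x + 427 + 1 - (x - 427)).toNat = 855 := by intro x; omega
  rw [e, e]

theorem fourth_power_step (h : ConeFamily lam c₀ β w₀ L J f H) (hκ : IsBandWeight κ) (i : ℕ) (k : ℤ) :
    ∫⁻ z, ‖sup3 coneMap volume (blockFn f H L (i + 1) k) z‖ₑ ^ 4 ∂(wMeas3 κ) ≤
      4 * 1462050 * L * ∑ c ∈ Finset.Ico (k * L) ((k + 1) * L),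
        ∫⁻ z, ‖sup3 coneMap volume (blockFn f H L i c) z‖ₑ ^ 4 ∂(wMeas3 κ) := by
  have := hκ.isFiniteMeasure3
  simp_rw [h.sup3_succ]
  obtain ⟨hα, hlα⟩ := h.le_scale i
  have hL' : (1:ℝ) ≤ L := by exact_mod_cast h.one_le_L
  set α := (L:ℝ) ^ i * β with hαdef
  have hcard : (Finset.Ico (k * L) ((k + 1) * L)).card = L := by
    rw [Int.card_Ico, add_mul, add_sub_cancel_left]; simp
  have hB : ∃ B : ℝ, ∀ c ∈ Finset.Ico (k * L) ((k + 1) * L), ∀ z,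
      ‖sup3 coneMap volume (blockFn f H L i c) z‖ ≤ B := by
    refine ⟨∑ c ∈ Finset.Ico (k * L) ((k + 1) * L), ∫ ξ, ‖blockFn f H L i c ξ‖, fun c hc z => ?_⟩
    refine (norm_sup3_le (h.int i c) z).trans ?_
    exact Finset.single_le_sum (f := fun c => ∫ ξ, ‖blockFn f H L i c ξ‖)
      (fun c _ => integral_nonneg fun ξ => norm_nonneg _) hc
  obtain ⟨B, hB⟩ := hB
  have main := lintegral_sum_pow_four_le (ρ := wMeas3 κ) (Finset.Ico (k * L) ((k + 1) * L))
    (fun c => sup3 coneMap volume (blockFn f H L i c)) (fun c _ => h.smeas i c) hB Interact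
    (fun t t' ht => by
      simp only [Interact, abs_le] at *
      omega)
    (D := 1462050) (fun t _ => card_interact_le _ t) ?_
  · rw [hcard] at main
    exact_mod_cast main
  · intro t ht t' ht' hn
    simp_rw [sup3_mul_sup3]
    refine sup3_inner_eq_zero hκ (by fun_prop) ((h.int i _).mul_prod (h.int i _))
      ((h.int i _).mul_prod (h.int i _)) ?_
    intro ω ω' hω hω' hnear
    apply hn
    have m1 := mul_ne_zero_iff.1 hω
    have m2 := mul_ne_zero_iff.1 hω'
    rw [Finset.mem_product, Finset.mem_Ico, Finset.mem_Ico] at ht ht'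
    have hdiff : ∀ x y : ℤ, (k * L ≤ x ∧ x < (k + 1) * L) → (k * L ≤ y ∧ y < (k + 1) * L) →
        |(w₀ + x * α) - (w₀ + y * α)| ≤ (L - 1) * α := by
      intro x y hx hy
      have e : (w₀ + x * α) - (w₀ + y * α) = ((x:ℝ) - y) * α := by ring
      rw [e, abs_mul, abs_of_pos hα]
      refine mul_le_mul_of_nonneg_right ?_ hα.le
      have hz : |x - y| ≤ (L:ℤ) - 1 := by
        have e : (k + 1) * (L:ℤ) = k * L + L := by ring
        rw [abs_le]; constructor <;> linarith
      exact_mod_cast hz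
    have back : ∀ x y : ℤ, |(w₀ + x * α) - (w₀ + y * α)| ≤ 427 * α → |x - y| ≤ 427 := by
      intro x y hxy
      have e : (w₀ + x * α) - (w₀ + y * α) = ((x:ℝ) - y) * α := by ring
      rw [e, abs_mul, abs_of_pos hα] at hxy
      have := le_of_mul_le_mul_right hxy hα
      exact_mod_cast this
    have res := abs_sub_le_of_near3 h.one_le_lam hα hlα hL' (h.mem m1.1) (h.mem m1.2)
      (h.mem m2.1) (h.mem m2.2) ?_ hnear
    · rcases res with ⟨r1, r2⟩ | ⟨r1, r2⟩
      · exact Or.inl ⟨back _ _ r1, back _ _ r2⟩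
      · exact Or.inr ⟨back _ _ r1, back _ _ r2⟩
    · intro x hx y hy
      simp only [mem_insert_iff, mem_singleton_iff] at hx hy
      rcases hx with rfl | rfl | rfl | rfl <;> rcases hy with rfl | rfl | rfl | rfl <;>
        apply hdiff <;> first | exact ht.1 | exact ht.2 | exact ht'.1 | exact ht'.2

theorem fourth_power_le (h : ConeFamily lam c₀ β w₀ L J f H) (hκ : IsBandWeight κ) {i j : ℕ}
    (hij : i + j = J) :
    ∑ k ∈ Finset.Ico (0:ℤ) ((L ^ j : ℕ) : ℤ),
      ∫⁻ z, ‖sup3 coneMap volume (blockFn f H L i k) z‖ₑ ^ 4 ∂(wMeas3 κ) ≤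
      (4 * 1462050 * L) ^ i * ∑ n ∈ Finset.Ico (0:ℤ) ((L ^ J : ℕ) : ℤ),
        ∫⁻ z, ‖sup3 coneMap volume (blockFn f H L 0 n) z‖ₑ ^ 4 ∂(wMeas3 κ) := by
  induction i generalizing j with
  | zero => simp at hij; simp [hij]
  | succ i ih =>
    calc _ ≤ ∑ k ∈ Finset.Ico (0:ℤ) ((L ^ j : ℕ) : ℤ), (4 * 1462050 * L *
          ∑ c ∈ Finset.Ico (k * L) ((k + 1) * L),
            ∫⁻ z, ‖sup3 coneMap volume (blockFn f H L i c) z‖ₑ ^ 4 ∂(wMeas3 κ)) :=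
          Finset.sum_le_sum fun k _ => h.fourth_power_step hκ i k
      _ = 4 * 1462050 * L * ∑ c ∈ Finset.Ico (0:ℤ) ((L ^ (j + 1) : ℕ) : ℤ),
            ∫⁻ z, ‖sup3 coneMap volume (blockFn f H L i c) z‖ₑ ^ 4 ∂(wMeas3 κ) := by
          rw [← Finset.mul_sum, sum_sum_Ico_mul, ← pow_succ]
      _ ≤ _ := by
          rw [pow_succ' (4 * 1462050 * (L:ℝ≥0∞)), mul_assoc (4 * 1462050 * (L:ℝ≥0∞))]
          refine mul_le_mul_right ?_ _
          exact ih (j := j + 1) (by omega)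

theorem bilinear_le (h : ConeFamily lam c₀ β w₀ L J f H) (hκ : IsBandWeight κ) (i : ℕ) {c c' : ℤ}
    (hcc : 4 ≤ |c - c'|) :
    ∫⁻ z, ‖sup3 coneMap volume (blockFn f H L i c) z *
        sup3 coneMap volume (blockFn f H L i c') z‖ₑ ^ 2 ∂(wMeas3 κ) ≤
      2 * wMeas3 κ univ * ENNReal.ofReal (800 * lam / (L ^ i * β)) *
        ((∫⁻ ξ, ‖blockFn f H L i c ξ‖ₑ ^ 2) * ∫⁻ ξ, ‖blockFn f H L i c' ξ‖ₑ ^ 2) := by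
  obtain ⟨hα, hlα⟩ := h.le_scale i
  refine sup3_mul_sq_lintegral_le hκ (by fun_prop) (h.int i c) (h.meas i c) (h.int i c')
    (h.meas i c') ?_
  intro ω _ _
  refine (measure_mono ?_).trans (volume_bilinear_le (r := lam / L ^ 2) (c₀ := c₀)
    (lt_of_lt_of_le one_pos h.one_le_lam) hα (w := w₀ + c * (L ^ i * β))
    (w' := w₀ + c' * (L ^ i * β)) ?_ (coneMap ω.1 + coneMap ω.2))
  · intro ω' hω'
    exact ⟨⟨h.mem hω'.1.1, h.mem hω'.1.2⟩, hω'.2⟩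
  · have e : (w₀ + c * (L ^ i * β)) - (w₀ + c' * (L ^ i * β)) = ((c:ℝ) - c') * (L ^ i * β) := by ring
    rw [e, abs_mul, abs_of_pos hα]
    refine mul_le_mul_of_nonneg_right ?_ hα.le
    exact_mod_cast hcc

theorem fifth_power_step (h : ConeFamily lam c₀ β w₀ L J f H) (hκ : IsBandWeight κ)
    {S : Set (ℝ × ℝ × ℝ)} (hS : MeasurableSet S) {M : ℝ} (hM : 0 ≤ M) (i : ℕ) (k : ℤ)
    (hM0 : ∀ c, ∀ z ∈ S, ‖sup3 coneMap volume (blockFn f H L i c) z‖ ≤ M) :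
    ∫⁻ z in S, ‖sup3 coneMap volume (blockFn f H L (i + 1) k) z‖ₑ ^ 5 ∂(wMeas3 κ) ≤
      8 ^ 5 * ∑ c ∈ Finset.Ico (k * L) ((k + 1) * L),
        ∫⁻ z in S, ‖sup3 coneMap volume (blockFn f H L i c) z‖ₑ ^ 5 ∂(wMeas3 κ) +
      ENNReal.ofReal (4 * L ^ 7 * M) * (2 * wMeas3 κ univ *
        ENNReal.ofReal (800 * lam / (L ^ i * β))) *
        (∑ c ∈ Finset.Ico (k * L) ((k + 1) * L), ∫⁻ ξ, ‖blockFn f H L i c ξ‖ₑ ^ 2) ^ 2 := by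
  simp_rw [h.sup3_succ]
  set s := Finset.Ico (k * L) ((k + 1) * L) with hs
  have hcard : s.card = L := by
    rw [hs, Int.card_Ico, add_mul, add_sub_cancel_left]; simp
  set F := fun c => sup3 coneMap volume (blockFn f H L i c) with hF
  have hFm : ∀ c, Measurable (F c) := fun c => h.smeas i c
  have hpt : ∀ z ∈ S, ‖∑ c ∈ s, F c z‖ₑ ^ 5 ≤ 8 ^ 5 * ∑ c ∈ s, ‖F c z‖ₑ ^ 5 +
      ENNReal.ofReal (4 * L ^ 7 * M) *
        ∑ p ∈ (s ×ˢ s).filter (fun p => 4 ≤ |p.1 - p.2|), ‖F p.1 z * F p.2 z‖ₑ ^ 2 := by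
    intro z hz
    have bn := broad_narrow s (fun c => ‖F c z‖) (fun c _ => norm_nonneg _)
      (fun c _ => hM0 c z hz) hcard.le
    have e1 : ∀ (x : ℂ) (n : ℕ), ‖x‖ₑ ^ n = ENNReal.ofReal (‖x‖ ^ n) := by
      intro x n
      rw [ENNReal.ofReal_pow (norm_nonneg _), ofReal_norm]
    simp_rw [e1, norm_mul]
    rw [← ENNReal.ofReal_sum_of_nonneg fun c _ => by positivity,
      ← ENNReal.ofReal_sum_of_nonneg fun c _ => by positivity,
      ← ENNReal.ofReal_mul (by positivity)]
    have e2 : (8:ℝ≥0∞) ^ 5 = ENNReal.ofReal (8 ^ 5) := by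
      rw [ENNReal.ofReal_pow (by norm_num)]; norm_num
    rw [e2, ← ENNReal.ofReal_mul (by positivity), ← ENNReal.ofReal_add (by positivity) (by positivity)]
    apply ENNReal.ofReal_le_ofReal
    refine le_trans ?_ bn
    gcongr
    exact norm_sum_le _ _
  refine (setLIntegral_mono' hS hpt).trans ?_
  rw [lintegral_add_left (by fun_prop), lintegral_const_mul _ (by fun_prop),
    lintegral_const_mul _ (by fun_prop), lintegral_finsetSum _ (by fun_prop),
    lintegral_finsetSum _ (by fun_prop), mul_assoc (ENNReal.ofReal (4 * L ^ 7 * M))]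
  gcongr
  set I := fun c => ∫⁻ ξ, ‖blockFn f H L i c ξ‖ₑ ^ 2 with hI
  calc _ ≤ ∑ p ∈ (s ×ˢ s).filter (fun p => 4 ≤ |p.1 - p.2|),
        2 * wMeas3 κ univ * ENNReal.ofReal (800 * lam / (L ^ i * β)) * (I p.1 * I p.2) := by
        refine Finset.sum_le_sum fun p hp => ?_
        exact (setLIntegral_le_lintegral _ _).trans (h.bilinear_le hκ i (Finset.mem_filter.1 hp).2)
    _ ≤ ∑ p ∈ s ×ˢ s,
        2 * wMeas3 κ univ * ENNReal.ofReal (800 * lam / (L ^ i * β)) * (I p.1 * I p.2) :=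
        Finset.sum_le_sum_of_subset (Finset.filter_subset _ _)
    _ = _ := by
        rw [← Finset.mul_sum, sq, Finset.sum_mul_sum, Finset.sum_product]

theorem norm_sup3_block_le (h : ConeFamily lam c₀ β w₀ L J f H) {z : ℝ × ℝ × ℝ} {M : ℝ}
    (hM0 : ∀ c, ‖sup3 coneMap volume (blockFn f H L 0 c) z‖ ≤ M) (i : ℕ) (c : ℤ) :
    ‖sup3 coneMap volume (blockFn f H L i c) z‖ ≤ L ^ i * M := by
  induction i generalizing c with
  | zero => simpa using hM0 c
  | succ i ih =>
    rw [h.sup3_succ]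
    refine (norm_sum_le_of_le _ fun c _ => ih c).trans (le_of_eq ?_)
    have hcard : (Finset.Ico (c * L) ((c + 1) * L)).card = L := by
      rw [Int.card_Ico, add_mul, add_sub_cancel_left]; simp
    rw [Finset.sum_const, hcard, nsmul_eq_mul]
    ring

theorem fifth_power_le (h : ConeFamily lam c₀ β w₀ L J f H) (hκ : IsBandWeight κ)
    {S : Set (ℝ × ℝ × ℝ)} (hS : MeasurableSet S) {M : ℝ} (hM : 0 ≤ M)
    (hM0 : ∀ c, ∀ z ∈ S, ‖sup3 coneMap volume (blockFn f H L 0 c) z‖ ≤ M) {i j : ℕ}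
    (hij : i + j = J) :
    ∑ k ∈ Finset.Ico (0:ℤ) ((L ^ j : ℕ) : ℤ),
      ∫⁻ z in S, ‖sup3 coneMap volume (blockFn f H L i k) z‖ₑ ^ 5 ∂(wMeas3 κ) ≤
      (8 ^ 5 + 1) ^ i * (∑ n ∈ Finset.Ico (0:ℤ) ((L ^ J : ℕ) : ℤ),
        ∫⁻ z in S, ‖sup3 coneMap volume (blockFn f H L 0 n) z‖ₑ ^ 5 ∂(wMeas3 κ) +
        2 * wMeas3 κ univ * ENNReal.ofReal (3200 * L ^ 7 * M * lam / β) *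
          (∫⁻ ξ, ‖H ξ‖ₑ ^ 2) ^ 2) := by
  have hL' : (1:ℝ) ≤ L := by exact_mod_cast h.one_le_L
  have hβ := h.β_pos
  have hlam : 0 < lam := lt_of_lt_of_le one_pos h.one_le_lam
  set X := 2 * wMeas3 κ univ * ENNReal.ofReal (3200 * L ^ 7 * M * lam / β) *
          (∫⁻ ξ, ‖H ξ‖ₑ ^ 2) ^ 2 with hX
  set A₀ := ∑ n ∈ Finset.Ico (0:ℤ) ((L ^ J : ℕ) : ℤ),
        ∫⁻ z in S, ‖sup3 coneMap volume (blockFn f H L 0 n) z‖ₑ ^ 5 ∂(wMeas3 κ) with hA₀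
  induction i generalizing j with
  | zero => simp at hij; simp [hij, hA₀]
  | succ i ih =>
    have hMi : ∀ c, ∀ z ∈ S, ‖sup3 coneMap volume (blockFn f H L i c) z‖ ≤ L ^ i * M :=
      fun c z hz => h.norm_sup3_block_le (fun c => hM0 c z hz) i c
    set I := fun c => ∫⁻ ξ, ‖blockFn f H L i c ξ‖ₑ ^ 2 with hI
    have hcoef : ENNReal.ofReal (4 * L ^ 7 * (L ^ i * M)) * (2 * wMeas3 κ univ *
        ENNReal.ofReal (800 * lam / (L ^ i * β))) =
        2 * wMeas3 κ univ * ENNReal.ofReal (3200 * L ^ 7 * M * lam / β) := by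
      rw [mul_left_comm, ← ENNReal.ofReal_mul (by positivity)]
      congr 2
      field_simp
      ring
    calc _ ≤ ∑ k ∈ Finset.Ico (0:ℤ) ((L ^ j : ℕ) : ℤ),
          (8 ^ 5 * ∑ c ∈ Finset.Ico (k * L) ((k + 1) * L),
            ∫⁻ z in S, ‖sup3 coneMap volume (blockFn f H L i c) z‖ₑ ^ 5 ∂(wMeas3 κ) +
          2 * wMeas3 κ univ * ENNReal.ofReal (3200 * L ^ 7 * M * lam / β) *
            (∑ c ∈ Finset.Ico (k * L) ((k + 1) * L), I c) ^ 2) :=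
          Finset.sum_le_sum fun k _ => by
            rw [← hcoef]
            exact h.fifth_power_step hκ hS (by positivity) i k hMi
      _ = 8 ^ 5 * ∑ c ∈ Finset.Ico (0:ℤ) ((L ^ (j + 1) : ℕ) : ℤ),
            ∫⁻ z in S, ‖sup3 coneMap volume (blockFn f H L i c) z‖ₑ ^ 5 ∂(wMeas3 κ) +
          2 * wMeas3 κ univ * ENNReal.ofReal (3200 * L ^ 7 * M * lam / β) *
            ∑ k ∈ Finset.Ico (0:ℤ) ((L ^ j : ℕ) : ℤ),
              (∑ c ∈ Finset.Ico (k * L) ((k + 1) * L), I c) ^ 2 := by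
          rw [Finset.sum_add_distrib, ← Finset.mul_sum, sum_sum_Ico_mul, ← pow_succ,
            ← Finset.mul_sum]
      _ ≤ 8 ^ 5 * ((8 ^ 5 + 1) ^ i * (A₀ + X)) + X := by
          gcongr
          · exact ih (j := j + 1) (by omega)
          · rw [hX]
            gcongr
            have h2 : ∑ k ∈ Finset.Ico (0:ℤ) ((L ^ j : ℕ) : ℤ),
                ∑ c ∈ Finset.Ico (k * L) ((k + 1) * L), I c ≤ ∫⁻ ξ, ‖H ξ‖ₑ ^ 2 := by
              rw [sum_sum_Ico_mul, ← pow_succ]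
              exact h.sum_sq_le (by omega)
            set V := ∫⁻ ξ, ‖H ξ‖ₑ ^ 2
            set G := fun k : ℤ => ∑ c ∈ Finset.Ico (k * L) ((k + 1) * L), I c
            calc _ ≤ ∑ k ∈ Finset.Ico (0:ℤ) ((L ^ j : ℕ) : ℤ), G k * V := by
                  refine Finset.sum_le_sum fun k hk => ?_
                  rw [sq]
                  gcongr
                  exact (Finset.single_le_sum (f := G) (fun _ _ => zero_le) hk).trans h2
              _ = (∑ k ∈ Finset.Ico (0:ℤ) ((L ^ j : ℕ) : ℤ), G k) * V := by rw [Finset.sum_mul]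
              _ ≤ V * V := by gcongr
              _ = V ^ 2 := by ring
      _ ≤ 8 ^ 5 * ((8 ^ 5 + 1) ^ i * (A₀ + X)) + (8 ^ 5 + 1) ^ i * (A₀ + X) := by
          gcongr
          have : (1:ℝ≥0∞) ≤ (8 ^ 5 + 1) ^ i := one_le_pow₀ le_add_self
          calc X ≤ 1 * (A₀ + X) := by rw [one_mul]; exact le_add_self
            _ ≤ _ := by gcongr
      _ = _ := by rw [pow_succ]; ring

end ConeFamily

end

section

theorem volume_conePiece_le {lam : ℝ} (hlam : 0 < lam) {a : ℝ} (ha : 0 < a) (r c₀ w : ℝ) :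
    volume (conePiece lam r c₀ a w) ≤ ENNReal.ofReal (128 * lam ^ 2 * a) := by
  rw [Measure.volume_eq_prod, Measure.prod_apply (measurableSet_conePiece _ _ _ _ _)]
  calc _ ≤ ∫⁻ p, (Icc (0:ℝ) (8 * lam)).indicator (fun _ => ENNReal.ofReal (16 * lam * a)) p := by
        refine lintegral_mono fun p => ?_
        by_cases hp : p ∈ Icc (0:ℝ) (8 * lam)
        · rw [indicator_of_mem hp]
          by_cases hp0 : 0 < p
          · calc _ ≤ volume (Icc (p * (w - a)) (p * (w + a))) := by
                  refine measure_mono fun q hq => ?_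
                  have h := abs_le.1 hq.2.2.2.2
                  simp only at h
                  have e : p * (q / p) = q := mul_div_cancel₀ _ hp0.ne'
                  constructor
                  · nlinarith
                  · nlinarith
              _ ≤ _ := by
                  rw [Real.volume_Icc]
                  apply ENNReal.ofReal_le_ofReal
                  nlinarith [hp.2]
          · refine le_of_eq_of_le ?_ zero_le
            convert measure_empty (μ := (volume : Measure ℝ))
            ext q
            simp only [mem_preimage, mem_empty_iff_false, iff_false]
            intro hq
            have := hq.1
            simp only at this
            linarith
        · rw [indicator_of_notMem hp, le_zero_iff]
          convert measure_empty (μ := (volume : Measure ℝ))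
          ext q
          simp only [mem_preimage, mem_empty_iff_false, iff_false]
          intro hq
          exact hp ⟨by have := hq.1; simp only at this; linarith, hq.2.1⟩
    _ = _ := by
        rw [lintegral_indicator measurableSet_Icc, setLIntegral_const, Real.volume_Icc,
          ← ENNReal.ofReal_mul (by positivity)]
        congr 1; ring

/-- Cauchy-Schwarz for a function supported in a set of finite measure. -/
theorem lintegral_sq_le_measure_mul {X : Type*} [MeasurableSpace X] {μ : Measure X} {f : X → ℝ≥0∞}
    (hf : Measurable f) {s : Set X} (hs : MeasurableSet s) (h0 : ∀ x, f x ≠ 0 → x ∈ s) :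
    (∫⁻ x, f x ∂μ) ^ 2 ≤ μ s * ∫⁻ x, f x ^ 2 ∂μ := by
  have e : ∀ x, f x = s.indicator 1 x * f x := by
    intro x
    by_cases hx : x ∈ s
    · simp [hx]
    · have : f x = 0 := by by_contra h; exact hx (h0 x h)
      simp [this]
  have h := ENNReal.lintegral_mul_le_Lp_mul_Lq μ (Real.HolderConjugate.two_two)
    (f := s.indicator (1 : X → ℝ≥0∞)) (g := f) ((measurable_one.indicator hs).aemeasurable) hf.aemeasurable
  have e2 : ∫⁻ x, f x ∂μ = ∫⁻ x, (s.indicator (1 : X → ℝ≥0∞) * f) x ∂μ := lintegral_congr fun x => e x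
  rw [e2]
  refine (pow_le_pow_left₀ zero_le h 2).trans (le_of_eq ?_)
  have r : ∀ a : ℝ≥0∞, (a ^ (1 / (2:ℝ))) ^ 2 = a := by
    intro a
    rw [← ENNReal.rpow_natCast, ← ENNReal.rpow_mul]; norm_num
  rw [mul_pow, r, r]
  congr 1
  · rw [← lintegral_indicator_one hs]
    refine lintegral_congr fun x => ?_
    by_cases hx : x ∈ s <;> simp [hx]
  · refine lintegral_congr fun x => ?_
    exact ENNReal.rpow_two _

/-- The measure `(1 + |s|)⁶ κ(s) ds`. -/
def heavyMeas (κ : ℝ → ℝ) : Measure ℝ :=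
  (wMeas κ).withDensity fun s => ENNReal.ofReal ((1 + |s|) ^ 6)

theorem IsBandWeight.isFiniteMeasure_heavy {κ : ℝ → ℝ} (h : IsBandWeight κ) :
    IsFiniteMeasure (heavyMeas κ) := by
  refine isFiniteMeasure_withDensity ?_
  have hκm : Measurable fun x => ENNReal.ofReal (κ x) := h.cont.measurable.ennreal_ofReal
  rw [wMeas, lintegral_withDensity_eq_lintegral_mul _ hκm (by fun_prop)]
  have hi : Integrable fun x => 64 * (κ x + |x| ^ 6 * κ x) :=
    (h.integrable.add (h.moment 6)).const_mul 64
  refine ((lintegral_mono fun x => ?_).trans_lt hi.lintegral_lt_top).ne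
  simp only [Pi.mul_apply]
  rw [← ENNReal.ofReal_mul (h.nonneg x)]
  apply ENNReal.ofReal_le_ofReal
  have h0 := h.nonneg x
  have h1 : (1 + |x|) ^ 6 ≤ 64 * (1 + |x| ^ 6) := by
    have := add_pow_le (zero_le_one) (abs_nonneg x) 6
    norm_num at this
    nlinarith [pow_nonneg (abs_nonneg x) 6]
  nlinarith

namespace ConeFamily

variable {lam c₀ β w₀ : ℝ} {L J : ℕ} {f : ℤ → ℝ × ℝ → ℝ} {H : ℝ × ℝ → ℂ} {κ : ℝ → ℝ}

theorem enorm_sup3_sq_le (h : ConeFamily lam c₀ β w₀ L J f H) (n : ℤ) (z : ℝ × ℝ × ℝ) :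
    ‖sup3 coneMap volume (blockFn f H L 0 n) z‖ₑ ^ 2 ≤
      ENNReal.ofReal (128 * lam ^ 2 * β) * ∫⁻ ξ, ‖blockFn f H L 0 n ξ‖ₑ ^ 2 := by
  have h1 : ‖sup3 coneMap volume (blockFn f H L 0 n) z‖ₑ ≤ ∫⁻ ξ, ‖blockFn f H L 0 n ξ‖ₑ := by
    refine (enorm_integral_le_lintegral_enorm _).trans (le_of_eq ?_)
    simp [enorm_ec]
  refine (pow_le_pow_left₀ zero_le h1 2).trans ?_
  refine (lintegral_sq_le_measure_mul (h.meas 0 n).enorm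
    (measurableSet_conePiece lam (lam / L ^ 2) c₀ β (w₀ + n * β)) (fun ξ hξ => ?_)).trans ?_
  · have := h.mem (i := 0) (k := n) (ξ := ξ) (by simpa using hξ)
    simpa using this
  · gcongr
    exact volume_conePiece_le (lt_of_lt_of_le one_pos h.one_le_lam) h.β_pos _ _ _

theorem sum_fifth_base_le (h : ConeFamily lam c₀ β w₀ L J f H) (hκ : IsBandWeight κ)
    {S : Set (ℝ × ℝ × ℝ)} (hS : MeasurableSet S) {M : ℝ}
    (hM0 : ∀ c, ∀ z ∈ S, ‖sup3 coneMap volume (blockFn f H L 0 c) z‖ ≤ M) :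
    ∑ n ∈ Finset.Ico (0:ℤ) ((L ^ J : ℕ) : ℤ),
      ∫⁻ z in S, ‖sup3 coneMap volume (blockFn f H L 0 n) z‖ₑ ^ 5 ∂(wMeas3 κ) ≤
      ENNReal.ofReal M * ENNReal.ofReal (128 * lam ^ 2 * β) * (8 * wMeas3 κ univ) *
        (∫⁻ ξ, ‖H ξ‖ₑ ^ 2) ^ 2 := by
  have := hκ.isFiniteMeasure
  set u := ∫⁻ ξ, ‖H ξ‖ₑ ^ 2
  have hs := h.sum_sq_le (i := 0) (j := J) (by simp)
  have hterm : ∀ n ∈ Finset.Ico (0:ℤ) ((L ^ J : ℕ) : ℤ),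
      ∫⁻ z in S, ‖sup3 coneMap volume (blockFn f H L 0 n) z‖ₑ ^ 5 ∂(wMeas3 κ) ≤
      ENNReal.ofReal M * (ENNReal.ofReal (128 * lam ^ 2 * β) * u) * (8 * wMeas3 κ univ) *
        ∫⁻ ξ, ‖blockFn f H L 0 n ξ‖ₑ ^ 2 := by
    intro n hn
    have hu : ∫⁻ ξ, ‖blockFn f H L 0 n ξ‖ₑ ^ 2 ≤ u :=
      (Finset.single_le_sum (f := fun n => ∫⁻ ξ, ‖blockFn f H L 0 n ξ‖ₑ ^ 2)
        (fun _ _ => zero_le) hn).trans hs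
    calc _ ≤ ∫⁻ z in S, ENNReal.ofReal M * (ENNReal.ofReal (128 * lam ^ 2 * β) * u) *
          ‖sup3 coneMap volume (blockFn f H L 0 n) z‖ₑ ^ 2 ∂(wMeas3 κ) := by
          refine setLIntegral_mono' hS fun z hz => ?_
          have e : ∀ x : ℝ≥0∞, x ^ 5 = x * x ^ 2 * x ^ 2 := fun x => by ring
          rw [e]
          gcongr
          · rw [← ofReal_norm]
            exact ENNReal.ofReal_le_ofReal (hM0 n z hz)
          · exact (h.enorm_sup3_sq_le n z).trans (by gcongr)
      _ ≤ ∫⁻ z, ENNReal.ofReal M * (ENNReal.ofReal (128 * lam ^ 2 * β) * u) *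
          ‖sup3 coneMap volume (blockFn f H L 0 n) z‖ₑ ^ 2 ∂(wMeas3 κ) := setLIntegral_le_lintegral _ _
      _ ≤ _ := by
          rw [lintegral_const_mul _ ((h.smeas 0 n).enorm.pow_const 2), mul_assoc _ (8 * _)]
          gcongr
          exact cone_sq_lintegral_le hκ _ (h.int 0 n) (h.meas 0 n)
  refine (Finset.sum_le_sum hterm).trans ?_
  rw [← Finset.mul_sum]
  calc _ ≤ ENNReal.ofReal M * (ENNReal.ofReal (128 * lam ^ 2 * β) * u) * (8 * wMeas3 κ univ) * u := by
        gcongr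
    _ = _ := by ring

theorem sum_fourth_base_le (h : ConeFamily lam c₀ β w₀ L J f H) (hκ : IsBandWeight κ) {P : ℝ}
    (hP : 0 ≤ P)
    (hP0 : ∀ c z, ‖sup3 coneMap volume (blockFn f H L 0 c) z‖ ≤ P * (1 + |z.2.2|) ^ 3) :
    ∑ n ∈ Finset.Ico (0:ℤ) ((L ^ J : ℕ) : ℤ),
      ∫⁻ z, ‖sup3 coneMap volume (blockFn f H L 0 n) z‖ₑ ^ 4 ∂(wMeas3 κ) ≤
      ENNReal.ofReal (P ^ 2) * (8 * ((wMeas κ).prod ((wMeas κ).prod (heavyMeas κ))) univ) *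
        ∫⁻ ξ, ‖H ξ‖ₑ ^ 2 := by
  have := hκ.isFiniteMeasure
  have := hκ.isFiniteMeasure_heavy
  have hs := h.sum_sq_le (i := 0) (j := J) (by simp)
  have hprod : (wMeas κ).prod ((wMeas κ).prod (heavyMeas κ)) =
      (wMeas3 κ).withDensity fun z => ENNReal.ofReal ((1 + |z.2.2|) ^ 6) := by
    unfold heavyMeas wMeas3
    rw [prod_withDensity_right (by fun_prop), prod_withDensity_right (by fun_prop)]
  have hterm : ∀ n, ∫⁻ z, ‖sup3 coneMap volume (blockFn f H L 0 n) z‖ₑ ^ 4 ∂(wMeas3 κ) ≤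
      ENNReal.ofReal (P ^ 2) * (8 * ((wMeas κ).prod ((wMeas κ).prod (heavyMeas κ))) univ) *
        ∫⁻ ξ, ‖blockFn f H L 0 n ξ‖ₑ ^ 2 := by
    intro n
    have hm := (h.smeas 0 n).enorm.pow_const 2
    calc _ ≤ ∫⁻ z, ENNReal.ofReal (P ^ 2) * (ENNReal.ofReal ((1 + |z.2.2|) ^ 6) *
          ‖sup3 coneMap volume (blockFn f H L 0 n) z‖ₑ ^ 2) ∂(wMeas3 κ) := by
          refine lintegral_mono fun z => ?_
          have e : ∀ x : ℝ≥0∞, x ^ 4 = x ^ 2 * x ^ 2 := fun x => by ring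
          rw [e, ← mul_assoc, ← ENNReal.ofReal_mul (by positivity)]
          gcongr
          rw [← ofReal_norm, ← ENNReal.ofReal_pow (norm_nonneg _)]
          apply ENNReal.ofReal_le_ofReal
          refine (pow_le_pow_left₀ (norm_nonneg _) (hP0 n z) 2).trans (le_of_eq ?_)
          ring
      _ = ENNReal.ofReal (P ^ 2) * ∫⁻ z, ‖sup3 coneMap volume (blockFn f H L 0 n) z‖ₑ ^ 2
          ∂((wMeas κ).prod ((wMeas κ).prod (heavyMeas κ))) := by
          rw [lintegral_const_mul _ (by fun_prop), hprod,
            lintegral_withDensity_eq_lintegral_mul _ (by fun_prop) hm]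
          rfl
      _ ≤ _ := by
          rw [mul_assoc]
          gcongr
          exact cone_sq_lintegral_le hκ _ (h.int 0 n) (h.meas 0 n)
  refine (Finset.sum_le_sum fun n _ => hterm n).trans ?_
  rw [← Finset.mul_sum]
  gcongr

end ConeFamily

/-- The slab where the last coordinate is at most `10` in absolute value. -/
def slab : Set (ℝ × ℝ × ℝ) := {z | |z.2.2| ≤ 10}

theorem measurableSet_slab : MeasurableSet slab := by
  have : Measurable fun z : ℝ × ℝ × ℝ => |z.2.2| := by fun_prop
  exact measurableSet_le this measurable_const

theorem exists_coneFamily_bound {κ : ℝ → ℝ} (hκ : IsBandWeight κ) (J : ℕ) {P : ℝ} (hP : 0 ≤ P)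
    {q y z : ℝ} (hy : 0 ≤ y) (hz : 0 ≤ z) (hyz : y + z ≤ 1) (hq : q = 2 + 2 * y + 3 * z) :
    ∃ C : ℝ≥0∞, C ≠ ∞ ∧ ∀ {lam c₀ β w₀ : ℝ} {L : ℕ} {f : ℤ → ℝ × ℝ → ℝ} {H : ℝ × ℝ → ℂ},
      ConeFamily lam c₀ β w₀ L J f H → lam * β ^ 2 = 1 →
      (∀ ξ, H ξ ≠ 0 → ∑ n ∈ Finset.Ico (0:ℤ) ((L ^ J : ℕ) : ℤ), f n ξ = 1) →
      (L:ℝ) ^ J ≤ P / β →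
      (∀ c x, ‖sup3 coneMap volume (blockFn f H L 0 c) x‖ ≤ P * (1 + |x.2.2|) ^ 3) →
      ∫⁻ x in slab, ‖sup3 coneMap volume H x‖ₑ ^ q ∂(wMeas3 κ) ≤
        C * L ^ 7 * ENNReal.ofReal lam ^ (q / 2 - 1 - y / 2) * (∫⁻ ξ, ‖H ξ‖ₑ ^ 2) ^ (1 + z) := by
  have i1 := hκ.isFiniteMeasure
  have i2 := hκ.isFiniteMeasure_heavy
  have i3 := hκ.isFiniteMeasure3
  set m := wMeas3 κ univ
  set m' := ((wMeas κ).prod ((wMeas κ).prod (heavyMeas κ))) univ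
  have hm : m ≠ ∞ := measure_ne_top _ _
  have hm' : m' ≠ ∞ := measure_ne_top _ _
  set K₂ := 8 * m
  set K₄ := (4 * 1462050) ^ J * ENNReal.ofReal P * (ENNReal.ofReal (P ^ 2) * (8 * m'))
  set K₅ := (8 ^ 5 + 1) ^ J * ENNReal.ofReal (P * 11 ^ 3) * (1024 * m + 6400 * m)
  have hK2 : K₂ ≠ ∞ := by finiteness
  have hK4 : K₄ ≠ ∞ := by finiteness
  have hK5 : K₅ ≠ ∞ := by finiteness
  refine ⟨K₂ ^ (1 - y - z) * K₄ ^ y * K₅ ^ z, ?_, ?_⟩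
  · have := ENNReal.rpow_ne_top_of_nonneg (by linarith : 0 ≤ 1 - y - z) hK2
    have := ENNReal.rpow_ne_top_of_nonneg hy hK4
    have := ENNReal.rpow_ne_top_of_nonneg hz hK5
    finiteness
  intro lam c₀ β w₀ L f H h hβlam hone hLJ hplank
  have hlam : 0 < lam := lt_of_lt_of_le one_pos h.one_le_lam
  have hβ := h.β_pos
  set u := ∫⁻ ξ, ‖H ξ‖ₑ ^ 2
  set Λ := ENNReal.ofReal lam
  have hΛ0 : Λ ≠ 0 := by simpa [Λ] using hlam
  have hΛt : Λ ≠ ∞ := ENNReal.ofReal_ne_top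
  have hβ1 : 1 / β = lam ^ (1 / 2 : ℝ) := by
    rw [← Real.sqrt_eq_rpow]
    symm
    rw [Real.sqrt_eq_iff_mul_self_eq hlam.le (by positivity)]
    field_simp; linarith
  have hβ2 : ENNReal.ofReal (1 / β) = Λ ^ (1 / 2 : ℝ) := by
    rw [hβ1, ENNReal.ofReal_rpow_of_pos hlam]
  have hβ3 : ENNReal.ofReal (lam / β) = Λ ^ (3 / 2 : ℝ) := by
    rw [div_eq_mul_one_div, ENNReal.ofReal_mul hlam.le, hβ2]
    nth_rewrite 1 [← ENNReal.rpow_one (ENNReal.ofReal lam)]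
    rw [← ENNReal.rpow_add _ _ hΛ0 hΛt]
    norm_num
  have hβ4 : lam ^ 2 * β = lam / β := by
    field_simp; nlinarith
  have hF : blockFn f H L J 0 = H := by
    funext ξ
    by_cases hξ : H ξ = 0
    · simp [blockFn, hξ]
    · have e := sum_blockWt (f := f) (L := L) J 0 ξ
      simp only [pow_zero, Nat.cast_one, add_zero] at e
      rw [hone ξ hξ] at e
      have : Finset.Ico (0:ℤ) 1 = {0} := by ext; simp; omega
      rw [this, Finset.sum_singleton] at e
      simp [blockFn, e]
  have hIco : Finset.Ico (0:ℤ) ((L ^ 0 : ℕ) : ℤ) = {0} := by ext; simp; omega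
  set F := sup3 coneMap volume H
  have hFm : Measurable F := (sup3_stronglyMeasurable (by fun_prop) h.H_meas).measurable
  have B2 : ∫⁻ x in slab, ‖F x‖ₑ ^ 2 ∂(wMeas3 κ) ≤ K₂ * u :=
    (setLIntegral_le_lintegral _ _).trans (cone_sq_lintegral_le hκ _ h.H_int h.H_meas)
  have B4 : ∫⁻ x in slab, ‖F x‖ₑ ^ 4 ∂(wMeas3 κ) ≤ K₄ * Λ ^ (1 / 2 : ℝ) * u := by
    refine (setLIntegral_le_lintegral _ _).trans ?_
    have := h.fourth_power_le hκ (i := J) (j := 0) (by simp)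
    rw [hIco, Finset.sum_singleton, hF] at this
    refine this.trans ?_
    have hLe : (L:ℝ≥0∞) ^ J ≤ ENNReal.ofReal P * Λ ^ (1 / 2 : ℝ) := by
      rw [← hβ2, ← ENNReal.ofReal_mul hP, mul_one_div]
      have e : (L:ℝ≥0∞) = ENNReal.ofReal L := by simp
      rw [e, ← ENNReal.ofReal_pow (by positivity)]
      exact ENNReal.ofReal_le_ofReal hLJ
    calc _ ≤ (4 * 1462050 * L) ^ J * (ENNReal.ofReal (P ^ 2) * (8 * m') * u) := by
          gcongr
          exact h.sum_fourth_base_le hκ hP hplank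
      _ = (4 * 1462050) ^ J * (L:ℝ≥0∞) ^ J * (ENNReal.ofReal (P ^ 2) * (8 * m') * u) := by
          rw [mul_pow (4 * 1462050) (L:ℝ≥0∞)]
      _ ≤ (4 * 1462050) ^ J * (ENNReal.ofReal P * Λ ^ (1 / 2 : ℝ)) *
          (ENNReal.ofReal (P ^ 2) * (8 * m') * u) := by gcongr
      _ = _ := by ring
  have B5 : ∫⁻ x in slab, ‖F x‖ₑ ^ 5 ∂(wMeas3 κ) ≤ K₅ * L ^ 7 * Λ ^ (3 / 2 : ℝ) * u ^ 2 := by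
    have hM0 : ∀ c, ∀ x ∈ slab, ‖sup3 coneMap volume (blockFn f H L 0 c) x‖ ≤ P * 11 ^ 3 := by
      intro c x hx
      refine (hplank c x).trans ?_
      have : |x.2.2| ≤ 10 := hx
      gcongr
      linarith
    have := h.fifth_power_le hκ measurableSet_slab (M := P * 11 ^ 3) (by positivity) hM0
      (i := J) (j := 0) (by simp)
    rw [hIco, Finset.sum_singleton, hF] at this
    refine this.trans ?_
    have hL1 : (1:ℝ≥0∞) ≤ L ^ 7 := one_le_pow₀ (by exact_mod_cast h.one_le_L)
    have e1 : ENNReal.ofReal (128 * lam ^ 2 * β) = 128 * Λ ^ (3 / 2 : ℝ) := by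
      rw [mul_assoc, hβ4, ENNReal.ofReal_mul (by norm_num), hβ3]; norm_num
    have e2 : ENNReal.ofReal (3200 * L ^ 7 * (P * 11 ^ 3) * lam / β) =
        3200 * L ^ 7 * ENNReal.ofReal (P * 11 ^ 3) * Λ ^ (3 / 2 : ℝ) := by
      rw [mul_div_assoc, ENNReal.ofReal_mul (by positivity), ENNReal.ofReal_mul (by positivity),
        ENNReal.ofReal_mul (by positivity), hβ3, ENNReal.ofReal_pow (by positivity)]
      norm_num
    calc _ ≤ (8 ^ 5 + 1) ^ J * (ENNReal.ofReal (P * 11 ^ 3) * (128 * Λ ^ (3 / 2 : ℝ)) * (8 * m) * u ^ 2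
          + 2 * m * (3200 * L ^ 7 * ENNReal.ofReal (P * 11 ^ 3) * Λ ^ (3 / 2 : ℝ)) * u ^ 2) := by
          rw [← e1, ← e2]
          refine mul_le_mul_right (add_le_add ?_ le_rfl) _
          exact h.sum_fifth_base_le hκ measurableSet_slab hM0
      _ = (8 ^ 5 + 1) ^ J * ENNReal.ofReal (P * 11 ^ 3) * (1024 * m * 1 + 6400 * m * L ^ 7) *
          Λ ^ (3 / 2 : ℝ) * u ^ 2 := by ring
      _ ≤ (8 ^ 5 + 1) ^ J * ENNReal.ofReal (P * 11 ^ 3) * (1024 * m * L ^ 7 + 6400 * m * L ^ 7) *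
          Λ ^ (3 / 2 : ℝ) * u ^ 2 := by gcongr
      _ = _ := by ring
  have hölder := ENNReal.lintegral_prod_norm_pow_le (μ := (wMeas3 κ).restrict slab)
    (Finset.univ : Finset (Fin 3)) (f := ![fun x => ‖F x‖ₑ ^ 2, fun x => ‖F x‖ₑ ^ 4,
      fun x => ‖F x‖ₑ ^ 5]) (by
      intro i _
      fin_cases i
      · exact (hFm.enorm.pow_const 2).aemeasurable
      · exact (hFm.enorm.pow_const 4).aemeasurable
      · exact (hFm.enorm.pow_const 5).aemeasurable)
    (p := ![1 - y - z, y, z]) (by simp [Fin.sum_univ_three]; ring) (by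
      intro i _
      fin_cases i
      · simp; linarith
      · exact hy
      · exact hz)
  simp only [Fin.prod_univ_three, Matrix.cons_val_zero, Matrix.cons_val_one, Matrix.cons_val] at hölder
  have hx0 : 0 ≤ 1 - y - z := by linarith
  have epow : ∀ x, ‖F x‖ₑ ^ q = (‖F x‖ₑ ^ 2) ^ (1 - y - z) * (‖F x‖ₑ ^ 4) ^ y * (‖F x‖ₑ ^ 5) ^ z := by
    intro x
    simp only [← ENNReal.rpow_natCast, ← ENNReal.rpow_mul]
    rw [← ENNReal.rpow_add_of_nonneg _ _ (by positivity) (by positivity),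
      ← ENNReal.rpow_add_of_nonneg _ _ (by positivity) (by positivity)]
    congr 1
    rw [hq]; push_cast; ring
  simp_rw [epow]
  refine hölder.trans ?_
  calc _ ≤ (K₂ * u) ^ (1 - y - z) * (K₄ * Λ ^ (1 / 2 : ℝ) * u) ^ y *
        (K₅ * L ^ 7 * Λ ^ (3 / 2 : ℝ) * u ^ 2) ^ z := by gcongr
    _ = (K₂ ^ (1 - y - z) * K₄ ^ y * K₅ ^ z) * ((L:ℝ≥0∞) ^ 7) ^ z *
        ((Λ ^ (1 / 2 : ℝ)) ^ y * (Λ ^ (3 / 2 : ℝ)) ^ z) * (u ^ (1 - y - z) * u ^ y * (u ^ 2) ^ z) := by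
        rw [ENNReal.mul_rpow_of_nonneg _ _ hx0, ENNReal.mul_rpow_of_nonneg _ _ hy,
          ENNReal.mul_rpow_of_nonneg _ _ hy, ENNReal.mul_rpow_of_nonneg _ _ hz,
          ENNReal.mul_rpow_of_nonneg _ _ hz, ENNReal.mul_rpow_of_nonneg _ _ hz]
        ring
    _ ≤ (K₂ ^ (1 - y - z) * K₄ ^ y * K₅ ^ z) * (L:ℝ≥0∞) ^ 7 *
        Λ ^ (q / 2 - 1 - y / 2) * u ^ (1 + z) := by
        gcongr
        · calc ((L:ℝ≥0∞) ^ 7) ^ z ≤ ((L:ℝ≥0∞) ^ 7) ^ (1:ℝ) :=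
              ENNReal.rpow_le_rpow_of_exponent_le (one_le_pow₀ (by exact_mod_cast h.one_le_L))
                (by linarith)
            _ = _ := ENNReal.rpow_one _
        · rw [← ENNReal.rpow_mul, ← ENNReal.rpow_mul, ← ENNReal.rpow_add _ _ hΛ0 hΛt]
          apply le_of_eq
          congr 1
          rw [hq]; ring
        · rw [← ENNReal.rpow_natCast, ← ENNReal.rpow_mul,
            ← ENNReal.rpow_add_of_nonneg _ _ hx0 hy,
            ← ENNReal.rpow_add_of_nonneg _ _ (by linarith) (by positivity)]
          apply le_of_eq
          congr 1
          push_cast; ring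

end

section

/-- A smooth bump on `[-1, 1]` whose integer translates sum to one. -/
def hat (x : ℝ) : ℝ := smoothTransition (x + 1) - smoothTransition x

theorem hat_contDiff : ContDiff ℝ (⊤ : ℕ∞) hat := by
  unfold hat
  exact (smoothTransition.contDiff.comp (contDiff_id.add contDiff_const)).sub
    smoothTransition.contDiff

theorem continuous_hat : Continuous hat := hat_contDiff.continuous

@[fun_prop]
theorem measurable_hat : Measurable hat := continuous_hat.measurable

theorem hat_nonneg (x : ℝ) : 0 ≤ hat x := sub_nonneg.2 (smoothTransition.monotone (by linarith))

theorem hat_le_one (x : ℝ) : hat x ≤ 1 := by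
  have := smoothTransition.le_one (x + 1)
  have := smoothTransition.nonneg x
  unfold hat; linarith

theorem abs_lt_one_of_hat_ne_zero {x : ℝ} (h : hat x ≠ 0) : |x| < 1 := by
  rw [abs_lt]
  by_contra hx
  apply h
  rw [not_and_or, not_lt, not_lt] at hx
  unfold hat
  rcases hx with hx | hx
  · rw [smoothTransition.zero_of_nonpos (by linarith), smoothTransition.zero_of_nonpos (by linarith)]
    simp
  · rw [smoothTransition.one_of_one_le hx, smoothTransition.one_of_one_le (by linarith)]
    simp

theorem sum_hat_sub (M : ℕ) (x : ℝ) :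
    ∑ n ∈ Finset.Ico (0:ℤ) M, hat (x - n) = smoothTransition (x + 1) - smoothTransition (x + 1 - M) := by
  induction M with
  | zero => simp
  | succ M ih =>
    have : Finset.Ico (0:ℤ) ((M + 1 : ℕ) : ℤ) = insert (M:ℤ) (Finset.Ico (0:ℤ) M) := by
      ext n; simp only [Finset.mem_Ico, Finset.mem_insert]; push_cast; omega
    rw [this, Finset.sum_insert (by simp), ih]
    unfold hat
    push_cast
    rw [show x - (M:ℝ) + 1 = x + 1 - M by ring, show x + 1 - ((M:ℝ) + 1) = x - M by ring]
    ring

theorem sum_hat_sub_le_one (M : ℕ) (x : ℝ) : ∑ n ∈ Finset.Ico (0:ℤ) M, hat (x - n) ≤ 1 := by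
  rw [sum_hat_sub]
  have := smoothTransition.le_one (x + 1)
  have := smoothTransition.nonneg (x + 1 - M)
  linarith

theorem sum_hat_sub_eq_one {M : ℕ} {x : ℝ} (h0 : 0 ≤ x) (h1 : x + 1 ≤ M) :
    ∑ n ∈ Finset.Ico (0:ℤ) M, hat (x - n) = 1 := by
  rw [sum_hat_sub, smoothTransition.one_of_one_le (by linarith),
    smoothTransition.zero_of_nonpos (by linarith), sub_zero]

/-- A smooth positive function that is the identity on `[1/64, ∞)`. -/
def posPart' (x : ℝ) : ℝ :=
  smoothTransition (128 * x - 1) * x + (1 - smoothTransition (128 * x - 1))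

theorem posPart'_contDiff : ContDiff ℝ (⊤ : ℕ∞) posPart' := by
  unfold posPart'
  have : ContDiff ℝ (⊤ : ℕ∞) fun x : ℝ => smoothTransition (128 * x - 1) :=
    smoothTransition.contDiff.comp ((contDiff_const.mul contDiff_id).sub contDiff_const)
  exact (this.mul contDiff_id).add (contDiff_const.sub this)

theorem posPart'_eq {x : ℝ} (h : 1 / 64 ≤ x) : posPart' x = x := by
  unfold posPart'
  rw [smoothTransition.one_of_one_le (by linarith)]; ring

theorem posPart'_pos (x : ℝ) : 0 < posPart' x := by
  unfold posPart'
  have h1 := smoothTransition.le_one (128 * x - 1)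
  have h0 := smoothTransition.nonneg (128 * x - 1)
  rcases le_or_gt x (1 / 128) with hx | hx
  · rw [smoothTransition.zero_of_nonpos (by linarith)]; norm_num
  · rcases lt_or_ge (smoothTransition (128 * x - 1)) 1 with h | h
    · have : 0 ≤ smoothTransition (128 * x - 1) * x := mul_nonneg h0 (by linarith)
      linarith
    · have : smoothTransition (128 * x - 1) = 1 := le_antisymm h1 h
      rw [this]; linarith

section OscDecay
variable {U : Type*} [NormedAddCommGroup U] [NormedSpace ℝ U]

/-- The partial derivative in the last variables. -/
def pder (v : ℝ × ℝ) {G : Type*} [NormedAddCommGroup G] [NormedSpace ℝ G] (a : U × ℝ × ℝ → G)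
    (z : U × ℝ × ℝ) : G := fderiv ℝ a z (0, v)

theorem pder_contDiff {G : Type*} [NormedAddCommGroup G] [NormedSpace ℝ G] (v : ℝ × ℝ)
    {a : U × ℝ × ℝ → G} (ha : ContDiff ℝ (⊤ : ℕ∞) a) : ContDiff ℝ (⊤ : ℕ∞) (pder v a) := by
  unfold pder
  exact (ha.fderiv_right (m := (⊤ : ℕ∞)) (by simp)).clm_apply contDiff_const

theorem pder_eq_fderiv {G : Type*} [NormedAddCommGroup G] [NormedSpace ℝ G] (v : ℝ × ℝ)
    {a : U × ℝ × ℝ → G} (ha : ContDiff ℝ (⊤ : ℕ∞) a) (u : U) (w : ℝ × ℝ) :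
    fderiv ℝ (fun w => a (u, w)) w v = pder v a (u, w) := by
  have h1 : HasFDerivAt a (fderiv ℝ a (u, w)) (u, w) :=
    (ha.differentiable (by simp) (u, w)).hasFDerivAt
  have h2 : HasFDerivAt (fun w : ℝ × ℝ => (u, w)) (ContinuousLinearMap.inr ℝ U (ℝ × ℝ)) w :=
    hasFDerivAt_prodMk_right u w
  have := (h1.comp w h2).fderiv
  simp only [Function.comp_def] at this
  rw [this]; rfl

theorem pder_eq_zero {v : ℝ × ℝ} {a : U × ℝ × ℝ → ℂ} (ha : ContDiff ℝ (⊤ : ℕ∞) a) {R : ℝ}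
    (h0 : ∀ u w, R < ‖w‖ → a (u, w) = 0) (u : U) (w : ℝ × ℝ) (hw : R < ‖w‖) :
    pder v a (u, w) = 0 := by
  rw [← pder_eq_fderiv v ha]
  have : (fun w => a (u, w)) =ᶠ[nhds w] fun _ => 0 := by
    filter_upwards [(isOpen_lt continuous_const continuous_norm).mem_nhds hw] with w' hw'
    exact h0 u w' hw'
  rw [this.fderiv_eq]; simp

/-- The pairing on the plane. -/
def dot2 (x w : ℝ × ℝ) : ℝ := x.1 * w.1 + x.2 * w.2

@[fun_prop]
theorem Continuous.dot2 {X : Type*} [TopologicalSpace X] {f g : X → ℝ × ℝ}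
    (hf : Continuous f) (hg : Continuous g) : Continuous fun x => dot2 (f x) (g x) := by
  unfold _root_.dot2; fun_prop

theorem continuous_slice {G : Type*} [TopologicalSpace G] {a : U × ℝ × ℝ → G} (ha : Continuous a)
    (u : U) : Continuous fun w => a (u, w) := ha.comp (by fun_prop)

theorem integrable_osc_slice {Φ : U × ℝ × ℝ → ℝ} {a : U × ℝ × ℝ → ℂ} (hΦ : Continuous Φ)
    (ha : Continuous a) {R : ℝ} (h0 : ∀ u w, R < ‖w‖ → a (u, w) = 0) (u : U) (s : ℝ) (x : ℝ × ℝ) :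
    Integrable fun w => ec (dot2 x w + s * Φ (u, w)) * a (u, w) := by
  refine Continuous.integrable_of_hasCompactSupport ?_ ?_
  · have h1 := continuous_slice hΦ u
    have h2 := continuous_slice ha u
    exact (continuous_ec.comp (by fun_prop)).mul h2
  · refine HasCompactSupport.intro (isCompact_closedBall (0 : ℝ × ℝ) R) fun w hw => ?_
    rw [h0 u w (by simpa using hw), mul_zero]

theorem osc_by_parts {Φ : U × ℝ × ℝ → ℝ} {a : U × ℝ × ℝ → ℂ} (hΦ : ContDiff ℝ (⊤ : ℕ∞) Φ)
    (ha : ContDiff ℝ (⊤ : ℕ∞) a) {R : ℝ} (h0 : ∀ u w, R < ‖w‖ → a (u, w) = 0) (u : U) (s : ℝ)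
    (x v : ℝ × ℝ) :
    Complex.I * (dot2 x v : ℂ) * ∫ w, ec (dot2 x w + s * Φ (u, w)) * a (u, w) =
      -((∫ w, ec (dot2 x w + s * Φ (u, w)) * pder v a (u, w)) + Complex.I * s *
        ∫ w, ec (dot2 x w + s * Φ (u, w)) * (((pder v Φ (u, w) : ℝ) : ℂ) * a (u, w))) := by
  have hΦd : ∀ w, HasFDerivAt (fun w => Φ (u, w)) (fderiv ℝ (fun w => Φ (u, w)) w) w := fun w =>
    (((hΦ.comp (contDiff_const.prodMk contDiff_id)).differentiable (by simp)) w).hasFDerivAt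
  have had : Differentiable ℝ fun w => a (u, w) :=
    (ha.comp (contDiff_const.prodMk contDiff_id)).differentiable (by simp)
  have hE : ∀ w, HasFDerivAt (fun w => ec (dot2 x w + s * Φ (u, w)))
      ((Complex.I * ec (dot2 x w + s * Φ (u, w))) • (Complex.ofRealCLM.comp
        ((x.1 • ContinuousLinearMap.fst ℝ ℝ ℝ + x.2 • ContinuousLinearMap.snd ℝ ℝ ℝ) +
          s • fderiv ℝ (fun w => Φ (u, w)) w))) w := by
    intro w
    have h1 : HasFDerivAt (fun w : ℝ × ℝ => dot2 x w)
        (x.1 • ContinuousLinearMap.fst ℝ ℝ ℝ + x.2 • ContinuousLinearMap.snd ℝ ℝ ℝ) w := by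
      unfold dot2
      exact (hasFDerivAt_fst.const_mul x.1).add (hasFDerivAt_snd.const_mul x.2)
    have h2 := h1.add ((hΦd w).const_mul s)
    have h3 : HasFDerivAt (fun w => ((dot2 x w + s * Φ (u, w) : ℝ) : ℂ)) _ w :=
      Complex.ofRealCLM.hasFDerivAt.comp w h2
    have h4 := (h3.const_mul Complex.I).cexp
    refine h4.congr_fderiv ?_
    simp only [ec]
    rw [smul_smul, mul_comm (Complex.exp _) Complex.I]
  have hEv : ∀ w, fderiv ℝ (fun w => ec (dot2 x w + s * Φ (u, w))) w v =
      Complex.I * ec (dot2 x w + s * Φ (u, w)) * ((dot2 x v : ℂ) + s * ((pder v Φ (u, w) : ℝ) : ℂ)) := by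
    intro w
    rw [(hE w).fderiv, ← pder_eq_fderiv v hΦ]
    simp [dot2]
    ring
  have hΦc := hΦ.continuous
  have hac := ha.continuous
  have hpc : Continuous fun z => ((pder v Φ z : ℝ) : ℂ) * a z :=
    (Complex.continuous_ofReal.comp (pder_contDiff v hΦ).continuous).mul hac
  have i0 := integrable_osc_slice hΦc hac h0 u s x
  have i1 := integrable_osc_slice hΦc (pder_contDiff v ha).continuous (pder_eq_zero ha h0) u s x
  have i2 := integrable_osc_slice hΦc hpc
    (fun u w hw => by rw [h0 u w hw, mul_zero]) u s x
  have e1 : ∀ w, fderiv ℝ (fun w => ec (dot2 x w + s * Φ (u, w))) w v * a (u, w) =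
      Complex.I * (dot2 x v : ℂ) * (ec (dot2 x w + s * Φ (u, w)) * a (u, w)) +
      Complex.I * s * (ec (dot2 x w + s * Φ (u, w)) * (((pder v Φ (u, w) : ℝ) : ℂ) * a (u, w))) := by
    intro w; rw [hEv]; ring
  have hp := integral_mul_fderiv_eq_neg_fderiv_mul_of_integrable (μ := (volume : Measure (ℝ × ℝ)))
    (f := fun w => ec (dot2 x w + s * Φ (u, w))) (g := fun w => a (u, w)) (v := v) (by
      simp_rw [e1]
      exact (i0.const_mul _).add (i2.const_mul _)) (by simpa only [pder_eq_fderiv v ha] using i1) i0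
    (fun w _ => (hE w).differentiableAt) (fun w _ => had w)
  simp_rw [e1, pder_eq_fderiv v ha] at hp
  rw [integral_add (i0.const_mul _) (i2.const_mul _), integral_const_mul, integral_const_mul] at hp
  rw [hp]; ring

theorem osc_decay {K : Set U} (hK : IsCompact K) {Φ : U × ℝ × ℝ → ℝ}
    (hΦ : ContDiff ℝ (⊤ : ℕ∞) Φ) (v : ℝ × ℝ) (R : ℝ) (n : ℕ) :
    ∀ {a : U × ℝ × ℝ → ℂ}, ContDiff ℝ (⊤ : ℕ∞) a → (∀ u w, R < ‖w‖ → a (u, w) = 0) →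
    ∃ C : ℝ, 0 ≤ C ∧ ∀ u ∈ K, ∀ s x,
      |dot2 x v| ^ n * ‖∫ w, ec (dot2 x w + s * Φ (u, w)) * a (u, w)‖ ≤ C * (1 + |s|) ^ n := by
  induction n with
  | zero =>
    intro a ha h0
    obtain ⟨C, hC⟩ := (hK.prod (isCompact_closedBall (0 : ℝ × ℝ) R)).exists_bound_of_continuousOn
      ha.continuous.continuousOn
    refine ⟨max C 0 * (volume (Metric.closedBall (0 : ℝ × ℝ) R)).toReal, by positivity, ?_⟩
    intro u hu s x
    rw [pow_zero, one_mul, pow_zero, mul_one]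
    rw [← setIntegral_eq_integral_of_forall_compl_eq_zero (s := Metric.closedBall (0 : ℝ × ℝ) R) (by
      intro w hw; rw [h0 u w (by simpa using hw), mul_zero])]
    refine norm_setIntegral_le_of_norm_le_const measure_closedBall_lt_top fun w hw => ?_
    rw [norm_mul, norm_ec, one_mul]
    exact (hC (u, w) ⟨hu, hw⟩).trans (le_max_left _ _)
  | succ n ih =>
    intro a ha h0
    obtain ⟨C1, hC1, h1⟩ := ih (pder_contDiff v ha) (pder_eq_zero ha h0)
    obtain ⟨C2, hC2, h2⟩ := ih (a := fun z => ((pder v Φ z : ℝ) : ℂ) * a z)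
      ((Complex.ofRealCLM.contDiff.comp (pder_contDiff v hΦ)).mul ha)
      (fun u w hw => by simp only [h0 u w hw, mul_zero])
    refine ⟨C1 + C2, by positivity, fun u hu s x => ?_⟩
    have key := congrArg norm (osc_by_parts hΦ ha h0 u s x v)
    rw [norm_mul, norm_mul, Complex.norm_I, one_mul, Complex.norm_real, Real.norm_eq_abs, norm_neg] at key
    rw [pow_succ, mul_assoc, key]
    have hs : 0 ≤ |s| := abs_nonneg s
    calc _ ≤ |dot2 x v| ^ n * (‖∫ w, ec (dot2 x w + s * Φ (u, w)) * pder v a (u, w)‖ +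
          |s| * ‖∫ w, ec (dot2 x w + s * Φ (u, w)) * (((pder v Φ (u, w) : ℝ) : ℂ) * a (u, w))‖) := by
          refine mul_le_mul_of_nonneg_left ((norm_add_le _ _).trans ?_) (by positivity)
          rw [norm_mul, norm_mul, Complex.norm_I, one_mul, Complex.norm_real, Real.norm_eq_abs]
      _ = |dot2 x v| ^ n * ‖∫ w, ec (dot2 x w + s * Φ (u, w)) * pder v a (u, w)‖ +
          |s| * (|dot2 x v| ^ n *
            ‖∫ w, ec (dot2 x w + s * Φ (u, w)) * (((pder v Φ (u, w) : ℝ) : ℂ) * a (u, w))‖) := by ring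
      _ ≤ C1 * (1 + |s|) ^ n + |s| * (C2 * (1 + |s|) ^ n) := by
          exact add_le_add (h1 u hu s x) (mul_le_mul_of_nonneg_left (h2 u hu s x) hs)
      _ ≤ _ := by
          have : 0 ≤ (1 + |s|) ^ n := by positivity
          rw [pow_succ]
          nlinarith [mul_nonneg hC1 this, mul_nonneg hC2 this, mul_nonneg (mul_nonneg hC1 this) hs]

theorem osc_L1 {K : Set U} (hK : IsCompact K) {Φ : U × ℝ × ℝ → ℝ}
    (hΦ : ContDiff ℝ (⊤ : ℕ∞) Φ) (R : ℝ) {a : U × ℝ × ℝ → ℂ} (ha : ContDiff ℝ (⊤ : ℕ∞) a)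
    (h0 : ∀ u w, R < ‖w‖ → a (u, w) = 0) :
    ∃ C : ℝ, 0 ≤ C ∧ ∀ u ∈ K, ∀ s,
      ∫⁻ x, ‖∫ w, ec (dot2 x w + s * Φ (u, w)) * a (u, w)‖ₑ ≤ ENNReal.ofReal (C * (1 + |s|) ^ 3) := by
  obtain ⟨C0, hC0, h0'⟩ := osc_decay hK hΦ 0 R 0 ha h0
  obtain ⟨C1, hC1, h1'⟩ := osc_decay hK hΦ (1, 0) R 3 ha h0
  obtain ⟨C2, hC2, h2'⟩ := osc_decay hK hΦ (0, 1) R 3 ha h0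
  have hintg : Integrable (fun x : ℝ × ℝ => (1 + ‖x‖) ^ (-(3:ℝ))) :=
    integrable_one_add_norm (by simp; norm_num)
  refine ⟨8 * (C0 + C1 + C2) * ∫ x : ℝ × ℝ, (1 + ‖x‖) ^ (-(3:ℝ)),
    mul_nonneg (by positivity) (integral_nonneg fun x => by positivity), fun u hu s => ?_⟩
  have hs : 1 ≤ (1 + |s|) ^ 3 := one_le_pow₀ (by linarith [abs_nonneg s])
  calc _ ≤ ∫⁻ x : ℝ × ℝ, ENNReal.ofReal (8 * (C0 + C1 + C2) * (1 + |s|) ^ 3 *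
        (1 + ‖x‖) ^ (-(3:ℝ))) := by
        refine lintegral_mono fun x => ?_
        rw [← ofReal_norm]
        apply ENNReal.ofReal_le_ofReal
        set I := ‖∫ w, ec (dot2 x w + s * Φ (u, w)) * a (u, w)‖
        have hI : 0 ≤ I := norm_nonneg _
        have a0 : I ≤ C0 := by simpa only [pow_zero, one_mul, mul_one] using h0' u hu s x
        have a1 := h1' u hu s x
        have a2 := h2' u hu s x
        rw [show dot2 x (1, 0) = x.1 by simp [dot2]] at a1
        rw [show dot2 x (0, 1) = x.2 by simp [dot2]] at a2
        change |x.1| ^ 3 * I ≤ _ at a1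
        change |x.2| ^ 3 * I ≤ _ at a2
        rw [Real.rpow_neg (by positivity), ← div_eq_mul_inv, le_div_iff₀ (by positivity)]
        rw [show (3:ℝ) = ((3:ℕ):ℝ) by norm_num, Real.rpow_natCast]
        have hx : (1 + ‖x‖) ^ 3 ≤ 8 * (1 + |x.1| ^ 3 + |x.2| ^ 3) := by
          have h1 := abs_nonneg x.1
          have h2 := abs_nonneg x.2
          have hb : ∀ t : ℝ, 0 ≤ t → (1 + t) ^ 3 ≤ 8 * (1 + t ^ 3) := by
            intro t ht
            nlinarith [mul_nonneg ht (sq_nonneg (t - 1)), sq_nonneg (t - 1), sq_nonneg (t + 1), pow_nonneg ht 3]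
          rw [Prod.norm_def, Real.norm_eq_abs, Real.norm_eq_abs]
          rcases max_choice |x.1| |x.2| with h | h <;> rw [h]
          · have := hb _ h1
            have := pow_nonneg h2 3
            linarith
          · have := hb _ h2
            have := pow_nonneg h1 3
            linarith
        calc I * (1 + ‖x‖) ^ 3 ≤ I * (8 * (1 + |x.1| ^ 3 + |x.2| ^ 3)) := by gcongr
          _ = 8 * (I + |x.1| ^ 3 * I + |x.2| ^ 3 * I) := by ring
          _ ≤ 8 * (C0 * (1 + |s|) ^ 3 + C1 * (1 + |s|) ^ 3 + C2 * (1 + |s|) ^ 3) := by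
              have : C0 ≤ C0 * (1 + |s|) ^ 3 := le_mul_of_one_le_right hC0 hs
              gcongr
              linarith
          _ = _ := by ring
    _ = _ := by
        rw [← ofReal_integral_eq_lintegral_ofReal (hintg.const_mul _)
          (Filter.Eventually.of_forall fun x => by positivity), integral_const_mul]
        congr 1; ring

end OscDecay

/-- An affine map of the plane. -/
def aff (a b c d e f : ℝ) (w : ℝ × ℝ) : ℝ × ℝ := (a * w.1 + b * w.2 + e, c * w.1 + d * w.2 + f)

@[fun_prop]
theorem continuous_aff (a b c d e f : ℝ) : Continuous (aff a b c d e f) := by unfold aff; fun_prop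

theorem map_aff {a b c d : ℝ} (h : a * d - b * c ≠ 0) (e f : ℝ) :
    Measure.map (aff a b c d e f) volume =
      ENNReal.ofReal |(a * d - b * c)⁻¹| • (volume : Measure (ℝ × ℝ)) := by
  let T : (ℝ × ℝ) →ₗ[ℝ] (ℝ × ℝ) :=
    Matrix.toLin (Module.Basis.finTwoProd ℝ) (Module.Basis.finTwoProd ℝ) !![a, b; c, d]
  have hT : ∀ w, T w = (a * w.1 + b * w.2, c * w.1 + d * w.2) := by
    intro w
    simp only [T, Matrix.toLin_finTwoProd_apply]
  have hdet : LinearMap.det T = a * d - b * c := by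
    simp only [T, LinearMap.det_toLin, Matrix.det_fin_two_of]
  have h1 := Measure.map_linearMap_addHaar_eq_smul_addHaar (volume : Measure (ℝ × ℝ))
    (f := T) (by rw [hdet]; exact h)
  have hTc : Continuous T := T.continuous_of_finiteDimensional
  have h2 : aff a b c d e f = (fun w => w + (e, f)) ∘ T := by
    funext w; simp [aff, hT]
  rw [h2, ← Measure.map_map (by fun_prop) hTc.measurable, h1, Measure.map_smul, hdet,
    map_add_right_eq_self]

theorem integral_comp_aff {a b c d : ℝ} (h : a * d - b * c ≠ 0) (e f : ℝ) {F : ℝ × ℝ → ℂ}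
    (hF : AEStronglyMeasurable F volume) :
    ∫ w, F (aff a b c d e f w) = (|a * d - b * c|⁻¹ : ℝ) • ∫ w, F w := by
  have := integral_map (μ := volume) (continuous_aff a b c d e f).aemeasurable (f := F) (by
    rw [map_aff h]; exact hF.smul_measure _)
  rw [← this, map_aff h, integral_smul_measure, abs_inv, ENNReal.toReal_ofReal (by positivity)]

theorem lintegral_comp_aff {a b c d : ℝ} (h : a * d - b * c ≠ 0) (e f : ℝ) {F : ℝ × ℝ → ℝ≥0∞}
    (hF : Measurable F) :
    ∫⁻ w, F (aff a b c d e f w) = ENNReal.ofReal (|a * d - b * c|⁻¹) * ∫⁻ w, F w := by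
  rw [← lintegral_map hF (continuous_aff a b c d e f).measurable, map_aff h, lintegral_smul_measure,
    abs_inv, smul_eq_mul]

end

section

/-- Amplitudes supported in the sector `|ξ₂| ≤ 2ξ₁`, `1/8 ≤ ξ₁ ≤ 8`. -/
structure IsSectorAmp (A : ℝ × ℝ → ℂ) : Prop where
  smooth : ContDiff ℝ (⊤ : ℕ∞) A
  supp : ∀ ξ, A ξ ≠ 0 → 1 / 8 ≤ ξ.1 ∧ ξ.1 ≤ 8 ∧ |ξ.2| ≤ 2 * ξ.1

/-- The amplitude of a plank. -/
def plankAmp (A : ℝ × ℝ → ℂ) (lam v m : ℝ) (L : ℕ) (ξ : ℝ × ℝ) : ℂ :=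
  (hat (√lam * (ξ.2 / ξ.1 - v)) : ℂ) * (A (ξ.1 / lam, ξ.2 / lam) * (hat (L ^ 2 * (ξ.1 / lam) - m) : ℂ))

/-- The kernel attached to a frequency amplitude. -/
def coneKer (b : ℝ × ℝ → ℂ) (s : ℝ) (x : ℝ × ℝ) : ℂ := ∫ ξ, ec (dot2 x ξ + s * enorm2 ξ) * b ξ

theorem measurable_integral_osc {Φ : ℝ × ℝ → ℝ} (hΦ : Measurable Φ) {b : ℝ × ℝ → ℂ}
    (hb : Measurable b) : Measurable fun x => ∫ ξ, ec (dot2 x ξ + Φ ξ) * b ξ := by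
  have : StronglyMeasurable fun z : (ℝ × ℝ) × (ℝ × ℝ) => ec (dot2 z.1 z.2 + Φ z.2) * b z.2 := by
    apply Measurable.stronglyMeasurable
    have h1 : Measurable fun z : (ℝ × ℝ) × (ℝ × ℝ) => dot2 z.1 z.2 := by
      unfold dot2; fun_prop
    exact (measurable_ec.comp (h1.add (hΦ.comp measurable_snd))).mul (hb.comp measurable_snd)
  exact this.integral_prod_right.measurable

theorem norm_sup3_mul_ft2_le {b g : ℝ × ℝ → ℂ} (hb : Measurable b) (hbi : Integrable b)
    (hg : Integrable g) (hg1 : ∀ x, ‖g x‖ ≤ 1) (x : ℝ × ℝ × ℝ) :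
    ‖sup3 coneMap volume (fun ξ => b ξ * ft2 g ξ) x‖ₑ ≤ ∫⁻ z, ‖coneKer b x.2.2 z‖ₑ := by
  have hsw : sup3 coneMap volume (fun ξ => b ξ * ft2 g ξ) x =
      ∫ z, coneKer b x.2.2 ((x.1, x.2.1) - z) * g z := by
    calc _ = ∫ ξ, ∫ z, ec (dot2 ((x.1, x.2.1) - z) ξ + x.2.2 * enorm2 ξ) * b ξ * g z := by
          rw [sup3, osc]
          refine integral_congr_ae (Filter.Eventually.of_forall fun ξ => ?_)
          simp only [ft2]
          rw [← integral_const_mul, ← integral_mul_const]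
          refine integral_congr_ae (Filter.Eventually.of_forall fun z => ?_)
          simp only
          have : ec (dot2 ((x.1, x.2.1) - z) ξ + x.2.2 * enorm2 ξ) = ec (dot3 x (coneMap ξ)) *
              Complex.exp (-Complex.I * ((z.1 * ξ.1 + z.2 * ξ.2 : ℝ) : ℂ)) := by
            simp only [ec, dot3, coneMap, dot2, Prod.fst_sub, Prod.snd_sub]
            rw [← Complex.exp_add]
            congr 1; push_cast; ring
          rw [this]; ring
      _ = ∫ z, ∫ ξ, ec (dot2 ((x.1, x.2.1) - z) ξ + x.2.2 * enorm2 ξ) * b ξ * g z := by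
          rw [integral_integral_swap]
          have hI : Integrable (fun p : (ℝ × ℝ) × (ℝ × ℝ) => b p.1 * g p.2)
              ((volume : Measure (ℝ × ℝ)).prod (volume : Measure (ℝ × ℝ))) := hbi.mul_prod hg
          have hc : Continuous fun p : (ℝ × ℝ) × (ℝ × ℝ) =>
              ec (dot2 ((x.1, x.2.1) - p.2) p.1 + x.2.2 * enorm2 p.1) := by
            have := continuous_enorm2
            exact continuous_ec.comp (by fun_prop)
          refine (hI.bdd_mul (c := 1) hc.aestronglyMeasurable (Filter.Eventually.of_forall fun p => by
            rw [norm_ec])).congr (Filter.Eventually.of_forall fun p => ?_)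
          simp only [Function.uncurry]; ring
      _ = _ := by
          refine integral_congr_ae (Filter.Eventually.of_forall fun z => ?_)
          simp only [coneKer]
          rw [integral_mul_const]
  have hm : Measurable fun z => ‖coneKer b x.2.2 z‖ₑ :=
    (measurable_integral_osc (measurable_const.mul continuous_enorm2.measurable) hb).enorm
  rw [hsw]
  calc _ ≤ ∫⁻ z, ‖coneKer b x.2.2 ((x.1, x.2.1) - z)‖ₑ := by
        refine (enorm_integral_le_lintegral_enorm _).trans (lintegral_mono fun z => ?_)
        rw [enorm_mul]
        have : ‖g z‖ₑ ≤ 1 := by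
          rw [← ofReal_norm, ← ENNReal.ofReal_one]; exact ENNReal.ofReal_le_ofReal (hg1 z)
        calc _ ≤ ‖coneKer b x.2.2 ((x.1, x.2.1) - z)‖ₑ * 1 := by gcongr
          _ = _ := mul_one _
    _ = _ := lintegral_sub_left_eq_self (fun z => ‖coneKer b x.2.2 z‖ₑ) _

section Model

/-- The rescaled plank coordinates. -/
def modP (z : (ℝ × ℝ × ℝ × ℝ) × ℝ × ℝ) : ℝ := z.1.2.2.1 + z.1.2.2.2 * z.2.1

def modQ (z : (ℝ × ℝ × ℝ × ℝ) × ℝ × ℝ) : ℝ := z.1.1 * modP z + z.1.2.1 * z.2.2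

def modS (z : (ℝ × ℝ × ℝ × ℝ) × ℝ × ℝ) : ℝ := √(1 + z.1.1 ^ 2)

def modB (z : (ℝ × ℝ × ℝ × ℝ) × ℝ × ℝ) : ℝ :=
  modS z * modP z + z.1.1 / modS z * z.1.2.1 * z.2.2

/-- The phase in rescaled plank coordinates. -/
def modPhase (z : (ℝ × ℝ × ℝ × ℝ) × ℝ × ℝ) : ℝ :=
  z.2.2 ^ 2 / (modS z ^ 2 * posPart' (√(posPart' (modP z ^ 2 + modQ z ^ 2)) + modB z))

/-- The amplitude in rescaled plank coordinates. -/
def modAmp (A : ℝ × ℝ → ℂ) (z : (ℝ × ℝ × ℝ × ℝ) × ℝ × ℝ) : ℂ :=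
  (hat (z.2.2 / posPart' (modP z)) : ℂ) * (A (modP z, modQ z) * (hat z.2.1 : ℂ))

theorem modS_pos (z) : 0 < modS z := by unfold modS; positivity

theorem modP_contDiff : ContDiff ℝ (⊤ : ℕ∞) modP := by unfold modP; fun_prop

theorem modQ_contDiff : ContDiff ℝ (⊤ : ℕ∞) modQ := by
  have := modP_contDiff
  unfold modQ; fun_prop

theorem modS_contDiff : ContDiff ℝ (⊤ : ℕ∞) modS := by
  unfold modS
  refine ContDiff.sqrt (by fun_prop) fun z => ?_
  positivity

theorem modB_contDiff : ContDiff ℝ (⊤ : ℕ∞) modB := by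
  unfold modB
  have h1 : ContDiff ℝ (⊤ : ℕ∞) fun z : (ℝ × ℝ × ℝ × ℝ) × ℝ × ℝ => z.1.1 / modS z :=
    ContDiff.div (by fun_prop) modS_contDiff fun z => (modS_pos z).ne'
  have := modP_contDiff
  have := modS_contDiff
  fun_prop

theorem modPhase_contDiff : ContDiff ℝ (⊤ : ℕ∞) modPhase := by
  unfold modPhase
  have hP := modP_contDiff
  have hQ := modQ_contDiff
  have hS := modS_contDiff
  have h1 : ContDiff ℝ (⊤ : ℕ∞) fun z => √(posPart' (modP z ^ 2 + modQ z ^ 2)) :=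
    (posPart'_contDiff.comp ((hP.pow 2).add (hQ.pow 2))).sqrt fun z => (posPart'_pos _).ne'
  refine ContDiff.div (by fun_prop) ((hS.pow 2).mul (posPart'_contDiff.comp (h1.add modB_contDiff)))
    fun z => ?_
  exact (mul_pos (pow_pos (modS_pos z) 2) (posPart'_pos _)).ne'

variable {A : ℝ × ℝ → ℂ}

theorem modAmp_contDiff (hA : IsSectorAmp A) : ContDiff ℝ (⊤ : ℕ∞) (modAmp A) := by
  unfold modAmp
  have h1 : ContDiff ℝ (⊤ : ℕ∞) fun z => hat (z.2.2 / posPart' (modP z)) :=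
    hat_contDiff.comp (ContDiff.div (by fun_prop) (posPart'_contDiff.comp modP_contDiff)
      fun z => (posPart'_pos _).ne')
  have h2 : ContDiff ℝ (⊤ : ℕ∞) fun z : (ℝ × ℝ × ℝ × ℝ) × ℝ × ℝ => hat z.2.1 :=
    hat_contDiff.comp (by fun_prop)
  exact (Complex.ofRealCLM.contDiff.comp h1).mul
    ((hA.smooth.comp (modP_contDiff.prodMk modQ_contDiff)).mul (Complex.ofRealCLM.contDiff.comp h2))

theorem modAmp_supp (hA : IsSectorAmp A) {z : (ℝ × ℝ × ℝ × ℝ) × ℝ × ℝ} (h : modAmp A z ≠ 0) :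
    1 / 8 ≤ modP z ∧ modP z ≤ 8 ∧ |modQ z| ≤ 2 * modP z ∧ |z.2.1| < 1 ∧ |z.2.2| < modP z := by
  unfold modAmp at h
  have h1 : hat (z.2.2 / posPart' (modP z)) ≠ 0 := by
    intro h'; apply h; rw [h']; simp
  have h2 : A (modP z, modQ z) ≠ 0 := by
    intro h'; apply h; rw [h']; simp
  have h3 : hat z.2.1 ≠ 0 := by
    intro h'; apply h; rw [h']; simp
  obtain ⟨a1, a2, a3⟩ := hA.supp _ h2
  simp only at a1 a2 a3
  refine ⟨a1, a2, a3, abs_lt_one_of_hat_ne_zero h3, ?_⟩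
  have := abs_lt_one_of_hat_ne_zero h1
  rw [posPart'_eq (by linarith), abs_div, abs_of_pos (by linarith : 0 < modP z),
    div_lt_one (by linarith)] at this
  exact this

theorem modAmp_eq_zero (hA : IsSectorAmp A) (u : ℝ × ℝ × ℝ × ℝ) (w : ℝ × ℝ) (hw : 8 < ‖w‖) :
    modAmp A (u, w) = 0 := by
  by_contra h
  obtain ⟨_, h2, _, h4, h5⟩ := modAmp_supp hA h
  rw [Prod.norm_def, Real.norm_eq_abs, Real.norm_eq_abs] at hw
  simp only at h4 h5
  rcases lt_max_iff.1 hw with h | h <;> linarith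

theorem modPhase_spec (hA : IsSectorAmp A) {z : (ℝ × ℝ × ℝ × ℝ) × ℝ × ℝ} (h : modAmp A z ≠ 0)
    {lam : ℝ} (hlam : lam * z.1.2.1 ^ 2 = 1) (hε : |z.1.2.1| ≤ 1) :
    lam * √(modP z ^ 2 + modQ z ^ 2) = lam * modB z + modPhase z := by
  obtain ⟨h1, h2, h3, h4, h5⟩ := modAmp_supp hA h
  have hS := modS_pos z
  have hS2 : modS z ^ 2 = 1 + z.1.1 ^ 2 := Real.sq_sqrt (by positivity)
  set S := modS z
  set E := √(modP z ^ 2 + modQ z ^ 2) with hE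
  have hE2 : E ^ 2 = modP z ^ 2 + modQ z ^ 2 := Real.sq_sqrt (by positivity)
  have hE0 : 0 ≤ E := Real.sqrt_nonneg _
  have hE8 : 1 / 8 ≤ E := by
    by_contra hlt
    nlinarith [sq_nonneg (modQ z)]
  have hBS : modB z * S = (1 + z.1.1 ^ 2) * modP z + z.1.1 * (z.1.2.1 * z.2.2) := by
    rw [← hS2]
    rw [show modB z = S * modP z + z.1.1 / S * z.1.2.1 * z.2.2 from rfl]
    field_simp
  have hζ : |z.1.2.1 * z.2.2| ≤ modP z := by
    rw [abs_mul]
    calc _ ≤ 1 * |z.2.2| := by gcongr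
      _ ≤ _ := by linarith
  have hB0 : 0 ≤ modB z := by
    refine nonneg_of_mul_nonneg_left (b := S) ?_ hS
    rw [hBS]
    have b1 := neg_abs_le (z.1.1 * (z.1.2.1 * z.2.2))
    rw [abs_mul] at b1
    have b2 : |z.1.1| * |z.1.2.1 * z.2.2| ≤ |z.1.1| * modP z := by gcongr
    rw [← sq_abs z.1.1]
    nlinarith [sq_nonneg (|z.1.1| - 1), sq_nonneg |z.1.1|]
  have hτ : posPart' (modP z ^ 2 + modQ z ^ 2) = modP z ^ 2 + modQ z ^ 2 :=
    posPart'_eq (by nlinarith [sq_nonneg (modQ z)])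
  unfold modPhase
  rw [hτ, ← hE, posPart'_eq (by linarith)]
  have hEB : 0 < E + modB z := by linarith
  have hdiff : (E - modB z) * (E + modB z) * S ^ 2 = (z.1.2.1 * z.2.2) ^ 2 := by
    have : (E - modB z) * (E + modB z) * S ^ 2 = E ^ 2 * S ^ 2 - (modB z * S) ^ 2 := by ring
    rw [this, hBS, hE2, hS2]
    unfold modQ; ring
  have : lam * (E - modB z) = z.2.2 ^ 2 / (S ^ 2 * (E + modB z)) := by
    rw [eq_div_iff (by positivity)]
    calc _ = lam * ((E - modB z) * (E + modB z) * S ^ 2) := by ring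
      _ = (lam * z.1.2.1 ^ 2) * z.2.2 ^ 2 := by rw [hdiff]; ring
      _ = _ := by rw [hlam, one_mul]
  linarith

end Model

end

section

variable {A : ℝ × ℝ → ℂ}

theorem IsSectorAmp.exists_bound (hA : IsSectorAmp A) : ∃ C : ℝ, 0 ≤ C ∧ ∀ ξ, ‖A ξ‖ ≤ C := by
  obtain ⟨C, hC⟩ := ((isCompact_closedBall (0 : ℝ × ℝ) 16)).exists_bound_of_continuousOn
    hA.smooth.continuous.continuousOn
  refine ⟨max C 0, le_max_right _ _, fun ξ => ?_⟩
  by_cases h : A ξ = 0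
  · rw [h, norm_zero]; exact le_max_right _ _
  · refine (hC ξ ?_).trans (le_max_left _ _)
    obtain ⟨h1, h2, h3⟩ := hA.supp ξ h
    rw [mem_closedBall_zero_iff, Prod.norm_def, Real.norm_eq_abs, Real.norm_eq_abs, max_le_iff,
      abs_of_pos (by linarith : 0 < ξ.1)]
    constructor <;> linarith

theorem measurable_plankAmp (hA : IsSectorAmp A) (lam v m : ℝ) (L : ℕ) :
    Measurable (plankAmp A lam v m L) := by
  unfold plankAmp
  have h1 : Measurable fun ξ : ℝ × ℝ => A (ξ.1 / lam, ξ.2 / lam) :=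
    hA.smooth.continuous.measurable.comp (by fun_prop)
  have h2 : Measurable fun ξ : ℝ × ℝ => hat (√lam * (ξ.2 / ξ.1 - v)) :=
    measurable_hat.comp (by fun_prop)
  have h3 : Measurable fun ξ : ℝ × ℝ => hat (L ^ 2 * (ξ.1 / lam) - m) :=
    measurable_hat.comp (by fun_prop)
  exact (Complex.measurable_ofReal.comp h2).mul (h1.mul (Complex.measurable_ofReal.comp h3))

theorem plankAmp_supp (hA : IsSectorAmp A) {lam : ℝ} (hlam : 1 ≤ lam) {v m : ℝ} {L : ℕ} {ξ : ℝ × ℝ}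
    (h : plankAmp A lam v m L ξ ≠ 0) : lam / 8 ≤ ξ.1 ∧ ξ.1 ≤ 8 * lam ∧ |ξ.2| ≤ 2 * ξ.1 ∧
      √lam * |ξ.2 / ξ.1 - v| < 1 ∧ |L ^ 2 * (ξ.1 / lam) - m| < 1 := by
  unfold plankAmp at h
  have h1 : hat (√lam * (ξ.2 / ξ.1 - v)) ≠ 0 := by
    intro h'; apply h; rw [h']; simp
  have h2 : A (ξ.1 / lam, ξ.2 / lam) ≠ 0 := by
    intro h'; apply h; rw [h']; simp
  have h3 : hat (L ^ 2 * (ξ.1 / lam) - m) ≠ 0 := by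
    intro h'; apply h; rw [h']; simp
  have hl : 0 < lam := by linarith
  obtain ⟨a1, a2, a3⟩ := hA.supp _ h2
  simp only at a1 a2 a3
  rw [abs_div, abs_of_pos hl, div_le_iff₀ hl] at a3
  rw [le_div_iff₀ hl] at a1
  rw [div_le_iff₀ hl] at a2
  refine ⟨by linarith, by linarith, ?_, ?_, abs_lt_one_of_hat_ne_zero h3⟩
  · rw [mul_assoc, div_mul_cancel₀ _ hl.ne'] at a3; exact a3
  · have := abs_lt_one_of_hat_ne_zero h1
    rwa [abs_mul, abs_of_nonneg (Real.sqrt_nonneg _)] at this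

theorem norm_hat_le (x : ℝ) : ‖(hat x : ℂ)‖ ≤ 1 := by
  rw [Complex.norm_real, Real.norm_eq_abs, abs_of_nonneg (hat_nonneg x)]; exact hat_le_one x

theorem integrable_plankAmp (hA : IsSectorAmp A) {lam : ℝ} (hlam : 1 ≤ lam) (v m : ℝ) (L : ℕ) :
    Integrable (plankAmp A lam v m L) := by
  obtain ⟨C, hC0, hC⟩ := hA.exists_bound
  refine Integrable.mono' (g := (Metric.closedBall (0 : ℝ × ℝ) (16 * lam)).indicator fun _ => C)
    ((integrable_indicator_iff measurableSet_closedBall).2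
      (integrableOn_const measure_closedBall_lt_top.ne))
    (measurable_plankAmp hA lam v m L).aestronglyMeasurable
    (Filter.Eventually.of_forall fun ξ => ?_)
  by_cases h : plankAmp A lam v m L ξ = 0
  · rw [h, norm_zero]; exact indicator_nonneg (fun _ _ => hC0) _
  · obtain ⟨h1, h2, h3, -, -⟩ := plankAmp_supp hA hlam h
    rw [indicator_of_mem]
    · unfold plankAmp
      rw [norm_mul, norm_mul]
      calc _ ≤ 1 * (C * 1) := by
            gcongr
            · exact norm_hat_le _
            · exact hC _
            · exact norm_hat_le _
        _ = C := by ring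
    · rw [mem_closedBall_zero_iff, Prod.norm_def, Real.norm_eq_abs, Real.norm_eq_abs, max_le_iff,
        abs_of_pos (by linarith : 0 < ξ.1)]
      constructor <;> linarith

theorem plankAmp_aff (hA : IsSectorAmp A) {lam : ℝ} (hlam : 1 ≤ lam) {v m : ℝ} {L : ℕ} (hL : 1 ≤ L)
    (w : ℝ × ℝ) :
    plankAmp A lam v m L (aff (lam * (L ^ 2 : ℝ)⁻¹) 0 (lam * v * (L ^ 2 : ℝ)⁻¹) (lam * (√lam)⁻¹)
      (lam * (m / L ^ 2)) (lam * v * (m / L ^ 2)) w) =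
      modAmp A ((v, (√lam)⁻¹, m / L ^ 2, (L ^ 2 : ℝ)⁻¹), w) := by
  have hl : 0 < lam := by linarith
  have hs : 0 < √lam := Real.sqrt_pos.2 hl
  have hL0 : (0:ℝ) < L := by exact_mod_cast hL
  set z : (ℝ × ℝ × ℝ × ℝ) × ℝ × ℝ := ((v, (√lam)⁻¹, m / L ^ 2, (L ^ 2 : ℝ)⁻¹), w) with hz
  have e1 : (aff (lam * (L ^ 2 : ℝ)⁻¹) 0 (lam * v * (L ^ 2 : ℝ)⁻¹) (lam * (√lam)⁻¹)
      (lam * (m / L ^ 2)) (lam * v * (m / L ^ 2)) w).1 = lam * modP z := by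
    simp only [aff, modP, hz]; ring
  have e2 : (aff (lam * (L ^ 2 : ℝ)⁻¹) 0 (lam * v * (L ^ 2 : ℝ)⁻¹) (lam * (√lam)⁻¹)
      (lam * (m / L ^ 2)) (lam * v * (m / L ^ 2)) w).2 = lam * modQ z := by
    simp only [aff, modQ, modP, hz]; ring
  unfold plankAmp modAmp
  rw [e1, e2, mul_div_cancel_left₀ _ hl.ne', mul_div_cancel_left₀ _ hl.ne']
  by_cases h : A (modP z, modQ z) = 0
  · rw [h]; simp
  · obtain ⟨a1, -, -⟩ := hA.supp _ h
    simp only at a1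
    rw [posPart'_eq (by linarith)]
    have hP : modP z ≠ 0 := by linarith
    have e3 : √lam * (lam * modQ z / (lam * modP z) - v) = z.2.2 / modP z := by
      rw [mul_div_mul_left _ _ hl.ne']
      have : modQ z = v * modP z + (√lam)⁻¹ * z.2.2 := rfl
      rw [this]
      field_simp
      ring
    have e4 : L ^ 2 * modP z - m = z.2.1 := by
      have : modP z = m / L ^ 2 + (L ^ 2 : ℝ)⁻¹ * z.2.1 := rfl
      rw [this]
      field_simp
      ring
    rw [e3, e4]

theorem exists_coneKer_bound (hA : IsSectorAmp A) : ∃ P : ℝ, 0 ≤ P ∧ ∀ {lam : ℝ}, 1 ≤ lam →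
    ∀ (v m : ℝ) {L : ℕ}, 1 ≤ L → ∀ s,
      ∫⁻ x, ‖coneKer (plankAmp A lam v m L) s x‖ₑ ≤ ENNReal.ofReal (P * (1 + |s|) ^ 3) := by
  obtain ⟨P, hP, h⟩ := osc_L1 (isCompact_closedBall (0 : ℝ × ℝ × ℝ × ℝ) 10) modPhase_contDiff 8
    (modAmp_contDiff hA) (modAmp_eq_zero hA)
  refine ⟨P, hP, fun {lam} hlam v m {L} hL s => ?_⟩
  have hl : 0 < lam := by linarith
  have hs : 1 ≤ √lam := Real.one_le_sqrt.2 hlam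
  have hs0 : 0 < √lam := by linarith
  have hL1 : (1:ℝ) ≤ L := by exact_mod_cast hL
  have hL0 : (0:ℝ) < L := by linarith
  by_cases hb0 : ∀ ξ, plankAmp A lam v m L ξ = 0
  · simp [coneKer, hb0]
  push Not at hb0
  obtain ⟨ξ, hξ⟩ := hb0
  obtain ⟨h1, h2, h3, h4, h5⟩ := plankAmp_supp hA hlam hξ
  set c := m / (L:ℝ) ^ 2 with hc
  set δ := ((L:ℝ) ^ 2)⁻¹ with hδ
  set ε := (√lam)⁻¹ with hε
  have hδ0 : 0 < δ := by positivity
  have hε0 : 0 < ε := by positivity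
  have hδ1 : δ ≤ 1 := inv_le_one_of_one_le₀ (one_le_pow₀ hL1)
  have hε1 : ε ≤ 1 := inv_le_one_of_one_le₀ hs
  have hv : |v| ≤ 10 := by
    have hx : 0 < ξ.1 := by linarith
    have a1 : |ξ.2 / ξ.1| ≤ 2 := by rw [abs_div, abs_of_pos hx, div_le_iff₀ hx]; exact h3
    have a2 : |ξ.2 / ξ.1 - v| ≤ 1 := by nlinarith [abs_nonneg (ξ.2 / ξ.1 - v)]
    rw [abs_le] at *
    constructor <;> linarith
  have hcb : |c| ≤ 10 := by
    have a1 : ξ.1 / lam - c = δ * (L ^ 2 * (ξ.1 / lam) - m) := by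
      rw [hc, hδ]; field_simp
    have a2 : |ξ.1 / lam - c| ≤ 1 := by
      rw [a1, abs_mul, abs_of_pos hδ0]
      nlinarith [abs_nonneg (L ^ 2 * (ξ.1 / lam) - m)]
    have a3 : 0 ≤ ξ.1 / lam := div_nonneg (by linarith) hl.le
    have a4 : ξ.1 / lam ≤ 8 := by rw [div_le_iff₀ hl]; exact h2
    rw [abs_le] at *
    constructor <;> linarith
  have hu : ((v, ε, c, δ) : ℝ × ℝ × ℝ × ℝ) ∈ Metric.closedBall (0 : ℝ × ℝ × ℝ × ℝ) 10 := by
    rw [mem_closedBall_zero_iff]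
    simp only [Prod.norm_def, Real.norm_eq_abs, max_le_iff]
    rw [abs_of_pos hε0, abs_of_pos hδ0]
    exact ⟨hv, by linarith, hcb, by linarith⟩
  set u : ℝ × ℝ × ℝ × ℝ := (v, ε, c, δ) with hu'
  have hS := Real.sqrt_pos.2 (show 0 < 1 + v ^ 2 by positivity)
  set S := √(1 + v ^ 2) with hSdef
  have hdet : (lam * δ) * (lam * ε) - 0 * (lam * v * δ) ≠ 0 := by
    have : 0 < (lam * δ) * (lam * ε) := by positivity
    rw [zero_mul, sub_zero]; exact this.ne'
  have hdet2 : (lam * δ) * (lam * ε) - (lam * δ * v) * 0 ≠ 0 := by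
    have : 0 < (lam * δ) * (lam * ε) := by positivity
    rw [mul_zero, sub_zero]; exact this.ne'
  set T := aff (lam * δ) 0 (lam * v * δ) (lam * ε) (lam * c) (lam * v * c) with hT
  set T' := aff (lam * δ) (lam * δ * v) 0 (lam * ε) (s * lam * S * δ) (s * lam * (v / S) * ε) with hT'
  set G : ℝ × ℝ → ℂ := fun x => ∫ w, ec (dot2 x w + s * modPhase (u, w)) * modAmp A (u, w) with hG
  have hGm : Measurable G := measurable_integral_osc
    ((continuous_slice modPhase_contDiff.continuous u).measurable.const_mul s)
    (continuous_slice (modAmp_contDiff hA).continuous u).measurable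
  have key : ∀ x, ‖coneKer (plankAmp A lam v m L) s x‖ₑ =
      ENNReal.ofReal ((lam * δ) * (lam * ε)) * ‖G (T' x)‖ₑ := by
    intro x
    have hm : AEStronglyMeasurable (fun ξ => ec (dot2 x ξ + s * enorm2 ξ) * plankAmp A lam v m L ξ)
        volume := by
      have h1 : Continuous fun ξ => ec (dot2 x ξ + s * enorm2 ξ) := by
        have := continuous_enorm2
        exact continuous_ec.comp (by fun_prop)
      exact (h1.measurable.mul (measurable_plankAmp hA lam v m L)).aestronglyMeasurable
    have e1 := integral_comp_aff hdet (lam * c) (lam * v * c) hm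
    have e2 : ∀ w, ec (dot2 x (T w) + s * enorm2 (T w)) * plankAmp A lam v m L (T w) =
        ec (lam * c * x.1 + lam * v * c * x.2 + s * lam * S * c) *
          (ec (dot2 (T' x) w + s * modPhase (u, w)) * modAmp A (u, w)) := by
      intro w
      rw [hT, plankAmp_aff hA hlam hL]
      by_cases h0 : modAmp A (u, w) = 0
      · rw [h0]; simp
      · rw [← mul_assoc, ← ec_add]
        have hsp := modPhase_spec hA h0 (lam := lam) (by
          simp only [hu', hε]
          rw [inv_pow, Real.sq_sqrt hl.le, mul_inv_cancel₀ hl.ne']) (by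
          simp only [hu']; rw [abs_of_pos hε0]; exact hε1)
        have en : enorm2 (aff (lam * δ) 0 (lam * v * δ) (lam * ε) (lam * c) (lam * v * c) w) =
            lam * √(modP (u, w) ^ 2 + modQ (u, w) ^ 2) := by
          unfold enorm2
          conv_rhs => rw [← Real.sqrt_sq hl.le]
          rw [← Real.sqrt_mul (by positivity)]
          congr 1
          simp only [aff, modP, modQ, hu']
          ring
        rw [en, hsp]
        congr 2
        rw [hT']
        have : modB (u, w) = S * (c + δ * w.1) + v / S * ε * w.2 := rfl
        rw [this]
        simp only [aff, dot2]
        ring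
    rw [abs_of_pos (by rw [zero_mul, sub_zero]; positivity)] at e1
    have e3 : coneKer (plankAmp A lam v m L) s x = (((lam * δ) * (lam * ε) : ℝ) : ℂ) *
        (ec (lam * c * x.1 + lam * v * c * x.2 + s * lam * S * c) * G (T' x)) := by
      rw [hG]
      simp only
      rw [← integral_const_mul]
      simp_rw [← e2]
      rw [e1, coneKer, zero_mul, sub_zero, Complex.real_smul, ← mul_assoc, ← Complex.ofReal_mul,
        mul_inv_cancel₀ (by positivity), Complex.ofReal_one, one_mul]
    rw [e3, enorm_mul, enorm_mul, enorm_ec, one_mul, ← ofReal_norm (((lam * δ) * (lam * ε) : ℝ) : ℂ),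
      Complex.norm_real, Real.norm_eq_abs, abs_of_pos (by positivity)]
  simp_rw [key]
  have hGT : Measurable fun x => ‖G (T' x)‖ₑ := (hGm.comp (continuous_aff _ _ _ _ _ _).measurable).enorm
  rw [lintegral_const_mul _ hGT, lintegral_comp_aff hdet2 _ _ hGm.enorm, ← mul_assoc,
    ← ENNReal.ofReal_mul (by positivity), mul_zero, sub_zero, abs_of_pos (by positivity),
    mul_inv_cancel₀ (by positivity), ENNReal.ofReal_one, one_mul]
  exact h u hu s

theorem exists_plank_bound (hA : IsSectorAmp A) : ∃ P : ℝ, 0 ≤ P ∧ ∀ {lam : ℝ}, 1 ≤ lam →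
    ∀ (v m : ℝ) {L : ℕ}, 1 ≤ L → ∀ {g : ℝ × ℝ → ℂ}, Integrable g → (∀ x, ‖g x‖ ≤ 1) → ∀ x,
      ‖sup3 coneMap volume (fun ξ => plankAmp A lam v m L ξ * ft2 g ξ) x‖ ≤
        P * (1 + |x.2.2|) ^ 3 := by
  obtain ⟨P, hP, h⟩ := exists_coneKer_bound hA
  refine ⟨P, hP, fun {lam} hlam v m {L} hL {g} hg hg1 x => ?_⟩
  have := (norm_sup3_mul_ft2_le (measurable_plankAmp hA lam v m L) (integrable_plankAmp hA hlam v m L)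
    hg hg1 x).trans (h hlam v m hL x.2.2)
  rw [← ofReal_norm] at this
  exact (ENNReal.ofReal_le_ofReal_iff (by positivity)).1 this

end

section

theorem measurable_ft2 {g : ℝ × ℝ → ℂ} (hg : Measurable g) : Measurable (ft2 g) := by
  have : StronglyMeasurable fun z : (ℝ × ℝ) × (ℝ × ℝ) =>
      Complex.exp (-(Complex.I) * ((z.2.1 * z.1.1 + z.2.2 * z.1.2 : ℝ) : ℂ)) * g z.2 := by
    apply Measurable.stronglyMeasurable
    exact Measurable.mul (by fun_prop) (hg.comp measurable_snd)
  exact this.integral_prod_right.measurable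

theorem norm_exp_neg_I_mul (t : ℝ) : ‖Complex.exp (-Complex.I * (t : ℂ))‖ = 1 := by
  rw [show -Complex.I * (t:ℂ) = ((-t : ℝ) : ℂ) * Complex.I by push_cast; ring]
  exact Complex.norm_exp_ofReal_mul_I _

theorem norm_ft2_le (g : ℝ × ℝ → ℂ) (ξ : ℝ × ℝ) : ‖ft2 g ξ‖ ≤ ∫ x, ‖g x‖ := by
  refine (norm_integral_le_integral_norm _).trans (le_of_eq ?_)
  simp_rw [norm_mul, norm_exp_neg_I_mul, one_mul]

/-- The cube in which the solutions are measured. -/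
def box3 : Set (ℝ × ℝ × ℝ) := Icc (-10) 10 ×ˢ (Icc (-10) 10 ×ˢ Icc (-10) 10)

theorem measurableSet_box3 : MeasurableSet box3 :=
  measurableSet_Icc.prod (measurableSet_Icc.prod measurableSet_Icc)

theorem volume_restrict_box3_le {κ : ℝ → ℝ} (h : IsBandWeight κ) :
    volume.restrict box3 ≤ (wMeas3 κ).restrict slab := by
  have h1 := volume_restrict_le_wMeas h
  have := h.isFiniteMeasure
  have e : (volume : Measure (ℝ × ℝ × ℝ)).restrict box3 =
      (volume.restrict (Icc (-10) 10)).prod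
        ((volume.restrict (Icc (-10) 10)).prod (volume.restrict (Icc (-10) 10))) := by
    rw [Measure.prod_restrict, Measure.prod_restrict]; rfl
  have h2 : (volume : Measure (ℝ × ℝ × ℝ)).restrict box3 ≤ wMeas3 κ := by
    rw [e, wMeas3]
    exact Measure.prod_mono h1 (Measure.prod_mono h1 h1)
  have h3 : box3 ⊆ slab := fun z hz => abs_le.2 hz.2.2
  have h4 : volume.restrict box3 = (volume.restrict box3).restrict slab := by
    rw [Measure.restrict_restrict measurableSet_slab, inter_eq_right.2 h3]
  rw [h4]
  exact Measure.restrict_mono le_rfl h2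

theorem ENNReal.sum_rpow_le {ι : Type*} (s : Finset ι) (a : ι → ℝ≥0∞) {q : ℝ} (hq : 0 < q) :
    (∑ i ∈ s, a i) ^ q ≤ (s.card : ℝ≥0∞) ^ q * ∑ i ∈ s, a i ^ q := by
  rcases s.eq_empty_or_nonempty with rfl | hs
  · simp [hq]
  · obtain ⟨j, hj, hmax⟩ := s.exists_max_image a hs
    calc _ ≤ (s.card * a j) ^ q := by
          gcongr
          calc _ ≤ ∑ i ∈ s, a j := Finset.sum_le_sum hmax
            _ = _ := by rw [Finset.sum_const, nsmul_eq_mul]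
      _ = (s.card : ℝ≥0∞) ^ q * a j ^ q := ENNReal.mul_rpow_of_nonneg _ _ hq.le
      _ ≤ _ := by
          gcongr
          exact Finset.single_le_sum (f := fun i => a i ^ q) (fun i _ => zero_le) hj


variable {A : ℝ × ℝ → ℂ}

/-- The amplitude of a radial slice. -/
def sliceAmp (A : ℝ × ℝ → ℂ) (lam m : ℝ) (L : ℕ) (ξ : ℝ × ℝ) : ℂ :=
  A (ξ.1 / lam, ξ.2 / lam) * (hat (L ^ 2 * (ξ.1 / lam) - m) : ℂ)

theorem measurable_sliceAmp (hA : IsSectorAmp A) (lam m : ℝ) (L : ℕ) :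
    Measurable (sliceAmp A lam m L) := by
  unfold sliceAmp
  have h1 : Measurable fun ξ : ℝ × ℝ => A (ξ.1 / lam, ξ.2 / lam) :=
    hA.smooth.continuous.measurable.comp (by fun_prop)
  have h3 : Measurable fun ξ : ℝ × ℝ => hat (L ^ 2 * (ξ.1 / lam) - m) :=
    measurable_hat.comp (by fun_prop)
  exact h1.mul (Complex.measurable_ofReal.comp h3)

theorem sliceAmp_supp (hA : IsSectorAmp A) {lam : ℝ} (hlam : 1 ≤ lam) {m : ℝ} {L : ℕ} {ξ : ℝ × ℝ}
    (h : sliceAmp A lam m L ξ ≠ 0) : lam / 8 ≤ ξ.1 ∧ ξ.1 ≤ 8 * lam ∧ |ξ.2| ≤ 2 * ξ.1 ∧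
      |L ^ 2 * (ξ.1 / lam) - m| < 1 := by
  have hl : 0 < lam := by linarith
  have hv : plankAmp A lam (ξ.2 / ξ.1 - (√lam)⁻¹ * (1 / 2)) m L ξ ≠ 0 ∨
      plankAmp A lam (ξ.2 / ξ.1) m L ξ ≠ 0 := by
    right
    unfold plankAmp
    refine mul_ne_zero ?_ h
    rw [sub_self, mul_zero, Complex.ofReal_ne_zero]
    unfold hat
    rw [zero_add, smoothTransition.one, smoothTransition.zero]
    norm_num
  rcases hv with hv | hv <;>
  · obtain ⟨h1, h2, h3, -, h5⟩ := plankAmp_supp hA hlam hv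
    exact ⟨h1, h2, h3, h5⟩

theorem norm_sliceAmp_le {C : ℝ} (hC0 : 0 ≤ C) (hC : ∀ ξ, ‖A ξ‖ ≤ C) (lam m : ℝ) (L : ℕ)
    (ξ : ℝ × ℝ) : ‖sliceAmp A lam m L ξ‖ ≤ C := by
  unfold sliceAmp
  rw [norm_mul]
  calc _ ≤ C * 1 := by
        gcongr
        · exact hC _
        · exact norm_hat_le _
    _ = C := mul_one C

theorem sliceAmp_mem (hA : IsSectorAmp A) {lam : ℝ} (hlam : 1 ≤ lam) {m : ℝ} {L : ℕ} {ξ : ℝ × ℝ}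
    (h : sliceAmp A lam m L ξ ≠ 0) :
    ξ ∈ Icc (-(16 * lam)) (16 * lam) ×ˢ Icc (-(16 * lam)) (16 * lam) := by
  obtain ⟨h1, h2, h3, -⟩ := sliceAmp_supp hA hlam h
  have := abs_le.1 h3
  exact ⟨⟨by linarith, by linarith⟩, ⟨by linarith, by linarith⟩⟩

theorem integrable_sliceAmp_mul (hA : IsSectorAmp A) {lam : ℝ} (hlam : 1 ≤ lam) (m : ℝ) (L : ℕ)
    {g : ℝ × ℝ → ℂ} (hgm : Measurable g) :
    Integrable fun ξ => sliceAmp A lam m L ξ * ft2 g ξ := by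
  obtain ⟨C, hC0, hC⟩ := hA.exists_bound
  set B := ∫ x, ‖g x‖
  set s := Icc (-(16 * lam)) (16 * lam) ×ˢ Icc (-(16 * lam)) (16 * lam)
  have hs : MeasurableSet s := measurableSet_Icc.prod measurableSet_Icc
  have hv : volume s < ∞ := (isCompact_Icc.prod isCompact_Icc).measure_lt_top
  refine Integrable.mono' (g := s.indicator fun _ => C * B)
    ((integrable_indicator_iff hs).2 (integrableOn_const hv.ne))
    ((measurable_sliceAmp hA lam m L).mul (measurable_ft2 hgm)).aestronglyMeasurable
    (Filter.Eventually.of_forall fun ξ => ?_)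
  by_cases h : sliceAmp A lam m L ξ = 0
  · rw [h, zero_mul, norm_zero]
    exact indicator_nonneg (fun _ _ => mul_nonneg hC0 (integral_nonneg fun _ => norm_nonneg _)) _
  · rw [indicator_of_mem (sliceAmp_mem hA hlam h), norm_mul]
    gcongr
    · exact norm_sliceAmp_le hC0 hC lam m L ξ
    · exact norm_ft2_le g ξ

theorem sliceAmp_coneFamily (hA : IsSectorAmp A) {lam : ℝ} (hlam : 1 ≤ lam) (m : ℝ) {L J : ℕ}
    (hL : 1 ≤ L) {g : ℝ × ℝ → ℂ} (hgm : Measurable g) (N : ℕ) :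
    ConeFamily lam (lam * m / L ^ 2) (√lam)⁻¹ (-(N * (√lam)⁻¹)) L J
      (fun n ξ => hat (√lam * (ξ.2 / ξ.1) + N - n)) (fun ξ => sliceAmp A lam m L ξ * ft2 g ξ) where
  one_le_lam := hlam
  β_pos := inv_pos.2 (Real.sqrt_pos.2 (by linarith))
  le_lam := by rw [inv_pow, Real.sq_sqrt (by linarith), mul_inv_cancel₀ (by linarith)]
  one_le_L := hL
  f_meas := fun n => measurable_hat.comp (by fun_prop)
  f_nonneg := fun n ξ => hat_nonneg _
  f_sum := fun ξ => sum_hat_sub_le_one _ _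
  f_le := fun n ξ => hat_le_one _
  H_meas := (measurable_sliceAmp hA lam m L).mul (measurable_ft2 hgm)
  H_int := integrable_sliceAmp_mul hA hlam m L hgm
  supp := fun n ξ hf hH => by
    have hl : 0 < lam := by linarith
    have hs : 0 < √lam := Real.sqrt_pos.2 hl
    have hL0 : (0:ℝ) < L := by exact_mod_cast hL
    obtain ⟨h1, h2, h3, h4⟩ := sliceAmp_supp hA hlam (left_ne_zero_of_mul hH)
    have h5 := abs_lt_one_of_hat_ne_zero hf
    refine ⟨h1, h2, h3, ?_, ?_⟩
    · have e : ξ.1 - lam * m / L ^ 2 = lam / L ^ 2 * (L ^ 2 * (ξ.1 / lam) - m) := by field_simp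
      rw [e, abs_mul, abs_of_pos (by positivity)]
      have : 0 < lam / (L:ℝ) ^ 2 := by positivity
      nlinarith
    · have e : ξ.2 / ξ.1 - (-(N * (√lam)⁻¹) + n * (√lam)⁻¹) =
          (√lam)⁻¹ * (√lam * (ξ.2 / ξ.1) + N - n) := by field_simp; ring
      rw [e, abs_mul, abs_of_pos (inv_pos.2 hs)]
      have := inv_pos.2 hs
      nlinarith

theorem blockFn_slice_eq (lam m : ℝ) (hlam : 1 ≤ lam) (L N : ℕ) (g : ℝ × ℝ → ℂ) (c : ℤ) :
    blockFn (fun n ξ => hat (√lam * (ξ.2 / ξ.1) + N - n)) (fun ξ => sliceAmp A lam m L ξ * ft2 g ξ)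
      L 0 c = fun ξ => plankAmp A lam ((c - N) * (√lam)⁻¹) m L ξ * ft2 g ξ := by
  funext ξ
  have hs : 0 < √lam := Real.sqrt_pos.2 (by linarith)
  simp only [blockFn, blockWt, plankAmp, sliceAmp]
  have : √lam * (ξ.2 / ξ.1 - (c - N) * (√lam)⁻¹) = √lam * (ξ.2 / ξ.1) + N - c := by
    field_simp
    ring
  rw [this]; ring

/-- The scale parameters. -/
theorem exists_scale (J : ℕ) (hJ : 1 ≤ J) {lam : ℝ} (hlam : 1 ≤ lam) : ∃ L : ℕ, 1 ≤ L ∧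
    10 * √lam ≤ (L:ℝ) ^ J ∧ (L:ℝ) ^ J ≤ 2 ^ J * 10 * √lam ∧ (L:ℝ) ≤ 20 * lam ^ (1 / (2 * J) : ℝ) := by
  have hs : 1 ≤ √lam := Real.one_le_sqrt.2 hlam
  set b := 10 * √lam
  have hb : 1 ≤ b := by simp only [b]; linarith
  have hJ0 : (0:ℝ) < J := by exact_mod_cast hJ
  set x := b ^ (1 / J : ℝ) with hx
  have hx1 : 1 ≤ x := Real.one_le_rpow hb (by positivity)
  have hxJ : x ^ J = b := by
    rw [hx, ← Real.rpow_natCast, ← Real.rpow_mul (by positivity), one_div, inv_mul_cancel₀ hJ0.ne',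
      Real.rpow_one]
  have hle : x ≤ (⌈x⌉₊ : ℝ) := Nat.le_ceil x
  have hlt : (⌈x⌉₊ : ℝ) ≤ 2 * x := by
    have := (Nat.ceil_lt_add_one (by linarith : 0 ≤ x)).le
    linarith
  refine ⟨⌈x⌉₊, Nat.one_le_ceil_iff.2 (by linarith), ?_, ?_, ?_⟩
  · rw [← hxJ]; gcongr
  · calc (⌈x⌉₊ : ℝ) ^ J ≤ (2 * x) ^ J := by gcongr
      _ = 2 ^ J * 10 * √lam := by rw [mul_pow, hxJ]; ring
  · refine hlt.trans ?_
    have h1 : (10:ℝ) ^ (1 / J : ℝ) ≤ 10 := by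
      calc _ ≤ (10:ℝ) ^ (1:ℝ) := by
            apply Real.rpow_le_rpow_of_exponent_le (by norm_num)
            rw [div_le_one hJ0]; exact_mod_cast hJ
        _ = 10 := Real.rpow_one _
    have h2 : (√lam) ^ (1 / J : ℝ) = lam ^ (1 / (2 * J) : ℝ) := by
      rw [Real.sqrt_eq_rpow, ← Real.rpow_mul (by linarith)]
      congr 1; field_simp
    rw [hx, Real.mul_rpow (by norm_num) (by positivity), h2]
    have : 0 ≤ lam ^ (1 / (2 * J) : ℝ) := by positivity
    nlinarith

theorem sum_sliceAmp (hA : IsSectorAmp A) {lam : ℝ} (hlam : 1 ≤ lam) (L : ℕ) (ξ : ℝ × ℝ) :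
    ∑ m ∈ Finset.Ico (0:ℤ) ((8 * L ^ 2 + 1 : ℕ) : ℤ), sliceAmp A lam m L ξ =
      A (ξ.1 / lam, ξ.2 / lam) := by
  simp only [sliceAmp]
  rw [← Finset.mul_sum]
  by_cases h : A (ξ.1 / lam, ξ.2 / lam) = 0
  · rw [h, zero_mul]
  · obtain ⟨h1, h2, -⟩ := hA.supp _ h
    simp only at h1 h2
    rw [← Complex.ofReal_sum, sum_hat_sub_eq_one, Complex.ofReal_one, mul_one]
    · exact mul_nonneg (by positivity) (by linarith)
    · push_cast
      have : (L:ℝ) ^ 2 * (ξ.1 / lam) ≤ L ^ 2 * 8 := by gcongr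
      linarith

end

theorem lintegral_sliceAmp_sq_le {A : ℝ × ℝ → ℂ} (hA : IsSectorAmp A) : ∃ C : ℝ≥0∞, C ≠ ∞ ∧
    ∀ {lam : ℝ}, 1 ≤ lam → ∀ (m : ℝ) (L : ℕ) {g : ℝ × ℝ → ℂ}, Integrable g → Measurable g →
      ∫⁻ ξ, ‖sliceAmp A lam m L ξ * ft2 g ξ‖ₑ ^ 2 ≤ C * ∫⁻ x, ‖g x‖ₑ ^ 2 := by
  obtain ⟨CA, hCA0, hCA⟩ := hA.exists_bound
  obtain ⟨CB, hCB, hB⟩ := exists_bessel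
  refine ⟨ENNReal.ofReal CA ^ 2 * CB, ENNReal.mul_ne_top (by simp) hCB,
    fun {lam} hlam m L {g} hg hgm => ?_⟩
  have hs : MeasurableSet (Icc (-(16 * lam)) (16 * lam) ×ˢ Icc (-(16 * lam)) (16 * lam)) :=
    measurableSet_Icc.prod measurableSet_Icc
  calc ∫⁻ ξ, ‖sliceAmp A lam m L ξ * ft2 g ξ‖ₑ ^ 2
      ≤ ∫⁻ ξ in Icc (-(16 * lam)) (16 * lam) ×ˢ Icc (-(16 * lam)) (16 * lam),
          ENNReal.ofReal CA ^ 2 * ‖ft2 g ξ‖ₑ ^ 2 := by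
        rw [← lintegral_indicator hs]
        refine lintegral_mono fun ξ => ?_
        by_cases h : sliceAmp A lam m L ξ = 0
        · simp [h]
        · rw [indicator_of_mem (sliceAmp_mem hA hlam h), enorm_mul, mul_pow]
          gcongr
          rw [← ofReal_norm]
          exact ENNReal.ofReal_le_ofReal (norm_sliceAmp_le hCA0 hCA lam m L ξ)
    _ ≤ _ := by
        rw [lintegral_const_mul' _ _ (by simp), mul_assoc]
        gcongr
        exact hB _ (by linarith) g hg hgm

theorem exists_sector_bound {A : ℝ × ℝ → ℂ} (hA : IsSectorAmp A) {q y z : ℝ} (hy : 0 < y)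
    (hz : 0 ≤ z) (hyz : y + z ≤ 1) (hq : q = 2 + 2 * y + 3 * z) : ∃ C : ℝ≥0∞, C ≠ ∞ ∧
    ∀ {lam : ℝ}, 1 ≤ lam → ∀ {g : ℝ × ℝ → ℂ}, Integrable g → Measurable g → (∀ x, ‖g x‖ ≤ 1) →
      ∫⁻ x in box3, ‖sup3 coneMap volume (fun ξ => A (ξ.1 / lam, ξ.2 / lam) * ft2 g ξ) x‖ₑ ^ q ≤
        C * ENNReal.ofReal lam ^ (q / 2 - 1 - y / 4) * (∫⁻ x, ‖g x‖ₑ ^ 2) ^ (1 + z) := by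
  obtain ⟨κ, hκ⟩ := exists_isBandWeight
  obtain ⟨P₀, hP₀, hP⟩ := exists_plank_bound hA
  obtain ⟨C₂, hC₂, h2⟩ := lintegral_sliceAmp_sq_le hA
  obtain ⟨J, hJ⟩ := exists_nat_ge (38 / y)
  have hJ1 : 1 ≤ J := by
    have : (0:ℝ) < J := lt_of_lt_of_le (by positivity) hJ
    exact_mod_cast this
  set P := max P₀ (2 ^ J * 10)
  obtain ⟨C₁, hC₁, h1⟩ := exists_coneFamily_bound hκ J (P := P) (hP₀.trans (le_max_left _ _))
    hy.le hz hyz hq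
  refine ⟨9 ^ 6 * 20 ^ 19 * C₁ * C₂ ^ (1 + z), by finiteness,
    fun {lam} hlam {g} hg hgm hg1 => ?_⟩
  obtain ⟨L, hL1, hLa, hLb, hLc⟩ := exists_scale J hJ1 hlam
  have hlam0 : 0 < lam := by linarith
  have hs1 : 1 ≤ √lam := Real.one_le_sqrt.2 hlam
  have hs0 : 0 < √lam := by linarith
  set N := ⌈2 * √lam⌉₊ + 1 with hN
  have hN1 : 2 * √lam ≤ N := by
    have := Nat.le_ceil (2 * √lam); rw [hN]; push_cast; linarith
  have hN2 : (N:ℝ) ≤ 2 * √lam + 2 := by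
    have := Nat.ceil_lt_add_one (show 0 ≤ 2 * √lam by positivity); rw [hN]; push_cast; linarith
  set X := ∫⁻ x, ‖g x‖ₑ ^ 2
  have hm : ∀ m : ℝ, ∫⁻ x in box3, ‖sup3 coneMap volume (fun ξ => sliceAmp A lam m L ξ * ft2 g ξ) x‖ₑ ^ q
      ≤ C₁ * L ^ 7 * ENNReal.ofReal lam ^ (q / 2 - 1 - y / 2) * (C₂ * X) ^ (1 + z) := by
    intro m
    refine (lintegral_mono' (volume_restrict_box3_le hκ) le_rfl).trans ?_
    refine (h1 (sliceAmp_coneFamily hA hlam m hL1 hgm N) ?_ ?_ ?_ ?_).trans ?_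
    · rw [inv_pow, Real.sq_sqrt hlam0.le, mul_inv_cancel₀ hlam0.ne']
    · intro ξ hξ
      obtain ⟨a1, a2, a3, -⟩ := sliceAmp_supp hA hlam (left_ne_zero_of_mul hξ)
      have hx1 : 0 < ξ.1 := by linarith [div_pos hlam0 (show (0:ℝ) < 8 by norm_num)]
      have : |ξ.2 / ξ.1| ≤ 2 := by rw [abs_div, abs_of_pos hx1, div_le_iff₀ hx1]; exact a3
      obtain ⟨b1, b2⟩ := abs_le.1 this
      refine sum_hat_sub_eq_one ?_ ?_
      · nlinarith
      · push_cast
        nlinarith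
    · rw [div_inv_eq_mul]
      exact hLb.trans (mul_le_mul_of_nonneg_right (le_max_right _ _) hs0.le)
    · intro c x
      rw [blockFn_slice_eq lam m hlam]
      refine (hP hlam _ m hL1 hg hg1 x).trans ?_
      exact mul_le_mul_of_nonneg_right (le_max_left _ _) (by positivity)
    · gcongr
      exact h2 hlam m L hg hgm
  have hc : ((8 * L ^ 2 + 1 : ℕ) : ℝ≥0∞) ≤ 9 * L ^ 2 := by
    have : 8 * L ^ 2 + 1 ≤ 9 * L ^ 2 := by nlinarith [Nat.one_le_pow 2 L hL1]
    exact_mod_cast this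
  have hsum : ∀ x, ‖sup3 coneMap volume (fun ξ => A (ξ.1 / lam, ξ.2 / lam) * ft2 g ξ) x‖ₑ ^ q ≤
      (9 * L ^ 2 : ℝ≥0∞) ^ (5:ℕ) * ∑ m ∈ Finset.Ico (0:ℤ) ((8 * L ^ 2 + 1 : ℕ) : ℤ),
        ‖sup3 coneMap volume (fun ξ => sliceAmp A lam m L ξ * ft2 g ξ) x‖ₑ ^ q := by
    intro x
    have : (fun ξ => A (ξ.1 / lam, ξ.2 / lam) * ft2 g ξ) = fun ξ =>
        ∑ m ∈ Finset.Ico (0:ℤ) ((8 * L ^ 2 + 1 : ℕ) : ℤ), sliceAmp A lam m L ξ * ft2 g ξ := by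
      funext ξ; rw [← Finset.sum_mul, sum_sliceAmp hA hlam]
    rw [this, sup3_sum _ (H := fun (m : ℤ) ξ => sliceAmp A lam m L ξ * ft2 g ξ)
      (fun m _ => integrable_sliceAmp_mul hA hlam m L hgm) continuous_coneMap.measurable]
    have hq0 : 0 < q := by rw [hq]; positivity
    refine (ENNReal.rpow_le_rpow (enorm_sum_le _ _) hq0.le).trans
      ((ENNReal.sum_rpow_le _ _ hq0).trans ?_)
    gcongr
    have hL' : (1:ℝ≥0∞) ≤ L := by exact_mod_cast hL1
    have hL2 : (1:ℝ≥0∞) ≤ (L:ℝ≥0∞) ^ 2 := one_le_pow₀ hL'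
    rw [Int.card_Ico, sub_zero, Int.toNat_natCast]
    refine (ENNReal.rpow_le_rpow hc hq0.le).trans ?_
    rw [← ENNReal.rpow_natCast (9 * (L:ℝ≥0∞) ^ 2) 5]
    refine ENNReal.rpow_le_rpow_of_exponent_le ?_ ?_
    · calc (1:ℝ≥0∞) = 1 * 1 := by simp
        _ ≤ _ := by gcongr; norm_num
    · push_cast; linarith
  have hLp : (L:ℝ≥0∞) ^ 19 ≤ 20 ^ 19 * ENNReal.ofReal lam ^ (y / 4) := by
    have e1 : (L:ℝ≥0∞) ≤ 20 * ENNReal.ofReal lam ^ (1 / (2 * J) : ℝ) := by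
      rw [ENNReal.ofReal_rpow_of_pos hlam0]
      calc (L:ℝ≥0∞) = ENNReal.ofReal (L:ℝ) := by simp
        _ ≤ ENNReal.ofReal (20 * lam ^ (1 / (2 * J) : ℝ)) := ENNReal.ofReal_le_ofReal hLc
        _ = _ := by rw [ENNReal.ofReal_mul (by norm_num)]; norm_num
    calc (L:ℝ≥0∞) ^ 19 ≤ (20 * ENNReal.ofReal lam ^ (1 / (2 * J) : ℝ)) ^ 19 := by gcongr
      _ = 20 ^ 19 * ENNReal.ofReal lam ^ (1 / (2 * J) * (19:ℕ) : ℝ) := by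
          rw [mul_pow, ENNReal.rpow_mul, ENNReal.rpow_natCast]
      _ ≤ _ := by
          gcongr
          · rw [ENNReal.one_le_ofReal]; exact hlam
          · have : (0:ℝ) < J := by exact_mod_cast hJ1
            rw [div_le_iff₀ hy] at hJ
            push_cast
            rw [div_mul_eq_mul_div, div_le_div_iff₀ (by positivity) (by norm_num)]
            nlinarith
  have hmeas : ∀ m : ℝ, Measurable fun x =>
      ‖sup3 coneMap volume (fun ξ => sliceAmp A lam m L ξ * ft2 g ξ) x‖ₑ ^ q := fun m =>
    ((sup3_stronglyMeasurable continuous_coneMap.measurable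
      ((measurable_sliceAmp hA lam m L).mul (measurable_ft2 hgm))).measurable.enorm).pow_const q
  refine (lintegral_mono hsum).trans ?_
  rw [lintegral_const_mul' _ _ (by finiteness), lintegral_finsetSum (f := fun (m : ℤ) x =>
    ‖sup3 coneMap volume (fun ξ => sliceAmp A lam m L ξ * ft2 g ξ) x‖ₑ ^ q) _ (fun m _ => hmeas m)]
  refine (mul_le_mul_right (Finset.sum_le_sum fun (m : ℤ) _ => hm m) _).trans ?_
  rw [Finset.sum_const, nsmul_eq_mul, Int.card_Ico, sub_zero, Int.toNat_natCast,
    ENNReal.mul_rpow_of_nonneg _ _ (by positivity : 0 ≤ 1 + z)]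
  calc (9 * (L:ℝ≥0∞) ^ 2) ^ 5 * (((8 * L ^ 2 + 1 : ℕ) : ℝ≥0∞) *
        (C₁ * L ^ 7 * ENNReal.ofReal lam ^ (q / 2 - 1 - y / 2) * (C₂ ^ (1 + z) * X ^ (1 + z))))
      ≤ (9 * (L:ℝ≥0∞) ^ 2) ^ 5 * ((9 * L ^ 2) *
        (C₁ * L ^ 7 * ENNReal.ofReal lam ^ (q / 2 - 1 - y / 2) * (C₂ ^ (1 + z) * X ^ (1 + z)))) := by
        gcongr
    _ = 9 ^ 6 * (L:ℝ≥0∞) ^ 19 * (C₁ * ENNReal.ofReal lam ^ (q / 2 - 1 - y / 2) * (C₂ ^ (1 + z) * X ^ (1 + z))) := by ring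
    _ ≤ 9 ^ 6 * (20 ^ 19 * ENNReal.ofReal lam ^ (y / 4)) *
        (C₁ * ENNReal.ofReal lam ^ (q / 2 - 1 - y / 2) * (C₂ ^ (1 + z) * X ^ (1 + z))) := by gcongr
    _ = 9 ^ 6 * 20 ^ 19 * C₁ * C₂ ^ (1 + z) *
        (ENNReal.ofReal lam ^ (y / 4) * ENNReal.ofReal lam ^ (q / 2 - 1 - y / 2)) * X ^ (1 + z) := by ring
    _ = _ := by
        rw [← ENNReal.rpow_add _ _ (by simpa using hlam0) (by simp)]
        ring_nf

/-- The half-wave operator with frequency amplitude `A(·/lam)`. -/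
def waveOp (A : ℝ × ℝ → ℂ) (lam : ℝ) (g : ℝ × ℝ → ℂ) : ℝ × ℝ × ℝ → ℂ :=
  sup3 coneMap volume fun ξ => A (ξ.1 / lam, ξ.2 / lam) * ft2 g ξ

/-- Smooth amplitudes supported in a fixed annulus. -/
structure IsAnnAmp (A : ℝ × ℝ → ℂ) : Prop where
  smooth : ContDiff ℝ (⊤ : ℕ∞) A
  supp : ∀ ξ, A ξ ≠ 0 → 1 / 9 ≤ ξ.1 ^ 2 + ξ.2 ^ 2 ∧ ξ.1 ^ 2 + ξ.2 ^ 2 ≤ 64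

/-- The single scale local smoothing estimate for the amplitude `A`. -/
def HasWaveBound (q c e : ℝ) (A : ℝ × ℝ → ℂ) : Prop :=
  ∃ C : ℝ≥0∞, C ≠ ∞ ∧ ∀ {lam : ℝ}, 1 ≤ lam → ∀ {g : ℝ × ℝ → ℂ}, Integrable g → Measurable g →
    (∀ x, ‖g x‖ ≤ 1) → ∫⁻ x in box3, ‖waveOp A lam g x‖ₑ ^ q ≤
      C * ENNReal.ofReal lam ^ c * (∫⁻ x, ‖g x‖ₑ ^ 2) ^ e

theorem IsAnnAmp.mem_box {A : ℝ × ℝ → ℂ} (hA : IsAnnAmp A) {lam : ℝ} (hlam : 1 ≤ lam) {ξ : ℝ × ℝ}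
    (h : A (ξ.1 / lam, ξ.2 / lam) ≠ 0) :
    ξ ∈ Icc (-(16 * lam)) (16 * lam) ×ˢ Icc (-(16 * lam)) (16 * lam) := by
  have hlam0 : 0 < lam := by linarith
  obtain ⟨-, h2⟩ := hA.supp _ h
  have h1 : |ξ.1 / lam| ≤ 16 := abs_le_of_sq_le_sq (by nlinarith [sq_nonneg (ξ.2 / lam)]) (by norm_num)
  have h3 : |ξ.2 / lam| ≤ 16 := abs_le_of_sq_le_sq (by nlinarith [sq_nonneg (ξ.1 / lam)]) (by norm_num)
  rw [abs_div, abs_of_pos hlam0, div_le_iff₀ hlam0] at h1 h3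
  exact ⟨abs_le.1 h1, abs_le.1 h3⟩

theorem IsAnnAmp.continuous_dil {A : ℝ × ℝ → ℂ} (hA : IsAnnAmp A) (lam : ℝ) :
    Continuous fun ξ : ℝ × ℝ => A (ξ.1 / lam, ξ.2 / lam) :=
  hA.smooth.continuous.comp (by fun_prop)

theorem IsAnnAmp.integrable_dil {A : ℝ × ℝ → ℂ} (hA : IsAnnAmp A) {lam : ℝ} (hlam : 1 ≤ lam) :
    Integrable fun ξ : ℝ × ℝ => A (ξ.1 / lam, ξ.2 / lam) := by
  refine (hA.continuous_dil lam).integrable_of_hasCompactSupport ?_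
  refine HasCompactSupport.intro (isCompact_Icc.prod isCompact_Icc :
    IsCompact (Icc (-(16 * lam)) (16 * lam) ×ˢ Icc (-(16 * lam)) (16 * lam))) fun ξ hξ => ?_
  by_contra h
  exact hξ (hA.mem_box hlam h)

theorem IsAnnAmp.integrable_dil_mul {A : ℝ × ℝ → ℂ} (hA : IsAnnAmp A) {lam : ℝ} (hlam : 1 ≤ lam)
    {g : ℝ × ℝ → ℂ} (hgm : Measurable g) :
    Integrable fun ξ : ℝ × ℝ => A (ξ.1 / lam, ξ.2 / lam) * ft2 g ξ :=
  (hA.integrable_dil hlam).mul_bdd (c := ∫ x, ‖g x‖) (measurable_ft2 hgm).aestronglyMeasurable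
    (Filter.Eventually.of_forall (norm_ft2_le g))

theorem IsAnnAmp.measurable_waveOp {A : ℝ × ℝ → ℂ} (hA : IsAnnAmp A) (lam : ℝ)
    {g : ℝ × ℝ → ℂ} (hgm : Measurable g) : Measurable (waveOp A lam g) :=
  (sup3_stronglyMeasurable continuous_coneMap.measurable
    ((hA.continuous_dil lam).measurable.mul (measurable_ft2 hgm))).measurable

theorem IsAnnAmp.of_mul {A : ℝ × ℝ → ℂ} (hA : IsAnnAmp A) {w : ℝ × ℝ → ℂ}
    (hw : ContDiff ℝ (⊤ : ℕ∞) fun ξ => A ξ * w ξ) : IsAnnAmp fun ξ => A ξ * w ξ :=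
  ⟨hw, fun ξ h => hA.supp ξ (left_ne_zero_of_mul h)⟩

theorem HasWaveBound.add {q c e : ℝ} (hq : 0 < q) {A B : ℝ × ℝ → ℂ} (hA : IsAnnAmp A)
    (hB : IsAnnAmp B) (h1 : HasWaveBound q c e A) (h2 : HasWaveBound q c e B) :
    HasWaveBound q c e fun ξ => A ξ + B ξ := by
  obtain ⟨C₁, hC₁, h1⟩ := h1
  obtain ⟨C₂, hC₂, h2⟩ := h2
  refine ⟨2 ^ q * (C₁ + C₂), by finiteness, fun {lam} hlam {g} hg hgm hg1 => ?_⟩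
  have key : ∀ x, ‖waveOp (fun ξ => A ξ + B ξ) lam g x‖ₑ ^ q ≤
      2 ^ q * (‖waveOp A lam g x‖ₑ ^ q + ‖waveOp B lam g x‖ₑ ^ q) := by
    intro x
    have : waveOp (fun ξ => A ξ + B ξ) lam g x = waveOp A lam g x + waveOp B lam g x := by
      have := sup3_sum (μ := volume) (Finset.univ : Finset Bool)
        (H := fun b ξ => (if b then A (ξ.1 / lam, ξ.2 / lam) else B (ξ.1 / lam, ξ.2 / lam)) * ft2 g ξ)
        (fun b _ => by
          cases b
          · exact hB.integrable_dil_mul hlam hgm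
          · exact hA.integrable_dil_mul hlam hgm) continuous_coneMap.measurable x
      simp only [Fintype.sum_bool, if_true, Bool.false_eq_true, if_false, ← add_mul] at this
      exact this
    rw [this]
    have h3 := ENNReal.sum_rpow_le (Finset.univ : Finset Bool)
      (fun b => if b then ‖waveOp A lam g x‖ₑ else ‖waveOp B lam g x‖ₑ) hq
    simp only [Fintype.sum_bool, if_true, Bool.false_eq_true, if_false, Finset.card_univ,
      Fintype.card_bool, Nat.cast_ofNat] at h3
    exact (ENNReal.rpow_le_rpow (enorm_add_le _ _) hq.le).trans h3
  refine (lintegral_mono key).trans ?_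
  rw [lintegral_const_mul' _ _ (by finiteness),
    lintegral_add_left (((hA.measurable_waveOp lam hgm).enorm).pow_const q), mul_assoc, mul_assoc, add_mul]
  gcongr
  · rw [← mul_assoc]; exact h1 hlam hg hgm hg1
  · rw [← mul_assoc]; exact h2 hlam hg hgm hg1

theorem ft2_comp_symm {S : ℝ × ℝ ≃ᵐ ℝ × ℝ} (hS : MeasurePreserving S)
    (hd : ∀ x ξ, dot2 (S x) (S ξ) = dot2 x ξ) (g : ℝ × ℝ → ℂ) (ξ : ℝ × ℝ) :
    ft2 (fun x => g (S x)) ξ = ft2 g (S ξ) := by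
  unfold ft2
  rw [← hS.integral_comp S.measurableEmbedding (fun y : ℝ × ℝ =>
    Complex.exp (-(Complex.I) * ((y.1 * (S ξ).1 + y.2 * (S ξ).2 : ℝ) : ℂ)) * g y)]
  refine integral_congr_ae (Filter.Eventually.of_forall fun x => ?_)
  have := hd x ξ
  unfold dot2 at this
  simp only [this]

theorem HasWaveBound.of_comp {q c e : ℝ} {A : ℝ × ℝ → ℂ} {S : ℝ × ℝ ≃ᵐ ℝ × ℝ}
    (hS : MeasurePreserving S) (hd : ∀ x ξ, dot2 (S x) (S ξ) = dot2 x ξ)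
    (hn : ∀ ξ, enorm2 (S ξ) = enorm2 ξ) (hl : ∀ ξ lam, S (ξ.1 / lam, ξ.2 / lam) =
      ((S ξ).1 / lam, (S ξ).2 / lam))
    (hb : ∀ (x : ℝ × ℝ) s, ((S x).1, (S x).2, s) ∈ box3 ↔ (x.1, x.2, s) ∈ box3)
    (h : HasWaveBound q c e fun ξ => A (S ξ)) : HasWaveBound q c e A := by
  obtain ⟨C, hC, h⟩ := h
  refine ⟨C, hC, fun {lam} hlam {g} hg hgm hg1 => ?_⟩
  have h' := h hlam (g := fun x => g (S x)) ((hS.integrable_comp_emb S.measurableEmbedding).2 hg)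
    (hgm.comp S.measurable) (fun x => hg1 _)
  rw [hS.lintegral_comp_emb S.measurableEmbedding (fun x => ‖g x‖ₑ ^ 2)] at h'
  refine le_trans (le_of_eq ?_) h'
  have hw : ∀ (x : ℝ × ℝ) s, waveOp (fun ξ => A (S ξ)) lam (fun x => g (S x)) (x.1, x.2, s) =
      waveOp A lam g ((S x).1, (S x).2, s) := by
    intro x s
    unfold waveOp sup3 osc
    rw [← hS.integral_comp S.measurableEmbedding (fun ξ : ℝ × ℝ => A (ξ.1 / lam, ξ.2 / lam) * ft2 g ξ *
      ec (dot3 ((S x).1, (S x).2, s) (coneMap ξ)))]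
    refine integral_congr_ae (Filter.Eventually.of_forall fun ξ => ?_)
    have e1 : dot3 (x.1, x.2, s) (coneMap ξ) = dot3 ((S x).1, (S x).2, s) (coneMap (S ξ)) := by
      have := hd x ξ
      simp only [dot3, coneMap, hn, dot2] at this ⊢
      linarith
    simp only [hl, ft2_comp_symm hS hd, e1]
  let S' : (ℝ × ℝ) × ℝ ≃ᵐ (ℝ × ℝ) × ℝ := S.prodCongr (MeasurableEquiv.refl ℝ)
  let T : ℝ × ℝ × ℝ ≃ᵐ ℝ × ℝ × ℝ :=
    (MeasurableEquiv.prodAssoc.symm.trans S').trans MeasurableEquiv.prodAssoc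
  have hT : MeasurePreserving T := by
    have h1 : MeasurePreserving (MeasurableEquiv.prodAssoc : (ℝ × ℝ) × ℝ ≃ᵐ ℝ × ℝ × ℝ) :=
      measurePreserving_prodAssoc volume volume volume
    exact h1.comp ((hS.prod (MeasurePreserving.id volume)).comp (h1.symm _))
  have hTx : ∀ x : ℝ × ℝ × ℝ, T x = ((S (x.1, x.2.1)).1, (S (x.1, x.2.1)).2, x.2.2) := fun x => rfl
  rw [← lintegral_indicator measurableSet_box3, ← lintegral_indicator measurableSet_box3,
    ← hT.lintegral_comp_emb T.measurableEmbedding]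
  refine lintegral_congr fun x => ?_
  have hm : T x ∈ box3 ↔ x ∈ box3 := hb (x.1, x.2.1) x.2.2
  have hv := hw (x.1, x.2.1) x.2.2
  by_cases hx : x ∈ box3
  · rw [indicator_of_mem hx, indicator_of_mem (hm.2 hx), hTx, ← hv]
  · rw [indicator_of_notMem hx, indicator_of_notMem (fun h => hx (hm.1 h))]

theorem IsAnnAmp.mul_smooth {A w : ℝ × ℝ → ℂ} (hA : IsAnnAmp A)
    (hw : ∀ ξ : ℝ × ℝ, ξ ≠ 0 → ContDiffAt ℝ (⊤ : ℕ∞) w ξ) : IsAnnAmp fun ξ => A ξ * w ξ := by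
  refine hA.of_mul (contDiff_iff_contDiffAt.2 fun ξ => ?_)
  by_cases h : ξ = 0
  · subst h
    refine (contDiffAt_const (c := (0:ℂ))).congr_of_eventuallyEq ?_
    have : {ξ : ℝ × ℝ | ξ.1 ^ 2 + ξ.2 ^ 2 < 1 / 9} ∈ nhds (0 : ℝ × ℝ) :=
      (isOpen_lt (by fun_prop) continuous_const).mem_nhds (by norm_num)
    filter_upwards [this] with ξ hξ
    have : A ξ = 0 := by
      by_contra h
      exact absurd (hA.supp ξ h).1 (not_le.2 hξ)
    rw [this, zero_mul]
  · exact hA.smooth.contDiffAt.mul (hw ξ h)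

/-- A smooth cutoff to the sector `|ξ.2| ≤ 2 |ξ.1|`. -/
def secCut (ξ : ℝ × ℝ) : ℝ := smoothTransition ((5 * (ξ.1 ^ 2 / (ξ.1 ^ 2 + ξ.2 ^ 2)) - 1) / 3)

theorem sq_add_sq_pos {ξ : ℝ × ℝ} (h : ξ ≠ 0) : 0 < ξ.1 ^ 2 + ξ.2 ^ 2 := by
  rcases lt_or_eq_of_le (by positivity : 0 ≤ ξ.1 ^ 2 + ξ.2 ^ 2) with h' | h'
  · exact h'
  · exfalso
    have h1 : ξ.1 = 0 := by nlinarith [sq_nonneg ξ.1, sq_nonneg ξ.2]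
    have h2 : ξ.2 = 0 := by nlinarith [sq_nonneg ξ.1, sq_nonneg ξ.2]
    exact h (Prod.ext h1 h2)

theorem secCut_contDiffAt {ξ : ℝ × ℝ} (h : ξ ≠ 0) : ContDiffAt ℝ (⊤ : ℕ∞) secCut ξ := by
  unfold secCut
  have h1 : ContDiffAt ℝ (⊤ : ℕ∞) (fun ξ : ℝ × ℝ => ξ.1 ^ 2 / (ξ.1 ^ 2 + ξ.2 ^ 2)) ξ :=
    ContDiffAt.div (by fun_prop) (by fun_prop) (sq_add_sq_pos h).ne'
  refine (smoothTransition.contDiff (n := (⊤ : ℕ∞))).contDiffAt.comp ξ ?_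
  exact ((contDiffAt_const.mul h1).sub contDiffAt_const).div_const _

theorem le_of_secCut_ne_zero {ξ : ℝ × ℝ} (h0 : ξ ≠ 0) (h : secCut ξ ≠ 0) : ξ.2 ^ 2 ≤ 4 * ξ.1 ^ 2 := by
  by_contra hc
  push Not at hc
  refine h (smoothTransition.zero_of_nonpos ?_)
  have := sq_add_sq_pos h0
  have : ξ.1 ^ 2 / (ξ.1 ^ 2 + ξ.2 ^ 2) ≤ 1 / 5 := by
    rw [div_le_div_iff₀ this (by norm_num)]; linarith
  linarith

theorem le_of_secCut_ne_one {ξ : ℝ × ℝ} (h0 : ξ ≠ 0) (h : 1 - secCut ξ ≠ 0) :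
    ξ.1 ^ 2 ≤ 4 * ξ.2 ^ 2 := by
  by_contra hc
  push Not at hc
  refine h (sub_eq_zero.2 (smoothTransition.one_of_one_le ?_).symm)
  have := sq_add_sq_pos h0
  have : 4 / 5 ≤ ξ.1 ^ 2 / (ξ.1 ^ 2 + ξ.2 ^ 2) := by
    rw [div_le_div_iff₀ (by norm_num) this]; linarith
  linarith

theorem IsAnnAmp.ne_zero {A : ℝ × ℝ → ℂ} (hA : IsAnnAmp A) {ξ : ℝ × ℝ} (h : A ξ ≠ 0) : ξ ≠ 0 := by
  rintro rfl
  have := (hA.supp _ h).1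
  norm_num at this

theorem IsAnnAmp.comp_symm {A : ℝ × ℝ → ℂ} (hA : IsAnnAmp A) {S : ℝ × ℝ → ℝ × ℝ}
    (hS : ContDiff ℝ (⊤ : ℕ∞) S) (hn : ∀ ξ, (S ξ).1 ^ 2 + (S ξ).2 ^ 2 = ξ.1 ^ 2 + ξ.2 ^ 2) :
    IsAnnAmp fun ξ => A (S ξ) :=
  ⟨hA.smooth.comp hS, fun ξ h => by have := hA.supp _ h; rwa [hn] at this⟩

/-- Reflection in the second coordinate axis. -/
def reflEquiv : ℝ × ℝ ≃ᵐ ℝ × ℝ := (MeasurableEquiv.neg ℝ).prodCongr (MeasurableEquiv.refl ℝ)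

theorem reflEquiv_apply (ξ : ℝ × ℝ) : reflEquiv ξ = (-ξ.1, ξ.2) := rfl

theorem measurePreserving_reflEquiv : MeasurePreserving reflEquiv :=
  (Measure.measurePreserving_neg (volume : Measure ℝ)).prod (MeasurePreserving.id volume)

theorem hasWaveBound_of_refl {q c e : ℝ} {A : ℝ × ℝ → ℂ}
    (h : HasWaveBound q c e fun ξ => A (-ξ.1, ξ.2)) : HasWaveBound q c e A := by
  refine HasWaveBound.of_comp measurePreserving_reflEquiv ?_ ?_ ?_ ?_ h
  · intro x ξ; simp [reflEquiv_apply, dot2]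
  · intro ξ; simp [reflEquiv_apply, enorm2]
  · intro ξ lam; simp [reflEquiv_apply, neg_div]
  · intro x s
    simp only [reflEquiv_apply, box3, mem_prod, mem_Icc, neg_le_neg_iff]
    constructor <;> rintro ⟨⟨a, b⟩, c⟩ <;> exact ⟨⟨by linarith, by linarith⟩, c⟩

theorem hasWaveBound_of_swap {q c e : ℝ} {A : ℝ × ℝ → ℂ}
    (h : HasWaveBound q c e fun ξ => A (ξ.2, ξ.1)) : HasWaveBound q c e A := by
  have hp : MeasurePreserving (MeasurableEquiv.prodComm : ℝ × ℝ ≃ᵐ ℝ × ℝ) :=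
    Measure.measurePreserving_swap (μ := (volume : Measure ℝ)) (ν := (volume : Measure ℝ))
  refine HasWaveBound.of_comp hp ?_ ?_ ?_ ?_ h
  · intro x ξ; exact add_comm _ _
  · intro ξ; exact congrArg Real.sqrt (add_comm _ _)
  · intro ξ lam; rfl
  · intro x s
    simp only [box3, mem_prod, MeasurableEquiv.prodComm, MeasurableEquiv.coe_mk, Equiv.prodComm_apply,
      Prod.fst_swap, Prod.snd_swap]
    tauto

theorem IsSectorAmp.hasWaveBound {q y z : ℝ} (hy : 0 < y) (hz : 0 ≤ z) (hyz : y + z ≤ 1)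
    (hq : q = 2 + 2 * y + 3 * z)
    {A : ℝ × ℝ → ℂ} (hA : IsSectorAmp A) :
    HasWaveBound q (q / 2 - 1 - y / 4) (1 + z) A :=
  exists_sector_bound hA hy hz hyz hq

theorem IsAnnAmp.hasWaveBound_of_sector {q y z : ℝ} (hy : 0 < y) (hz : 0 ≤ z) (hyz : y + z ≤ 1)
    (hq : q = 2 + 2 * y + 3 * z)
    {A : ℝ × ℝ → ℂ} (hA : IsAnnAmp A)
    (hs : ∀ ξ, A ξ ≠ 0 → ξ.2 ^ 2 ≤ 4 * ξ.1 ^ 2) : HasWaveBound q (q / 2 - 1 - y / 4) (1 + z) A := by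
  have hst : ContDiff ℝ (⊤ : ℕ∞) fun ξ : ℝ × ℝ => (smoothTransition (16 * ξ.1) : ℂ) :=
    Complex.ofRealCLM.contDiff.comp
      ((smoothTransition.contDiff (n := (⊤ : ℕ∞))).comp (contDiff_const.mul contDiff_fst))
  have hrf : ContDiff ℝ (⊤ : ℕ∞) fun ξ : ℝ × ℝ => (-ξ.1, ξ.2) := by fun_prop
  have key : ∀ B : ℝ × ℝ → ℂ, IsAnnAmp B → (∀ ξ, B ξ ≠ 0 → ξ.2 ^ 2 ≤ 4 * ξ.1 ^ 2) →
      IsSectorAmp fun ξ => B ξ * (smoothTransition (16 * ξ.1) : ℂ) := by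
    intro B hB hBs
    refine ⟨hB.smooth.mul hst, fun ξ h => ?_⟩
    obtain ⟨h1, h2⟩ := hB.supp ξ (left_ne_zero_of_mul h)
    have h3 := hBs ξ (left_ne_zero_of_mul h)
    have h4 : 0 < ξ.1 := by
      by_contra hc
      exact right_ne_zero_of_mul h (by
        rw [smoothTransition.zero_of_nonpos (by linarith), Complex.ofReal_zero])
    refine ⟨by nlinarith, by nlinarith [sq_nonneg ξ.2], abs_le_of_sq_le_sq (by linarith) (by linarith)⟩
  have h1 := (key A hA hs).hasWaveBound hy hz hyz hq
  have h2 := (key (fun ξ => A (-ξ.1, ξ.2)) (hA.comp_symm hrf (by simp)) (fun ξ h => by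
    simpa using hs _ h)).hasWaveBound hy hz hyz hq
  have h3 : HasWaveBound q (q / 2 - 1 - y / 4) (1 + z)
      fun ξ => A ξ * (smoothTransition (16 * -ξ.1) : ℂ) :=
    hasWaveBound_of_refl (by simpa using h2)
  have := h1.add (by rw [hq]; positivity) (hA.mul_smooth fun ξ _ => hst.contDiffAt)
    (hA.mul_smooth fun ξ _ => (hst.comp hrf).contDiffAt) h3
  convert this using 2 with ξ
  by_cases h : A ξ = 0
  · simp [h]
  · rw [← mul_add]
    change A ξ = A ξ * ((smoothTransition (16 * ξ.1) : ℂ) + (smoothTransition (16 * -ξ.1) : ℂ))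
    obtain ⟨a1, -⟩ := hA.supp ξ h
    have a3 := hs ξ h
    have : (1/16:ℝ) ^ 2 ≤ ξ.1 ^ 2 := by linarith
    rcases le_total 0 ξ.1 with h0 | h0
    · have := (sq_le_sq₀ (by norm_num) h0).1 this
      rw [smoothTransition.one_of_one_le (x := 16 * ξ.1) (by linarith),
        smoothTransition.zero_of_nonpos (x := 16 * -ξ.1) (by linarith)]
      simp
    · rw [← neg_sq ξ.1] at this
      have := (sq_le_sq₀ (by norm_num) (by linarith)).1 this
      rw [smoothTransition.one_of_one_le (x := 16 * -ξ.1) (by linarith),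
        smoothTransition.zero_of_nonpos (x := 16 * ξ.1) (by linarith)]
      simp

theorem IsAnnAmp.hasWaveBound {q y z : ℝ} (hy : 0 < y) (hz : 0 ≤ z) (hyz : y + z ≤ 1)
    (hq : q = 2 + 2 * y + 3 * z)
    {A : ℝ × ℝ → ℂ} (hA : IsAnnAmp A) :
    HasWaveBound q (q / 2 - 1 - y / 4) (1 + z) A := by
  have hs1 : ∀ ξ : ℝ × ℝ, ξ ≠ 0 → ContDiffAt ℝ (⊤ : ℕ∞) (fun ξ => (secCut ξ : ℂ)) ξ := fun ξ h =>
    Complex.ofRealCLM.contDiff.contDiffAt.comp ξ (secCut_contDiffAt h)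
  have hs2 : ∀ ξ : ℝ × ℝ, ξ ≠ 0 → ContDiffAt ℝ (⊤ : ℕ∞) (fun ξ => ((1 - secCut ξ : ℝ) : ℂ)) ξ :=
    fun ξ h => Complex.ofRealCLM.contDiff.contDiffAt.comp ξ (contDiffAt_const.sub (secCut_contDiffAt h))
  have a1 := hA.mul_smooth hs1
  have a2 := hA.mul_smooth hs2
  have hsw : ContDiff ℝ (⊤ : ℕ∞) fun ξ : ℝ × ℝ => (ξ.2, ξ.1) := by fun_prop
  have h1 := a1.hasWaveBound_of_sector hy hz hyz hq fun ξ h =>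
    le_of_secCut_ne_zero (a1.ne_zero h) (by exact_mod_cast right_ne_zero_of_mul h)
  have a3 : IsAnnAmp fun ξ : ℝ × ℝ => A (ξ.2, ξ.1) * ((1 - secCut (ξ.2, ξ.1) : ℝ) : ℂ) :=
    a2.comp_symm hsw (fun ξ => add_comm _ _)
  have h2 : HasWaveBound q (q / 2 - 1 - y / 4) (1 + z) fun ξ => A ξ * ((1 - secCut ξ : ℝ) : ℂ) := by
    refine hasWaveBound_of_swap (a3.hasWaveBound_of_sector hy hz hyz hq fun ξ h => ?_)
    have h0 : ((ξ.2, ξ.1) : ℝ × ℝ) ≠ 0 := hA.ne_zero (left_ne_zero_of_mul h)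
    have h1 : 1 - secCut (ξ.2, ξ.1) ≠ 0 := fun h' =>
      right_ne_zero_of_mul h (by rw [h', Complex.ofReal_zero])
    exact le_of_secCut_ne_one h0 h1
  have := h1.add (by rw [hq]; positivity) a1 a2 h2
  convert this using 2 with ξ
  push_cast
  ring

/-- Moments of the circular exponential integral. -/
def circInt (a : ℝ → ℂ) (x : ℝ) : ℂ := ∫ θ in (0:ℝ)..(2 * π), a θ * ec (-(x * Real.cos θ))

theorem hasDerivAt_ec_comp {f : ℝ → ℝ} {f' x : ℝ} (hf : HasDerivAt f f' x) :
    HasDerivAt (fun x => ec (f x)) (ec (f x) * (Complex.I * f')) x := by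
  unfold ec
  exact ((hf.ofReal_comp).const_mul Complex.I).cexp

theorem hasDerivAt_circInt {a : ℝ → ℂ} (ha : Continuous a) (x : ℝ) :
    HasDerivAt (circInt a) (circInt (fun θ => a θ * (-Complex.I * Real.cos θ)) x) x := by
  refine (intervalIntegral.hasDerivAt_integral_of_dominated_loc_of_deriv_le (μ := volume)
    (F := fun x θ => a θ * ec (-(x * Real.cos θ)))
    (F' := fun x θ => a θ * (-Complex.I * Real.cos θ) * ec (-(x * Real.cos θ)))
    (bound := fun θ => ‖a θ‖) Filter.univ_mem ?_ ?_ ?_ ?_ ?_ ?_).2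
  · have := continuous_ec
    exact Filter.Eventually.of_forall fun y => Continuous.aestronglyMeasurable (by fun_prop)
  · have := continuous_ec
    exact Continuous.intervalIntegrable (by fun_prop) _ _
  · have := continuous_ec
    exact Continuous.aestronglyMeasurable (by fun_prop)
  · refine Filter.Eventually.of_forall fun θ _ y _ => ?_
    rw [norm_mul, norm_ec, mul_one, norm_mul, norm_mul, norm_neg, Complex.norm_I, one_mul,
      Complex.norm_real]
    exact mul_le_of_le_one_right (norm_nonneg _) (Real.abs_cos_le_one θ)
  · exact ha.norm.intervalIntegrable _ _
  · refine Filter.Eventually.of_forall fun θ _ y _ => ?_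
    have h1 : HasDerivAt (fun y : ℝ => -(y * Real.cos θ)) (-(1 * Real.cos θ)) y :=
      ((hasDerivAt_id y).mul_const _).neg
    refine ((hasDerivAt_ec_comp h1).const_mul (a θ)).congr_deriv ?_
    push_cast
    ring

/-- The Bessel function `x ↦ ∫ exp(-i x cos θ) dθ`. -/
def bes : ℝ → ℂ := circInt fun _ => 1

/-- The derivative of `bes`. -/
def bes1 : ℝ → ℂ := circInt fun θ => -Complex.I * Real.cos θ

/-- The second derivative of `bes`. -/
def bes2 : ℝ → ℂ := circInt fun θ => -(Real.cos θ : ℂ) ^ 2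

theorem hasDerivAt_bes (x : ℝ) : HasDerivAt bes (bes1 x) x := by
  have := hasDerivAt_circInt (a := fun _ => (1:ℂ)) continuous_const x
  simpa [bes, bes1] using this

theorem hasDerivAt_bes1 (x : ℝ) : HasDerivAt bes1 (bes2 x) x := by
  have := hasDerivAt_circInt (a := fun θ => -Complex.I * Real.cos θ) (by fun_prop) x
  unfold bes1 bes2
  convert this using 2
  funext θ
  have := Complex.I_sq
  linear_combination (-(Real.cos θ : ℂ) ^ 2) * this

theorem bes_ode (x : ℝ) : x * (bes2 x + bes x) = -bes1 x := by
  have hc := continuous_ec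
  have h0 : ∫ θ in (0:ℝ)..(2 * π), ((Real.cos θ : ℂ) * ec (-(x * Real.cos θ)) +
      Real.sin θ * (ec (-(x * Real.cos θ)) * (Complex.I * (x * Real.sin θ)))) = 0 := by
    rw [intervalIntegral.integral_eq_sub_of_hasDerivAt
      (f := fun θ => (Real.sin θ : ℂ) * ec (-(x * Real.cos θ)))]
    · simp
    · intro θ _
      have h1 : HasDerivAt (fun θ : ℝ => -(x * Real.cos θ)) (-(x * -Real.sin θ)) θ :=
        ((Real.hasDerivAt_cos θ).const_mul x).neg
      have := ((Real.hasDerivAt_sin θ).ofReal_comp).mul (hasDerivAt_ec_comp h1)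
      refine this.congr_deriv ?_
      push_cast
      ring
    · exact Continuous.intervalIntegrable (by fun_prop) _ _
  have e1 : (x:ℂ) * (bes2 x + bes x) + bes1 x = -Complex.I * ∫ θ in (0:ℝ)..(2 * π),
      ((Real.cos θ : ℂ) * ec (-(x * Real.cos θ)) +
      Real.sin θ * (ec (-(x * Real.cos θ)) * (Complex.I * (x * Real.sin θ)))) := by
    unfold bes bes1 bes2 circInt
    rw [← intervalIntegral.integral_add, ← intervalIntegral.integral_const_mul,
      ← intervalIntegral.integral_const_mul, ← intervalIntegral.integral_add]
    · refine intervalIntegral.integral_congr fun θ _ => ?_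
      have h2 : (Real.sin θ : ℂ) ^ 2 = 1 - (Real.cos θ : ℂ) ^ 2 := by
        have := Real.sin_sq θ
        exact_mod_cast congrArg (fun t : ℝ => (t:ℂ)) this
      have := Complex.I_sq
      simp only
      linear_combination (-(x:ℂ) * ec (-(x * Real.cos θ))) * h2 +
        ((x:ℂ) * (Real.sin θ : ℂ) ^ 2 * ec (-(x * Real.cos θ))) * this
    all_goals exact Continuous.intervalIntegrable (by fun_prop) _ _
  rw [h0, mul_zero] at e1
  exact eq_neg_of_add_eq_zero_left e1

/-- The normalised Bessel function `√x · bes x`. -/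
def besU (x : ℝ) : ℂ := (√x : ℂ) * bes x

/-- The derivative of `besU`. -/
def besU1 (x : ℝ) : ℂ := (√x : ℂ) * (bes1 x + bes x / (2 * x))

theorem hasDerivAt_sqrt_ofReal {x : ℝ} (hx : 0 < x) :
    HasDerivAt (fun x : ℝ => (√x : ℂ)) ((√x : ℂ) / (2 * x)) x := by
  have := (Real.hasDerivAt_sqrt hx.ne').ofReal_comp
  convert this using 1
  have h : (√x : ℂ) * √x = x := by exact_mod_cast Real.mul_self_sqrt hx.le
  have h0 : (√x : ℂ) ≠ 0 := by exact_mod_cast (Real.sqrt_pos.2 hx).ne'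
  have h1 : (x : ℂ) ≠ 0 := by exact_mod_cast hx.ne'
  push_cast
  field_simp
  linear_combination h

theorem hasDerivAt_besU {x : ℝ} (hx : 0 < x) : HasDerivAt besU (besU1 x) x := by
  refine ((hasDerivAt_sqrt_ofReal hx).mul (hasDerivAt_bes x)).congr_deriv ?_
  unfold besU1
  ring

theorem hasDerivAt_besU1 {x : ℝ} (hx : 0 < x) :
    HasDerivAt besU1 (-besU x - besU x / (4 * x ^ 2)) x := by
  have h1 : (x : ℂ) ≠ 0 := by exact_mod_cast hx.ne'
  have hd : HasDerivAt (fun x : ℝ => (2 * x : ℂ)) 2 x := by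
    simpa using ((hasDerivAt_id x).ofReal_comp).const_mul (2:ℂ)
  have := (hasDerivAt_sqrt_ofReal hx).mul
    ((hasDerivAt_bes1 x).add ((hasDerivAt_bes x).div hd (by simpa using h1)))
  refine this.congr_deriv ?_
  have ho := bes_ode x
  have hb : bes2 x = -bes1 x / x - bes x := by
    field_simp
    linear_combination ho
  unfold besU
  simp only [Pi.add_apply, Pi.div_apply, hb]
  field_simp
  ring

theorem exists_besU_bound : ∃ K : ℝ, 0 ≤ K ∧ ∀ x, 1 ≤ x → ‖besU x‖ ≤ K := by
  set E : ℝ → ℝ := fun x => ‖besU x‖ ^ 2 + ‖besU1 x‖ ^ 2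
  set F : ℝ → ℝ := fun x => E x * Real.exp (1 / (4 * x))
  set E' : ℝ → ℝ := fun x => 2 * inner ℝ (besU x) (besU1 x) +
    2 * inner ℝ (besU1 x) (-besU x - besU x / (4 * x ^ 2))
  have hE : ∀ x, 0 < x → HasDerivAt E (E' x) x := fun x hx =>
    (hasDerivAt_besU hx).norm_sq.add (hasDerivAt_besU1 hx).norm_sq
  have hle : ∀ x, 0 < x → E' x ≤ E x / (4 * x ^ 2) := by
    intro x hx
    have e1 : E' x = -(2 * inner ℝ (besU1 x) (besU x) / (4 * x ^ 2)) := by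
      have : besU x / (4 * (x:ℂ) ^ 2) = (1 / (4 * x ^ 2) : ℝ) • besU x := by
        rw [Complex.real_smul]; push_cast; ring
      simp only [E', this, inner_sub_right, inner_neg_right, real_inner_smul_right,
        real_inner_comm (besU x) (besU1 x)]
      ring
    rw [e1, ← neg_div]
    gcongr
    have := abs_le.1 (abs_real_inner_le_norm (besU1 x) (besU x))
    simp only [E]
    nlinarith [sq_nonneg (‖besU1 x‖ - ‖besU x‖)]
  have hF : ∀ x, 0 < x → HasDerivAt F (E' x * Real.exp (1 / (4 * x)) +
      E x * (Real.exp (1 / (4 * x)) * (-(1 / (4 * x ^ 2))))) x := by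
    intro x hx
    have h1 : HasDerivAt (fun x : ℝ => 1 / (4 * x)) (-(1 / (4 * x ^ 2))) x := by
      have := ((hasDerivAt_id x).const_mul 4).inv (by simpa using hx.ne')
      simp only [id, ← one_div] at this
      refine this.congr_deriv ?_
      field_simp
    exact (hE x hx).mul h1.exp
  have hanti : AntitoneOn F (Ici 1) := by
    refine antitoneOn_of_deriv_nonpos (convex_Ici 1)
      (fun x hx => (hF x (lt_of_lt_of_le one_pos hx)).continuousAt.continuousWithinAt)
      (fun x hx => ?_) fun x hx => ?_
    · rw [interior_Ici] at hx
      exact (hF x (one_pos.trans hx)).differentiableAt.differentiableWithinAt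
    · rw [interior_Ici] at hx
      have hx0 : 0 < x := one_pos.trans hx
      rw [(hF x hx0).deriv]
      have h1 := hle x hx0
      have h2 := Real.exp_pos (1 / (4 * x))
      have : E' x * Real.exp (1 / (4 * x)) + E x * (Real.exp (1 / (4 * x)) * (-(1 / (4 * x ^ 2)))) =
        (E' x - E x / (4 * x ^ 2)) * Real.exp (1 / (4 * x)) := by ring
      rw [this]
      exact mul_nonpos_of_nonpos_of_nonneg (by linarith) h2.le
  refine ⟨√(F 1), Real.sqrt_nonneg _, fun x hx => Real.le_sqrt_of_sq_le ?_⟩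
  refine le_trans ?_ (hanti (mem_Ici.2 le_rfl) (mem_Ici.2 hx) hx)
  have : 1 ≤ Real.exp (1 / (4 * x)) := Real.one_le_exp (by positivity)
  have h0 : 0 ≤ ‖besU1 x‖ ^ 2 := by positivity
  have h1 : 0 ≤ ‖besU x‖ ^ 2 := by positivity
  simp only [F, E]
  nlinarith

theorem hasDerivAt_ec_mul_const (s x : ℝ) :
    HasDerivAt (fun x => ec (s * x)) (ec (s * x) * (Complex.I * s)) x := by
  have := hasDerivAt_ec_comp ((hasDerivAt_id x).const_mul s)
  simpa using this

/-- Convergence with rate of a function with quadratically decaying derivative. -/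
theorem exists_limit_of_deriv_bound {w w' : ℝ → ℂ} {K : ℝ} (hw : ∀ x, 1 ≤ x → HasDerivAt w (w' x) x)
    (hc : ContinuousOn w' (Ici 1)) (hb : ∀ x, 1 ≤ x → ‖w' x‖ ≤ K / x ^ 2) :
    ∃ c : ℂ, ∀ x, 1 ≤ x → ‖w x - c‖ ≤ K / x := by
  have hintg : ∀ x, 1 ≤ x → IntegrableOn (fun x : ℝ => K / x ^ 2) (Ioi x) := by
    intro x hx
    have : IntegrableOn (fun y : ℝ => K * y ^ (-2:ℝ)) (Ioi x) :=
      (integrableOn_Ioi_rpow_of_lt (a := -2) (by norm_num) (lt_of_lt_of_le one_pos hx)).const_mul K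
    refine IntegrableOn.congr_fun this (fun y hy => ?_) measurableSet_Ioi
    have hy : 0 < y := lt_trans (lt_of_lt_of_le one_pos hx) hy
    rw [Real.rpow_neg hy.le, div_eq_mul_inv]
    norm_cast
  have hwint : ∀ x, 1 ≤ x → IntegrableOn w' (Ioi x) := by
    intro x hx
    refine (hintg x hx).mono' ((hc.mono fun y hy => mem_Ici.2 (hx.trans (le_of_lt hy))).aestronglyMeasurable
      measurableSet_Ioi) ?_
    refine (ae_restrict_iff' measurableSet_Ioi).2 (Filter.Eventually.of_forall fun y hy => ?_)
    exact hb y (hx.trans (le_of_lt hy))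
  have hlim := tendsto_limUnder_of_hasDerivAt_of_integrableOn_Ioi (a := 1) (f := w) (f' := w')
    (fun x hx => hw x (le_of_lt hx)) (hwint 1 le_rfl)
  refine ⟨Filter.limUnder Filter.atTop w, fun x hx => ?_⟩
  have hx0 : 0 < x := lt_of_lt_of_le one_pos hx
  have h1 := integral_Ioi_of_hasDerivAt_of_tendsto (hw x hx).continuousAt.continuousWithinAt
    (fun y hy => hw y (hx.trans (le_of_lt hy))) (hwint x hx) hlim
  rw [← norm_neg, neg_sub, ← h1]
  refine (norm_integral_le_of_norm_le (hintg x hx) ?_).trans (le_of_eq ?_)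
  · refine (ae_restrict_iff' measurableSet_Ioi).2 (Filter.Eventually.of_forall fun y hy => ?_)
    exact hb y (hx.trans (le_of_lt hy))
  · have h2 := integral_Ioi_rpow_of_lt (a := -2) (by norm_num) hx0
    have h3 : ∫ y in Ioi x, K / y ^ 2 = ∫ y in Ioi x, K * y ^ (-2 : ℝ) := by
      refine setIntegral_congr_fun measurableSet_Ioi fun y hy => ?_
      have hy : 0 < y := lt_trans hx0 hy
      rw [Real.rpow_neg hy.le, div_eq_mul_inv]
      norm_cast
    rw [h3, integral_const_mul, h2, show (-2:ℝ) + 1 = -1 by norm_num, Real.rpow_neg_one]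
    field_simp

/-- The modulated Bessel function. -/
theorem exists_besU_asymp : ∃ a b : ℂ, ∃ K : ℝ, 0 ≤ K ∧ ∀ x, 1 ≤ x →
    ‖besU x - (a * ec x + b * ec (-x))‖ ≤ K / x := by
  obtain ⟨K, hK0, hK⟩ := exists_besU_bound
  have key : ∀ s : ℝ, s ^ 2 = 1 → ∃ c : ℂ, ∀ x, 1 ≤ x →
      ‖ec (-s * x) * (besU1 x + Complex.I * s * besU x) - c‖ ≤ K / x := by
    intro s hs
    refine exists_limit_of_deriv_bound (w' := fun x => -(ec (-s * x) * (besU x / (4 * x ^ 2)))) ?_ ?_ ?_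
    · intro x hx
      have hx0 : 0 < x := by linarith
      refine ((hasDerivAt_ec_mul_const (-s) x).mul ((hasDerivAt_besU1 hx0).add
        ((hasDerivAt_besU hx0).const_mul (Complex.I * s)))).congr_deriv ?_
      have h1 : (s:ℂ) ^ 2 = 1 := by exact_mod_cast hs
      have h2 := Complex.I_sq
      simp only [Pi.add_apply]
      push_cast
      linear_combination (ec (-s * x) * besU x) * h1 - (ec (-s * x) * besU x * s ^ 2) * h2
    · intro x hx
      have hx0 : 0 < x := lt_of_lt_of_le one_pos hx
      refine ContinuousAt.continuousWithinAt (ContinuousAt.neg (ContinuousAt.mul ?_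
        (ContinuousAt.div (hasDerivAt_besU hx0).continuousAt ?_ ?_)))
      · exact (hasDerivAt_ec_mul_const (-s) x).continuousAt
      · fun_prop
      · have : (x:ℂ) ≠ 0 := by exact_mod_cast hx0.ne'
        simpa using this
    · intro x hx
      have hx0 : 0 < x := by linarith
      rw [norm_neg, norm_mul, norm_ec, one_mul, norm_div, norm_mul, norm_pow, Complex.norm_real,
        Real.norm_of_nonneg hx0.le, Complex.norm_ofNat]
      have := hK x hx
      gcongr
      nlinarith [sq_nonneg x]
  obtain ⟨c, hc⟩ := key 1 (by norm_num)
  obtain ⟨d, hd⟩ := key (-1) (by norm_num)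
  refine ⟨c / (2 * Complex.I), -(d / (2 * Complex.I)), K, hK0, fun x hx => ?_⟩
  have h1 := hc x hx
  have h2 := hd x hx
  simp only [neg_neg, one_mul, neg_mul, Complex.ofReal_one, mul_one, Complex.ofReal_neg, mul_neg] at h1 h2
  have e : ec x * ec (-x) = 1 := by rw [← ec_add, add_neg_cancel, ec_zero]
  have : besU x - (c / (2 * Complex.I) * ec x + -(d / (2 * Complex.I)) * ec (-x)) =
      (2 * Complex.I)⁻¹ * (ec x * (ec (-x) * (besU1 x + Complex.I * besU x) - c) -
        ec (-x) * (ec x * (besU1 x + -(Complex.I * besU x)) - d)) := by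
    have hI := Complex.I_ne_zero
    field_simp
    linear_combination (-(2 * Complex.I * besU x)) * e
  rw [this, norm_mul]
  have h3 : ‖(2 * Complex.I)⁻¹‖ = 1 / 2 := by simp
  rw [h3]
  refine (mul_le_mul_of_nonneg_left (norm_sub_le _ _) (by norm_num)).trans ?_
  rw [norm_mul, norm_mul, norm_ec, norm_ec, one_mul, one_mul]
  linarith

theorem sigmaHat_eq_bes (ξ : ℝ × ℝ) : sigmaHat ξ = bes (enorm2 ξ) := by
  obtain ⟨α, h1, h2⟩ : ∃ α : ℝ, ξ.1 = enorm2 ξ * Real.cos α ∧ ξ.2 = enorm2 ξ * Real.sin α := by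
    refine ⟨Complex.arg ⟨ξ.1, ξ.2⟩, ?_, ?_⟩
    · have := Complex.norm_mul_cos_arg (⟨ξ.1, ξ.2⟩ : ℂ)
      rw [Complex.norm_def, Complex.normSq_mk] at this
      rw [enorm2, pow_two, pow_two]; exact this.symm
    · have := Complex.norm_mul_sin_arg (⟨ξ.1, ξ.2⟩ : ℂ)
      rw [Complex.norm_def, Complex.normSq_mk] at this
      rw [enorm2, pow_two, pow_two]; exact this.symm
  set f : ℝ → ℂ := fun θ => ec (-(enorm2 ξ * Real.cos θ))
  have hf : Function.Periodic f (2 * π) := fun θ => by simp [f, Real.cos_add_two_pi]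
  have e1 : sigmaHat ξ = ∫ θ in (0:ℝ)..(2 * π), f (θ - α) := by
    rw [sigmaHat, intervalIntegral.integral_of_le (by positivity)]
    refine setIntegral_congr_fun measurableSet_Ioc fun θ _ => ?_
    simp only [f, ec, Real.cos_sub]
    conv_lhs => rw [h1, h2]
    congr 1
    push_cast
    ring
  rw [e1, intervalIntegral.integral_comp_sub_right f α]
  have := hf.intervalIntegral_add_eq (0 - α) 0
  rw [show (0 - α) + 2 * π = 2 * π - α by ring, zero_add] at this
  rw [this]
  simp [bes, circInt, f]

theorem norm_sigmaHat_le (ξ : ℝ × ℝ) : ‖sigmaHat ξ‖ ≤ 2 * π := by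
  rw [sigmaHat_eq_bes, bes, circInt]
  have := intervalIntegral.norm_integral_le_of_norm_le_const (a := 0) (b := 2 * π) (C := 1)
    (f := fun θ => (1:ℂ) * ec (-(enorm2 ξ * Real.cos θ))) (fun θ _ => by rw [one_mul, norm_ec])
  rwa [one_mul, sub_zero, abs_of_pos (by positivity)] at this

theorem exists_sigmaHat_asymp : ∃ a b : ℂ, ∃ K : ℝ, 0 ≤ K ∧ ∀ ξ, 1 ≤ enorm2 ξ →
    ‖sigmaHat ξ - (√(enorm2 ξ) : ℂ)⁻¹ * (a * ec (enorm2 ξ) + b * ec (-enorm2 ξ))‖ ≤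
      K * ((√(enorm2 ξ))⁻¹ * (enorm2 ξ)⁻¹) := by
  obtain ⟨a, b, K, hK0, hK⟩ := exists_besU_asymp
  refine ⟨a, b, K, hK0, fun ξ hξ => ?_⟩
  have hs : 0 < √(enorm2 ξ) := Real.sqrt_pos.2 (by linarith)
  have h0 : (√(enorm2 ξ) : ℂ) ≠ 0 := by exact_mod_cast hs.ne'
  have : sigmaHat ξ - (√(enorm2 ξ) : ℂ)⁻¹ * (a * ec (enorm2 ξ) + b * ec (-enorm2 ξ)) =
      (√(enorm2 ξ) : ℂ)⁻¹ * (besU (enorm2 ξ) - (a * ec (enorm2 ξ) + b * ec (-enorm2 ξ))) := by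
    rw [sigmaHat_eq_bes, besU]
    field_simp
  rw [this, norm_mul, norm_inv, Complex.norm_real, Real.norm_of_nonneg hs.le]
  have := hK _ hξ
  calc (√(enorm2 ξ))⁻¹ * ‖besU (enorm2 ξ) - (a * ec (enorm2 ξ) + b * ec (-enorm2 ξ))‖
      ≤ (√(enorm2 ξ))⁻¹ * (K / enorm2 ξ) := by gcongr
    _ = _ := by ring

theorem continuous_sigmaHat : Continuous sigmaHat := by
  rw [show sigmaHat = fun ξ => bes (enorm2 ξ) from funext sigmaHat_eq_bes]
  have : Continuous bes := continuous_iff_continuousAt.2 fun x => (hasDerivAt_bes x).continuousAt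
  exact this.comp continuous_enorm2

theorem lintegral_rpow_le_of_measure {α : Type*} [MeasurableSpace α] {μ : Measure α} {u : α → ℝ≥0∞}
    (hu : AEMeasurable u μ) {q : ℝ} (hq : 1 < q) :
    (∫⁻ x, u x ∂μ) ^ q ≤ μ univ ^ (q - 1) * ∫⁻ x, u x ^ q ∂μ := by
  have h := ENNReal.lintegral_mul_le_Lp_mul_Lq μ (Real.HolderConjugate.conjExponent hq) hu
    (aemeasurable_const (b := (1:ℝ≥0∞)))
  have hq0 : 0 < q := by linarith
  simp only [Pi.mul_apply, mul_one, ENNReal.one_rpow, lintegral_one] at h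
  refine (ENNReal.rpow_le_rpow h hq0.le).trans (le_of_eq ?_)
  rw [ENNReal.mul_rpow_of_nonneg _ _ hq0.le, ← ENNReal.rpow_mul, ← ENNReal.rpow_mul,
    one_div_mul_cancel hq0.ne', ENNReal.rpow_one, mul_comm]
  congr 2
  rw [Real.conjExponent]
  field_simp

/-- The one dimensional Sobolev embedding at scale `lam⁻¹`. -/
theorem sobolev_Ioo {G H : ℝ → ℂ} {lam : ℝ} (hlam : 1 ≤ lam)
    (hG : ∀ t, HasDerivAt G (lam * H t) t) (hH : Continuous H) {q : ℝ} (hq : 1 < q) {t : ℝ}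
    (ht : t ∈ Icc (1:ℝ) 2) :
    ‖G t‖ₑ ^ q ≤ ENNReal.ofReal (2 * lam) * ∫⁻ s in Ioo (1:ℝ) 2, (‖G s‖ₑ + ‖H s‖ₑ) ^ q := by
  have hlam0 : 0 < lam := by linarith
  have hq0 : 0 < q := by linarith
  set l : ℝ := 1 / (2 * lam) with hl
  have hl0 : 0 < l := by positivity
  have hl1 : l ≤ 1 / 2 := by rw [hl, div_le_div_iff₀ (by positivity) (by norm_num)]; linarith
  obtain ⟨a, ha1, ha2, hat, hta⟩ : ∃ a, 1 ≤ a ∧ a + l ≤ 2 ∧ a ≤ t ∧ t ≤ a + l := by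
    rcases le_total t (3 / 2) with h | h
    · exact ⟨t, ht.1, by linarith, le_rfl, by linarith⟩
    · exact ⟨t - l, by linarith, by linarith [ht.2], by linarith, by linarith⟩
  have hGc : Continuous G := continuous_iff_continuousAt.2 fun x => (hG x).continuousAt
  have hGm : Measurable fun s => ‖G s‖ₑ := hGc.measurable.enorm
  have hHm : Measurable fun s => ‖H s‖ₑ := hH.measurable.enorm
  set J := Ioo a (a + l)
  have hJ : volume J = ENNReal.ofReal l := by rw [Real.volume_Ioo, add_sub_cancel_left]
  set D := ∫⁻ s in J, ENNReal.ofReal lam * ‖H s‖ₑ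
  have hpt : ∀ s ∈ J, ‖G t‖ₑ ≤ ‖G s‖ₑ + D := by
    intro s hs
    have h1 : ∫ x in s..t, (lam * H x : ℂ) = G t - G s :=
      intervalIntegral.integral_eq_sub_of_hasDerivAt (fun x _ => hG x)
        ((continuous_const.mul hH).intervalIntegrable _ _)
    have h2 : G t = G s + ∫ x in s..t, (lam * H x : ℂ) := by rw [h1]; ring
    rw [h2]
    refine (enorm_add_le _ _).trans (add_le_add le_rfl ?_)
    rw [← ofReal_norm, intervalIntegral.norm_integral_eq_norm_integral_uIoc,
      ofReal_norm]
    refine (enorm_integral_le_lintegral_enorm _).trans ?_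
    have h3 : ∀ x, ‖(lam:ℂ) * H x‖ₑ = ENNReal.ofReal lam * ‖H x‖ₑ := fun x => by
      rw [enorm_mul, ← ofReal_norm (lam:ℂ), Complex.norm_real, Real.norm_of_nonneg hlam0.le]
    simp_rw [h3]
    simp only [D, J]
    rw [restrict_Ioo_eq_restrict_Ioc]
    refine lintegral_mono_set fun x hx => ?_
    rw [mem_uIoc] at hx
    rcases hx with hx | hx
    · exact ⟨hs.1.trans hx.1, hx.2.trans hta⟩
    · exact ⟨lt_of_le_of_lt hat hx.1, hx.2.trans hs.2.le⟩
  have hav : ‖G t‖ₑ * ENNReal.ofReal l ≤ ∫⁻ s in J, (‖G s‖ₑ + ‖H s‖ₑ) := by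
    calc ‖G t‖ₑ * ENNReal.ofReal l = ∫⁻ s in J, ‖G t‖ₑ := by
          rw [lintegral_const, Measure.restrict_apply_univ, hJ]
      _ ≤ ∫⁻ s in J, (‖G s‖ₑ + D) := setLIntegral_mono (by fun_prop) hpt
      _ = (∫⁻ s in J, ‖G s‖ₑ) + D * ENNReal.ofReal l := by
          rw [lintegral_add_left hGm, lintegral_const, Measure.restrict_apply_univ, hJ]
      _ ≤ (∫⁻ s in J, ‖G s‖ₑ) + ∫⁻ s in J, ‖H s‖ₑ := by
          gcongr
          simp only [D]
          rw [lintegral_const_mul _ hHm, mul_assoc, mul_comm, mul_assoc, ← ENNReal.ofReal_mul hl0.le]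
          refine mul_le_of_le_one_right' (ENNReal.ofReal_le_one.2 ?_)
          rw [hl]; field_simp; norm_num
      _ = ∫⁻ s in J, (‖G s‖ₑ + ‖H s‖ₑ) := (lintegral_add_left hGm _).symm
  have h1 := ENNReal.rpow_le_rpow hav hq0.le
  have h2 := lintegral_rpow_le_of_measure (μ := volume.restrict J)
    (u := fun s => ‖G s‖ₑ + ‖H s‖ₑ) (by fun_prop) hq
  rw [Measure.restrict_apply_univ, hJ] at h2
  rw [ENNReal.mul_rpow_of_nonneg _ _ hq0.le] at h1
  have h3 := h1.trans h2
  have hL0 : ENNReal.ofReal l ≠ 0 := (ENNReal.ofReal_pos.2 hl0).ne'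
  have hLt : ENNReal.ofReal l ≠ ∞ := ENNReal.ofReal_ne_top
  have h4 : ‖G t‖ₑ ^ q ≤ (ENNReal.ofReal l)⁻¹ * ∫⁻ s in J, (‖G s‖ₑ + ‖H s‖ₑ) ^ q := by
    have e1 : ENNReal.ofReal l ^ (q - 1) = ENNReal.ofReal l ^ q * (ENNReal.ofReal l)⁻¹ := by
      rw [ENNReal.rpow_sub _ _ hL0 hLt, ENNReal.rpow_one, div_eq_mul_inv]
    rw [e1, mul_assoc, mul_comm] at h3
    exact (ENNReal.mul_le_mul_iff_right (by simp [hL0, hLt]) (by finiteness)).1 h3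
  refine h4.trans ?_
  have e2 : (ENNReal.ofReal l)⁻¹ = ENNReal.ofReal (2 * lam) := by
    rw [← ENNReal.ofReal_inv_of_pos hl0, hl, one_div, inv_inv]
  rw [e2]
  gcongr
  exact Ioo_subset_Ioo ha1 ha2

theorem lintegral_comp_le_of_deriv {s : Set ℝ} (hs : MeasurableSet s) {f f' : ℝ → ℝ}
    (hf : ∀ x ∈ s, HasDerivAt f (f' x) x) (hinj : InjOn f s) {c : ℝ} (hc0 : 0 ≤ c)
    (hc : ∀ x ∈ s, 1 ≤ c * |f' x|) (H : ℝ → ℝ≥0∞) :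
    ∫⁻ x in s, H (f x) ≤ ENNReal.ofReal c * ∫⁻ y in f '' s, H y := by
  rw [lintegral_image_eq_lintegral_abs_deriv_mul hs (fun x hx => (hf x hx).hasDerivWithinAt) hinj,
    ← lintegral_const_mul' _ _ ENNReal.ofReal_ne_top]
  refine setLIntegral_mono' hs fun x hx => ?_
  rw [← mul_assoc, ← ENNReal.ofReal_mul hc0]
  exact le_mul_of_one_le_left' (ENNReal.one_le_ofReal.2 (hc x hx))

/-- Change of variables `(r, t) ↦ ((r² + t²) / (2 * R), t r / R)`. -/
theorem lintegral_paraboloid_le {R : ℝ} (hR : 39 / 10 ≤ R) {W : ℝ × ℝ → ℝ≥0∞} (hW : Measurable W) :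
    ∫⁻ r in Ico R (2 * R), ∫⁻ t in Ioo (1:ℝ) 2, W ((r ^ 2 + t ^ 2) / (2 * R), t * r / R) ≤
      2 * ∫⁻ ρ, ∫⁻ y, W (y, ρ) := by
  have hR0 : 0 < R := by linarith
  set E : Set (ℝ × ℝ) := {z | z.1 * R / z.2 ∈ Ioo (1:ℝ) 2} with hE
  have hEm : MeasurableSet E := measurableSet_Ioo.preimage (by fun_prop)
  set V : ℝ × ℝ → ℝ≥0∞ := E.indicator fun z => W ((z.2 ^ 2 + (z.1 * R / z.2) ^ 2) / (2 * R), z.1)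
  have hV : Measurable V := (hW.comp (by fun_prop)).indicator hEm
  have h1 : ∀ r ∈ Ico R (2 * R), ∫⁻ t in Ioo (1:ℝ) 2, W ((r ^ 2 + t ^ 2) / (2 * R), t * r / R) ≤
      ∫⁻ ρ, V (ρ, r) := by
    intro r hr
    have hr0 : 0 < r := hR0.trans_le hr.1
    have hd : ∀ t ∈ Ioo (1:ℝ) 2, HasDerivAt (fun t => t * r / R) (r / R) t := fun t _ => by
      simpa using ((hasDerivAt_id t).mul_const r).div_const R
    have e : ∀ t ∈ Ioo (1:ℝ) 2, W ((r ^ 2 + t ^ 2) / (2 * R), t * r / R) ≤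
        (fun ρ => V (ρ, r)) (t * r / R) := by
      intro t ht
      have e1 : t * r / R * R / r = t := by field_simp
      have e2 : (t * r / R, r) ∈ E := by simp only [hE, mem_ofPred_eq, e1]; exact ht
      simp only [V]
      rw [indicator_of_mem e2]
      simp only [e1]
      exact le_rfl
    refine (setLIntegral_mono' measurableSet_Ioo e).trans ?_
    refine (lintegral_comp_le_of_deriv measurableSet_Ioo hd ?_ zero_le_one ?_ (fun ρ => V (ρ, r))).trans ?_
    · intro a _ b _ hab
      simp only at hab
      field_simp at hab
      exact hab
    · intro t _
      rw [one_mul, abs_of_pos (by positivity), le_div_iff₀ hR0]; linarith [hr.1]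
    · rw [ENNReal.ofReal_one, one_mul]
      exact setLIntegral_le_lintegral _ _
  refine (setLIntegral_mono' measurableSet_Ico h1).trans ?_
  rw [lintegral_lintegral_swap (by
    exact (hV.comp (measurable_snd.prodMk measurable_fst)).aemeasurable)]
  rw [← lintegral_const_mul' _ _ (by norm_num)]
  refine lintegral_mono fun ρ => ?_
  set s : Set ℝ := Ico R (2 * R) ∩ {r | ρ * R / r ∈ Ioo (1:ℝ) 2} with hs
  have hs2 : MeasurableSet {r : ℝ | ρ * R / r ∈ Ioo (1:ℝ) 2} :=
    measurableSet_Ioo.preimage (f := fun r => ρ * R / r) (by fun_prop)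
  have hsm : MeasurableSet s := measurableSet_Ico.inter hs2
  set f : ℝ → ℝ := fun r => (r ^ 2 + (ρ * R / r) ^ 2) / (2 * R)
  have h2 : ∫⁻ r in Ico R (2 * R), V (ρ, r) = ∫⁻ r in s, W (f r, ρ) := by
    have : ∀ r, V (ρ, r) = ({r | ρ * R / r ∈ Ioo (1:ℝ) 2} : Set ℝ).indicator (fun r => W (f r, ρ)) r := by
      intro r
      by_cases h : (ρ, r) ∈ E
      · simp only [V]
        rw [indicator_of_mem h, indicator_of_mem (show r ∈ {r | ρ * R / r ∈ Ioo (1:ℝ) 2} from h)]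
      · simp only [V]
        rw [indicator_of_notMem h,
          indicator_of_notMem (show r ∉ {r | ρ * R / r ∈ Ioo (1:ℝ) 2} from h)]
    simp_rw [this]
    rw [lintegral_indicator hs2, Measure.restrict_restrict hs2, inter_comm, hs]
  rw [h2]
  have hs' : ∀ r ∈ s, R ≤ r ∧ 0 < r ∧ 0 < ρ * R / r ∧ ρ * R / r < 2 := fun r hr =>
    ⟨hr.1.1, hR0.trans_le hr.1.1, one_pos.trans hr.2.1, hr.2.2⟩
  refine (lintegral_comp_le_of_deriv (c := 2) hsm (f := f)
    (f' := fun r => (2 * r + 2 * (ρ * R / r) * (-(ρ * R / r ^ 2))) / (2 * R)) ?_ ?_ (by norm_num) ?_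
    fun y => W (y, ρ)).trans ?_
  · intro r hr
    obtain ⟨-, hr0, -, -⟩ := hs' r hr
    have h3 : HasDerivAt (fun r => ρ * R / r) (-(ρ * R / r ^ 2)) r := by
      have := (hasDerivAt_inv hr0.ne').const_mul (ρ * R)
      simp only [← div_eq_mul_inv] at this
      exact this.congr_deriv (by ring)
    exact (((hasDerivAt_pow 2 r).add (h3.pow 2)).div_const (2 * R)).congr_deriv (by
      push_cast; ring)
  · intro a ha b hb hab
    obtain ⟨h3, ha0, ha1, ha2⟩ := hs' a ha
    obtain ⟨h4, hb0, hb1, hb2⟩ := hs' b hb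
    simp only [f] at hab
    rw [div_left_inj' (by positivity)] at hab
    set u := ρ * R / a with hu
    set v := ρ * R / b with hv
    have hub : u * a = v * b := by rw [hu, hv]; field_simp
    have h5 : (b ^ 2 - a ^ 2) * (a ^ 2 - v ^ 2) = 0 := by
      have : (u * a) ^ 2 = (v * b) ^ 2 := by rw [hub]
      linear_combination (-a ^ 2) * hab + this
    have h6 : a ^ 2 - v ^ 2 ≠ 0 := by nlinarith
    have h7 := (mul_eq_zero.1 h5).resolve_right h6
    nlinarith
  · intro r hr
    obtain ⟨h3, hr0, h4, h5⟩ := hs' r hr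
    refine le_trans ?_ (mul_le_mul_of_nonneg_left (le_abs_self _) (by norm_num))
    set u := ρ * R / r
    have e : ρ * R / r ^ 2 = u / r := by simp only [u]; field_simp
    have h6 : u * (u / r) ≤ 2 * (2 / (39 / 10)) := by
      gcongr
      · linarith
    simp only [e]
    rw [← mul_div_assoc, le_div_iff₀ (by positivity)]
    nlinarith
  · rw [show ENNReal.ofReal 2 = 2 by simp]
    gcongr
    exact Measure.restrict_le_self

/-- A smooth cutoff to the disc of radius `2`, equal to `1` on the unit disc. -/
def lowCut (ξ : ℝ × ℝ) : ℝ := smoothTransition ((4 - (ξ.1 ^ 2 + ξ.2 ^ 2)) / 3)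

theorem lowCut_contDiff : ContDiff ℝ (⊤ : ℕ∞) lowCut :=
  (smoothTransition.contDiff (n := (⊤ : ℕ∞))).comp (by fun_prop)

theorem lowCut_eq_one {ξ : ℝ × ℝ} (h : ξ.1 ^ 2 + ξ.2 ^ 2 ≤ 1) : lowCut ξ = 1 :=
  smoothTransition.one_of_one_le (by linarith)

theorem lowCut_eq_zero {ξ : ℝ × ℝ} (h : 4 ≤ ξ.1 ^ 2 + ξ.2 ^ 2) : lowCut ξ = 0 :=
  smoothTransition.zero_of_nonpos (by linarith)

theorem lowCut_nonneg (ξ : ℝ × ℝ) : 0 ≤ lowCut ξ := smoothTransition.nonneg _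

theorem lowCut_le_one (ξ : ℝ × ℝ) : lowCut ξ ≤ 1 := smoothTransition.le_one _

theorem lowCut_eq_zero_of_norm {ξ : ℝ × ℝ} (h : 2 < ‖ξ‖) : lowCut ξ = 0 := by
  refine lowCut_eq_zero ?_
  rw [Prod.norm_def, Real.norm_eq_abs, Real.norm_eq_abs, lt_max_iff] at h
  rcases h with h | h
  · nlinarith [sq_abs ξ.1, sq_nonneg ξ.2]
  · nlinarith [sq_abs ξ.2, sq_nonneg ξ.1]

/-- The Littlewood-Paley bump associated with `lowCut`. -/
def annCut (ξ : ℝ × ℝ) : ℝ := lowCut (ξ.1 / 2, ξ.2 / 2) - lowCut ξ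

theorem isAnnAmp_annCut : IsAnnAmp fun ξ => (annCut ξ : ℂ) := by
  refine ⟨Complex.ofRealCLM.contDiff.comp (ContDiff.sub (lowCut_contDiff.comp (by fun_prop))
    lowCut_contDiff), fun ξ h => ?_⟩
  by_contra hc
  apply h
  simp only [annCut, Complex.ofReal_eq_zero]
  rcases lt_or_ge (ξ.1 ^ 2 + ξ.2 ^ 2) (1 / 9) with h1 | h1
  · rw [lowCut_eq_one (by simp only; nlinarith), lowCut_eq_one (by linarith), sub_self]
  · have h2 : 64 < ξ.1 ^ 2 + ξ.2 ^ 2 := by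
      by_contra h2; exact hc ⟨h1, not_lt.1 h2⟩
    rw [lowCut_eq_zero (by simp only; nlinarith), lowCut_eq_zero (by linarith), sub_self]

theorem one_le_of_annCut_ne_zero {ξ : ℝ × ℝ} (h : annCut ξ ≠ 0) : 1 ≤ ξ.1 ^ 2 + ξ.2 ^ 2 := by
  by_contra hc
  apply h
  rw [annCut, lowCut_eq_one (by simp only; nlinarith), lowCut_eq_one (by linarith), sub_self]

theorem lowCut_eq_sum (J : ℕ) (ξ : ℝ × ℝ) : lowCut (ξ.1 / 2 ^ J, ξ.2 / 2 ^ J) =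
    lowCut ξ + ∑ j ∈ Finset.range J, annCut (ξ.1 / 2 ^ j, ξ.2 / 2 ^ j) := by
  induction J with
  | zero => simp
  | succ J ih =>
    rw [Finset.sum_range_succ, ← add_assoc, ← ih, annCut]
    simp only [div_div, ← pow_succ]
    ring

theorem continuous_lowCut_dil (L : ℝ) :
    Continuous fun ξ : ℝ × ℝ => (lowCut (ξ.1 / L, ξ.2 / L) : ℂ) :=
  Complex.continuous_ofReal.comp (lowCut_contDiff.continuous.comp (by fun_prop))

theorem integrable_lowCut_dil {L : ℝ} (hL : 0 < L) :
    Integrable fun ξ : ℝ × ℝ => (lowCut (ξ.1 / L, ξ.2 / L) : ℂ) := by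
  refine (continuous_lowCut_dil L).integrable_of_hasCompactSupport ?_
  refine HasCompactSupport.intro (isCompact_closedBall (0 : ℝ × ℝ) (2 * L)) fun ξ hξ => ?_
  rw [mem_closedBall_zero_iff, not_le] at hξ
  rw [lowCut_eq_zero_of_norm, Complex.ofReal_zero]
  have : (ξ.1 / L, ξ.2 / L) = L⁻¹ • ξ := by ext <;> simp [div_eq_inv_mul]
  rw [this, norm_smul, norm_inv, Real.norm_of_nonneg hL.le, ← div_eq_inv_mul, lt_div_iff₀ hL]
  exact hξ

/-- The frequency localised spherical mean. -/
def sphOp (b f : ℝ × ℝ → ℂ) (y : ℝ × ℝ) (ρ : ℝ) : ℂ :=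
  ∫ ξ, ec (dot2 y ξ) * sigmaHat (ρ * ξ.1, ρ * ξ.2) * (b ξ * ft2 f ξ)

theorem continuous_mult (y : ℝ × ℝ) (ρ : ℝ) :
    Continuous fun ξ : ℝ × ℝ => ec (dot2 y ξ) * sigmaHat (ρ * ξ.1, ρ * ξ.2) :=
  (continuous_ec.comp (continuous_const.dot2 continuous_id)).mul (continuous_sigmaHat.comp (by fun_prop))

theorem norm_mult_le (y : ℝ × ℝ) (ρ : ℝ) (ξ : ℝ × ℝ) :
    ‖ec (dot2 y ξ) * sigmaHat (ρ * ξ.1, ρ * ξ.2)‖ ≤ 2 * π := by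
  rw [norm_mul, norm_ec, one_mul]; exact norm_sigmaHat_le _

theorem continuous_ft2 {f : ℝ × ℝ → ℂ} (hf : Integrable f) : Continuous (ft2 f) := by
  refine continuous_of_dominated (bound := fun y => ‖f y‖) (fun ξ => ?_) (fun ξ => ?_) hf.norm ?_
  · exact (Continuous.aestronglyMeasurable (by fun_prop)).mul hf.aestronglyMeasurable
  · refine Filter.Eventually.of_forall fun y => ?_
    rw [norm_mul, norm_exp_neg_I_mul, one_mul]
  · exact Filter.Eventually.of_forall fun y => by fun_prop

theorem integrable_mul_ft2 {b f : ℝ × ℝ → ℂ} (hb : Integrable b) (hf : Integrable f) :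
    Integrable fun ξ => b ξ * ft2 f ξ :=
  hb.mul_bdd (c := ∫ x, ‖f x‖) (continuous_ft2 hf).aestronglyMeasurable
    (Filter.Eventually.of_forall (norm_ft2_le f))

theorem integrable_sphOp {b f : ℝ × ℝ → ℂ} (hb : Integrable b) (hf : Integrable f) (y : ℝ × ℝ) (ρ : ℝ) :
    Integrable fun ξ => ec (dot2 y ξ) * sigmaHat (ρ * ξ.1, ρ * ξ.2) * (b ξ * ft2 f ξ) :=
  (integrable_mul_ft2 hb hf).bdd_mul (c := 2 * π) (continuous_mult y ρ).aestronglyMeasurable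
    (Filter.Eventually.of_forall (norm_mult_le y ρ))

theorem norm_sphOp_le {b f : ℝ × ℝ → ℂ} (hb : Integrable b) (y : ℝ × ℝ) (ρ : ℝ) :
    ‖sphOp b f y ρ‖ ≤ 2 * π * (∫ ξ, ‖b ξ‖) * ∫ x, ‖f x‖ := by
  rw [mul_assoc, mul_comm (∫ ξ, ‖b ξ‖), ← mul_assoc, ← integral_const_mul]
  refine norm_integral_le_of_norm_le (hb.norm.const_mul _) (Filter.Eventually.of_forall fun ξ => ?_)
  rw [norm_mul, norm_mul (b ξ), mul_comm ‖b ξ‖, ← mul_assoc]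
  gcongr
  · exact norm_mult_le y ρ ξ
  · exact norm_ft2_le f ξ

theorem ft2_integrand_integrable {f : ℝ × ℝ → ℂ} (hf : Integrable f) (ξ : ℝ × ℝ) : Integrable fun y : ℝ × ℝ =>
    Complex.exp (-(Complex.I) * ((y.1 * ξ.1 + y.2 * ξ.2 : ℝ) : ℂ)) * f y :=
  hf.bdd_mul (c := 1) (Continuous.aestronglyMeasurable (by fun_prop))
    (Filter.Eventually.of_forall fun y => (norm_exp_neg_I_mul _).le)

theorem ft2_add {f g : ℝ × ℝ → ℂ} (hf : Integrable f) (hg : Integrable g) (ξ : ℝ × ℝ) :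
    ft2 (fun x => f x + g x) ξ = ft2 f ξ + ft2 g ξ := by
  simp only [ft2, mul_add]
  exact integral_add (ft2_integrand_integrable hf ξ) (ft2_integrand_integrable hg ξ)

theorem sphOp_add {b f g : ℝ × ℝ → ℂ} (hb : Integrable b) (hf : Integrable f) (hg : Integrable g)
    (y : ℝ × ℝ) (ρ : ℝ) : sphOp b (fun x => f x + g x) y ρ = sphOp b f y ρ + sphOp b g y ρ := by
  simp only [sphOp]
  rw [← integral_add (integrable_sphOp hb hf y ρ) (integrable_sphOp hb hg y ρ)]
  refine integral_congr_ae (Filter.Eventually.of_forall fun ξ => ?_)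
  simp only [ft2_add hf hg]
  ring

theorem ft2_zero (ξ : ℝ × ℝ) : ft2 (fun _ => 0) ξ = 0 := by simp [ft2]

theorem sphOp_sum {ι : Type*} (s : Finset ι) {b : ℝ × ℝ → ℂ} {f : ι → ℝ × ℝ → ℂ} (hb : Integrable b)
    (hf : ∀ i ∈ s, Integrable (f i)) (y : ℝ × ℝ) (ρ : ℝ) :
    sphOp b (fun x => ∑ i ∈ s, f i x) y ρ = ∑ i ∈ s, sphOp b (f i) y ρ := by
  classical
  induction s using Finset.induction_on with
  | empty => simp [sphOp, ft2_zero]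
  | insert i s hi ih =>
    simp_rw [Finset.sum_insert hi]
    rw [sphOp_add hb (hf i (Finset.mem_insert_self _ _))
      (integrable_finsetSum _ fun j hj => hf j (Finset.mem_insert_of_mem hj)),
      ih fun j hj => hf j (Finset.mem_insert_of_mem hj)]

theorem ft2_const_mul (c : ℂ) (f : ℝ × ℝ → ℂ) (ξ : ℝ × ℝ) :
    ft2 (fun x => c * f x) ξ = c * ft2 f ξ := by
  simp only [ft2]
  rw [← integral_const_mul]
  congr 1; ext x; ring

theorem sphOp_const_mul (c : ℂ) (b f : ℝ × ℝ → ℂ) (y : ℝ × ℝ) (ρ : ℝ) :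
    sphOp b (fun x => c * f x) y ρ = c * sphOp b f y ρ := by
  simp only [sphOp, ft2_const_mul]
  rw [← integral_const_mul]
  congr 1; ext x; ring

theorem integral_mul_ft2 {c f : ℝ × ℝ → ℂ} (hc : Integrable c) (hf : Integrable f) :
    ∫ ξ, c ξ * ft2 f ξ = ∫ u, (∫ ξ, ec (-dot2 u ξ) * c ξ) * f u := by
  calc ∫ ξ, c ξ * ft2 f ξ = ∫ ξ, ∫ u, ec (-dot2 u ξ) * c ξ * f u := by
        refine integral_congr_ae (Filter.Eventually.of_forall fun ξ => ?_)
        simp only [ft2]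
        rw [← integral_const_mul]
        refine integral_congr_ae (Filter.Eventually.of_forall fun u => ?_)
        simp only [ec, dot2]
        rw [mul_comm (Complex.exp _) (c ξ), mul_assoc]
        congr 3; push_cast; ring
    _ = ∫ u, ∫ ξ, ec (-dot2 u ξ) * c ξ * f u := by
        rw [integral_integral_swap]
        have hI : Integrable (fun p : (ℝ × ℝ) × (ℝ × ℝ) => c p.1 * f p.2)
            ((volume : Measure (ℝ × ℝ)).prod (volume : Measure (ℝ × ℝ))) := hc.mul_prod hf
        have hcont : Continuous fun p : (ℝ × ℝ) × (ℝ × ℝ) => ec (-dot2 p.2 p.1) :=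
          continuous_ec.comp (continuous_snd.dot2 continuous_fst).neg
        refine (hI.bdd_mul (c := 1) hcont.aestronglyMeasurable (Filter.Eventually.of_forall fun p => by
          rw [norm_ec])).congr (Filter.Eventually.of_forall fun p => ?_)
        simp only [Function.uncurry]; ring
    _ = _ := by
        refine integral_congr_ae (Filter.Eventually.of_forall fun u => ?_)
        simp only
        rw [integral_mul_const]

theorem sigmaHat_eq_ec (ξ : ℝ × ℝ) :
    sigmaHat ξ = ∫ θ in Ioc (0:ℝ) (2 * π), ec (-dot2 (Real.cos θ, Real.sin θ) ξ) := by
  rw [sigmaHat]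
  congr 1; ext θ
  simp only [ec, dot2]
  congr 1; push_cast; ring

/-- The kernel of the frequency localised spherical mean. -/
theorem integral_ec_mul_sigmaHat {b : ℝ × ℝ → ℂ} (hb : Integrable b) (v : ℝ × ℝ) (ρ : ℝ) :
    ∫ ξ, ec (dot2 v ξ) * sigmaHat (ρ * ξ.1, ρ * ξ.2) * b ξ = ∫ θ in Ioc (0:ℝ) (2 * π),
      ∫ ξ, ec (dot2 (v.1 - ρ * Real.cos θ, v.2 - ρ * Real.sin θ) ξ) * b ξ := by
  calc _ = ∫ ξ, ∫ θ in Ioc (0:ℝ) (2 * π),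
        ec (dot2 (v.1 - ρ * Real.cos θ, v.2 - ρ * Real.sin θ) ξ) * b ξ := by
        refine integral_congr_ae (Filter.Eventually.of_forall fun ξ => ?_)
        simp only [sigmaHat_eq_ec]
        rw [← integral_const_mul, ← integral_mul_const]
        congr 1; ext θ
        rw [← ec_add]
        simp only [dot2]
        congr 2; ring
    _ = _ := by
        rw [integral_integral_swap]
        have hI : Integrable (fun p : (ℝ × ℝ) × ℝ => b p.1 * (1:ℂ))
            ((volume : Measure (ℝ × ℝ)).prod (volume.restrict (Ioc (0:ℝ) (2 * π)))) :=
          hb.mul_prod (integrable_const _)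
        have hcont : Continuous fun p : (ℝ × ℝ) × ℝ =>
            ec (dot2 (v.1 - ρ * Real.cos p.2, v.2 - ρ * Real.sin p.2) p.1) :=
          continuous_ec.comp (Continuous.dot2 (by fun_prop) continuous_fst)
        refine (hI.bdd_mul (c := 1) hcont.aestronglyMeasurable (Filter.Eventually.of_forall fun p => by
          rw [norm_ec])).congr (Filter.Eventually.of_forall fun p => ?_)
        simp only [Function.uncurry]; ring

theorem exists_lowCut_kernel_bound : ∃ C : ℝ, 0 ≤ C ∧ ∀ L : ℝ, 1 ≤ L → ∀ w : ℝ × ℝ,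
    1 ≤ |w.1| ∨ 1 ≤ |w.2| → ‖∫ ξ, ec (dot2 w ξ) * (lowCut (ξ.1 / L, ξ.2 / L) : ℂ)‖ ≤ C / L := by
  have ha : ContDiff ℝ (⊤ : ℕ∞) fun z : ℝ × ℝ × ℝ => (lowCut z.2 : ℂ) :=
    Complex.ofRealCLM.contDiff.comp (lowCut_contDiff.comp contDiff_snd)
  have h0 : ∀ (u : ℝ) (w : ℝ × ℝ), 2 < ‖w‖ → (lowCut (u, w).2 : ℂ) = 0 := fun u w hw => by
    rw [lowCut_eq_zero_of_norm hw, Complex.ofReal_zero]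
  obtain ⟨C₁, hC₁, h1⟩ := osc_decay (isCompact_singleton (x := (0:ℝ)))
    (Φ := fun _ => 0) contDiff_const (1, 0) 2 3 ha h0
  obtain ⟨C₂, hC₂, h2⟩ := osc_decay (isCompact_singleton (x := (0:ℝ)))
    (Φ := fun _ => 0) contDiff_const (0, 1) 2 3 ha h0
  refine ⟨C₁ + C₂, by positivity, fun L hL w hw => ?_⟩
  have hL0 : 0 < L := by linarith
  set B := ∫ ξ, ec (dot2 (L * w.1, L * w.2) ξ) * (lowCut ξ : ℂ)
  have e1 : ∫ ξ, ec (dot2 w ξ) * (lowCut (ξ.1 / L, ξ.2 / L) : ℂ) = ((L ^ 2 : ℝ) : ℂ) * B := by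
    have := integral_comp_aff (a := L⁻¹) (b := 0) (c := 0) (d := L⁻¹) (by simp [hL0.ne']) 0 0
      (F := fun ξ => ec (dot2 (L * w.1, L * w.2) ξ) * (lowCut ξ : ℂ))
      (((continuous_ec.comp (continuous_const.dot2 continuous_id)).mul
        (Complex.continuous_ofReal.comp lowCut_contDiff.continuous)).aestronglyMeasurable)
    rw [show |L⁻¹ * L⁻¹ - 0 * 0|⁻¹ = L ^ 2 by
      rw [mul_zero, sub_zero, abs_of_pos (by positivity)]; field_simp, Complex.real_smul] at this
    rw [← this]
    refine integral_congr_ae (Filter.Eventually.of_forall fun ξ => ?_)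
    simp only [aff, dot2, zero_mul, add_zero, zero_add]
    congr 2
    · field_simp
    · congr 2 <;> rw [div_eq_inv_mul]
  have hB : ‖B‖ ≤ (C₁ + C₂) / L ^ 3 := by
    rw [le_div_iff₀ (by positivity)]
    have k1 := h1 0 rfl 0 (L * w.1, L * w.2)
    have k2 := h2 0 rfl 0 (L * w.1, L * w.2)
    simp only [dot2, mul_one, mul_zero, add_zero, zero_add, abs_zero, one_pow, abs_mul,
      abs_of_pos hL0, mul_pow] at k1 k2
    have hBn : 0 ≤ ‖B‖ := norm_nonneg _
    have hL3 : 0 < L ^ 3 := by positivity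
    rcases hw with hw | hw
    · have : 1 ≤ |w.1| ^ 3 := one_le_pow₀ hw
      calc ‖B‖ * L ^ 3 ≤ ‖B‖ * L ^ 3 * |w.1| ^ 3 := le_mul_of_one_le_right (by positivity) this
        _ = L ^ 3 * |w.1| ^ 3 * ‖B‖ := by ring
        _ ≤ C₁ := k1
        _ ≤ _ := by linarith
    · have : 1 ≤ |w.2| ^ 3 := one_le_pow₀ hw
      calc ‖B‖ * L ^ 3 ≤ ‖B‖ * L ^ 3 * |w.2| ^ 3 := le_mul_of_one_le_right (by positivity) this
        _ = L ^ 3 * |w.2| ^ 3 * ‖B‖ := by ring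
        _ ≤ C₂ := k2
        _ ≤ _ := by linarith
  rw [e1, norm_mul, Complex.norm_real, Real.norm_of_nonneg (by positivity)]
  calc L ^ 2 * ‖B‖ ≤ L ^ 2 * ((C₁ + C₂) / L ^ 3) := by gcongr
    _ = _ := by field_simp

/-- Functions supported far from `y` contribute negligibly. -/
theorem exists_sphOp_far_bound : ∃ C : ℝ, 0 ≤ C ∧ ∀ L : ℝ, 1 ≤ L → ∀ f : ℝ × ℝ → ℂ, Integrable f →
    (∀ u ∈ Icc (-16:ℝ) 16 ×ˢ Icc (-16:ℝ) 16, f u = 0) → ∀ (y : ℝ × ℝ) (ρ : ℝ), |y.1| ≤ 10 → |y.2| ≤ 10 →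
    |ρ| ≤ 4 →
    ‖sphOp (fun ξ => (lowCut (ξ.1 / L, ξ.2 / L) : ℂ)) f y ρ‖ ≤ C / L * ∫ x, ‖f x‖ := by
  obtain ⟨C, hC0, hC⟩ := exists_lowCut_kernel_bound
  refine ⟨2 * π * C, by positivity, fun L hL f hf hfs y ρ hy1 hy2 hρ => ?_⟩
  have hL0 : 0 < L := by linarith
  have hb := integrable_lowCut_dil hL0
  have hm : Integrable fun ξ : ℝ × ℝ => ec (dot2 y ξ) * sigmaHat (ρ * ξ.1, ρ * ξ.2) *
      (lowCut (ξ.1 / L, ξ.2 / L) : ℂ) := hb.bdd_mul (c := 2 * π) (continuous_mult y ρ).aestronglyMeasurable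
    (Filter.Eventually.of_forall (norm_mult_le y ρ))
  have e1 : sphOp (fun ξ => (lowCut (ξ.1 / L, ξ.2 / L) : ℂ)) f y ρ =
      ∫ u, (∫ ξ, ec (dot2 (y - u) ξ) * sigmaHat (ρ * ξ.1, ρ * ξ.2) *
        (lowCut (ξ.1 / L, ξ.2 / L) : ℂ)) * f u := by
    simp only [sphOp, ← mul_assoc]
    rw [integral_mul_ft2 hm hf]
    refine integral_congr_ae (Filter.Eventually.of_forall fun u => ?_)
    simp only
    congr 2; ext ξ
    rw [show dot2 (y - u) ξ = -dot2 u ξ + dot2 y ξ by simp only [dot2, Prod.fst_sub, Prod.snd_sub]; ring,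
      ec_add]
    ring
  rw [e1, ← integral_const_mul]
  refine norm_integral_le_of_norm_le (hf.norm.const_mul _) (Filter.Eventually.of_forall fun u => ?_)
  by_cases hu : f u = 0
  · simp [hu]
  rw [norm_mul]
  gcongr
  rw [integral_ec_mul_sigmaHat hb]
  have hk : ∀ θ ∈ Ioc (0:ℝ) (2 * π), ‖∫ ξ, ec (dot2 ((y - u).1 - ρ * Real.cos θ, (y - u).2 -
      ρ * Real.sin θ) ξ) * (lowCut (ξ.1 / L, ξ.2 / L) : ℂ)‖ ≤ C / L := by
    intro θ _
    refine hC L hL _ ?_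
    by_contra hcon
    push Not at hcon
    apply hu
    apply hfs
    obtain ⟨k1, k2⟩ := hcon
    have k3 : |ρ * Real.cos θ| ≤ 4 := by
      rw [abs_mul]; nlinarith [abs_nonneg ρ, abs_nonneg (Real.cos θ), Real.abs_cos_le_one θ]
    have k4 : |ρ * Real.sin θ| ≤ 4 := by
      rw [abs_mul]; nlinarith [abs_nonneg ρ, abs_nonneg (Real.sin θ), Real.abs_sin_le_one θ]
    rw [abs_lt] at k1 k2
    rw [abs_le] at k3 k4 hy1 hy2
    simp only [Prod.fst_sub, Prod.snd_sub] at k1 k2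
    exact ⟨⟨by linarith, by linarith⟩, ⟨by linarith, by linarith⟩⟩
  have := norm_setIntegral_le_of_norm_le_const (μ := volume) (s := Ioc (0:ℝ) (2 * π))
    measure_Ioc_lt_top hk
  refine this.trans (le_of_eq ?_)
  rw [Real.volume_real_Ioc_of_le (by positivity)]
  ring

theorem ENNReal.add3_rpow_le (a b c : ℝ≥0∞) {q : ℝ} (hq : 0 < q) :
    (a + b + c) ^ q ≤ 3 ^ q * (a ^ q + b ^ q + c ^ q) := by
  simpa [Fin.sum_univ_three] using ENNReal.sum_rpow_le Finset.univ ![a, b, c] hq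

theorem enorm2_smul {c : ℝ} (hc : 0 ≤ c) (ξ : ℝ × ℝ) : enorm2 (c * ξ.1, c * ξ.2) = c * enorm2 ξ := by
  rw [enorm2, enorm2, show (c * ξ.1) ^ 2 + (c * ξ.2) ^ 2 = c ^ 2 * (ξ.1 ^ 2 + ξ.2 ^ 2) by ring,
    Real.sqrt_mul (sq_nonneg c), Real.sqrt_sq hc]

theorem enorm2_div {c : ℝ} (hc : 0 < c) (ξ : ℝ × ℝ) : enorm2 (ξ.1 / c, ξ.2 / c) = enorm2 ξ / c := by
  rw [div_eq_inv_mul, div_eq_inv_mul, div_eq_inv_mul, enorm2_smul (by positivity)]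

theorem enorm2_contDiffAt {ξ : ℝ × ℝ} (h : ξ ≠ 0) : ContDiffAt ℝ (⊤ : ℕ∞) enorm2 ξ := by
  have : ContDiffAt ℝ (⊤ : ℕ∞) (fun ξ : ℝ × ℝ => ξ.1 ^ 2 + ξ.2 ^ 2) ξ := by fun_prop
  exact this.sqrt (sq_add_sq_pos h).ne'

theorem enorm2_pos {ξ : ℝ × ℝ} (h : ξ ≠ 0) : 0 < enorm2 ξ := Real.sqrt_pos.2 (sq_add_sq_pos h)

/-- The principal amplitude of the localised spherical mean. -/
def mainAmp (ξ : ℝ × ℝ) : ℂ := (annCut ξ : ℂ) * (((√(enorm2 ξ))⁻¹ : ℝ) : ℂ)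

theorem isAnnAmp_mainAmp : IsAnnAmp mainAmp := by
  refine isAnnAmp_annCut.mul_smooth fun ξ h => ?_
  refine Complex.ofRealCLM.contDiff.contDiffAt.comp ξ (ContDiffAt.inv ?_ ?_)
  · exact (enorm2_contDiffAt h).sqrt (enorm2_pos h).ne'
  · exact (Real.sqrt_pos.2 (enorm2_pos h)).ne'

theorem lintegral_ft2_le : ∃ C : ℝ≥0∞, C ≠ ∞ ∧ ∀ {lam : ℝ}, 1 ≤ lam → ∀ {g : ℝ × ℝ → ℂ},
    Integrable g → Measurable g → ∫⁻ ξ in Icc (-(16 * lam)) (16 * lam) ×ˢ Icc (-(16 * lam)) (16 * lam),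
      ‖ft2 g ξ‖ₑ ≤ C * ENNReal.ofReal lam * (∫⁻ x, ‖g x‖ₑ ^ 2) ^ (1 / 2 : ℝ) := by
  obtain ⟨C, hC, h⟩ := exists_bessel
  refine ⟨32 * C ^ (1 / 2 : ℝ), by finiteness, fun {lam} hlam {g} hg hgm => ?_⟩
  have hlam0 : 0 < lam := by linarith
  set Q := Icc (-(16 * lam)) (16 * lam) ×ˢ Icc (-(16 * lam)) (16 * lam)
  have h1 := lintegral_rpow_le_of_measure (μ := (volume : Measure (ℝ × ℝ)).restrict Q)
    (u := fun ξ => ‖ft2 g ξ‖ₑ) (measurable_ft2 hgm).enorm.aemeasurable (q := 2) (by norm_num)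
  have hvol : (volume : Measure (ℝ × ℝ)) Q = ENNReal.ofReal (32 * lam) * ENNReal.ofReal (32 * lam) := by
    simp only [Q]
    rw [Measure.volume_eq_prod, Measure.prod_prod, Real.volume_Icc]
    congr 2 <;> ring
  rw [Measure.restrict_apply_univ, hvol] at h1
  have h2 := h (16 * lam) (by positivity) g hg hgm
  have h32 : ENNReal.ofReal (32 * lam) = 32 * ENNReal.ofReal lam := by
    rw [ENNReal.ofReal_mul (by norm_num)]; norm_num
  norm_num [h32] at h1
  have h3 : (∫⁻ ξ in Q, ‖ft2 g ξ‖ₑ) ^ 2 ≤ (32 * ENNReal.ofReal lam) ^ 2 * (C * ∫⁻ x, ‖g x‖ₑ ^ 2) := by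
    rw [pow_two (32 * ENNReal.ofReal _)]
    exact h1.trans (by gcongr)
  have h4 := ENNReal.rpow_le_rpow h3 (z := 1 / 2) (by norm_num)
  rw [ENNReal.mul_rpow_of_nonneg _ _ (by norm_num), ENNReal.mul_rpow_of_nonneg _ _ (by norm_num),
    ← ENNReal.rpow_natCast, ← ENNReal.rpow_mul, ← ENNReal.rpow_natCast, ← ENNReal.rpow_mul] at h4
  norm_num at h4
  refine h4.trans (le_of_eq ?_)
  ring

/-- Pointwise asymptotics of the localised spherical mean. -/
theorem exists_sphOp_asymp : ∃ K : ℝ≥0∞, K ≠ ∞ ∧ ∀ {lam : ℝ}, 1 ≤ lam → ∀ {g : ℝ × ℝ → ℂ},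
    Integrable g → Measurable g → ∀ (y : ℝ × ℝ) (ρ : ℝ), 1 ≤ ρ →
    ‖sphOp (fun ξ => (annCut (ξ.1 / lam, ξ.2 / lam) : ℂ)) g y ρ‖ₑ ≤
      K * ENNReal.ofReal lam ^ (-(1 / 2) : ℝ) * (‖waveOp mainAmp lam g (y.1, y.2, ρ)‖ₑ +
        ‖waveOp mainAmp lam g (y.1, y.2, -ρ)‖ₑ + (∫⁻ x, ‖g x‖ₑ ^ 2) ^ (1 / 2 : ℝ)) := by
  obtain ⟨a, b, K, hK0, hK⟩ := exists_sigmaHat_asymp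
  obtain ⟨C, hC, hft⟩ := lintegral_ft2_le
  refine ⟨‖a‖ₑ + ‖b‖ₑ + ENNReal.ofReal K * C, by finiteness, fun {lam} hlam {g} hg hgm y ρ hρ => ?_⟩
  have hlam0 : 0 < lam := by linarith
  have hρ0 : 0 < ρ := by linarith
  set s : ℝ := (√ρ)⁻¹ * (√lam)⁻¹ with hs
  have hs0 : 0 ≤ s := by positivity
  have hs1 : s ≤ (√lam)⁻¹ := by
    rw [hs]; exact mul_le_of_le_one_left (by positivity) (inv_le_one_of_one_le₀ (Real.one_le_sqrt.2 hρ))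
  have hA := isAnnAmp_mainAmp
  set E : ℝ × ℝ → ℂ := fun ξ => sigmaHat (ρ * ξ.1, ρ * ξ.2) -
    (√(ρ * enorm2 ξ) : ℂ)⁻¹ * (a * ec (ρ * enorm2 ξ) + b * ec (-(ρ * enorm2 ξ)))
  have hpos : ∀ ξ : ℝ × ℝ, annCut (ξ.1 / lam, ξ.2 / lam) ≠ 0 → lam ≤ enorm2 ξ := by
    intro ξ h
    have := one_le_of_annCut_ne_zero h
    have h2 : 1 ≤ enorm2 (ξ.1 / lam, ξ.2 / lam) := by
      rw [enorm2]; exact Real.one_le_sqrt.2 this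
    rwa [enorm2_div hlam0, le_div_iff₀ hlam0, one_mul] at h2
  have hE : ∀ ξ : ℝ × ℝ, annCut (ξ.1 / lam, ξ.2 / lam) ≠ 0 → ‖E ξ‖ ≤ K * ((√lam)⁻¹ * lam⁻¹) := by
    intro ξ h
    have h1 := hpos ξ h
    have h2 := hK (ρ * ξ.1, ρ * ξ.2) (by rw [enorm2_smul hρ0.le]; nlinarith)
    rw [enorm2_smul hρ0.le] at h2
    refine h2.trans ?_
    have h3 : lam ≤ ρ * enorm2 ξ := by nlinarith
    have h4 : (√(ρ * enorm2 ξ))⁻¹ ≤ (√lam)⁻¹ :=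
      inv_anti₀ (Real.sqrt_pos.2 hlam0) (Real.sqrt_le_sqrt h3)
    exact mul_le_mul_of_nonneg_left (mul_le_mul h4 (inv_anti₀ hlam0 h3)
      (inv_nonneg.2 (hlam0.le.trans h3)) (by positivity)) hK0
  have hamp : ∀ ξ : ℝ × ℝ, (√(ρ * enorm2 ξ) : ℂ)⁻¹ * (annCut (ξ.1 / lam, ξ.2 / lam) : ℂ) =
      (s : ℂ) * mainAmp (ξ.1 / lam, ξ.2 / lam) := by
    intro ξ
    simp only [mainAmp]
    rw [enorm2_div hlam0, Real.sqrt_div' _ hlam0.le, Real.sqrt_mul hρ0.le, hs]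
    have : (√lam : ℂ) ≠ 0 := by exact_mod_cast (Real.sqrt_pos.2 hlam0).ne'
    push_cast
    field_simp
  have hI1 : ∀ σ : ℝ, Integrable fun ξ : ℝ × ℝ => mainAmp (ξ.1 / lam, ξ.2 / lam) * ft2 g ξ *
      ec (dot3 (y.1, y.2, σ) (coneMap ξ)) := fun σ =>
    (hA.integrable_dil_mul hlam hgm).mul_bdd (c := 1)
      (continuous_ec.comp (by unfold dot3 coneMap; have := continuous_enorm2; fun_prop)).aestronglyMeasurable
      (Filter.Eventually.of_forall fun ξ => (norm_ec _).le)
  set M : ℝ × ℝ → ℂ := fun ξ => (s * a : ℂ) * (mainAmp (ξ.1 / lam, ξ.2 / lam) * ft2 g ξ *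
      ec (dot3 (y.1, y.2, ρ) (coneMap ξ))) + (s * b : ℂ) * (mainAmp (ξ.1 / lam, ξ.2 / lam) * ft2 g ξ *
      ec (dot3 (y.1, y.2, -ρ) (coneMap ξ)))
  have hM : Integrable M := ((hI1 ρ).const_mul _).add ((hI1 (-ρ)).const_mul _)
  have hMi : ∫ ξ, M ξ = s * a * waveOp mainAmp lam g (y.1, y.2, ρ) +
      s * b * waveOp mainAmp lam g (y.1, y.2, -ρ) := by
    simp only [M]
    rw [integral_add ((hI1 ρ).const_mul _) ((hI1 (-ρ)).const_mul _), integral_const_mul,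
      integral_const_mul]
    rfl
  have hS := integrable_sphOp (isAnnAmp_annCut.integrable_dil hlam) hg y ρ
  have hsplit : ∀ ξ : ℝ × ℝ, ec (dot2 y ξ) * sigmaHat (ρ * ξ.1, ρ * ξ.2) *
      ((annCut (ξ.1 / lam, ξ.2 / lam) : ℂ) * ft2 g ξ) - M ξ =
      ec (dot2 y ξ) * (E ξ * (annCut (ξ.1 / lam, ξ.2 / lam) : ℂ) * ft2 g ξ) := by
    intro ξ
    have e1 : ec (dot3 (y.1, y.2, ρ) (coneMap ξ)) = ec (dot2 y ξ) * ec (ρ * enorm2 ξ) := by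
      rw [← ec_add]; simp only [dot3, coneMap, dot2]; congr 1; ring
    have e2 : ec (dot3 (y.1, y.2, -ρ) (coneMap ξ)) = ec (dot2 y ξ) * ec (-(ρ * enorm2 ξ)) := by
      rw [← ec_add]; simp only [dot3, coneMap, dot2]; congr 1; ring
    simp only [M, E, e1, e2]
    linear_combination (ec (dot2 y ξ) * ft2 g ξ *
      (a * ec (ρ * enorm2 ξ) + b * ec (-(ρ * enorm2 ξ)))) * hamp ξ
  have hdec : sphOp (fun ξ => (annCut (ξ.1 / lam, ξ.2 / lam) : ℂ)) g y ρ =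
      (s * a * waveOp mainAmp lam g (y.1, y.2, ρ) + s * b * waveOp mainAmp lam g (y.1, y.2, -ρ)) +
      ∫ ξ, ec (dot2 y ξ) * (E ξ * (annCut (ξ.1 / lam, ξ.2 / lam) : ℂ) * ft2 g ξ) := by
    rw [← hMi, ← integral_congr_ae (Filter.Eventually.of_forall hsplit), integral_sub hS hM]
    simp only [sphOp]
    ring
  set Q := Icc (-(16 * lam)) (16 * lam) ×ˢ Icc (-(16 * lam)) (16 * lam)
  have herr : ‖∫ ξ, ec (dot2 y ξ) * (E ξ * (annCut (ξ.1 / lam, ξ.2 / lam) : ℂ) * ft2 g ξ)‖ₑ ≤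
      ENNReal.ofReal (K * ((√lam)⁻¹ * lam⁻¹)) * ∫⁻ ξ in Q, ‖ft2 g ξ‖ₑ := by
    refine (enorm_integral_le_lintegral_enorm _).trans ?_
    rw [← lintegral_const_mul' _ _ ENNReal.ofReal_ne_top,
      ← lintegral_indicator (measurableSet_Icc.prod measurableSet_Icc)]
    refine lintegral_mono fun ξ => ?_
    by_cases h : annCut (ξ.1 / lam, ξ.2 / lam) = 0
    · simp [h]
    have hq : ξ ∈ Q := isAnnAmp_annCut.mem_box hlam (by exact_mod_cast h)
    rw [indicator_of_mem hq, enorm_mul, enorm_ec, one_mul, enorm_mul]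
    gcongr
    rw [← ofReal_norm]
    refine ENNReal.ofReal_le_ofReal ?_
    rw [norm_mul, Complex.norm_real]
    refine (mul_le_of_le_one_right (norm_nonneg _) ?_).trans (hE ξ h)
    rw [Real.norm_eq_abs, annCut, abs_le]
    constructor <;> linarith [lowCut_nonneg (ξ.1 / lam, ξ.2 / lam), lowCut_le_one (ξ.1 / lam, ξ.2 / lam),
      lowCut_nonneg (ξ.1 / lam / 2, ξ.2 / lam / 2), lowCut_le_one (ξ.1 / lam / 2, ξ.2 / lam / 2)]
  have hl : ENNReal.ofReal (√lam)⁻¹ = ENNReal.ofReal lam ^ (-(1 / 2) : ℝ) := by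
    rw [ENNReal.ofReal_rpow_of_pos hlam0, Real.rpow_neg hlam0.le, ← Real.sqrt_eq_rpow]
  have hsE : ‖(s:ℂ)‖ₑ ≤ ENNReal.ofReal lam ^ (-(1 / 2) : ℝ) := by
    rw [← ofReal_norm, Complex.norm_real, Real.norm_of_nonneg hs0, ← hl]
    exact ENNReal.ofReal_le_ofReal hs1
  set N := (∫⁻ x, ‖g x‖ₑ ^ 2) ^ (1 / 2 : ℝ)
  set l := ENNReal.ofReal lam ^ (-(1 / 2) : ℝ)
  set w1 := ‖waveOp mainAmp lam g (y.1, y.2, ρ)‖ₑ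
  set w2 := ‖waveOp mainAmp lam g (y.1, y.2, -ρ)‖ₑ
  have herr2 : ENNReal.ofReal (K * ((√lam)⁻¹ * lam⁻¹)) * ∫⁻ ξ in Q, ‖ft2 g ξ‖ₑ ≤
      l * (ENNReal.ofReal K * C) * N := by
    calc _ ≤ ENNReal.ofReal (K * ((√lam)⁻¹ * lam⁻¹)) * (C * ENNReal.ofReal lam * N) := by
          gcongr; exact hft hlam hg hgm
      _ = (ENNReal.ofReal (K * ((√lam)⁻¹ * lam⁻¹)) * ENNReal.ofReal lam) * C * N := by ring
      _ = _ := by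
          rw [← ENNReal.ofReal_mul (by positivity), show K * ((√lam)⁻¹ * lam⁻¹) * lam = (√lam)⁻¹ * K by
            field_simp, ENNReal.ofReal_mul (by positivity), hl]
          ring
  rw [hdec]
  calc _ ≤ ‖(s:ℂ)‖ₑ * ‖a‖ₑ * w1 + ‖(s:ℂ)‖ₑ * ‖b‖ₑ * w2 + l * (ENNReal.ofReal K * C) * N := by
        refine (enorm_add_le _ _).trans (add_le_add ((enorm_add_le _ _).trans (le_of_eq ?_))
          (herr.trans herr2))
        simp only [enorm_mul, w1, w2]
    _ ≤ l * ‖a‖ₑ * w1 + l * ‖b‖ₑ * w2 + l * (ENNReal.ofReal K * C) * N := by gcongr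
    _ ≤ (‖a‖ₑ + ‖b‖ₑ + ENNReal.ofReal K * C) * l * w1 + (‖a‖ₑ + ‖b‖ₑ + ENNReal.ofReal K * C) * l * w2 +
        (‖a‖ₑ + ‖b‖ₑ + ENNReal.ofReal K * C) * l * N := by
        rw [mul_comm l, mul_comm l, mul_comm l]
        gcongr
        · exact le_add_right le_self_add
        · exact le_add_right le_add_self
        · exact le_add_self
    _ = _ := by ring

theorem IsAnnAmp.continuous_waveOp {A : ℝ × ℝ → ℂ} (hA : IsAnnAmp A) {lam : ℝ} (hlam : 1 ≤ lam)
    {g : ℝ × ℝ → ℂ} (hgm : Measurable g) : Continuous (waveOp A lam g) := by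
  have hi := hA.integrable_dil_mul hlam hgm
  unfold waveOp sup3 osc
  refine continuous_of_dominated (bound := fun ξ => ‖A (ξ.1 / lam, ξ.2 / lam) * ft2 g ξ‖) ?_ ?_ hi.norm ?_
  · intro z
    refine AEStronglyMeasurable.mul hi.aestronglyMeasurable ?_
    exact (continuous_ec.comp (by unfold dot3 coneMap; have := continuous_enorm2; fun_prop)).aestronglyMeasurable
  · intro z
    refine Filter.Eventually.of_forall fun ξ => ?_
    rw [norm_mul, norm_ec, mul_one]
  · refine Filter.Eventually.of_forall fun ξ => ?_
    exact continuous_const.mul (continuous_ec.comp (by unfold dot3; fun_prop))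

/-- The amplitude of the derivative of a wave in its first variable. -/
def ampX (A : ℝ × ℝ → ℂ) (ξ : ℝ × ℝ) : ℂ := A ξ * (Complex.I * (ξ.1 : ℂ))

/-- The amplitude of the derivative of a wave in its last variable. -/
def ampT (A : ℝ × ℝ → ℂ) (ξ : ℝ × ℝ) : ℂ := A ξ * (Complex.I * (enorm2 ξ : ℂ))

theorem IsAnnAmp.ampX {A : ℝ × ℝ → ℂ} (hA : IsAnnAmp A) : IsAnnAmp (ampX A) :=
  hA.mul_smooth fun ξ _ => contDiffAt_const.mul
    (Complex.ofRealCLM.contDiff.contDiffAt.comp ξ contDiffAt_fst)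

theorem IsAnnAmp.ampT {A : ℝ × ℝ → ℂ} (hA : IsAnnAmp A) : IsAnnAmp (ampT A) :=
  hA.mul_smooth fun ξ h => contDiffAt_const.mul
    (Complex.ofRealCLM.contDiff.contDiffAt.comp ξ (enorm2_contDiffAt h))

theorem hasDerivAt_waveOp {A : ℝ × ℝ → ℂ} (hA : IsAnnAmp A) {lam : ℝ} (hlam : 1 ≤ lam)
    {g : ℝ × ℝ → ℂ} (hgm : Measurable g) (α β x κ t : ℝ) :
    HasDerivAt (fun t => waveOp A lam g (α + β * t ^ 2, x, κ * t))
      (lam * ((2 * β * t : ℝ) * waveOp (ampX A) lam g (α + β * t ^ 2, x, κ * t) +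
        κ * waveOp (ampT A) lam g (α + β * t ^ 2, x, κ * t))) t := by
  have hlam0 : 0 < lam := by linarith
  have hi := hA.integrable_dil_mul hlam hgm
  have hiX := hA.ampX.integrable_dil_mul hlam hgm
  have hiT := hA.ampT.integrable_dil_mul hlam hgm
  have hec : ∀ z, Continuous fun ξ => ec (dot3 z (coneMap ξ)) := fun z =>
    continuous_ec.comp (by unfold dot3 coneMap; have := continuous_enorm2; fun_prop)
  have hbd : ∀ {F : ℝ × ℝ → ℂ} (z), Integrable F → Integrable fun ξ => F ξ * ec (dot3 z (coneMap ξ)) :=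
    fun z h => h.mul_bdd (c := 1) (hec z).aestronglyMeasurable
      (Filter.Eventually.of_forall fun ξ => (norm_ec _).le)
  set Z : ℝ → ℝ × ℝ × ℝ := fun t => (α + β * t ^ 2, x, κ * t)
  set a := fun ξ : ℝ × ℝ => A (ξ.1 / lam, ξ.2 / lam) * ft2 g ξ
  set aX := fun ξ : ℝ × ℝ => _root_.ampX A (ξ.1 / lam, ξ.2 / lam) * ft2 g ξ
  set aT := fun ξ : ℝ × ℝ => _root_.ampT A (ξ.1 / lam, ξ.2 / lam) * ft2 g ξ
  set F' : ℝ → ℝ × ℝ → ℂ := fun s ξ => (lam * (2 * β * s : ℝ) : ℂ) * (aX ξ * ec (dot3 (Z s) (coneMap ξ))) +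
    (lam * κ : ℂ) * (aT ξ * ec (dot3 (Z s) (coneMap ξ)))
  have key := hasDerivAt_integral_of_dominated_loc_of_deriv_le (μ := (volume : Measure (ℝ × ℝ)))
    (F := fun s ξ => a ξ * ec (dot3 (Z s) (coneMap ξ))) (F' := F') (x₀ := t)
    (s := Metric.ball t 1)
    (bound := fun ξ => (lam * (2 * |β| * (|t| + 1))) * ‖aX ξ‖ + (lam * |κ|) * ‖aT ξ‖)
    (Metric.ball_mem_nhds t one_pos) (Filter.Eventually.of_forall fun s =>
      (hbd (Z s) hi).aestronglyMeasurable) (hbd (Z t) hi)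
    (((hbd (Z t) hiX).const_mul _).add ((hbd (Z t) hiT).const_mul _)).aestronglyMeasurable ?_ ?_ ?_
  · have h2 := key.2
    refine h2.congr_deriv ?_
    simp only [F']
    rw [integral_add ((hbd (Z t) hiX).const_mul _) ((hbd (Z t) hiT).const_mul _), integral_const_mul,
      integral_const_mul]
    change _ * waveOp (_root_.ampX A) lam g (Z t) + _ * waveOp (_root_.ampT A) lam g (Z t) = _
    ring
  · refine Filter.Eventually.of_forall fun ξ s hs => ?_
    have h1 : |s| ≤ |t| + 1 := by
      rw [Metric.mem_ball, Real.dist_eq] at hs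
      linarith [abs_sub_abs_le_abs_sub s t]
    refine (norm_add_le _ _).trans (add_le_add ?_ ?_)
    · rw [norm_mul, norm_mul, norm_mul (aX ξ), norm_ec, mul_one, Complex.norm_real, Complex.norm_real,
        Real.norm_eq_abs, Real.norm_eq_abs, abs_mul, abs_mul, abs_of_pos hlam0, abs_two]
      gcongr
    · rw [norm_mul, norm_mul, norm_mul (aT ξ), norm_ec, mul_one, Complex.norm_real, Complex.norm_real,
        Real.norm_eq_abs, Real.norm_eq_abs, abs_of_pos hlam0]
  · exact (hiX.norm.const_mul _).add (hiT.norm.const_mul _)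
  · refine Filter.Eventually.of_forall fun ξ s _ => ?_
    have hd : HasDerivAt (fun s => dot3 (Z s) (coneMap ξ)) (2 * β * s * ξ.1 + κ * enorm2 ξ) s := by
      simp only [dot3, Z, coneMap]
      have e1 := (((hasDerivAt_pow 2 s).const_mul β).const_add α).mul_const ξ.1
      have e2 := ((hasDerivAt_id s).const_mul κ).mul_const (enorm2 ξ)
      exact (e1.add (e2.const_add (x * ξ.2))).congr_deriv (by push_cast; ring)
    have h2 : HasDerivAt (fun s => ec (dot3 (Z s) (coneMap ξ)))
        (ec (dot3 (Z s) (coneMap ξ)) * (Complex.I * ((2 * β * s * ξ.1 + κ * enorm2 ξ : ℝ) : ℂ))) s :=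
      (hd.ofReal_comp.const_mul Complex.I).cexp
    refine (h2.const_mul (a ξ)).congr_deriv ?_
    simp only [F', a, aX, aT, _root_.ampX, _root_.ampT]
    rw [enorm2_div hlam0]
    have : (lam : ℂ) ≠ 0 := by exact_mod_cast hlam0.ne'
    push_cast
    field_simp

/-- The sum of a wave and its normalised derivatives. -/
def waveSum (A : ℝ × ℝ → ℂ) (lam : ℝ) (g : ℝ × ℝ → ℂ) (z : ℝ × ℝ × ℝ) : ℝ≥0∞ :=
  ‖waveOp A lam g z‖ₑ + ‖waveOp (ampX A) lam g z‖ₑ + 2 * ‖waveOp (ampT A) lam g z‖ₑ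

theorem IsAnnAmp.measurable_waveSum {A : ℝ × ℝ → ℂ} (hA : IsAnnAmp A) (lam : ℝ) {g : ℝ × ℝ → ℂ}
    (hgm : Measurable g) : Measurable (waveSum A lam g) :=
  ((hA.measurable_waveOp lam hgm).enorm.add (hA.ampX.measurable_waveOp lam hgm).enorm).add
    ((hA.ampT.measurable_waveOp lam hgm).enorm.const_mul _)

theorem lintegral_waveSum_le {A : ℝ × ℝ → ℂ} (hA : IsAnnAmp A) {q c e : ℝ} (hq : 0 < q)
    (h0 : HasWaveBound q c e A) (h1 : HasWaveBound q c e (ampX A)) (h2 : HasWaveBound q c e (ampT A)) :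
    ∃ C : ℝ≥0∞, C ≠ ∞ ∧ ∀ {lam : ℝ}, 1 ≤ lam → ∀ {g : ℝ × ℝ → ℂ}, Integrable g → Measurable g →
      (∀ x, ‖g x‖ ≤ 1) → ∫⁻ x in box3, waveSum A lam g x ^ q ≤
        C * ENNReal.ofReal lam ^ c * (∫⁻ x, ‖g x‖ₑ ^ 2) ^ e := by
  obtain ⟨C0, hC0, h0⟩ := h0
  obtain ⟨C1, hC1, h1⟩ := h1
  obtain ⟨C2, hC2, h2⟩ := h2
  refine ⟨3 ^ q * (C0 + C1 + 2 ^ q * C2), by finiteness, fun {lam} hlam {g} hg hgm hb => ?_⟩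
  have m0 := (hA.measurable_waveOp lam hgm).enorm.pow_const q
  have m1 := (hA.ampX.measurable_waveOp lam hgm).enorm.pow_const q
  have m2 := (hA.ampT.measurable_waveOp lam hgm).enorm.pow_const q
  calc _ ≤ ∫⁻ x in box3, 3 ^ q * (‖waveOp A lam g x‖ₑ ^ q + ‖waveOp (ampX A) lam g x‖ₑ ^ q +
        2 ^ q * ‖waveOp (ampT A) lam g x‖ₑ ^ q) := by
        refine lintegral_mono fun x => ?_
        rw [waveSum, ← ENNReal.mul_rpow_of_nonneg _ _ hq.le]
        exact ENNReal.add3_rpow_le _ _ _ hq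
    _ = 3 ^ q * (∫⁻ x in box3, ‖waveOp A lam g x‖ₑ ^ q) + 3 ^ q * (∫⁻ x in box3, ‖waveOp (ampX A) lam g x‖ₑ ^ q) +
        3 ^ q * (2 ^ q * ∫⁻ x in box3, ‖waveOp (ampT A) lam g x‖ₑ ^ q) := by
        rw [lintegral_const_mul _ (by exact (m0.add m1).add (m2.const_mul _)),
          lintegral_add_left (by exact m0.add m1), lintegral_add_left (by exact m0), lintegral_const_mul _ m2]
        ring
    _ ≤ 3 ^ q * (C0 * ENNReal.ofReal lam ^ c * (∫⁻ x, ‖g x‖ₑ ^ 2) ^ e) +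
        3 ^ q * (C1 * ENNReal.ofReal lam ^ c * (∫⁻ x, ‖g x‖ₑ ^ 2) ^ e) +
        3 ^ q * (2 ^ q * (C2 * ENNReal.ofReal lam ^ c * (∫⁻ x, ‖g x‖ₑ ^ 2) ^ e)) := by
        gcongr
        · exact h0 hlam hg hgm hb
        · exact h1 hlam hg hgm hb
        · exact h2 hlam hg hgm hb
    _ = _ := by ring

/-- The radii `r ∈ [R, 2 * R)` for which `r² / (2 * R)` lies in the unit interval at `m`. -/
def radTile (R m : ℝ) : Set ℝ := Ico R (2 * R) ∩ {r | r ^ 2 / (2 * R) - m ∈ Ico (0:ℝ) 1}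

theorem measurableSet_radTile (R m : ℝ) : MeasurableSet (radTile R m) :=
  measurableSet_Ico.inter (measurableSet_Ico.preimage (f := fun r => r ^ 2 / (2 * R) - m) (by fun_prop))

theorem volume_radTile_le {R : ℝ} (hR : 0 < R) (m : ℝ) : volume (radTile R m) ≤ 1 := by
  refine (Real.volume_le_diam _).trans (Metric.ediam_le fun r hr s hs => ?_)
  rw [edist_dist, ← ENNReal.ofReal_one]
  refine ENNReal.ofReal_le_ofReal ?_
  rw [Real.dist_eq]
  obtain ⟨⟨h1, -⟩, h2, h3⟩ := hr
  obtain ⟨⟨h4, -⟩, h5, h6⟩ := hs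
  have e1 : r ^ 2 / (2 * R) * (2 * R) = r ^ 2 := by field_simp
  have e2 : s ^ 2 / (2 * R) * (2 * R) = s ^ 2 := by field_simp
  rw [abs_le]
  constructor
  · by_contra! h
    nlinarith
  · by_contra! h
    nlinarith

theorem mem_box3_of_radTile {R m x r t σ : ℝ} (hR : 39 / 10 ≤ R) (hσ : |σ| = 1) (hx : x ∈ Ico (0:ℝ) 1)
    (hr : r ∈ radTile R m) (ht : t ∈ Ioo (1:ℝ) 2) :
    ((r ^ 2 + t ^ 2) / (2 * R) - m, x, σ * (t * r / R)) ∈ box3 := by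
  have hR0 : 0 < R := by linarith
  obtain ⟨⟨h1, h2⟩, h3, h4⟩ := hr
  have e1 : (r ^ 2 + t ^ 2) / (2 * R) - m = (r ^ 2 / (2 * R) - m) + t ^ 2 / (2 * R) := by ring
  have e2 : t ^ 2 / (2 * R) ≤ 1 := by rw [div_le_one (by positivity)]; nlinarith [ht.1, ht.2]
  have e3 : 0 ≤ t ^ 2 / (2 * R) := by positivity
  have e4 : t * r / R ≤ 4 := by rw [div_le_iff₀ hR0]; nlinarith [ht.1, ht.2]
  have e5 : 0 ≤ t * r / R := div_nonneg (mul_nonneg (by linarith [ht.1]) (by linarith)) hR0.le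
  have e6 : |σ * (t * r / R)| ≤ 10 := by rw [abs_mul, hσ, abs_of_nonneg e5]; linarith
  refine ⟨⟨?_, ?_⟩, ⟨?_, ?_⟩, abs_le.1 e6⟩
  · simp only; linarith
  · simp only; linarith
  · simp only; linarith [hx.1]
  · simp only; linarith [hx.2]

theorem lintegral_radTile_le {R : ℝ} (hR : 39 / 10 ≤ R) (m : ℝ) {σ : ℝ} (hσ : σ = 1 ∨ σ = -1)
    {F : ℝ × ℝ × ℝ → ℝ≥0∞} (hF : Measurable F) :
    ∫⁻ x in Ico (0:ℝ) 1, ∫⁻ r in radTile R m, ∫⁻ t in Ioo (1:ℝ) 2,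
      F ((r ^ 2 + t ^ 2) / (2 * R) - m, x, σ * (t * r / R)) ≤ 2 * ∫⁻ z in box3, F z := by
  have hσ1 : |σ| = 1 := by rcases hσ with h | h <;> simp [h]
  set B := box3.indicator F
  have hB : Measurable B := hF.indicator measurableSet_box3
  have hsl : ∀ x, Measurable fun w : ℝ × ℝ => B (w.1 - m, x, σ * w.2) := fun x =>
    hB.comp (by fun_prop)
  have hσi : ∀ f : ℝ → ℝ≥0∞, ∫⁻ ρ, f (σ * ρ) = ∫⁻ ρ, f ρ := by
    intro f
    rcases hσ with h | h
    · simp [h]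
    · simp only [h, neg_mul, one_mul]
      exact lintegral_neg_eq_self f
  calc _ ≤ ∫⁻ x in Ico (0:ℝ) 1, 2 * ∫⁻ ρ, ∫⁻ y, B (y, x, ρ) := by
        refine setLIntegral_mono' measurableSet_Ico fun x hx => ?_
        have h := lintegral_paraboloid_le hR (hsl x)
        have e : ∫⁻ ρ, ∫⁻ y, B (y - m, x, σ * ρ) = ∫⁻ ρ, ∫⁻ y, B (y, x, ρ) := by
          rw [← hσi fun ρ => ∫⁻ y, B (y, x, ρ)]
          refine lintegral_congr fun ρ => ?_
          exact lintegral_sub_right_eq_self (fun y => B (y, x, σ * ρ)) m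
        rw [← e]
        refine le_trans ?_ h
        refine le_trans ?_ (lintegral_mono_set (show radTile R m ⊆ Ico R (2 * R) from inter_subset_left))
        refine setLIntegral_mono' (measurableSet_radTile R m) fun r hr => ?_
        refine setLIntegral_mono' measurableSet_Ioo fun t ht => ?_
        simp only [B]
        rw [indicator_of_mem (mem_box3_of_radTile hR hσ1 hx hr ht)]
    _ ≤ ∫⁻ x, 2 * ∫⁻ ρ, ∫⁻ y, B (y, x, ρ) := setLIntegral_le_lintegral _ _
    _ = 2 * ∫⁻ z, B z := by
        have hm : Measurable fun w : ℝ × ℝ => ∫⁻ y, B (y, w) := hB.lintegral_prod_left'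
        rw [lintegral_const_mul _ (Measurable.lintegral_prod_right' (f := fun w : ℝ × ℝ => ∫⁻ y, B (y, w)) hm),
          Measure.volume_eq_prod ℝ (ℝ × ℝ), lintegral_prod_symm _ hB.aemeasurable,
          Measure.volume_eq_prod ℝ ℝ, lintegral_prod _ hm.aemeasurable]
    _ = _ := by rw [lintegral_indicator measurableSet_box3]

theorem enorm_waveOp_rpow_le {A : ℝ × ℝ → ℂ} (hA : IsAnnAmp A) {lam : ℝ} (hlam : 1 ≤ lam)
    {g : ℝ × ℝ → ℂ} (hgm : Measurable g) {q : ℝ} (hq : 1 < q) {R : ℝ} (hR : 39 / 10 ≤ R) (m x : ℝ)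
    {r : ℝ} (hr : r ∈ Ico R (2 * R)) {σ : ℝ} (hσ : |σ| = 1) {t : ℝ} (ht : t ∈ Ioo (1:ℝ) 2) :
    ‖waveOp A lam g ((r ^ 2 + t ^ 2) / (2 * R) - m, x, σ * (t * r / R))‖ₑ ^ q ≤
      ENNReal.ofReal (2 * lam) * ∫⁻ t in Ioo (1:ℝ) 2,
        waveSum A lam g ((r ^ 2 + t ^ 2) / (2 * R) - m, x, σ * (t * r / R)) ^ q := by
  have hR0 : 0 < R := by linarith
  have hZ : ∀ s : ℝ, ((r ^ 2 + s ^ 2) / (2 * R) - m, x, σ * (s * r / R)) =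
      ((r ^ 2 / (2 * R) - m) + (1 / (2 * R)) * s ^ 2, x, (σ * (r / R)) * s) := by
    intro s
    ext
    · simp only; ring
    · rfl
    · simp only; ring
  simp_rw [hZ]
  set α := r ^ 2 / (2 * R) - m
  set β := 1 / (2 * R)
  set κ := σ * (r / R)
  have hcX := hA.ampX.continuous_waveOp hlam hgm
  have hcT := hA.ampT.continuous_waveOp hlam hgm
  refine (sobolev_Ioo (G := fun t => waveOp A lam g (α + β * t ^ 2, x, κ * t)) hlam
    (fun t => hasDerivAt_waveOp hA hlam hgm α β x κ t) ?_ hq ⟨ht.1.le, ht.2.le⟩).trans ?_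
  · exact (Continuous.mul (by fun_prop) (hcX.comp (by fun_prop))).add
      (Continuous.mul (by fun_prop) (hcT.comp (by fun_prop)))
  · refine mul_le_mul' le_rfl (setLIntegral_mono' measurableSet_Ioo fun s hs => ?_)
    refine ENNReal.rpow_le_rpow ?_ (by linarith)
    rw [waveSum, add_assoc]
    gcongr
    refine (enorm_add_le _ _).trans (add_le_add ?_ ?_)
    · rw [enorm_mul]
      refine mul_le_of_le_one_left zero_le ?_
      rw [← ofReal_norm, Complex.norm_real, ← ENNReal.ofReal_one]
      refine ENNReal.ofReal_le_ofReal ?_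
      rw [Real.norm_eq_abs, abs_of_nonneg (by have := hs.1; positivity)]
      simp only [β]
      rw [show 2 * (1 / (2 * R)) * s = s / R by field_simp, div_le_one hR0]
      linarith [hs.2]
    · rw [enorm_mul]
      gcongr
      rw [← ofReal_norm, Complex.norm_real, show (2 : ℝ≥0∞) = ENNReal.ofReal 2 by simp]
      refine ENNReal.ofReal_le_ofReal ?_
      simp only [κ]
      rw [Real.norm_eq_abs, abs_mul, hσ, one_mul, abs_of_nonneg (div_nonneg (by linarith [hr.1]) hR0.le),
        div_le_iff₀ hR0]
      exact hr.2.le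

/-- Localised maximal bound at frequency `lam` on a unit tile. -/
theorem exists_scale_bound {q y z : ℝ} (hy : 0 < y) (hz : 0 ≤ z) (hyz : y + z ≤ 1)
    (hq : q = 2 + 2 * y + 3 * z) {E₀ : ℝ≥0∞} (hE₀ : E₀ ≠ ∞) : ∃ C : ℝ≥0∞, C ≠ ∞ ∧
    ∀ {lam : ℝ}, 1 ≤ lam → ∀ {g : ℝ × ℝ → ℂ}, Integrable g → Measurable g → (∀ x, ‖g x‖ ≤ 1) →
    ∫⁻ x, ‖g x‖ₑ ^ 2 ≤ E₀ → ∀ {R : ℝ}, 39 / 10 ≤ R → ∀ m : ℝ, ∃ D : ℝ × ℝ → ℝ≥0∞, Measurable D ∧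
      (∀ x r, r ∈ Ico R (2 * R) → ∀ t ∈ Ioo (1:ℝ) 2,
        ‖sphOp (fun ξ => (annCut (ξ.1 / lam, ξ.2 / lam) : ℂ)) g
          ((r ^ 2 + t ^ 2) / (2 * R) - m, x) (t * r / R)‖ₑ ^ q ≤ D (x, r)) ∧
      ∫⁻ x in Ico (0:ℝ) 1, ∫⁻ r in radTile R m, D (x, r) ≤
        C * ENNReal.ofReal lam ^ (-(y / 4)) * (∫⁻ x, ‖g x‖ₑ ^ 2) ^ (1 + z) := by
  have hA := isAnnAmp_mainAmp
  have hq0 : 0 < q := by linarith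
  obtain ⟨C₁, hC₁, hW⟩ := lintegral_waveSum_le hA hq0 (hA.hasWaveBound hy hz hyz hq)
    (hA.ampX.hasWaveBound hy hz hyz hq) (hA.ampT.hasWaveBound hy hz hyz hq)
  obtain ⟨K, hK, hasy⟩ := exists_sphOp_asymp
  have hez : 0 ≤ q / 2 - (1 + z) := by linarith
  refine ⟨3 ^ q * K ^ q * (8 * C₁ + E₀ ^ (q / 2 - (1 + z))), by finiteness,
    fun {lam} hlam {g} hg hgm hb hE {R} hR m => ?_⟩
  have hlam0 : 0 < lam := by linarith
  have hR0 : 0 < R := by linarith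
  set S := waveSum mainAmp lam g
  have hS : Measurable S := hA.measurable_waveSum lam hgm
  set I : ℝ → ℝ × ℝ → ℝ≥0∞ := fun σ w => ∫⁻ t in Ioo (1:ℝ) 2,
    S ((w.2 ^ 2 + t ^ 2) / (2 * R) - m, w.1, σ * (t * w.2 / R)) ^ q
  have hI : ∀ σ, Measurable (I σ) := by
    intro σ
    refine Measurable.lintegral_prod_right'
      (f := fun v : (ℝ × ℝ) × ℝ => S ((v.1.2 ^ 2 + v.2 ^ 2) / (2 * R) - m, v.1.1, σ * (v.2 * v.1.2 / R)) ^ q) ?_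
    exact (hS.comp (by fun_prop)).pow_const q
  set Λ := ENNReal.ofReal lam with hΛ
  set E := ∫⁻ x, ‖g x‖ₑ ^ 2
  have hΛ0 : Λ ≠ 0 := by simpa [hΛ] using hlam0
  have hΛt : Λ ≠ ∞ := ENNReal.ofReal_ne_top
  have hΛ1 : 1 ≤ Λ := by rw [hΛ, ← ENNReal.ofReal_one]; exact ENNReal.ofReal_le_ofReal hlam
  have h2Λ : ENNReal.ofReal (2 * lam) = 2 * Λ := by rw [ENNReal.ofReal_mul (by norm_num)]; norm_num [hΛ]
  set c := 3 ^ q * K ^ q * Λ ^ (-(q / 2))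
  refine ⟨fun w => c * (2 * Λ * I 1 w + 2 * Λ * I (-1) w + E ^ (q / 2)),
    ((((hI 1).const_mul _).add ((hI (-1)).const_mul _)).add_const _).const_mul _, ?_, ?_⟩
  · intro x r hr t ht
    have hρ : 1 ≤ t * r / R := by
      rw [le_div_iff₀ hR0]; nlinarith [ht.1, hr.1]
    have h1 := hasy hlam hg hgm ((r ^ 2 + t ^ 2) / (2 * R) - m, x) _ hρ
    have h2 := enorm_waveOp_rpow_le hA hlam hgm (q := q) (by linarith) hR m x hr (σ := 1) (by simp) ht
    have h3 := enorm_waveOp_rpow_le hA hlam hgm (q := q) (by linarith) hR m x hr (σ := -1) (by simp) ht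
    simp only [one_mul, neg_mul, h2Λ] at h2 h3
    refine (ENNReal.rpow_le_rpow h1 hq0.le).trans ?_
    rw [ENNReal.mul_rpow_of_nonneg _ _ hq0.le, ENNReal.mul_rpow_of_nonneg _ _ hq0.le, ← ENNReal.rpow_mul,
      show -(1 / 2) * q = -(q / 2) by ring]
    calc _ ≤ K ^ q * Λ ^ (-(q / 2)) * (3 ^ q * (_ + _ + _)) := by
          gcongr
          exact ENNReal.add3_rpow_le _ _ _ hq0
      _ ≤ K ^ q * Λ ^ (-(q / 2)) * (3 ^ q * (2 * Λ * I 1 (x, r) + 2 * Λ * I (-1) (x, r) + E ^ (q / 2))) := by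
          gcongr
          · simpa only [I, one_mul] using h2
          · simpa only [I, neg_mul, one_mul] using h3
          · rw [← ENNReal.rpow_mul]
            refine le_of_eq ?_
            congr 1
            ring
      _ = _ := by simp only [c]; ring
  · have hintg : ∀ σ : ℝ, (σ = 1 ∨ σ = -1) → ∫⁻ x in Ico (0:ℝ) 1, ∫⁻ r in radTile R m, I σ (x, r) ≤
        2 * (C₁ * Λ ^ (q / 2 - 1 - y / 4) * E ^ (1 + z)) := fun σ hσ =>
      (lintegral_radTile_le hR m hσ (hS.pow_const q)).trans (by gcongr; exact hW hlam hg hgm hb)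
    have hIr : ∀ σ x, Measurable fun r => I σ (x, r) := fun σ x => (hI σ).comp (by fun_prop)
    have hIx : ∀ σ, Measurable fun x => ∫⁻ r in radTile R m, I σ (x, r) := fun σ =>
      Measurable.lintegral_prod_right' (hI σ)
    have hexp : ∫⁻ x in Ico (0:ℝ) 1, ∫⁻ r in radTile R m, c * (2 * Λ * I 1 (x, r) + 2 * Λ * I (-1) (x, r) + E ^ (q / 2)) =
        c * (2 * Λ * (∫⁻ x in Ico (0:ℝ) 1, ∫⁻ r in radTile R m, I 1 (x, r)) +
          2 * Λ * (∫⁻ x in Ico (0:ℝ) 1, ∫⁻ r in radTile R m, I (-1) (x, r)) +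
          E ^ (q / 2) * volume (radTile R m)) := by
      have : ∀ x, ∫⁻ r in radTile R m, c * (2 * Λ * I 1 (x, r) + 2 * Λ * I (-1) (x, r) + E ^ (q / 2)) =
          c * (2 * Λ * (∫⁻ r in radTile R m, I 1 (x, r)) + 2 * Λ * (∫⁻ r in radTile R m, I (-1) (x, r)) +
            E ^ (q / 2) * volume (radTile R m)) := by
        intro x
        rw [lintegral_const_mul _ (by exact ((((hIr 1 x).const_mul _).add ((hIr (-1) x).const_mul _)).add_const _)),
          lintegral_add_right _ measurable_const, lintegral_add_left (by exact (hIr 1 x).const_mul _),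
          lintegral_const_mul _ (hIr 1 x), lintegral_const_mul _ (hIr (-1) x), setLIntegral_const]
      simp_rw [this]
      rw [lintegral_const_mul _ (by exact ((((hIx 1).const_mul _).add ((hIx (-1)).const_mul _)).add_const _)),
          lintegral_add_right _ measurable_const, lintegral_add_left (by exact (hIx 1).const_mul _),
          lintegral_const_mul _ (hIx 1), lintegral_const_mul _ (hIx (-1)), setLIntegral_const]
      simp
    have hEE : E ^ (q / 2) ≤ E₀ ^ (q / 2 - (1 + z)) * E ^ (1 + z) := by
      rw [show q / 2 = (q / 2 - (1 + z)) + (1 + z) by ring, ENNReal.rpow_add_of_nonneg _ _ hez (by linarith)]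
      rw [show (q / 2 - (1 + z)) + (1 + z) - (1 + z) = q / 2 - (1 + z) by ring]
      gcongr
    have hp1 : Λ ^ (-(q / 2)) * Λ * Λ ^ (q / 2 - 1 - y / 4) = Λ ^ (-(y / 4)) := by
      nth_rw 2 [← ENNReal.rpow_one Λ]
      rw [← ENNReal.rpow_add _ _ hΛ0 hΛt, ← ENNReal.rpow_add _ _ hΛ0 hΛt]
      congr 1; ring
    have hp2 : Λ ^ (-(q / 2)) ≤ Λ ^ (-(y / 4)) := ENNReal.rpow_le_rpow_of_exponent_le hΛ1 (by linarith)
    simp only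
    rw [hexp]
    calc _ ≤ c * (2 * Λ * (2 * (C₁ * Λ ^ (q / 2 - 1 - y / 4) * E ^ (1 + z))) +
          2 * Λ * (2 * (C₁ * Λ ^ (q / 2 - 1 - y / 4) * E ^ (1 + z))) +
          E₀ ^ (q / 2 - (1 + z)) * E ^ (1 + z) * 1) := by
          gcongr
          · exact hintg 1 (Or.inl rfl)
          · exact hintg (-1) (Or.inr rfl)
          · exact volume_radTile_le hR0 m
      _ = 3 ^ q * K ^ q * (8 * C₁ * (Λ ^ (-(q / 2)) * Λ * Λ ^ (q / 2 - 1 - y / 4)) +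
          E₀ ^ (q / 2 - (1 + z)) * Λ ^ (-(q / 2))) * E ^ (1 + z) := by
          simp only [c]; ring
      _ ≤ 3 ^ q * K ^ q * (8 * C₁ * Λ ^ (-(y / 4)) + E₀ ^ (q / 2 - (1 + z)) * Λ ^ (-(y / 4))) * E ^ (1 + z) := by
          rw [hp1]; gcongr
      _ = _ := by ring

/-- The neighbourhood of the origin that determines the spherical means on a unit tile. -/
def nearBox : Set (ℝ × ℝ) := Icc (-16) 16 ×ˢ Icc (-16) 16

theorem measurableSet_nearBox : MeasurableSet nearBox := measurableSet_Icc.prod measurableSet_Icc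

theorem volume_nearBox : (volume : Measure (ℝ × ℝ)) nearBox = 1024 := by
  rw [nearBox, Measure.volume_eq_prod, Measure.prod_prod, Real.volume_Icc,
    ← ENNReal.ofReal_mul (by norm_num)]
  norm_num

theorem sphOp_lowCut_eq {f : ℝ × ℝ → ℂ} (hf : Integrable f) (J : ℕ) (y : ℝ × ℝ) (ρ : ℝ) :
    sphOp (fun ξ => (lowCut (ξ.1 / 2 ^ J, ξ.2 / 2 ^ J) : ℂ)) f y ρ =
      sphOp (fun ξ => (lowCut ξ : ℂ)) f y ρ +
        ∑ j ∈ Finset.range J, sphOp (fun ξ => (annCut (ξ.1 / 2 ^ j, ξ.2 / 2 ^ j) : ℂ)) f y ρ := by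
  have hl : Integrable fun ξ => (lowCut ξ : ℂ) := by simpa using integrable_lowCut_dil one_pos
  have h1 := integrable_sphOp hl hf y ρ
  have h2 : ∀ j : ℕ, Integrable fun ξ : ℝ × ℝ => ec (dot2 y ξ) * sigmaHat (ρ * ξ.1, ρ * ξ.2) *
      ((annCut (ξ.1 / 2 ^ j, ξ.2 / 2 ^ j) : ℂ) * ft2 f ξ) := fun j =>
    integrable_sphOp (isAnnAmp_annCut.integrable_dil (one_le_pow₀ (by norm_num : (1:ℝ) ≤ 2))) hf y ρ
  simp only [sphOp]
  rw [← integral_finsetSum _ fun j _ => h2 j, ← integral_add h1 (integrable_finsetSum _ fun j _ => h2 j)]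
  refine integral_congr_ae (Filter.Eventually.of_forall fun ξ => ?_)
  simp only
  rw [lowCut_eq_sum J ξ, ← Finset.mul_sum, ← Finset.sum_mul]
  push_cast
  ring

theorem tendsto_sphOp_lowCut {f : ℝ × ℝ → ℂ} {y : ℝ × ℝ} {ρ : ℝ}
    (h : Integrable fun ξ => ec (dot2 y ξ) * sigmaHat (ρ * ξ.1, ρ * ξ.2) * (1 * ft2 f ξ)) :
    Filter.Tendsto (fun J : ℕ => sphOp (fun ξ => (lowCut (ξ.1 / 2 ^ J, ξ.2 / 2 ^ J) : ℂ)) f y ρ)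
      Filter.atTop (nhds (sphOp (fun _ => 1) f y ρ)) := by
  have e : ∀ (J : ℕ) (ξ : ℝ × ℝ), ec (dot2 y ξ) * sigmaHat (ρ * ξ.1, ρ * ξ.2) *
      ((lowCut (ξ.1 / 2 ^ J, ξ.2 / 2 ^ J) : ℂ) * ft2 f ξ) = (lowCut (ξ.1 / 2 ^ J, ξ.2 / 2 ^ J) : ℂ) *
      (ec (dot2 y ξ) * sigmaHat (ρ * ξ.1, ρ * ξ.2) * (1 * ft2 f ξ)) := by intros; ring
  simp only [sphOp, e]
  refine tendsto_integral_of_dominated_convergence _ (fun J =>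
    (continuous_lowCut_dil _).aestronglyMeasurable.mul h.aestronglyMeasurable) h.norm ?_ ?_
  · intro J
    refine Filter.Eventually.of_forall fun ξ => ?_
    rw [norm_mul, Complex.norm_real, Real.norm_of_nonneg (lowCut_nonneg _)]
    exact mul_le_of_le_one_left (norm_nonneg _) (lowCut_le_one _)
  · refine Filter.Eventually.of_forall fun ξ => tendsto_const_nhds.congr' ?_
    have ht : Filter.Tendsto (fun J : ℕ => (ξ.1 ^ 2 + ξ.2 ^ 2) * (1 / 4 : ℝ) ^ J) Filter.atTop (nhds 0) := by
      simpa using (tendsto_pow_atTop_nhds_zero_of_lt_one (by norm_num : (0:ℝ) ≤ 1 / 4)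
        (by norm_num)).const_mul (ξ.1 ^ 2 + ξ.2 ^ 2)
    filter_upwards [ht.eventually_le_const one_pos] with J hJ
    rw [lowCut_eq_one]
    · simp
    · have : (ξ.1 / 2 ^ J) ^ 2 + (ξ.2 / 2 ^ J) ^ 2 = (ξ.1 ^ 2 + ξ.2 ^ 2) * (1 / 4 : ℝ) ^ J := by
        rw [div_pow, div_pow, ← pow_mul, mul_comm J 2, pow_mul, one_div, inv_pow]
        norm_num
        ring
      simpa [this] using hJ

/-- Only the part of `f` near the origin matters for bounded arguments. -/
theorem enorm_sphOp_one_le {f : ℝ × ℝ → ℂ} (hf : Integrable f) {y : ℝ × ℝ} {ρ : ℝ} (hy1 : |y.1| ≤ 10)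
    (hy2 : |y.2| ≤ 10) (hρ : |ρ| ≤ 4) :
    ‖sphOp (fun _ => 1) f y ρ‖ₑ ≤ ‖sphOp (fun ξ => (lowCut ξ : ℂ)) (nearBox.indicator f) y ρ‖ₑ +
      ∑' j : ℕ, ‖sphOp (fun ξ => (annCut (ξ.1 / 2 ^ j, ξ.2 / 2 ^ j) : ℂ)) (nearBox.indicator f) y ρ‖ₑ := by
  by_cases h : Integrable fun ξ => ec (dot2 y ξ) * sigmaHat (ρ * ξ.1, ρ * ξ.2) * (1 * ft2 f ξ)
  swap
  · rw [sphOp, integral_undef h]; simp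
  obtain ⟨C, hC0, hC⟩ := exists_sphOp_far_bound
  set N := ∫ x, ‖nearBoxᶜ.indicator f x‖
  have hn : Integrable (nearBox.indicator f) := hf.indicator measurableSet_nearBox
  have hfar : Integrable (nearBoxᶜ.indicator f) := hf.indicator measurableSet_nearBox.compl
  have hsplit : (fun x => nearBox.indicator f x + nearBoxᶜ.indicator f x) = f :=
    indicator_self_add_compl nearBox f
  have hlim : Filter.Tendsto (fun J : ℕ => ENNReal.ofReal (C / 2 ^ J * N)) Filter.atTop (nhds 0) := by
    have : Filter.Tendsto (fun J : ℕ => (C * N) * (1 / 2 : ℝ) ^ J) Filter.atTop (nhds 0) := by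
      simpa using (tendsto_pow_atTop_nhds_zero_of_lt_one (by norm_num : (0:ℝ) ≤ 1 / 2)
        (by norm_num)).const_mul (C * N)
    have h2 := ENNReal.tendsto_ofReal this
    rw [ENNReal.ofReal_zero] at h2
    refine h2.congr fun J => ?_
    rw [one_div, inv_pow]; congr 1; ring
  have hbound : ∀ J : ℕ, ‖sphOp (fun ξ => (lowCut (ξ.1 / 2 ^ J, ξ.2 / 2 ^ J) : ℂ)) f y ρ‖ₑ ≤
      (‖sphOp (fun ξ => (lowCut ξ : ℂ)) (nearBox.indicator f) y ρ‖ₑ +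
      ∑' j : ℕ, ‖sphOp (fun ξ => (annCut (ξ.1 / 2 ^ j, ξ.2 / 2 ^ j) : ℂ)) (nearBox.indicator f) y ρ‖ₑ) +
      ENNReal.ofReal (C / 2 ^ J * N) := by
    intro J
    have h2 := hC (2 ^ J) (one_le_pow₀ (by norm_num)) _ hfar
      (fun u hu => indicator_of_notMem (notMem_compl_iff.2 hu) _) y ρ hy1 hy2 hρ
    conv_lhs => rw [← hsplit]
    rw [sphOp_add (integrable_lowCut_dil (by positivity)) hn hfar, sphOp_lowCut_eq hn]
    refine (enorm_add_le _ _).trans (add_le_add ((enorm_add_le _ _).trans (add_le_add le_rfl ?_)) ?_)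
    · exact (enorm_sum_le _ _).trans (ENNReal.sum_le_tsum _)
    · rw [← ofReal_norm]
      exact ENNReal.ofReal_le_ofReal h2
  refine le_of_tendsto_of_tendsto' (tendsto_sphOp_lowCut h).enorm ?_ hbound
  simpa using tendsto_const_nhds.add hlim

/-- The level sets of `h` at dyadic heights. -/
def dyadicLevel (h : ℝ × ℝ → ℂ) : ℕ → ℝ × ℝ → ℂ
  | 0 => {x | ‖h x‖ ≤ 1}.indicator h
  | n + 1 => {x | 2 ^ n < ‖h x‖ ∧ ‖h x‖ ≤ 2 ^ (n + 1)}.indicator h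

theorem sum_dyadicLevel (h : ℝ × ℝ → ℂ) (n : ℕ) (x : ℝ × ℝ) :
    ∑ i ∈ Finset.range (n + 1), dyadicLevel h i x = {x | ‖h x‖ ≤ 2 ^ n}.indicator h x := by
  induction n with
  | zero => simp [dyadicLevel]
  | succ n ih =>
    rw [Finset.sum_range_succ, ih, dyadicLevel]
    have h2 : (2:ℝ) ^ n ≤ 2 ^ (n + 1) := pow_le_pow_right₀ (by norm_num) (by omega)
    simp only [indicator, mem_ofPred_eq]
    by_cases h1 : ‖h x‖ ≤ 2 ^ n
    · simp [h1, h1.trans h2]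
    · have h3 := not_le.1 h1
      simp [h1, h3]

theorem measurable_dyadicLevel {h : ℝ × ℝ → ℂ} (hh : Measurable h) (n : ℕ) :
    Measurable (dyadicLevel h n) := by
  cases n with
  | zero => exact hh.indicator (measurableSet_le hh.norm measurable_const)
  | succ n => exact hh.indicator ((measurableSet_lt measurable_const hh.norm).inter
      (measurableSet_le hh.norm measurable_const))

theorem norm_dyadicLevel_le (h : ℝ × ℝ → ℂ) (n : ℕ) (x : ℝ × ℝ) : ‖dyadicLevel h n x‖ ≤ 2 ^ n := by
  cases n with
  | zero =>
    simp only [dyadicLevel, indicator, mem_ofPred_eq]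
    split_ifs with h1
    · simpa using h1
    · simp
  | succ n =>
    simp only [dyadicLevel, indicator, mem_ofPred_eq]
    split_ifs with h1
    · exact h1.2
    · rw [norm_zero]; positivity

theorem norm_dyadicLevel_le_self (h : ℝ × ℝ → ℂ) (n : ℕ) (x : ℝ × ℝ) : ‖dyadicLevel h n x‖ ≤ ‖h x‖ := by
  cases n with
  | zero => exact norm_indicator_le_norm_self _ _
  | succ n => exact norm_indicator_le_norm_self _ _

theorem enorm_sphOp_le_tsum_dyadicLevel {b h : ℝ × ℝ → ℂ} (hb : Integrable b) (hh : Integrable h)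
    (hm : Measurable h) (y : ℝ × ℝ) (ρ : ℝ) :
    ‖sphOp b h y ρ‖ₑ ≤ ∑' n, ‖sphOp b (dyadicLevel h n) y ρ‖ₑ := by
  have hi : ∀ n, Integrable (dyadicLevel h n) := fun n =>
    hh.mono (measurable_dyadicLevel hm n).aestronglyMeasurable
      (Filter.Eventually.of_forall (norm_dyadicLevel_le_self h n))
  set r : ℕ → ℝ × ℝ → ℂ := fun n => {x | ‖h x‖ ≤ 2 ^ n}ᶜ.indicator h
  have hS : ∀ n : ℕ, MeasurableSet {x | ‖h x‖ ≤ (2:ℝ) ^ n} := fun n => measurableSet_le hm.norm measurable_const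
  have hr : ∀ n, Integrable (r n) := fun n => hh.indicator (hS n).compl
  have hsplit : ∀ n, (fun x => (∑ i ∈ Finset.range (n + 1), dyadicLevel h i x) + r n x) = h := by
    intro n
    funext x
    rw [sum_dyadicLevel]
    exact congrFun (indicator_self_add_compl _ h) x
  have hlim : Filter.Tendsto (fun n => ∫ x, ‖r n x‖) Filter.atTop (nhds 0) := by
    have := tendsto_integral_of_dominated_convergence (μ := (volume : Measure (ℝ × ℝ)))
      (F := fun n x => ‖r n x‖) (f := fun _ => 0) (fun x => ‖h x‖) (fun n => (hr n).norm.aestronglyMeasurable)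
      hh.norm (fun n => Filter.Eventually.of_forall fun x => by
        rw [norm_norm]; exact norm_indicator_le_norm_self _ _) (Filter.Eventually.of_forall fun x => by
        refine tendsto_const_nhds.congr' ?_
        filter_upwards [(tendsto_pow_atTop_atTop_of_one_lt (by norm_num : (1:ℝ) < 2)).eventually_ge_atTop ‖h x‖] with n hn
        simp only [r]
        rw [indicator_of_notMem (notMem_compl_iff.2 (show x ∈ {x | ‖h x‖ ≤ 2 ^ n} from hn)), norm_zero])
    simpa using this
  have hlim2 : Filter.Tendsto (fun n => ENNReal.ofReal ((2 * π * ∫ ξ, ‖b ξ‖) * ∫ x, ‖r n x‖))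
      Filter.atTop (nhds 0) := by
    simpa using ENNReal.tendsto_ofReal (hlim.const_mul (2 * π * ∫ ξ, ‖b ξ‖))
  refine le_of_tendsto_of_tendsto' (f := fun _ : ℕ => ‖sphOp b h y ρ‖ₑ) (b := Filter.atTop) tendsto_const_nhds
    (g := fun n => (∑' n, ‖sphOp b (dyadicLevel h n) y ρ‖ₑ) +
      ENNReal.ofReal ((2 * π * ∫ ξ, ‖b ξ‖) * ∫ x, ‖r n x‖)) (by simpa using tendsto_const_nhds.add hlim2) fun n => ?_
  conv_lhs => rw [← hsplit n]
  rw [sphOp_add hb (integrable_finsetSum _ fun i _ => hi i) (hr n), sphOp_sum _ hb fun i _ => hi i]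
  refine (enorm_add_le _ _).trans (add_le_add ((enorm_sum_le _ _).trans (ENNReal.sum_le_tsum _)) ?_)
  rw [← ofReal_norm]
  exact ENNReal.ofReal_le_ofReal (norm_sphOp_le hb y ρ)

theorem ENNReal.pow_rpow_comm (a : ℝ≥0∞) (n : ℕ) (q : ℝ) : (a ^ n) ^ q = (a ^ q) ^ n := by
  rw [← ENNReal.rpow_natCast, ← ENNReal.rpow_mul, mul_comm, ENNReal.rpow_mul, ENNReal.rpow_natCast]

theorem ENNReal.tsum_rpow_le_of_weight {ι : Type*} {a d w : ι → ℝ≥0∞} {q : ℝ} (hq : 0 < q)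
    (had : ∀ i, a i ^ q ≤ d i) (hw0 : ∀ i, w i ≠ 0) (hwt : ∀ i, w i ≠ ∞) :
    (∑' i, a i) ^ q ≤ (∑' i, w i) ^ q * ∑' i, d i * (w i ^ q)⁻¹ := by
  set B := ∑' i, d i * (w i ^ q)⁻¹
  have h : ∀ i, a i ≤ w i * B ^ (1 / q) := by
    intro i
    have h1 : d i * (w i ^ q)⁻¹ ≤ B := ENNReal.le_tsum i
    have hw : w i ^ q ≠ 0 := by simp [hw0 i, hwt i]
    have hw' : w i ^ q ≠ ∞ := by simp [hw0 i, hwt i]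
    have h2 : a i ^ q ≤ w i ^ q * B := by
      refine (had i).trans ?_
      calc d i = w i ^ q * (d i * (w i ^ q)⁻¹) := by
            rw [mul_left_comm, ENNReal.mul_inv_cancel hw hw', mul_one]
        _ ≤ _ := by gcongr
    have h3 := ENNReal.rpow_le_rpow h2 (z := 1 / q) (by positivity)
    rwa [ENNReal.mul_rpow_of_nonneg _ _ (by positivity), ← ENNReal.rpow_mul, ← ENNReal.rpow_mul,
      mul_one_div_cancel hq.ne', ENNReal.rpow_one, ENNReal.rpow_one] at h3
  calc (∑' i, a i) ^ q ≤ (∑' i, w i * B ^ (1 / q)) ^ q := by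
        gcongr with i; exact h i
    _ = _ := by
        rw [ENNReal.tsum_mul_right, ENNReal.mul_rpow_of_nonneg _ _ hq.le, ← ENNReal.rpow_mul,
          one_div_mul_cancel hq.ne', ENNReal.rpow_one]

theorem ENNReal.tsum_prod_geometric (a b : ℝ≥0∞) :
    ∑' i : ℕ × ℕ, a ^ i.1 * b ^ i.2 = (1 - a)⁻¹ * (1 - b)⁻¹ := by
  rw [ENNReal.tsum_prod (f := fun i j => a ^ i * b ^ j)]
  simp_rw [ENNReal.tsum_mul_left, ENNReal.tsum_geometric, ENNReal.tsum_mul_right, ENNReal.tsum_geometric]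

theorem enorm_sq_dyadicLevel_le {f : ℝ × ℝ → ℂ} {p : ℝ} (hp : 0 < p) (n : ℕ) (x : ℝ × ℝ) :
    ‖(((2:ℝ) ^ n)⁻¹ : ℂ) * dyadicLevel (nearBox.indicator f) n x‖ₑ ^ 2 ≤
      nearBox.indicator (fun x => 2 ^ p * ((2:ℝ≥0∞) ^ (-p)) ^ n * (1 + ‖f x‖ₑ ^ p)) x := by
  have hle : ‖(((2:ℝ) ^ n)⁻¹ : ℂ) * dyadicLevel (nearBox.indicator f) n x‖ₑ ≤ 1 := by
    rw [← ofReal_norm, ← ENNReal.ofReal_one]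
    refine ENNReal.ofReal_le_ofReal ?_
    rw [norm_mul, norm_inv, norm_pow, Complex.norm_real]
    norm_num
    rw [inv_mul_le_one₀ (by positivity)]
    exact norm_dyadicLevel_le _ _ _
  by_cases h0 : dyadicLevel (nearBox.indicator f) n x = 0
  · simp [h0]
  have hx : x ∈ nearBox := by
    by_contra hx
    have := norm_dyadicLevel_le_self (nearBox.indicator f) n x
    rw [indicator_of_notMem hx, norm_zero] at this
    exact h0 (norm_le_zero_iff.1 this)
  rw [indicator_of_mem hx]
  refine (pow_le_one₀ zero_le hle).trans ?_
  cases n with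
  | zero =>
    rw [pow_zero, mul_one]
    calc (1:ℝ≥0∞) = 1 * 1 := by simp
      _ ≤ _ := mul_le_mul' (ENNReal.one_le_rpow (by norm_num) hp) le_self_add
  | succ n =>
    have h1 : (2:ℝ) ^ n < ‖f x‖ := by
      by_contra h1
      refine h0 ?_
      simp only [dyadicLevel]
      refine indicator_of_notMem (fun hh => h1 ?_) _
      have := hh.1
      rwa [indicator_of_mem hx] at this
    have h2 : (2:ℝ≥0∞) ^ n ≤ ‖f x‖ₑ := by
      rw [← ofReal_norm, show (2:ℝ≥0∞) ^ n = ENNReal.ofReal (2 ^ n) by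
        rw [ENNReal.ofReal_pow (by norm_num)]; simp]
      exact ENNReal.ofReal_le_ofReal h1.le
    have e : (2:ℝ≥0∞) ^ p * ((2:ℝ≥0∞) ^ (-p)) ^ (n + 1) * ((2:ℝ≥0∞) ^ n) ^ p = 1 := by
      have h3 : (2:ℝ≥0∞) ^ p * (2:ℝ≥0∞) ^ (-p) = 1 := by
        rw [← ENNReal.rpow_add _ _ (by norm_num) (by norm_num)]; simp
      calc _ = ((2:ℝ≥0∞) ^ p * (2:ℝ≥0∞) ^ (-p)) ^ (n + 1) := by
            rw [ENNReal.pow_rpow_comm, mul_pow]; ring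
        _ = 1 := by rw [h3, one_pow]
    rw [← e]
    gcongr
    exact (ENNReal.rpow_le_rpow h2 hp.le).trans le_add_self

theorem lintegral_sq_dyadicLevel_le {f : ℝ × ℝ → ℂ} {p : ℝ} (hp : 0 < p) (hf : Measurable f)
    (h1 : ∫⁻ x in nearBox, ‖f x‖ₑ ^ p ≤ 1) (n : ℕ) :
    ∫⁻ x, ‖(((2:ℝ) ^ n)⁻¹ : ℂ) * dyadicLevel (nearBox.indicator f) n x‖ₑ ^ 2 ≤
      (2 ^ p * 1025) * ((2:ℝ≥0∞) ^ (-p)) ^ n := by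
  calc _ ≤ ∫⁻ x, nearBox.indicator (fun x => 2 ^ p * ((2:ℝ≥0∞) ^ (-p)) ^ n * (1 + ‖f x‖ₑ ^ p)) x :=
        lintegral_mono fun x => enorm_sq_dyadicLevel_le hp n x
    _ = 2 ^ p * ((2:ℝ≥0∞) ^ (-p)) ^ n * (1024 + ∫⁻ x in nearBox, ‖f x‖ₑ ^ p) := by
        rw [lintegral_indicator measurableSet_nearBox,
          lintegral_const_mul _ (by exact (hf.enorm.pow_const p).const_add 1),
          lintegral_add_left measurable_const, setLIntegral_const, volume_nearBox, one_mul]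
    _ ≤ 2 ^ p * ((2:ℝ≥0∞) ^ (-p)) ^ n * (1024 + 1) := by gcongr
    _ = _ := by norm_num; ring

theorem exists_tile_bound_unit {p q y z : ℝ} (hp : 1 < p) (hy : 0 < y) (hz : 0 ≤ z) (hyz : y + z ≤ 1)
    (hq : q = 2 + 2 * y + 3 * z) (hpq : q < p * (1 + z)) : ∃ C : ℝ≥0∞, C ≠ ∞ ∧
    ∀ {f : ℝ × ℝ → ℂ}, Integrable f → Measurable f → ∫⁻ x in nearBox, ‖f x‖ₑ ^ p ≤ 1 →
    ∀ {R : ℝ}, 39 / 10 ≤ R → ∀ m : ℝ, ∃ D : ℝ × ℝ → ℝ≥0∞, Measurable D ∧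
      (∀ x ∈ Ico (0:ℝ) 1, ∀ r ∈ radTile R m, ∀ t ∈ Ioo (1:ℝ) 2,
        ‖sphOp (fun _ => 1) f ((r ^ 2 + t ^ 2) / (2 * R) - m, x) (t * r / R)‖ₑ ^ q ≤ D (x, r)) ∧
      ∫⁻ x in Ico (0:ℝ) 1, ∫⁻ r in radTile R m, D (x, r) ≤ C := by
  have hq0 : 0 < q := by linarith
  have hp0 : 0 < p := by linarith
  have hE0 : (2:ℝ≥0∞) ^ p * 1025 ≠ ∞ := by finiteness
  obtain ⟨C₀, hC₀, hscale⟩ := exists_scale_bound hy hz hyz hq hE0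
  set δ := p * (1 + z) - q
  have hδ : 0 < δ := by simp only [δ]; linarith
  set ε := min (y / 4) δ / (2 * q)
  have hε : 0 < ε := by positivity
  have hε2 : ε * (2 * q) = min (y / 4) δ := by simp only [ε]; field_simp
  set s : ℝ≥0∞ := 2 ^ (-ε)
  have hs1 : s < 1 := ENNReal.rpow_lt_one_of_one_lt_of_neg (by norm_num) (by linarith)
  have hs0 : s ≠ 0 := by simp [s]
  have hst : s ≠ ∞ := hs1.ne_top
  have hsq1 : s ^ q < 1 := ENNReal.rpow_lt_one hs1 hq0
  have hgeo : ∀ {a : ℝ≥0∞}, a < 1 → (1 - a)⁻¹ ≠ ∞ := fun h => by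
    simpa [ENNReal.inv_eq_top, tsub_eq_zero_iff_le] using h
  set W : ℝ≥0∞ := (1 - s)⁻¹ * (1 - s)⁻¹
  have hW : W ≠ ∞ := ENNReal.mul_ne_top (hgeo hs1) (hgeo hs1)
  have hl : Integrable fun ξ => (lowCut ξ : ℂ) := by simpa using integrable_lowCut_dil one_pos
  set cL : ℝ≥0∞ := ENNReal.ofReal (2 * π * ∫ ξ, ‖(lowCut ξ : ℂ)‖)
  refine ⟨3 ^ q * ((cL * 1025) ^ q + W ^ q * (C₀ * (2 ^ p * 1025) ^ (1 + z) *
    ((1 - s ^ q)⁻¹ * (1 - s ^ q)⁻¹))), ?_, fun {f} hf hfm hf1 {R} hR m => ?_⟩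
  · have := hgeo hsq1
    finiteness
  have hR0 : 0 < R := by linarith
  set h := nearBox.indicator f
  have hhm : Measurable h := hfm.indicator measurableSet_nearBox
  have hhi : Integrable h := hf.indicator measurableSet_nearBox
  set g : ℕ → ℝ × ℝ → ℂ := fun n x => (((2:ℝ) ^ n)⁻¹ : ℂ) * dyadicLevel h n x
  have hLm := fun n => measurable_dyadicLevel hhm n
  have hLi : ∀ n, Integrable (dyadicLevel h n) := fun n =>
    hhi.mono (hLm n).aestronglyMeasurable (Filter.Eventually.of_forall (norm_dyadicLevel_le_self h n))
  have hE : ∀ n, ∫⁻ x, ‖g n x‖ₑ ^ 2 ≤ (2 ^ p * 1025) * ((2:ℝ≥0∞) ^ (-p)) ^ n :=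
    lintegral_sq_dyadicLevel_le hp0 hfm hf1
  have h2p : (2:ℝ≥0∞) ^ (-p) ≤ 1 := ENNReal.rpow_le_one_of_one_le_of_neg (by norm_num) (by linarith)
  have hg1 : ∀ n x, ‖g n x‖ ≤ 1 := by
    intro n x
    simp only [g]
    rw [norm_mul, norm_inv, norm_pow, Complex.norm_real]
    norm_num
    rw [inv_mul_le_one₀ (by positivity)]
    exact norm_dyadicLevel_le _ _ _
  have hD := fun i : ℕ × ℕ => hscale (lam := 2 ^ i.1) (one_le_pow₀ (by norm_num)) ((hLi i.2).const_mul _)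
    ((hLm i.2).const_mul _) (hg1 i.2) ((hE i.2).trans (mul_le_of_le_one_right zero_le (pow_le_one₀ zero_le h2p))) hR m
  choose D hDm hDb hDi using hD
  set w : ℕ × ℕ → ℝ≥0∞ := fun i => s ^ i.1 * s ^ i.2
  have hw0 : ∀ i, w i ≠ 0 := fun i => mul_ne_zero (pow_ne_zero _ hs0) (pow_ne_zero _ hs0)
  have hwt : ∀ i, w i ≠ ∞ := fun i => ENNReal.mul_ne_top (ENNReal.pow_ne_top hst) (ENNReal.pow_ne_top hst)
  refine ⟨fun v => 3 ^ q * ((cL * 1025) ^ q + W ^ q * ∑' i, ((2:ℝ≥0∞) ^ q) ^ i.2 * D i v * (w i ^ q)⁻¹), ?_, ?_, ?_⟩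
  · exact (((Measurable.tsum fun i => ((hDm i).const_mul _).mul_const _).const_mul _).const_add _).const_mul _
  · intro x hx r hr t ht
    have hmem := mem_box3_of_radTile (σ := 1) hR (by simp) hx hr ht
    have hρ : |t * r / R| ≤ 4 := by
      rw [abs_of_nonneg (div_nonneg (mul_nonneg (by linarith [ht.1]) (by linarith [hr.1.1])) hR0.le),
        div_le_iff₀ hR0]
      nlinarith [ht.1, ht.2, hr.1.1, hr.1.2]
    have h1 := enorm_sphOp_one_le hf (y := ((r ^ 2 + t ^ 2) / (2 * R) - m, x)) (ρ := t * r / R)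
      (abs_le.2 hmem.1) (abs_le.2 hmem.2.1) hρ
    set Y : ℝ × ℝ := ((r ^ 2 + t ^ 2) / (2 * R) - m, x)
    set ρ := t * r / R
    have hlow : ‖sphOp (fun ξ => (lowCut ξ : ℂ)) h Y ρ‖ₑ ≤ cL * 1025 := by
      have h2 := norm_sphOp_le (f := h) hl Y ρ
      rw [← ofReal_norm]
      refine (ENNReal.ofReal_le_ofReal h2).trans ?_
      rw [ENNReal.ofReal_mul (mul_nonneg (by positivity) (integral_nonneg fun _ => norm_nonneg _))]
      gcongr
      rw [ofReal_integral_norm_eq_lintegral_enorm hhi]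
      calc _ = ∫⁻ x in nearBox, ‖f x‖ₑ := by
            rw [← lintegral_indicator measurableSet_nearBox]
            refine lintegral_congr fun x => ?_
            simp only [h]
            exact enorm_indicator_eq_indicator_enorm _ _
        _ ≤ ∫⁻ x in nearBox, (1 + ‖f x‖ₑ ^ p) := by
            refine lintegral_mono fun x => ?_
            rcases le_total ‖f x‖ₑ 1 with h3 | h3
            · exact h3.trans le_self_add
            · refine le_trans ?_ le_add_self
              conv_lhs => rw [← ENNReal.rpow_one ‖f x‖ₑ]
              exact ENNReal.rpow_le_rpow_of_exponent_le h3 hp.le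
        _ = 1024 + ∫⁻ x in nearBox, ‖f x‖ₑ ^ p := by
            rw [lintegral_add_left measurable_const, setLIntegral_const, volume_nearBox, one_mul]
        _ ≤ 1024 + 1 := by gcongr
        _ = 1025 := by norm_num
    have hann : ∑' j : ℕ, ‖sphOp (fun ξ => (annCut (ξ.1 / 2 ^ j, ξ.2 / 2 ^ j) : ℂ)) h Y ρ‖ₑ ≤
        ∑' i : ℕ × ℕ, ‖sphOp (fun ξ => (annCut (ξ.1 / 2 ^ i.1, ξ.2 / 2 ^ i.1) : ℂ)) (dyadicLevel h i.2) Y ρ‖ₑ := by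
      rw [ENNReal.tsum_prod (f := fun j n => ‖sphOp (fun ξ => (annCut (ξ.1 / 2 ^ j, ξ.2 / 2 ^ j) : ℂ))
        (dyadicLevel h n) Y ρ‖ₑ)]
      exact ENNReal.tsum_le_tsum fun j => enorm_sphOp_le_tsum_dyadicLevel
        (isAnnAmp_annCut.integrable_dil (one_le_pow₀ (by norm_num))) hhi hhm Y ρ
    have hcoef : ∀ i : ℕ × ℕ, ‖sphOp (fun ξ => (annCut (ξ.1 / 2 ^ i.1, ξ.2 / 2 ^ i.1) : ℂ))
        (dyadicLevel h i.2) Y ρ‖ₑ ^ q ≤ ((2:ℝ≥0∞) ^ q) ^ i.2 * D i (x, r) := by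
      intro i
      have e : dyadicLevel h i.2 = fun x => ((2:ℂ) ^ i.2) * g i.2 x := by
        funext x
        simp only [g]
        rw [← mul_assoc]
        push_cast
        rw [mul_inv_cancel₀ (pow_ne_zero _ two_ne_zero), one_mul]
      rw [e, sphOp_const_mul, enorm_mul, ENNReal.mul_rpow_of_nonneg _ _ hq0.le, enorm_pow,
        ENNReal.pow_rpow_comm]
      have e2 : ‖(2:ℂ)‖ₑ = 2 := by
        rw [← ofReal_norm]; simp
      rw [e2]
      gcongr
      exact hDb i x r hr.1 t ht
    calc _ ≤ (cL * 1025 + (∑' i : ℕ × ℕ, ‖sphOp (fun ξ => (annCut (ξ.1 / 2 ^ i.1, ξ.2 / 2 ^ i.1) : ℂ))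
          (dyadicLevel h i.2) Y ρ‖ₑ) + 0) ^ q := by
          rw [add_zero]
          exact ENNReal.rpow_le_rpow (h1.trans (add_le_add hlow hann)) hq0.le
      _ ≤ 3 ^ q * ((cL * 1025) ^ q + (∑' i : ℕ × ℕ, ‖sphOp (fun ξ => (annCut (ξ.1 / 2 ^ i.1, ξ.2 / 2 ^ i.1) : ℂ))
          (dyadicLevel h i.2) Y ρ‖ₑ) ^ q + 0 ^ q) := ENNReal.add3_rpow_le _ _ _ hq0
      _ ≤ _ := by
          rw [ENNReal.zero_rpow_of_pos hq0, add_zero]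
          refine mul_le_mul' le_rfl (add_le_add le_rfl ?_)
          refine (ENNReal.tsum_rpow_le_of_weight hq0 hcoef hw0 hwt).trans ?_
          rw [ENNReal.tsum_prod_geometric]
  · have hDr : ∀ i x, Measurable fun r => D i (x, r) := fun i x => (hDm i).comp (by fun_prop)
    have hDx : ∀ i, Measurable fun x => ∫⁻ r in radTile R m, D i (x, r) := fun i =>
      Measurable.lintegral_prod_right' (hDm i)
    have hterm : ∀ i : ℕ × ℕ, ((2:ℝ≥0∞) ^ q) ^ i.2 * (∫⁻ x in Ico (0:ℝ) 1, ∫⁻ r in radTile R m, D i (x, r)) *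
        (w i ^ q)⁻¹ ≤ C₀ * (2 ^ p * 1025) ^ (1 + z) * ((s ^ q) ^ i.1 * (s ^ q) ^ i.2) := by
      intro i
      have hsq0 : s ^ q ≠ 0 := by simp [hs0, hst]
      have hsqt : s ^ q ≠ ∞ := hsq1.ne_top
      have e1 : ENNReal.ofReal (2 ^ i.1) ^ (-(y / 4)) ≤ (s ^ q * s ^ q) ^ i.1 := by
        rw [ENNReal.ofReal_pow (by norm_num), ENNReal.pow_rpow_comm]
        refine pow_le_pow_left₀ zero_le ?_ _
        rw [← ENNReal.rpow_add _ _ hs0 hst, ← ENNReal.rpow_mul]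
        norm_num
        refine ENNReal.rpow_le_rpow_of_exponent_le (by norm_num) ?_
        have : min (y / 4) δ ≤ y / 4 := min_le_left _ _
        nlinarith
      have e2 : ((2:ℝ≥0∞) ^ q) ^ i.2 * (((2:ℝ≥0∞) ^ (-p)) ^ i.2) ^ (1 + z) ≤ (s ^ q * s ^ q) ^ i.2 := by
        rw [ENNReal.pow_rpow_comm, ← mul_pow]
        refine pow_le_pow_left₀ zero_le ?_ _
        rw [← ENNReal.rpow_add _ _ hs0 hst, ← ENNReal.rpow_mul, ← ENNReal.rpow_mul,
          ← ENNReal.rpow_add _ _ (by norm_num) (by norm_num)]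
        refine ENNReal.rpow_le_rpow_of_exponent_le (by norm_num) ?_
        have : min (y / 4) δ ≤ δ := min_le_right _ _
        simp only [δ] at this hε2
        nlinarith
      have e3 : w i ^ q = (s ^ q) ^ i.1 * (s ^ q) ^ i.2 := by
        simp only [w]
        rw [ENNReal.mul_rpow_of_nonneg _ _ hq0.le, ENNReal.pow_rpow_comm, ENNReal.pow_rpow_comm]
      calc _ ≤ ((2:ℝ≥0∞) ^ q) ^ i.2 * (C₀ * ENNReal.ofReal (2 ^ i.1) ^ (-(y / 4)) *
            ((2 ^ p * 1025) * ((2:ℝ≥0∞) ^ (-p)) ^ i.2) ^ (1 + z)) * (w i ^ q)⁻¹ := by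
            gcongr
            refine (hDi i).trans ?_
            gcongr
            exact hE i.2
        _ = C₀ * (2 ^ p * 1025) ^ (1 + z) * (ENNReal.ofReal (2 ^ i.1) ^ (-(y / 4)) *
            (((2:ℝ≥0∞) ^ q) ^ i.2 * (((2:ℝ≥0∞) ^ (-p)) ^ i.2) ^ (1 + z))) * (w i ^ q)⁻¹ := by
            rw [ENNReal.mul_rpow_of_nonneg _ _ (by linarith : 0 ≤ 1 + z)]
            ring
        _ ≤ C₀ * (2 ^ p * 1025) ^ (1 + z) * ((s ^ q * s ^ q) ^ i.1 * (s ^ q * s ^ q) ^ i.2) * (w i ^ q)⁻¹ := by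
            gcongr
        _ = C₀ * (2 ^ p * 1025) ^ (1 + z) * ((s ^ q) ^ i.1 * (s ^ q) ^ i.2) * (w i ^ q * (w i ^ q)⁻¹) := by
            rw [e3, mul_pow, mul_pow]; ring
        _ = _ := by
            rw [ENNReal.mul_inv_cancel, mul_one]
            · rw [e3]; exact mul_ne_zero (pow_ne_zero _ hsq0) (pow_ne_zero _ hsq0)
            · rw [e3]; exact ENNReal.mul_ne_top (ENNReal.pow_ne_top hsqt) (ENNReal.pow_ne_top hsqt)
    have hin : ∀ x, ∫⁻ r in radTile R m, 3 ^ q * ((cL * 1025) ^ q +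
        W ^ q * ∑' i : ℕ × ℕ, ((2:ℝ≥0∞) ^ q) ^ i.2 * D i (x, r) * (w i ^ q)⁻¹) ≤
        3 ^ q * ((cL * 1025) ^ q + W ^ q * ∑' i : ℕ × ℕ, ((2:ℝ≥0∞) ^ q) ^ i.2 *
          (∫⁻ r in radTile R m, D i (x, r)) * (w i ^ q)⁻¹) := by
      intro x
      have hm : Measurable fun r => ∑' i : ℕ × ℕ, ((2:ℝ≥0∞) ^ q) ^ i.2 * D i (x, r) * (w i ^ q)⁻¹ :=
        Measurable.tsum fun i => ((hDr i x).const_mul _).mul_const _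
      rw [lintegral_const_mul _ (by exact (hm.const_mul _).const_add _), lintegral_add_left measurable_const,
        setLIntegral_const, lintegral_const_mul _ hm,
        lintegral_tsum fun i => (((hDr i x).const_mul _).mul_const _).aemeasurable]
      gcongr with i
      · exact mul_le_of_le_one_right zero_le (volume_radTile_le hR0 m)
      · rw [lintegral_mul_const _ ((hDr i x).const_mul _), lintegral_const_mul _ (hDr i x)]
    refine (lintegral_mono hin).trans ?_
    have hm : Measurable fun x => ∑' i : ℕ × ℕ, ((2:ℝ≥0∞) ^ q) ^ i.2 *
        (∫⁻ r in radTile R m, D i (x, r)) * (w i ^ q)⁻¹ :=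
      Measurable.tsum fun i => ((hDx i).const_mul _).mul_const _
    rw [lintegral_const_mul _ (by exact (hm.const_mul _).const_add _), lintegral_add_left measurable_const,
        setLIntegral_const, lintegral_const_mul _ hm,
        lintegral_tsum fun i => (((hDx i).const_mul _).mul_const _).aemeasurable]
    have hv : volume (Ico (0:ℝ) 1) = 1 := by simp
    rw [hv, mul_one]
    gcongr
    rw [← ENNReal.tsum_prod_geometric, ← ENNReal.tsum_mul_left]
    refine ENNReal.tsum_le_tsum fun i => ?_
    rw [lintegral_mul_const _ ((hDx i).const_mul _), lintegral_const_mul _ (hDx i)]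
    exact hterm i

theorem exists_tile_bound {p q y z : ℝ} (hp : 1 < p) (hy : 0 < y) (hz : 0 ≤ z) (hyz : y + z ≤ 1)
    (hq : q = 2 + 2 * y + 3 * z) (hpq : q < p * (1 + z)) : ∃ C : ℝ≥0∞, C ≠ ∞ ∧
    ∀ {f : ℝ × ℝ → ℂ}, Integrable f → Measurable f →
    ∀ {R : ℝ}, 39 / 10 ≤ R → ∀ m : ℝ, ∃ D : ℝ × ℝ → ℝ≥0∞, Measurable D ∧
      (∀ x ∈ Ico (0:ℝ) 1, ∀ r ∈ radTile R m, ∀ t ∈ Ioo (1:ℝ) 2,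
        ‖sphOp (fun _ => 1) f ((r ^ 2 + t ^ 2) / (2 * R) - m, x) (t * r / R)‖ₑ ^ q ≤ D (x, r)) ∧
      ∫⁻ x in Ico (0:ℝ) 1, ∫⁻ r in radTile R m, D (x, r) ≤
        C * (∫⁻ x in nearBox, ‖f x‖ₑ ^ p) ^ (q / p) := by
  have hq0 : 0 < q := by linarith
  have hp0 : 0 < p := by linarith
  obtain ⟨C, hC, hb⟩ := exists_tile_bound_unit hp hy hz hyz hq hpq
  refine ⟨C + 1, by finiteness, fun {f} hf hfm {R} hR m => ?_⟩
  have hR0 : 0 < R := by linarith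
  set P := ∫⁻ x in nearBox, ‖f x‖ₑ ^ p with hP
  by_cases hPt : P = ∞
  · refine ⟨fun _ => ∞, measurable_const, fun _ _ _ _ _ _ => le_top, ?_⟩
    rw [hPt, ENNReal.top_rpow_of_pos (by positivity), ENNReal.mul_top (by simp)]
    exact le_top
  by_cases hP0 : P = 0
  · refine ⟨fun _ => 0, measurable_const, fun x hx r hr t ht => ?_, by simp⟩
    have hae : nearBox.indicator f =ᵐ[volume] fun _ => 0 := by
      have h1 := (lintegral_eq_zero_iff (hfm.enorm.pow_const p)).1 hP0
      rw [Filter.EventuallyEq, ae_restrict_iff' measurableSet_nearBox] at h1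
      filter_upwards [h1] with x hx
      by_cases hxn : x ∈ nearBox
      · have := hx hxn
        simp only [Pi.zero_apply, ENNReal.rpow_eq_zero_iff, enorm_eq_zero] at this
        rcases this with h | h
        · rw [indicator_of_mem hxn, h.1]
        · linarith
      · rw [indicator_of_notMem hxn]
    have hft : ∀ ξ, ft2 (nearBox.indicator f) ξ = 0 := by
      intro ξ
      rw [ft2]
      refine integral_eq_zero_of_ae ?_
      filter_upwards [hae] with x hx
      simp [hx]
    have hz : ∀ b Y ρ, sphOp b (nearBox.indicator f) Y ρ = 0 := by
      intro b Y ρ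
      simp [sphOp, hft]
    have hmem := mem_box3_of_radTile (σ := 1) hR (by simp) hx hr ht
    have hρ : |t * r / R| ≤ 4 := by
      rw [abs_of_nonneg (div_nonneg (mul_nonneg (by linarith [ht.1]) (by linarith [hr.1.1])) hR0.le),
        div_le_iff₀ hR0]
      nlinarith [ht.1, ht.2, hr.1.1, hr.1.2]
    have h1 := enorm_sphOp_one_le hf (y := ((r ^ 2 + t ^ 2) / (2 * R) - m, x)) (ρ := t * r / R)
      (abs_le.2 hmem.1) (abs_le.2 hmem.2.1) hρ
    simp only [hz, enorm_zero, tsum_zero, add_zero] at h1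
    rw [le_zero_iff.1 h1, ENNReal.zero_rpow_of_pos hq0]
  set T := (P ^ (1 / p)).toReal with hT
  have hPp : P ^ (1 / p) ≠ ∞ := by finiteness
  have hTP : ENNReal.ofReal T = P ^ (1 / p) := ENNReal.ofReal_toReal hPp
  have hT0 : 0 < T := ENNReal.toReal_pos (by simp [hP0, hPt]) hPp
  have hTp : ENNReal.ofReal T ^ p = P := by
    rw [hTP, ← ENNReal.rpow_mul, one_div_mul_cancel hp0.ne', ENNReal.rpow_one]
  have hTe : ‖(T : ℂ)‖ₑ = ENNReal.ofReal T := by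
    rw [← ofReal_norm, Complex.norm_real, Real.norm_of_nonneg hT0.le]
  have hTc : (T : ℂ) ≠ 0 := by exact_mod_cast hT0.ne'
  set g : ℝ × ℝ → ℂ := fun x => (T : ℂ)⁻¹ * f x
  have hfg : f = fun x => (T : ℂ) * g x := by
    funext x
    simp only [g]
    rw [← mul_assoc, mul_inv_cancel₀ hTc, one_mul]
  have hg1 : ∫⁻ x in nearBox, ‖g x‖ₑ ^ p ≤ 1 := by
    have e : ∀ x, ‖f x‖ₑ ^ p = P * ‖g x‖ₑ ^ p := by
      intro x
      rw [← hTp, ← hTe, ← ENNReal.mul_rpow_of_nonneg _ _ hp0.le, ← enorm_mul]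
      exact congrArg (fun v => ‖v‖ₑ ^ p) (congrFun hfg x)
    have h2 : P * ∫⁻ x in nearBox, ‖g x‖ₑ ^ p = P := by
      rw [← lintegral_const_mul' _ _ hPt]
      simp_rw [← e]
      rw [← hP]
    exact ((ENNReal.mul_eq_left hP0 hPt).1 h2).le
  obtain ⟨D, hDm, hDb, hDi⟩ := hb (hf.const_mul _) (hfm.const_mul _) hg1 hR m
  refine ⟨fun v => P ^ (q / p) * D v, hDm.const_mul _, fun x hx r hr t ht => ?_, ?_⟩
  · have hTq : ENNReal.ofReal T ^ q = P ^ (q / p) := by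
      rw [hTP, ← ENNReal.rpow_mul]; congr 1; ring
    rw [hfg, sphOp_const_mul, enorm_mul, ENNReal.mul_rpow_of_nonneg _ _ hq0.le, hTe, hTq]
    exact mul_le_mul' le_rfl (hDb x hx r hr t ht)
  · have hPq : P ^ (q / p) ≠ ∞ := by finiteness
    simp only [lintegral_const_mul' _ _ hPq]
    rw [mul_comm]
    gcongr
    exact hDi.trans le_self_add

/-- Rescaling the spherical means to a unit tile. -/
theorem Aop_eq_sphOp {g : ℝ × ℝ → ℂ} (hg : Measurable g) {R : ℝ} (hR : 0 < R) (m : ℝ × ℝ) (t r x : ℝ) :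
    Aop g t r x = (((2 * π) ^ (-2 : ℤ) : ℝ) : ℂ) * sphOp (fun _ => 1) (fun u => g (R * (u.1 + m.1), R * (u.2 + m.2)))
      ((r ^ 2 + t ^ 2) / (2 * R) - m.1, x / R - m.2) (t * r / R) := by
  set f : ℝ × ℝ → ℂ := fun u => g (R * (u.1 + m.1), R * (u.2 + m.2))
  have hd : R * R - 0 * 0 ≠ 0 := by nlinarith
  have hft : ∀ ξ : ℝ × ℝ, ft2 g ξ = ((R * R : ℝ) : ℂ) * (ec (-(R * (m.1 * ξ.1 + m.2 * ξ.2))) * ft2 f (R * ξ.1, R * ξ.2)) := by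
    intro ξ
    have h := integral_comp_aff hd (R * m.1) (R * m.2)
      (F := fun y : ℝ × ℝ => Complex.exp (-(Complex.I) * ((y.1 * ξ.1 + y.2 * ξ.2 : ℝ) : ℂ)) * g y)
      (by fun_prop)
    have h2 : ft2 g ξ = ((R * R : ℝ) : ℂ) * ∫ w : ℝ × ℝ, (fun y : ℝ × ℝ => Complex.exp (-(Complex.I) *
        ((y.1 * ξ.1 + y.2 * ξ.2 : ℝ) : ℂ)) * g y) (aff R 0 0 R (R * m.1) (R * m.2) w) := by
      rw [h, ft2]
      have hRR : (0:ℝ) < R * R := by positivity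
      rw [show R * R - 0 * 0 = R * R by ring, abs_of_pos hRR, Complex.real_smul, ← mul_assoc,
        ← Complex.ofReal_mul, mul_inv_cancel₀ hRR.ne', Complex.ofReal_one, one_mul]
    rw [h2]
    congr 1
    rw [ft2, ← integral_const_mul]
    refine integral_congr_ae (Filter.Eventually.of_forall fun w => ?_)
    simp only [aff, f, ec]
    rw [← mul_assoc, ← Complex.exp_add]
    congr 1
    · congr 1; push_cast; ring
    · congr 1; ext <;> simp <;> ring
  rw [Aop]
  congr 1
  set Y : ℝ × ℝ := ((r ^ 2 + t ^ 2) / (2 * R) - m.1, x / R - m.2)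
  set F : ℝ × ℝ → ℂ := fun ξ => ec (dot2 Y ξ) * sigmaHat (t * r / R * ξ.1, t * r / R * ξ.2) * (1 * ft2 f ξ)
  have hfm : Measurable f := by fun_prop
  have h := integral_comp_aff hd 0 0 (F := F)
    (((continuous_mult Y _).measurable.mul ((measurable_ft2 hfm).const_mul 1)).aestronglyMeasurable)
  have hRR : (0:ℝ) < R * R := by positivity
  have h2 : sphOp (fun _ => 1) f Y (t * r / R) = ((R * R : ℝ) : ℂ) * ∫ w, F (aff R 0 0 R 0 0 w) := by
    rw [h, sphOp, show R * R - 0 * 0 = R * R by ring, abs_of_pos hRR, Complex.real_smul, ← mul_assoc,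
        ← Complex.ofReal_mul, mul_inv_cancel₀ hRR.ne', Complex.ofReal_one, one_mul]
  rw [h2, ← integral_const_mul]
  refine integral_congr_ae (Filter.Eventually.of_forall fun ξ => ?_)
  have e1 : aff R 0 0 R 0 0 ξ = (R * ξ.1, R * ξ.2) := by
    ext <;> simp [aff]
  simp only [F, e1, hft]
  rw [show t * r / R * (R * ξ.1) = t * r * ξ.1 by field_simp, show t * r / R * (R * ξ.2) = t * r * ξ.2 by field_simp]
  have e2 : Complex.exp (Complex.I * ((((r ^ 2 + t ^ 2) / 2) * ξ.1 + x * ξ.2 : ℝ) : ℂ)) *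
      ec (-(R * (m.1 * ξ.1 + m.2 * ξ.2))) = ec (dot2 Y (R * ξ.1, R * ξ.2)) := by
    change ec _ * _ = _
    rw [← ec_add]
    congr 1
    simp only [dot2, Y]
    field_simp
    ring
  rw [← e2]
  ring

theorem ENNReal.tsum_le_card {ι : Type*} {f : ι → ℝ≥0∞} (s : Finset ι) (hf : ∀ i, f i ≤ 1)
    (hs : ∀ i, f i ≠ 0 → i ∈ s) : ∑' i, f i ≤ s.card := by
  rw [tsum_eq_sum (s := s) (fun i hi => by by_contra h; exact hi (hs i h))]
  refine (Finset.sum_le_card_nsmul s f 1 fun i _ => hf i).trans ?_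
  simp

/-- The strip of first coordinates that influence the radii in `[R, 2 * R)`. -/
def infStrip (R : ℝ) : Set (ℝ × ℝ) := {y | R * (R / 2 - 17) ≤ y.1 ∧ y.1 ≤ R * (2 * R + 16)}

theorem measurableSet_infStrip (R : ℝ) : MeasurableSet (infStrip R) :=
  (measurableSet_le measurable_const measurable_fst).inter
    (measurableSet_le measurable_fst measurable_const)

/-- Indicator of the `R`-scaled enlarged tile at `m`, zero when no radius meets the tile. -/
def tileWeight (R : ℝ) (m : ℤ × ℤ) (y : ℝ × ℝ) : ℝ≥0∞ :=
  {u : ℝ × ℝ | (radTile R m.1).Nonempty ∧ (u.1 / R - m.1, u.2 / R - m.2) ∈ nearBox}.indicator 1 y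

theorem measurable_tileWeight (R : ℝ) (m : ℤ × ℤ) : Measurable (tileWeight R m) := by
  refine measurable_one.indicator ?_
  exact (MeasurableSet.const _).inter (measurableSet_nearBox.preimage
    (f := fun u : ℝ × ℝ => (u.1 / R - m.1, u.2 / R - m.2)) (by fun_prop))

theorem tileWeight_le_one (R : ℝ) (m : ℤ × ℤ) (y : ℝ × ℝ) : tileWeight R m y ≤ 1 := by
  unfold tileWeight
  exact indicator_le_self' (by simp) y

theorem tsum_tileWeight_le {R : ℝ} (hR : 0 < R) (y : ℝ × ℝ) :
    ∑' m, tileWeight R m y ≤ 1089 * (infStrip R).indicator 1 y := by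
  have key : ∀ m, tileWeight R m y ≠ 0 → (radTile R m.1).Nonempty ∧
      (y.1 / R - m.1, y.2 / R - m.2) ∈ nearBox := by
    intro m hm
    by_contra h
    rw [tileWeight, indicator_of_notMem (by simpa only [mem_ofPred_eq] using h)] at hm
    exact hm rfl
  by_cases hy : y ∈ infStrip R
  · rw [indicator_of_mem hy, Pi.one_apply, mul_one]
    refine (ENNReal.tsum_le_card (Finset.Icc (⌊y.1 / R⌋ - 16) (⌊y.1 / R⌋ + 16) ×ˢ
      Finset.Icc (⌊y.2 / R⌋ - 16) (⌊y.2 / R⌋ + 16)) (fun m => tileWeight_le_one R m y) ?_).trans ?_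
    · intro m hm
      obtain ⟨-, h⟩ := key m hm
      simp only [nearBox, mem_prod, mem_Icc] at h
      have aux : ∀ (v : ℝ) (n : ℤ), -16 ≤ v - n → v - n ≤ 16 → ⌊v⌋ - 16 ≤ n ∧ n ≤ ⌊v⌋ + 16 := by
        intro v n h1 h2
        constructor
        · have : (⌊v⌋ : ℝ) ≤ (n + 16 : ℤ) := by push_cast; linarith [Int.floor_le v]
          have := Int.cast_le.1 this
          omega
        · have : n - 16 ≤ ⌊v⌋ := Int.le_floor.2 (by push_cast; linarith)
          omega
      rw [Finset.mem_product, Finset.mem_Icc, Finset.mem_Icc]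
      exact ⟨aux _ _ h.1.1 h.1.2, aux _ _ h.2.1 h.2.2⟩
    · rw [Finset.card_product, Int.card_Icc, Int.card_Icc,
        show ∀ a : ℤ, (a + 16 + 1 - (a - 16)).toNat = 33 by intro a; omega,
        show ∀ a : ℤ, (a + 16 + 1 - (a - 16)).toNat = 33 by intro a; omega]
      norm_num
  · have : ∀ m, tileWeight R m y = 0 := by
      intro m
      by_contra hm
      obtain ⟨⟨r, hr1, hr2⟩, h⟩ := key m hm
      simp only [nearBox, mem_prod, mem_Icc] at h
      simp only [mem_ofPred_eq, mem_Ico] at hr2 hr1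
      apply hy
      have e : y.1 = R * (y.1 / R) := by field_simp
      have b1 : R / 2 ≤ r ^ 2 / (2 * R) := by
        rw [le_div_iff₀ (by positivity)]; nlinarith
      have b2 : r ^ 2 / (2 * R) ≤ 2 * R := by
        rw [div_le_iff₀ (by positivity)]; nlinarith
      constructor
      · rw [e]; exact mul_le_mul_of_nonneg_left (by linarith) hR.le
      · rw [e]; exact mul_le_mul_of_nonneg_left (by linarith) hR.le
    simp [this]

theorem lintegral_nearBox_rescale {h : ℝ × ℝ → ℝ≥0∞} (hh : Measurable h) {R : ℝ} (hR : 0 < R)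
    {m : ℤ × ℤ} (hm : (radTile R m.1).Nonempty) :
    ∫⁻ u in nearBox, h (R * (u.1 + m.1), R * (u.2 + m.2)) =
      ENNReal.ofReal ((R ^ 2)⁻¹) * ∫⁻ y, tileWeight R m y * h y := by
  have h1 := lintegral_comp_aff (a := R) (b := 0) (c := 0) (d := R) (by nlinarith) (R * m.1) (R * m.2)
    ((measurable_tileWeight R m).mul hh)
  rw [show |R * R - 0 * 0|⁻¹ = (R ^ 2)⁻¹ by rw [abs_of_nonneg (by nlinarith)]; ring] at h1
  simp only [Pi.mul_apply] at h1
  rw [← h1, ← lintegral_indicator measurableSet_nearBox]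
  refine lintegral_congr fun u => ?_
  have e : aff R 0 0 R (R * m.1) (R * m.2) u = (R * (u.1 + m.1), R * (u.2 + m.2)) := by
    ext <;> simp [aff] <;> ring
  rw [e]
  by_cases hu : u ∈ nearBox
  · rw [indicator_of_mem hu, tileWeight, indicator_of_mem, Pi.one_apply, one_mul]
    refine ⟨hm, ?_⟩
    convert hu using 1
    ext <;> field_simp <;> ring
  · rw [indicator_of_notMem hu, tileWeight, indicator_of_notMem, zero_mul]
    rintro ⟨-, h2⟩
    apply hu
    convert h2 using 1
    ext <;> field_simp <;> ring

theorem exists_annulus_bound {p q y z : ℝ} (hp : 1 < p) (hy : 0 < y) (hz : 0 ≤ z) (hyz : y + z ≤ 1)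
    (hq : q = 2 + 2 * y + 3 * z) (hpq : q < p * (1 + z)) (hpq' : p ≤ q) : ∃ C : ℝ≥0∞, C ≠ ∞ ∧
    ∀ {g : ℝ × ℝ → ℂ}, Integrable g → Measurable g →
    ∀ {R : ℝ}, 39 / 10 ≤ R → ∃ M : ℝ × ℝ → ℝ≥0∞, Measurable M ∧
      (∀ r ∈ Ico R (2 * R), ∀ x, ∀ t ∈ Ioo (1:ℝ) 2, ‖Aop g t r x‖ₑ ^ q ≤ M (r, x)) ∧
      ∫⁻ v, M v ≤ C * ENNReal.ofReal R⁻¹ * (∫⁻ v, ‖g v‖ₑ ^ p) ^ (q / p - 1) *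
        ∫⁻ v in infStrip R, ‖g v‖ₑ ^ p := by
  have hp0 : 0 < p := by linarith
  have hq0 : 0 < q := by linarith
  obtain ⟨C, hC, hb⟩ := exists_tile_bound hp hy hz hyz hq hpq
  refine ⟨C * 1089, by finiteness, fun {g} hg hgm {R} hR => ?_⟩
  have hR0 : 0 < R := by linarith
  set P := ∫⁻ v, ‖g v‖ₑ ^ p with hP
  set s := q / p - 1 with hs
  have hs0 : 0 ≤ s := by rw [hs, sub_nonneg, one_le_div hp0]; exact hpq'
  have hgp : Measurable fun v => ‖g v‖ₑ ^ p := hgm.enorm.pow_const p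
  have hfi : ∀ m : ℤ × ℤ, Integrable fun u : ℝ × ℝ => g (R * (u.1 + m.1), R * (u.2 + m.2)) := by
    intro m
    refine ⟨Measurable.aestronglyMeasurable (by fun_prop), ?_⟩
    have h1 := lintegral_comp_aff (a := R) (b := 0) (c := 0) (d := R) (by nlinarith) (R * m.1)
      (R * m.2) hgm.enorm
    have e : ∀ u, aff R 0 0 R (R * m.1) (R * m.2) u = (R * (u.1 + m.1), R * (u.2 + m.2)) := by
      intro u; ext <;> simp [aff] <;> ring
    simp only [e] at h1
    rw [HasFiniteIntegral, h1]
    exact ENNReal.mul_lt_top ENNReal.ofReal_lt_top hg.2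
  choose D hDm hDb hDi using fun m : ℤ × ℤ =>
    hb (hfi m) (by fun_prop) hR (m.1 : ℝ)
  set F : ℤ × ℤ → ℝ × ℝ → ℝ≥0∞ := fun m => (Ico (0:ℝ) 1 ×ˢ radTile R m.1).indicator (D m)
  have hms : ∀ m : ℤ × ℤ, MeasurableSet (Ico (0:ℝ) 1 ×ˢ radTile R m.1) := fun m =>
    measurableSet_Ico.prod (measurableSet_radTile _ _)
  have hFm : ∀ m, Measurable (F m) := fun m => (hDm m).indicator (hms m)
  set E : ℤ × ℤ → ℝ × ℝ → ℝ≥0∞ := fun m v => F m (aff 0 R⁻¹ 1 0 (-m.2) 0 v)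
  have hEm : ∀ m, Measurable (E m) := fun m => (hFm m).comp (continuous_aff _ _ _ _ _ _).measurable
  have hX : ∀ m, ∫⁻ v, tileWeight R m v * ‖g v‖ₑ ^ p ≤ P := fun m =>
    lintegral_mono fun v => mul_le_of_le_one_left' (tileWeight_le_one R m v)
  have hEi : ∀ m, ∫⁻ v, E m v ≤ C * ENNReal.ofReal R⁻¹ * P ^ s *
      ∫⁻ v, tileWeight R m v * ‖g v‖ₑ ^ p := by
    intro m
    have h1 := lintegral_comp_aff (a := 0) (b := R⁻¹) (c := 1) (d := 0)
      (by simp [hR0.ne']) (-(m.2 : ℝ)) 0 (hFm m)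
    have h2 : ∫⁻ v, E m v = ENNReal.ofReal R * ∫⁻ v, F m v := by
      refine h1.trans ?_
      rw [show |0 * 0 - R⁻¹ * 1|⁻¹ = R by simp [abs_of_pos hR0]]
    have h3 : ∫⁻ v, F m v = ∫⁻ x in Ico (0:ℝ) 1, ∫⁻ r in radTile R m.1, D m (x, r) := by
      rw [lintegral_indicator (hms m), Measure.volume_eq_prod, ← Measure.prod_restrict,
        lintegral_prod _ (hDm m).aemeasurable]
    by_cases hm : (radTile R m.1).Nonempty
    · have h4 := lintegral_nearBox_rescale hgp hR0 hm
      rw [h2, h3]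
      refine (mul_le_mul' le_rfl (hDi m)).trans ?_
      rw [h4]
      set X := ∫⁻ v, tileWeight R m v * ‖g v‖ₑ ^ p
      rw [ENNReal.mul_rpow_of_nonneg _ _ (by positivity)]
      have h5 : ENNReal.ofReal ((R ^ 2)⁻¹) ^ (q / p) ≤ ENNReal.ofReal ((R ^ 2)⁻¹) := by
        refine ENNReal.rpow_le_self_of_le_one ?_ ?_
        · rw [← ENNReal.ofReal_one]
          refine ENNReal.ofReal_le_ofReal (inv_le_one_of_one_le₀ ?_)
          nlinarith
        · rw [one_le_div hp0]; exact hpq'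
      have h6 : X ^ (q / p) ≤ X * P ^ s := by
        rw [show q / p = 1 + s by rw [hs]; ring, ENNReal.rpow_add_of_nonneg _ _ zero_le_one hs0,
          ENNReal.rpow_one]
        exact mul_le_mul' le_rfl (ENNReal.rpow_le_rpow (hX m) hs0)
      have h7 : ENNReal.ofReal R * ENNReal.ofReal ((R ^ 2)⁻¹) = ENNReal.ofReal R⁻¹ := by
        rw [← ENNReal.ofReal_mul hR0.le]
        congr 1
        field_simp
      calc ENNReal.ofReal R * (C * (ENNReal.ofReal ((R ^ 2)⁻¹) ^ (q / p) * X ^ (q / p)))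
          ≤ ENNReal.ofReal R * (C * (ENNReal.ofReal ((R ^ 2)⁻¹) * (X * P ^ s))) := by gcongr
        _ = C * (ENNReal.ofReal R * ENNReal.ofReal ((R ^ 2)⁻¹)) * P ^ s * X := by ring
        _ = _ := by rw [h7]
    · rw [h2, h3, not_nonempty_iff_eq_empty.1 hm]
      simp
  refine ⟨fun v => ∑' m, E m v, Measurable.tsum hEm, ?_, ?_⟩
  · intro r hr x t ht
    set m : ℤ × ℤ := (⌊r ^ 2 / (2 * R)⌋, ⌊x / R⌋)
    refine le_trans ?_ (ENNReal.le_tsum m)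
    have e : aff 0 R⁻¹ 1 0 (-m.2) 0 (r, x) = (x / R - m.2, r) := by
      ext <;> simp [aff]; ring
    have hx1 : x / R - m.2 ∈ Ico (0:ℝ) 1 :=
      ⟨sub_nonneg.2 (Int.floor_le _), by linarith [Int.lt_floor_add_one (x / R)]⟩
    have hr1 : r ∈ radTile R m.1 :=
      ⟨hr, sub_nonneg.2 (Int.floor_le _), by linarith [Int.lt_floor_add_one (r ^ 2 / (2 * R))]⟩
    simp only [E, F, e]
    rw [indicator_of_mem (mem_prod.2 ⟨hx1, hr1⟩)]
    refine le_trans ?_ (hDb m _ hx1 _ hr1 t ht)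
    rw [Aop_eq_sphOp hgm hR0 (m.1, m.2) t r x, enorm_mul]
    refine ENNReal.rpow_le_rpow (mul_le_of_le_one_left' ?_) hq0.le
    rw [← ofReal_norm, Complex.norm_real, ← ENNReal.ofReal_one]
    refine ENNReal.ofReal_le_ofReal ?_
    rw [Real.norm_of_nonneg (by positivity), show (-2 : ℤ) = -((2 : ℕ) : ℤ) by rfl, zpow_neg,
      zpow_natCast]
    refine inv_le_one_of_one_le₀ ?_
    nlinarith [Real.pi_gt_three]
  · rw [lintegral_tsum fun m => (hEm m).aemeasurable]
    refine (ENNReal.tsum_le_tsum hEi).trans ?_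
    have h9 : ∀ m, AEMeasurable (fun v => tileWeight R m v * ‖g v‖ₑ ^ p) := fun m =>
      ((measurable_tileWeight R m).mul hgp).aemeasurable
    rw [ENNReal.tsum_mul_left, ← lintegral_tsum h9]
    simp only [ENNReal.tsum_mul_right]
    have h8 : ∫⁻ v, (∑' m, tileWeight R m v) * ‖g v‖ₑ ^ p ≤
        1089 * ∫⁻ v in infStrip R, ‖g v‖ₑ ^ p := by
      rw [← lintegral_const_mul _ hgp, ← lintegral_indicator (measurableSet_infStrip R)]
      refine lintegral_mono fun v => ?_
      refine (mul_le_mul' (tsum_tileWeight_le hR0 v) le_rfl).trans ?_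
      by_cases hv : v ∈ infStrip R <;> simp [hv]
    refine (mul_le_mul' le_rfl h8).trans (le_of_eq ?_)
    ring

/-- The dyadic radii `3.9 · 2^k`. -/
def dyadRad (k : ℕ) : ℝ := 39 / 10 * 2 ^ k

theorem dyadRad_ge (k : ℕ) : 39 / 10 ≤ dyadRad k := by
  unfold dyadRad
  nlinarith [one_le_pow₀ (n := k) (one_le_two (α := ℝ))]

theorem dyadRad_succ (k : ℕ) : dyadRad (k + 1) = 2 * dyadRad k := by
  unfold dyadRad; ring

theorem dyadRad_mono {k l : ℕ} (h : k ≤ l) : dyadRad k ≤ dyadRad l := by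
  unfold dyadRad
  gcongr
  exact one_le_two

theorem exists_mem_Ico_dyadRad {r : ℝ} (hr : 39 / 10 ≤ r) :
    ∃ k, r ∈ Ico (dyadRad k) (2 * dyadRad k) := by
  obtain ⟨n, h1, h2⟩ := exists_nat_pow_near (x := r / (39 / 10)) (y := (2:ℝ))
    (by rw [le_div_iff₀ (by norm_num)]; linarith) one_lt_two
  refine ⟨n, ?_, ?_⟩
  · rw [le_div_iff₀ (by norm_num)] at h1; unfold dyadRad; linarith
  · rw [div_lt_iff₀ (by norm_num), pow_succ] at h2; unfold dyadRad; linarith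

theorem tsum_infStrip_le (y : ℝ × ℝ) :
    ∑' k, (infStrip (dyadRad k)).indicator (1 : ℝ × ℝ → ℝ≥0∞) y ≤ 8 := by
  have h1 : ∀ k, (infStrip (dyadRad k)).indicator (1 : ℝ × ℝ → ℝ≥0∞) y ≤ 1 := fun k =>
    indicator_le_self' (by simp) y
  have hmem : ∀ k, (infStrip (dyadRad k)).indicator (1 : ℝ × ℝ → ℝ≥0∞) y ≠ 0 →
      y ∈ infStrip (dyadRad k) := fun k hk => mem_of_indicator_ne_zero hk
  have hbig : ∀ k, 5 ≤ k → y ∈ infStrip (dyadRad k) →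
      dyadRad k ^ 2 / 4 ≤ y.1 ∧ y.1 ≤ 3 * dyadRad k ^ 2 := by
    intro k hk hy
    have hR : 68 ≤ dyadRad k := (show (68:ℝ) ≤ dyadRad 5 by norm_num [dyadRad]).trans (dyadRad_mono hk)
    constructor
    · nlinarith [hy.1]
    · nlinarith [hy.2]
  have hcmp : ∀ k l, 5 ≤ k → 5 ≤ l → y ∈ infStrip (dyadRad k) → y ∈ infStrip (dyadRad l) →
      k ≤ l + 1 := by
    intro k l hk hl hyk hyl
    by_contra hlt
    have h2 := dyadRad_mono (show l + 1 + 1 ≤ k by omega)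
    rw [dyadRad_succ, dyadRad_succ] at h2
    have := hbig k hk hyk
    have := hbig l hl hyl
    nlinarith [dyadRad_ge l]
  by_cases hex : ∃ k, 5 ≤ k ∧ y ∈ infStrip (dyadRad k)
  · obtain ⟨k, hk, hyk⟩ := hex
    refine (ENNReal.tsum_le_card (Finset.range 5 ∪ Finset.Icc (k - 1) (k + 1)) h1 fun l hl => ?_).trans ?_
    · rw [Finset.mem_union, Finset.mem_range, Finset.mem_Icc]
      by_cases hl5 : l < 5
      · exact Or.inl hl5
      · have a1 := hcmp k l hk (by omega) hyk (hmem l hl)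
        have a2 := hcmp l k (by omega) hk (hmem l hl) hyk
        exact Or.inr ⟨by omega, a2⟩
    · have : (Finset.range 5 ∪ Finset.Icc (k - 1) (k + 1)).card ≤ 8 := by
        refine (Finset.card_union_le _ _).trans ?_
        rw [Finset.card_range, Nat.card_Icc]
        omega
      exact_mod_cast this
  · refine (ENNReal.tsum_le_card (Finset.range 5) h1 fun l hl => ?_).trans ?_
    · rw [Finset.mem_range]
      by_contra hl5
      exact hex ⟨l, by omega, hmem l hl⟩
    · rw [Finset.card_range]
      norm_num

theorem exists_large_radius_bound {p q y z : ℝ} (hp : 1 < p) (hy : 0 < y) (hz : 0 ≤ z)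
    (hyz : y + z ≤ 1) (hq : q = 2 + 2 * y + 3 * z) (hpq : q < p * (1 + z)) (hpq' : p ≤ q) :
    ∃ C : ℝ≥0∞, C ≠ ∞ ∧ ∀ {g : ℝ × ℝ → ℂ}, Integrable g → Measurable g →
    ∃ M : ℝ × ℝ → ℝ≥0∞, Measurable M ∧
      (∀ r, 39 / 10 ≤ r → ∀ x, ∀ t ∈ Ioo (1:ℝ) 2,
        ENNReal.ofReal r * ‖Aop g t r x‖ₑ ^ q ≤ M (r, x)) ∧
      ∫⁻ v, M v ≤ C * (∫⁻ v, ‖g v‖ₑ ^ p) ^ (q / p) := by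
  have hp0 : 0 < p := by linarith
  obtain ⟨C, hC, hb⟩ := exists_annulus_bound hp hy hz hyz hq hpq hpq'
  refine ⟨2 * C * 8, by finiteness, fun {g} hg hgm => ?_⟩
  choose D hDm hDb hDi using fun k => hb hg hgm (dyadRad_ge k)
  have hpos : ∀ k, 0 < dyadRad k := fun k => by linarith [dyadRad_ge k]
  set P := ∫⁻ v, ‖g v‖ₑ ^ p with hP
  have hgp : Measurable fun v => ‖g v‖ₑ ^ p := hgm.enorm.pow_const p
  set A : ℕ → Set (ℝ × ℝ) := fun k => {v | v.1 ∈ Ico (dyadRad k) (2 * dyadRad k)}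
  have hA : ∀ k, MeasurableSet (A k) := fun k => measurableSet_Ico.preimage measurable_fst
  set E : ℕ → ℝ × ℝ → ℝ≥0∞ := fun k =>
    (A k).indicator fun v => ENNReal.ofReal (2 * dyadRad k) * D k v
  have hEm : ∀ k, Measurable (E k) := fun k => ((hDm k).const_mul _).indicator (hA k)
  refine ⟨fun v => ∑' k, E k v, Measurable.tsum hEm, ?_, ?_⟩
  · intro r hr x t ht
    obtain ⟨k, hk⟩ := exists_mem_Ico_dyadRad hr
    refine le_trans ?_ (ENNReal.le_tsum k)
    simp only [E]
    rw [indicator_of_mem (show (r, x) ∈ A k from hk)]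
    exact mul_le_mul' (ENNReal.ofReal_le_ofReal hk.2.le) (hDb k r hk x t ht)
  · rw [lintegral_tsum fun k => (hEm k).aemeasurable]
    have hEi : ∀ k, ∫⁻ v, E k v ≤ 2 * C * P ^ (q / p - 1) *
        ∫⁻ v, (infStrip (dyadRad k)).indicator 1 v * ‖g v‖ₑ ^ p := by
      intro k
      have h1 : ∫⁻ v, E k v ≤ ENNReal.ofReal (2 * dyadRad k) * ∫⁻ v, D k v := by
        rw [← lintegral_const_mul _ (hDm k)]
        exact lintegral_mono fun v => indicator_le_self' (by simp) v
      have h2 : ∫⁻ v in infStrip (dyadRad k), ‖g v‖ₑ ^ p =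
          ∫⁻ v, (infStrip (dyadRad k)).indicator 1 v * ‖g v‖ₑ ^ p := by
        rw [← lintegral_indicator (measurableSet_infStrip _)]
        refine lintegral_congr fun v => ?_
        by_cases hv : v ∈ infStrip (dyadRad k) <;> simp [hv]
      have h3 : ENNReal.ofReal (2 * dyadRad k) * ENNReal.ofReal (dyadRad k)⁻¹ = 2 := by
        rw [← ENNReal.ofReal_mul (by linarith [hpos k]), mul_assoc, mul_inv_cancel₀ (hpos k).ne',
          mul_one]
        simp
      refine h1.trans ((mul_le_mul' le_rfl (hDi k)).trans (le_of_eq ?_))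
      rw [h2]
      calc _ = (ENNReal.ofReal (2 * dyadRad k) * ENNReal.ofReal (dyadRad k)⁻¹) * C * P ^ (q / p - 1) *
            ∫⁻ v, (infStrip (dyadRad k)).indicator 1 v * ‖g v‖ₑ ^ p := by ring
        _ = _ := by rw [h3]
    refine (ENNReal.tsum_le_tsum hEi).trans ?_
    have h9 : ∀ k, AEMeasurable (fun v => (infStrip (dyadRad k)).indicator 1 v * ‖g v‖ₑ ^ p) :=
      fun k => ((measurable_one.indicator (measurableSet_infStrip _)).mul hgp).aemeasurable
    rw [ENNReal.tsum_mul_left, ← lintegral_tsum h9]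
    simp only [ENNReal.tsum_mul_right]
    have h8 : ∫⁻ v, (∑' k, (infStrip (dyadRad k)).indicator 1 v) * ‖g v‖ₑ ^ p ≤ 8 * P := by
      rw [hP, ← lintegral_const_mul _ hgp]
      exact lintegral_mono fun v => mul_le_mul' (tsum_infStrip_le v) le_rfl
    refine (mul_le_mul' le_rfl h8).trans (le_of_eq ?_)
    have h10 : P ^ (q / p) = P ^ (q / p - 1) * P := by
      conv_rhs => rw [← ENNReal.rpow_one P, ← ENNReal.rpow_mul, one_mul]
      rw [← ENNReal.rpow_add_of_nonneg _ _ (by rw [sub_nonneg, one_le_div hp0]; exact hpq')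
        zero_le_one, sub_add_cancel]
    rw [h10]
    ring

theorem ft2_eq_zero_of_not_integrable {g : ℝ × ℝ → ℂ} (hg : ¬ Integrable g) (ξ : ℝ × ℝ) :
    ft2 g ξ = 0 := by
  refine integral_undef fun h => hg ?_
  have h1 : Integrable fun y : ℝ × ℝ => Complex.exp (Complex.I * ((y.1 * ξ.1 + y.2 * ξ.2 : ℝ) : ℂ)) *
      (Complex.exp (-(Complex.I) * ((y.1 * ξ.1 + y.2 * ξ.2 : ℝ) : ℂ)) * g y) := by
    refine h.bdd_mul (c := 1) (Continuous.aestronglyMeasurable (by fun_prop))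
      (Filter.Eventually.of_forall fun y => ?_)
    rw [mul_comm, Complex.norm_exp_ofReal_mul_I]
  refine h1.congr (Filter.Eventually.of_forall fun y => ?_)
  simp only
  rw [← mul_assoc, ← Complex.exp_add]
  simp

/-- The bound of `exists_large_radius_bound` without regularity assumptions on `g`. -/
theorem exists_large_radius_bound_of_any {p q y z : ℝ} (hp : 1 < p) (hy : 0 < y) (hz : 0 ≤ z)
    (hyz : y + z ≤ 1) (hq : q = 2 + 2 * y + 3 * z) (hpq : q < p * (1 + z)) (hpq' : p ≤ q) :
    ∃ C : ℝ≥0∞, C ≠ ∞ ∧ ∀ g : ℝ × ℝ → ℂ,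
    ∃ M : ℝ × ℝ → ℝ≥0∞,
      (∀ r, 39 / 10 ≤ r → ∀ x, ∀ t ∈ Ioo (1:ℝ) 2,
        ENNReal.ofReal r * ‖Aop g t r x‖ₑ ^ q ≤ M (r, x)) ∧
      ∫⁻ v, M v ≤ C * (∫⁻ v, ‖g v‖ₑ ^ p) ^ (q / p) := by
  obtain ⟨C, hC, hb⟩ := exists_large_radius_bound hp hy hz hyz hq hpq hpq'
  refine ⟨C, hC, fun g => ?_⟩
  by_cases hg : Integrable g
  · have hae := hg.1.ae_eq_mk
    obtain ⟨M, -, h1, h2⟩ := hb (hg.congr hae) hg.1.stronglyMeasurable_mk.measurable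
    have hft : ∀ ξ, ft2 (hg.1.mk g) ξ = ft2 g ξ := fun ξ => by
      refine integral_congr_ae ?_
      filter_upwards [hae] with v hv
      rw [hv]
    refine ⟨M, fun r hr x t ht => ?_, h2.trans (le_of_eq ?_)⟩
    · have := h1 r hr x t ht
      simpa only [Aop, hft] using this
    · congr 2
      refine lintegral_congr_ae ?_
      filter_upwards [hae] with v hv
      rw [hv]
  · refine ⟨fun _ => 0, fun r hr x t ht => ?_, by simp⟩
    have hq0 : 0 < q := by linarith
    simp [Aop, ft2_eq_zero_of_not_integrable hg, hq0]

theorem exists_sup_bound {q r : ℝ} (hq : 0 < q) (hr : 0 < r) {A : ℝ → ℂ} {M : ℝ≥0∞} (hM : M ≠ ∞)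
    (h : ∀ t ∈ Ioo (1:ℝ) 2, ENNReal.ofReal r * ‖A t‖ₑ ^ q ≤ M) :
    ∃ B : ℝ, 0 ≤ B ∧ (∀ c : ℝ, 0 ≤ c → ⨆ t ∈ Ioo (1:ℝ) 2, ‖(c : ℂ) * A t‖ ≤ c * B) ∧
      ENNReal.ofReal r * ENNReal.ofReal B ^ q ≤ M := by
  have hr' : ENNReal.ofReal r ≠ 0 := by simpa using hr
  set β := (M / ENNReal.ofReal r) ^ (1 / q) with hβ
  have hβt : β ≠ ∞ := ENNReal.rpow_ne_top_of_nonneg (by positivity) (ENNReal.div_ne_top hM hr')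
  refine ⟨β.toReal, ENNReal.toReal_nonneg, fun c hc => ?_, ?_⟩
  · have hcB : 0 ≤ c * β.toReal := mul_nonneg hc ENNReal.toReal_nonneg
    refine Real.iSup_le (fun t => Real.iSup_le (fun ht => ?_) hcB) hcB
    rw [norm_mul, Complex.norm_real, Real.norm_of_nonneg hc]
    refine mul_le_mul_of_nonneg_left ?_ hc
    have h1 : ‖A t‖ₑ ^ q ≤ M / ENNReal.ofReal r := by
      rw [ENNReal.le_div_iff_mul_le (Or.inl hr') (Or.inl ENNReal.ofReal_ne_top), mul_comm]
      exact h t ht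
    have h2 : ‖A t‖ₑ ≤ β := by
      rw [hβ, one_div, ENNReal.le_rpow_inv_iff hq]
      exact h1
    rw [← toReal_enorm]
    exact ENNReal.toReal_mono hβt h2
  · rw [ENNReal.ofReal_toReal hβt, hβ, ← ENNReal.rpow_mul, one_div_mul_cancel hq.ne',
      ENNReal.rpow_one]
    exact ENNReal.mul_div_le

theorem IsLPBump.eq_zero_of_lt {φ : ℝ → ℝ} (hφ : IsLPBump φ) {k : ℤ} (hk : 2 ≤ k) {r : ℝ}
    (hr : r < 39 / 10) : φ ((2:ℝ) ^ (-k) * r) = 0 := by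
  by_contra h
  have h1 : (1 - 1 / 1000 : ℝ) ≤ (2:ℝ) ^ (-k) * r := (hφ.2.2.1 h).1
  have h2 : (4:ℝ) ≤ 2 ^ k := by
    have := zpow_le_zpow_right₀ (one_le_two (α := ℝ)) hk
    norm_num at this ⊢
    exact this
  rw [zpow_neg, inv_mul_eq_div, le_div_iff₀ (by positivity)] at h1
  linarith

theorem IsLPBump.le_one {φ : ℝ → ℝ} (hφ : IsLPBump φ) (k : ℤ) {r : ℝ} (hr : 0 < r) :
    φ ((2:ℝ) ^ (-k) * r) ≤ 1 :=
  le_hasSum (hφ.2.2.2 r hr) k fun _ _ => hφ.2.1 _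

theorem IsLPBump.summable_nat {φ : ℝ → ℝ} (hφ : IsLPBump φ) {r : ℝ} (hr : 0 < r) :
    Summable fun k : ℕ => φ ((2:ℝ) ^ (-((k:ℤ) + 2)) * r) :=
  (hφ.2.2.2 r hr).summable.comp_injective (i := fun k : ℕ => (k:ℤ) + 2)
    fun a b h => by simpa using h

theorem IsLPBump.tsum_nat_le_one {φ : ℝ → ℝ} (hφ : IsLPBump φ) {r : ℝ} (hr : 0 < r) :
    ∑' k : ℕ, φ ((2:ℝ) ^ (-((k:ℤ) + 2)) * r) ≤ 1 := by
  refine hasSum_le_inj (g := fun j : ℤ => φ ((2:ℝ) ^ (-j) * r)) (fun k : ℕ => (k:ℤ) + 2) (fun a b h => by simpa using h)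
    (fun _ _ => hφ.2.1 _) (fun _ => le_rfl) (hφ.summable_nat hr).hasSum (hφ.2.2.2 r hr)

theorem exists_auxiliary_exponents {a b : ℝ} (ha : 0 < a) (hb : 0 < b) (hba : a⁻¹ ≤ b⁻¹)
    (h1 : 3 * a < 1 + b) (h3 : 1 ≤ a + 3 * b) : ∃ y z : ℝ, 1 < a⁻¹ ∧ 0 < y ∧ 0 ≤ z ∧ y + z ≤ 1 ∧
      b⁻¹ = 2 + 2 * y + 3 * z ∧ b⁻¹ < a⁻¹ * (1 + z) := by
  have hba' : b ≤ a := (inv_le_inv₀ ha hb).1 hba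
  have hQ2 : 2 < b⁻¹ := by
    rw [lt_inv_comm₀ two_pos hb]; linarith
  have hQ5 : b⁻¹ < 5 := by
    rw [inv_lt_comm₀ hb (by norm_num)]; linarith
  have hd : 0 < b⁻¹ * (1 + b - 3 * a) := mul_pos (inv_pos.2 hb) (by linarith)
  set Q := b⁻¹
  have hQb : Q * b = 1 := inv_mul_cancel₀ hb.ne'
  set y := min (min ((Q - 2) / 2) (5 - Q)) (Q * (1 + b - 3 * a) / 4)
  have y1 : y ≤ (Q - 2) / 2 := (min_le_left _ _).trans (min_le_left _ _)
  have y2 : y ≤ 5 - Q := (min_le_left _ _).trans (min_le_right _ _)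
  have y3 : y ≤ Q * (1 + b - 3 * a) / 4 := min_le_right _ _
  have y0 : 0 < y := lt_min (lt_min (by linarith) (by linarith)) (by linarith)
  refine ⟨y, (Q - 2 - 2 * y) / 3, ?_, y0, by linarith, by linarith, by ring, ?_⟩
  · rw [one_lt_inv₀ ha]; linarith
  · rw [inv_mul_eq_div, lt_div_iff₀ ha]
    nlinarith

theorem eLpNorm_le_of_pointwise {q : ℝ≥0∞} (hq0 : q ≠ 0) (hqt : q ≠ ∞) {A : ℝ → ℝ → ℝ → ℂ}
    {M : ℝ × ℝ → ℝ≥0∞} (hM : ∀ r, 39 / 10 ≤ r → ∀ x, ∀ t ∈ Ioo (1:ℝ) 2,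
        ENNReal.ofReal r * ‖A t r x‖ₑ ^ q.toReal ≤ M (r, x)) {V : ℝ × ℝ → ℝ}
    (hV0 : ∀ z : ℝ × ℝ, z.1 < 39 / 10 → V z = 0)
    (hV : ∀ z : ℝ × ℝ, 39 / 10 ≤ z.1 → ∀ B : ℝ, 0 ≤ B →
      (∀ c : ℝ, 0 ≤ c → ⨆ t ∈ Ioo (1:ℝ) 2, ‖(c : ℂ) * A t z.1 z.2‖ ≤ c * B) → |V z| ≤ B) :
    eLpNorm (fun z : ℝ × ℝ => z.1 ^ (1/q).toReal * V z) q volume ≤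
      (∫⁻ z, M z) ^ (1 / q.toReal) := by
  have hQ : 0 < q.toReal := ENNReal.toReal_pos hq0 hqt
  rw [eLpNorm_eq_lintegral_rpow_enorm_toReal hq0 hqt]
  refine ENNReal.rpow_le_rpow (lintegral_mono fun z => ?_) (by positivity)
  rcases lt_or_ge z.1 (39 / 10) with hr | hr
  · simp [hV0 z hr, hQ]
  by_cases hMt : M z = ∞
  · rw [hMt]; exact le_top
  have hr0 : 0 < z.1 := by linarith
  obtain ⟨B, hB0, hB, hBM⟩ := exists_sup_bound hQ hr0 (A := fun t => A t z.1 z.2) (M := M z) hMt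
    fun t ht => hM z.1 hr z.2 t ht
  refine le_trans ?_ hBM
  rw [enorm_mul, ENNReal.mul_rpow_of_nonneg _ _ hQ.le]
  refine mul_le_mul' (le_of_eq ?_) (ENNReal.rpow_le_rpow ?_ hQ.le)
  · rw [Real.enorm_of_nonneg (by positivity), ENNReal.ofReal_rpow_of_nonneg (by positivity) hQ.le,
      ← Real.rpow_mul hr0.le, one_div, ENNReal.toReal_inv, inv_mul_cancel₀ hQ.ne', Real.rpow_one]
  · rw [← ofReal_norm]
    exact ENNReal.ofReal_le_ofReal (hV z hr B hB0 hB)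

/-- The case `k ≥ 2` of the proof of the main theorem (estimate (2.10)/(2.11)):
for `p ≤ q`, `3/p − 1/q < 1`, `1/p + 1/q ≤ 1` and `1/p + 3/q ≥ 1`,
`‖r^{1/q} ∑_{k≥2} sup_{1<t<2} |φ_k(r) 𝒜_t g|‖_{L^q_{r,x₃}} ≤ C‖g‖_{L^p}`; in particular,
each single `k ≥ 2` piece obeys the same bound with `C` independent of `k`. -/
theorem Aop_large_radius_sum
    (φ : ℝ → ℝ) (hφ : IsLPBump φ) (p q : ℝ≥0∞)
    (hpq : p ≤ q) (h1 : 3/p < 1 + 1/q) (h2 : 1/p + 1/q ≤ 1) (h3 : 1 ≤ 1/p + 3/q) :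
    ∃ C : ℝ, 0 < C ∧ ∀ g : ℝ × ℝ → ℂ,
      (eLpNorm (fun z : ℝ × ℝ => z.1 ^ (1/q).toReal *
          ∑' k : ℕ, ⨆ t ∈ Set.Ioo (1:ℝ) 2,
            ‖((φ ((2:ℝ) ^ (-((k:ℤ) + 2)) * z.1) : ℝ) : ℂ) * Aop g t z.1 z.2‖) q volume ≤
        ENNReal.ofReal C * eLpNorm g p volume) ∧
      ∀ k : ℤ, 2 ≤ k →
        eLpNorm (fun z : ℝ × ℝ => z.1 ^ (1/q).toReal *
            ⨆ t ∈ Set.Ioo (1:ℝ) 2,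
              ‖((φ ((2:ℝ) ^ (-k) * z.1) : ℝ) : ℂ) * Aop g t z.1 z.2‖) q volume ≤
          ENNReal.ofReal C * eLpNorm g p volume := by
  have hp0 : p ≠ 0 := by
    rintro rfl
    simp [ENNReal.div_zero] at h1
  have hq0 : q ≠ 0 := fun h => hp0 (by simpa [h] using hpq)
  have hqt : q ≠ ∞ := by
    rintro rfl
    simp only [ENNReal.div_top, add_zero] at h1 h3
    have : (1 : ℝ≥0∞) / p ≤ 3 / p := ENNReal.div_le_div_right (by norm_num) p
    exact absurd (h3.trans this) (not_le.2 h1)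
  have hpt : p ≠ ∞ := ne_top_of_le_ne_top hqt hpq
  have hP : 0 < p.toReal := ENNReal.toReal_pos hp0 hpt
  have hQ : 0 < q.toReal := ENNReal.toReal_pos hq0 hqt
  have hPQ : p.toReal ≤ q.toReal := ENNReal.toReal_mono hqt hpq
  have hpe : p = ENNReal.ofReal p.toReal := (ENNReal.ofReal_toReal hpt).symm
  have hqe : q = ENNReal.ofReal q.toReal := (ENNReal.ofReal_toReal hqt).symm
  have h3e : (3 : ℝ≥0∞) = ENNReal.ofReal 3 := by simp
  have h1' : 3 * p.toReal⁻¹ < 1 + q.toReal⁻¹ := by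
    rw [hpe, hqe, h3e, ← ENNReal.ofReal_one, ← ENNReal.ofReal_div_of_pos hP,
      ← ENNReal.ofReal_div_of_pos hQ, ← ENNReal.ofReal_add zero_le_one (by positivity),
      ENNReal.ofReal_lt_ofReal_iff (by positivity)] at h1
    simpa only [div_eq_mul_inv, one_mul] using h1
  have h3' : 1 ≤ p.toReal⁻¹ + 3 * q.toReal⁻¹ := by
    rw [hpe, hqe, h3e, ← ENNReal.ofReal_one, ← ENNReal.ofReal_div_of_pos hP,
      ← ENNReal.ofReal_div_of_pos hQ, ← ENNReal.ofReal_add (by positivity) (by positivity),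
      ENNReal.ofReal_le_ofReal_iff (by positivity)] at h3
    simpa only [div_eq_mul_inv, one_mul] using h3
  obtain ⟨y, z, e1, e2, e3, e4, e5, e6⟩ := exists_auxiliary_exponents (inv_pos.2 hP) (inv_pos.2 hQ)
    (by rwa [inv_inv, inv_inv]) h1' h3'
  rw [inv_inv] at e1 e5 e6
  rw [inv_inv] at e6
  obtain ⟨C, hC, hb⟩ := exists_large_radius_bound_of_any e1 e2 e3 e4 e5 e6 hPQ
  have hCt : C ^ (1 / q.toReal) ≠ ∞ := by finiteness
  refine ⟨(C ^ (1 / q.toReal)).toReal + 1, by positivity, fun g => ?_⟩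
  obtain ⟨M, hM, hMi⟩ := hb g
  have hfin : (∫⁻ z, M z) ^ (1 / q.toReal) ≤
      ENNReal.ofReal ((C ^ (1 / q.toReal)).toReal + 1) * eLpNorm g p volume := by
    refine (ENNReal.rpow_le_rpow hMi (by positivity)).trans ?_
    rw [ENNReal.mul_rpow_of_nonneg _ _ (by positivity), ← ENNReal.rpow_mul,
      eLpNorm_eq_lintegral_rpow_enorm_toReal hp0 hpt,
      show q.toReal / p.toReal * (1 / q.toReal) = 1 / p.toReal by field_simp]
    refine mul_le_mul' ?_ le_rfl
    rw [ENNReal.ofReal_add ENNReal.toReal_nonneg zero_le_one, ENNReal.ofReal_toReal hCt]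
    exact le_self_add
  constructor
  · refine (eLpNorm_le_of_pointwise hq0 hqt hM (fun z hz => ?_) fun z hz B hB0 hB => ?_).trans hfin
    · have : ∀ k : ℕ, φ ((2:ℝ) ^ (-((k:ℤ) + 2)) * z.1) = 0 := fun k =>
        hφ.eq_zero_of_lt (by omega) hz
      simp only [this, Complex.ofReal_zero, zero_mul, norm_zero, Real.iSup_const_zero, tsum_zero]
    · have hr0 : 0 < z.1 := by linarith
      have hs := hφ.summable_nat hr0
      have hn : ∀ k : ℕ, 0 ≤ ⨆ t ∈ Ioo (1:ℝ) 2,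
          ‖((φ ((2:ℝ) ^ (-((k:ℤ) + 2)) * z.1) : ℝ) : ℂ) * Aop g t z.1 z.2‖ := fun k =>
        Real.iSup_nonneg fun t => Real.iSup_nonneg fun _ => norm_nonneg _
      rw [abs_of_nonneg (tsum_nonneg hn)]
      have hle := fun k : ℕ => hB (φ ((2:ℝ) ^ (-((k:ℤ) + 2)) * z.1)) (hφ.2.1 _)
      refine ((Summable.of_nonneg_of_le hn hle (hs.mul_right B)).tsum_le_tsum hle
        (hs.mul_right B)).trans ?_
      rw [tsum_mul_right]
      exact mul_le_of_le_one_left hB0 (hφ.tsum_nat_le_one hr0)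
  · intro k hk
    refine (eLpNorm_le_of_pointwise hq0 hqt hM (fun z hz => ?_) fun z hz B hB0 hB => ?_).trans hfin
    · simp only [hφ.eq_zero_of_lt hk hz, Complex.ofReal_zero, zero_mul, norm_zero,
        Real.iSup_const_zero]
    · rw [abs_of_nonneg (Real.iSup_nonneg fun t => Real.iSup_nonneg fun _ => norm_nonneg _)]
      exact (hB _ (hφ.2.1 _)).trans
        (mul_le_of_le_one_left hB0 (hφ.le_one k (by linarith)))

end
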